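/- Suppose n = 2 or 3 and M is a noncompact n-dimensional Alexandrov space with curvature ≥ -1, no boundary, and λ₀(M) = (n-1)²/4. Then either M has no finite-volume end, or M splits as ℝ ×_{e^t} N with N a compact Alexandrov space of nonnegative curvature. -/

import Mathlib

open MeasureTheory Metric Filter Topology Set
open scoped ENNReal NNReal

noncomputable section

/-- A unit-speed geodesic defined on `[0, L]`. -/
def IsUnitGeodesic {X : Type*} [MetricSpace X] (γ : ℝ → X) (L : ℝ) : Prop :=
  0 ≤ L ∧ ∀ s ∈ Set.Icc (0:ℝ) L, ∀ t ∈ Set.Icc (0:ℝ) L, dist (γ s) (γ t) = |s - t|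

/-- A geodesic metric space: any two points are joined by a unit-speed geodesic. -/
def IsGeodesicSpace (X : Type*) [MetricSpace X] : Prop :=
  ∀ x y : X, ∃ γ : ℝ → X, IsUnitGeodesic γ (dist x y) ∧ γ 0 = x ∧ γ (dist x y) = y

/-- A (unit-speed) ray. -/
def IsRay {X : Type*} [MetricSpace X] (γ : ℝ → X) : Prop :=
  ∀ s t : ℝ, 0 ≤ s → 0 ≤ t → dist (γ s) (γ t) = |s - t|

/-- Comparison angle in the hyperbolic plane (curvature `-1`), from the hyperbolic
law of cosines, for a triangle with side lengths `a, b` adjacent to the vertex and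
opposite side `c`. -/
def cmpAngleH (a b c : ℝ) : ℝ :=
  Real.arccos ((Real.cosh a * Real.cosh b - Real.cosh c) / (Real.sinh a * Real.sinh b))

/-- Comparison angle in the Euclidean plane. -/
def cmpAngleE (a b c : ℝ) : ℝ :=
  Real.arccos ((a ^ 2 + b ^ 2 - c ^ 2) / (2 * a * b))

/-- Comparison angle in the model plane of curvature `-K` (`K ≥ 0`). -/
def cmpAngleNeg (K a b c : ℝ) : ℝ :=
  if K = 0 then cmpAngleE a b c
  else cmpAngleH (Real.sqrt K * a) (Real.sqrt K * b) (Real.sqrt K * c)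

/-- Alexandrov curvature `≥ -K` via the (1+3)-point comparison condition. -/
def CurvGeNegK (X : Type*) [MetricSpace X] (K : ℝ) : Prop :=
  IsGeodesicSpace X ∧
    ∀ p a b c : X, p ≠ a → p ≠ b → p ≠ c →
      cmpAngleNeg K (dist p a) (dist p b) (dist a b) +
          cmpAngleNeg K (dist p b) (dist p c) (dist b c) +
          cmpAngleNeg K (dist p c) (dist p a) (dist c a) ≤ 2 * Real.pi

/-- Nonnegative Alexandrov curvature. -/
def CurvGeZero (X : Type*) [MetricSpace X] : Prop := CurvGeNegK X 0

/-- An `n`-dimensional Alexandrov space of curvature `≥ -1`. -/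
def AlexandrovNegOne (X : Type*) [MetricSpace X] (n : ℕ) : Prop :=
  CurvGeNegK X 1 ∧ dimH (Set.univ : Set X) = n

/-- The pointwise Lipschitz constant `Lip f (x) = limsup_{y → x} |f y - f x| / d(x,y)`. -/
def lipConst {X : Type*} [MetricSpace X] (f : X → ℝ) (x : X) : ℝ :=
  Filter.limsup (fun y => |f y - f x| / dist y x) (𝓝[≠] x)

/-- Lipschitz functions with compact support (test functions). -/
def TestFun {X : Type*} [MetricSpace X] (f : X → ℝ) : Prop :=
  (∃ K, LipschitzWith K f) ∧ HasCompactSupport f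

/-- Bottom of the `L²`-spectrum of the Laplacian on `U`, via the Rayleigh quotient with
the pointwise Lipschitz constant as gradient norm. -/
def lambda0 {X : Type*} [MetricSpace X] [MeasurableSpace X] (vol : Measure X)
    (U : Set X) : ℝ :=
  sInf { r : ℝ | ∃ f : X → ℝ, TestFun f ∧ tsupport f ⊆ U ∧
    (∫ x, f x ^ 2 ∂vol) ≠ 0 ∧
    r = (∫ x, lipConst f x ^ 2 ∂vol) / ∫ x, f x ^ 2 ∂vol }

/-- An abstract carré-du-champ ("scalar product of gradients") structure, compatible
with the metric-measure structure. -/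
structure GradStruct (X : Type*) [MetricSpace X] [MeasurableSpace X] (vol : Measure X) where
  ip : (X → ℝ) → (X → ℝ) → X → ℝ
  symm : ∀ f g, ip f g = ip g f
  nonneg : ∀ f x, 0 ≤ ip f f x
  lip_eq : ∀ f : X → ℝ, (∃ K, LipschitzWith K f) →
    ip f f =ᵐ[vol] fun x => lipConst f x ^ 2
  chain : ∀ (Φ : ℝ → ℝ), ContDiff ℝ 1 Φ → ∀ f g : X → ℝ,
    ip (fun x => Φ (f x)) g =ᵐ[vol] fun x => deriv Φ (f x) * ip f g x

/-- `ℒ_f = g · vol` in the distributional sense. -/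
def LapEq {X : Type*} [MetricSpace X] [MeasurableSpace X] {vol : Measure X}
    (G : GradStruct X vol) (f g : X → ℝ) : Prop :=
  ∀ φ : X → ℝ, TestFun φ → -∫ x, G.ip f φ x ∂vol = ∫ x, g x * φ x ∂vol

/-- `ℒ_f ≤ g · vol` in the distributional sense. -/
def LapLe {X : Type*} [MetricSpace X] [MeasurableSpace X] {vol : Measure X}
    (G : GradStruct X vol) (f g : X → ℝ) : Prop :=
  ∀ φ : X → ℝ, TestFun φ → (∀ x, 0 ≤ φ x) →
    -∫ x, G.ip f φ x ∂vol ≤ ∫ x, g x * φ x ∂vol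

/-- `ℒ_f ≥ g · vol` in the distributional sense. -/
def LapGe {X : Type*} [MetricSpace X] [MeasurableSpace X] {vol : Measure X}
    (G : GradStruct X vol) (f g : X → ℝ) : Prop :=
  ∀ φ : X → ℝ, TestFun φ → (∀ x, 0 ≤ φ x) →
    ∫ x, g x * φ x ∂vol ≤ -∫ x, G.ip f φ x ∂vol

/-- `f` is harmonic on `U` (distributionally). -/
def HarmonicOn {X : Type*} [MetricSpace X] [MeasurableSpace X] {vol : Measure X}
    (G : GradStruct X vol) (f : X → ℝ) (U : Set X) : Prop :=
  ∀ φ : X → ℝ, TestFun φ → tsupport φ ⊆ U → ∫ x, G.ip f φ x ∂vol = 0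

/-- `f` is subharmonic on `U` (`ℒ_f ≥ 0` distributionally). -/
def SubharmonicOn {X : Type*} [MetricSpace X] [MeasurableSpace X] {vol : Measure X}
    (G : GradStruct X vol) (f : X → ℝ) (U : Set X) : Prop :=
  ∀ φ : X → ℝ, TestFun φ → (∀ x, 0 ≤ φ x) → tsupport φ ⊆ U →
    ∫ x, G.ip f φ x ∂vol ≤ 0

/-- Local `W^{1,2}` membership: square-integrable with square-integrable gradient
on every compact set. -/
def W12loc {X : Type*} [MetricSpace X] [MeasurableSpace X] {vol : Measure X}
    (G : GradStruct X vol) (f : X → ℝ) : Prop :=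
  ∀ K : Set X, IsCompact K →
    IntegrableOn (fun x => f x ^ 2) K vol ∧ IntegrableOn (G.ip f f) K vol

/-- `f` is `l`-concave on `U`: along every geodesic in `U`, `f ∘ γ - l t²/2` is concave. -/
def SemiconcaveWith {X : Type*} [MetricSpace X] (f : X → ℝ) (U : Set X) (l : ℝ) : Prop :=
  ∀ γ : ℝ → X, ∀ L : ℝ, IsUnitGeodesic γ L → (∀ t ∈ Set.Icc (0:ℝ) L, γ t ∈ U) →
    ConcaveOn ℝ (Set.Icc 0 L) fun t => f (γ t) - l * t ^ 2 / 2

/-- `f` is semiconcave: locally `l`-concave for some `l`. -/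
def Semiconcave {X : Type*} [MetricSpace X] (f : X → ℝ) : Prop :=
  ∀ x : X, ∃ U ∈ 𝓝 x, ∃ l : ℝ, SemiconcaveWith f U l

/-- `f` is semiconvex. -/
def Semiconvex {X : Type*} [MetricSpace X] (f : X → ℝ) : Prop :=
  Semiconcave fun x => -f x

/-- `f` is `(-1)`-affine: along every unit-speed geodesic, `(f ∘ γ)'' = f ∘ γ`. -/
def NegOneAffine {X : Type*} [MetricSpace X] (f : X → ℝ) : Prop :=
  ∀ γ : ℝ → X, ∀ L : ℝ, IsUnitGeodesic γ L → ∃ g' : ℝ → ℝ,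
    (∀ t ∈ Set.Icc (0:ℝ) L, HasDerivWithinAt (fun s => f (γ s)) (g' t) (Set.Icc 0 L) t) ∧
    ∀ t ∈ Set.Icc (0:ℝ) L, HasDerivWithinAt g' (f (γ t)) (Set.Icc 0 L) t

/-- The cosine of the angle between two curves emanating from a common point,
via Euclidean comparison angles. -/
def cosAngleAt {X : Type*} [MetricSpace X] (c₁ c₂ : ℝ → X) : ℝ :=
  Filter.limsup
    (fun st : ℝ × ℝ =>
      (st.1 ^ 2 + st.2 ^ 2 - dist (c₁ st.1) (c₂ st.2) ^ 2) / (2 * st.1 * st.2))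
    ((𝓝[>] (0:ℝ)) ×ˢ (𝓝[>] (0:ℝ)))

/-- Inverse hyperbolic cosine. -/
def acoshR (x : ℝ) : ℝ := Real.log (x + Real.sqrt (x ^ 2 - 1))

/-- The distance in the warped product `ℝ ×_{e^t} N` between points over fiber distance
`dN` and base coordinates `s, t`:
`cosh d = cosh (s - t) + e^{s+t} dN² / 2`. -/
def warpDist (dN s t : ℝ) : ℝ :=
  acoshR (Real.cosh (s - t) + Real.exp (s + t) * dN ^ 2 / 2)

/-- The data of a splitting `X = ℝ ×_{e^t} N` with `N` a compact nonnegatively curved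
Alexandrov space. -/
structure WarpSplitCompactData (X : Type*) [MetricSpace X] where
  (N : Type)
  [instN : MetricSpace N]
  (compactN : CompactSpace N)
  (curvN : CurvGeZero N)
  (Φ : X → ℝ × N)
  (bij : Function.Bijective Φ)
  (dist_eq : ∀ u v : X, dist u v = warpDist (dist (Φ u).2 (Φ v).2) (Φ u).1 (Φ v).1)

/-- The data of a splitting `X = ℝ ×_{e^t} N` with `N` an `m`-dimensional nonnegatively
curved Alexandrov space. -/
structure WarpSplitDimData (X : Type*) [MetricSpace X] (m : ℕ) where
  (N : Type)
  [instN : MetricSpace N]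
  (curvN : CurvGeZero N)
  (dimN : dimH (Set.univ : Set N) = m)
  (Φ : X → ℝ × N)
  (bij : Function.Bijective Φ)
  (dist_eq : ∀ u v : X, dist u v = warpDist (dist (Φ u).2 (Φ v).2) (Φ u).1 (Φ v).1)

/-- `X` is isometric to hyperbolic `k`-space `ℍ^k = ℝ ×_{e^t} ℝ^{k-1}` (in horocyclic
coordinates). -/
def IsometricToHypSpace (X : Type*) [MetricSpace X] (k : ℕ) : Prop :=
  ∃ Φ : X → ℝ × EuclideanSpace ℝ (Fin (k - 1)), Function.Bijective Φ ∧
    ∀ u v : X, dist u v = warpDist (dist (Φ u).2 (Φ v).2) (Φ u).1 (Φ v).1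

/-- An end of `X` with respect to the ball `B_p(R₀)`: an unbounded connected component
of the complement of the closed ball. -/
def IsEnd {X : Type*} [MetricSpace X] (p : X) (R₀ : ℝ) (E : Set X) : Prop :=
  (∃ x ∈ (Metric.closedBall p R₀)ᶜ, E = connectedComponentIn (Metric.closedBall p R₀)ᶜ x) ∧
    ¬Bornology.IsBounded E

/-- The (2-)capacity of a set. -/
def cap2 {X : Type*} [MetricSpace X] [MeasurableSpace X] (vol : Measure X)
    (A : Set X) : ℝ≥0∞ :=
  ⨅ (u : X → ℝ) (_ : ∃ K, LipschitzWith K u) (_ : ∀ x ∈ A, 1 ≤ u x),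
    ∫⁻ x, ENNReal.ofReal (u x ^ 2 + lipConst u x ^ 2) ∂vol

/-- A property holds quasi-everywhere on `A`. -/
def QEOn {X : Type*} [MetricSpace X] [MeasurableSpace X] (vol : Measure X)
    (A : Set X) (P : X → Prop) : Prop :=
  ∃ Z : Set X, cap2 vol Z = 0 ∧ ∀ x ∈ A \ Z, P x

/-- `h` solves the Dirichlet problem on `E(R) = E ∩ B_p(R)` with boundary value `1`
on `∂E` and `0` on `∂E(R)`, attained quasi-everywhere. -/
def EndDirichlet {X : Type*} [MetricSpace X] [MeasurableSpace X] {vol : Measure X}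
    (G : GradStruct X vol) (p : X) (E : Set X) (R : ℝ) (h : X → ℝ) : Prop :=
  HarmonicOn G h (E ∩ Metric.ball p R) ∧ (∀ x, 0 ≤ h x ∧ h x ≤ 1) ∧
    QEOn vol (frontier E) (fun x => Tendsto h (𝓝[E ∩ Metric.ball p R] x) (𝓝 1)) ∧
    QEOn vol (E ∩ Metric.sphere p R) (fun x => Tendsto h (𝓝[E ∩ Metric.ball p R] x) (𝓝 0))

/-- A non-parabolic end: the Dirichlet harmonic functions `h_{R_i}` converge to a
nonconstant harmonic function on `E`. -/
def NonParabolicEnd {X : Type*} [MetricSpace X] [MeasurableSpace X] {vol : Measure X}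
    (G : GradStruct X vol) (p : X) (R₀ : ℝ) (E : Set X) : Prop :=
  IsEnd p R₀ E ∧ ∃ (R : ℕ → ℝ) (h : ℕ → X → ℝ) (h' : X → ℝ),
    (∀ i, R₀ < R i) ∧ Tendsto R atTop atTop ∧
    (∀ i, EndDirichlet G p E (R i) (h i)) ∧
    TendstoLocallyUniformlyOn h h' atTop E ∧
    ∃ x ∈ E, ∃ y ∈ E, h' x ≠ h' y

/-- A parabolic end. -/
def ParabolicEnd {X : Type*} [MetricSpace X] [MeasurableSpace X] {vol : Measure X}
    (G : GradStruct X vol) (p : X) (R₀ : ℝ) (E : Set X) : Prop :=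
  IsEnd p R₀ E ∧ ¬NonParabolicEnd G p R₀ E

end

section

open Real in
/-- The hyperbolic comparison inequality for the distance to a point on a geodesic. -/
def CoshCmp (X : Type*) [MetricSpace X] : Prop :=
  ∀ a b m q : X, dist a m + dist m b = dist a b →
    sinh (dist m b) * cosh (dist q a) + sinh (dist a m) * cosh (dist q b) ≤
      cosh (dist q m) * sinh (dist a b)

section Comparison

open Real

lemma cosh_arg_bounds {x y c : ℝ} (hx : 0 < x) (hy : 0 < y) (h1 : |x - y| ≤ c)
    (h2 : c ≤ x + y) :
    -1 ≤ (cosh x * cosh y - cosh c) / (sinh x * sinh y) ∧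
      (cosh x * cosh y - cosh c) / (sinh x * sinh y) ≤ 1 := by
  have hs : 0 < sinh x * sinh y := mul_pos (sinh_pos_iff.2 hx) (sinh_pos_iff.2 hy)
  have hc0 : 0 ≤ c := (abs_nonneg _).trans h1
  have e1 : cosh c ≤ cosh (x + y) := cosh_le_cosh.2 (by
    rw [abs_of_nonneg hc0, abs_of_pos (by linarith)]; exact h2)
  have e2 : cosh (x - y) ≤ cosh c := cosh_le_cosh.2 (by rwa [abs_of_nonneg hc0])
  rw [cosh_add] at e1
  rw [cosh_sub] at e2
  constructor
  · rw [le_div_iff₀ hs]; linarith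
  · rw [div_le_iff₀ hs]; linarith

variable {X : Type*} [MetricSpace X]

lemma CurvGeNegK.coshCmp (h : CurvGeNegK X 1) : CoshCmp X := by
  intro a b m q hab
  rcases eq_or_ne m a with rfl | hma
  · simp [mul_comm]
  rcases eq_or_ne m b with rfl | hmb
  · simp [mul_comm]
  rcases eq_or_ne m q with rfl | hmq
  · rw [← hab, sinh_add, dist_comm m a]; simp; linarith
  have hx : 0 < dist m a := dist_pos.2 hma
  have hy : 0 < dist m b := dist_pos.2 hmb
  have hz : 0 < dist m q := dist_pos.2 hmq
  have key := h.2 m a b q hma hmb hmq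
  simp only [cmpAngleNeg, one_ne_zero, if_false, Real.sqrt_one, one_mul] at key
  have hab' : dist a b = dist m a + dist m b := by rw [← hab, dist_comm a m]
  have h1 : cmpAngleH (dist m a) (dist m b) (dist a b) = π := by
    unfold cmpAngleH
    rw [hab', cosh_add]
    have hs : 0 < sinh (dist m a) * sinh (dist m b) :=
      mul_pos (sinh_pos_iff.2 hx) (sinh_pos_iff.2 hy)
    have : (cosh (dist m a) * cosh (dist m b) - (cosh (dist m a) * cosh (dist m b) +
      sinh (dist m a) * sinh (dist m b))) / (sinh (dist m a) * sinh (dist m b)) = -1 := by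
      rw [div_eq_iff hs.ne']; ring
    rw [this, arccos_neg_one]
  rw [h1] at key
  unfold cmpAngleH at key
  have b2 := cosh_arg_bounds hy hz (c := dist b q)
    (by rw [abs_le]; constructor <;> linarith [dist_triangle m b q, dist_triangle_right m b q, dist_comm b q])
    (by linarith [dist_triangle b m q, dist_comm b m])
  have b3 := cosh_arg_bounds hz hx (c := dist q a)
    (by rw [abs_le]; constructor <;> linarith [dist_triangle m q a, dist_triangle_right m q a, dist_comm q a])
    (by linarith [dist_triangle q m a, dist_comm q m])
  set A := (cosh (dist m b) * cosh (dist m q) - cosh (dist b q)) /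
    (sinh (dist m b) * sinh (dist m q)) with hA
  set B := (cosh (dist m q) * cosh (dist m a) - cosh (dist q a)) /
    (sinh (dist m q) * sinh (dist m a)) with hB
  have h2 : arccos A ≤ arccos (-B) := by rw [arccos_neg]; linarith
  have h3 : -B ≤ A := by
    by_contra hlt
    push Not at hlt
    have := strictAntiOn_arccos ⟨b2.1, b2.2⟩ ⟨by linarith [b3.2], by linarith [b3.1]⟩ hlt
    linarith
  have sx := sinh_pos_iff.2 hx
  have sy := sinh_pos_iff.2 hy
  have sz := sinh_pos_iff.2 hz
  have h4 : 0 ≤ A + B := by linarith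
  have h5 : 0 ≤ (A + B) * (sinh (dist m a) * sinh (dist m b) * sinh (dist m q)) := by positivity
  have h6 : (A + B) * (sinh (dist m a) * sinh (dist m b) * sinh (dist m q)) =
      sinh (dist m a) * (cosh (dist m b) * cosh (dist m q) - cosh (dist b q)) +
      sinh (dist m b) * (cosh (dist m q) * cosh (dist m a) - cosh (dist q a)) := by
    rw [hA, hB]; field_simp
  rw [h6] at h5
  rw [hab', sinh_add, dist_comm q m, dist_comm a m, dist_comm q b]
  nlinarith

lemma IsGeodesicSpace.exists_frac (hg : IsGeodesicSpace X) (x y : X) {l : ℝ} (h0 : 0 ≤ l)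
    (h1 : l ≤ 1) : ∃ z, dist x z = l * dist x y ∧ dist z y = (1 - l) * dist x y := by
  obtain ⟨γ, ⟨-, hγ⟩, hx, hy⟩ := hg x y
  have hd := dist_nonneg (x := x) (y := y)
  have m0 : (0:ℝ) ∈ Icc (0:ℝ) (dist x y) := ⟨le_rfl, hd⟩
  have m1 : dist x y ∈ Icc (0:ℝ) (dist x y) := ⟨hd, le_rfl⟩
  have ml : l * dist x y ∈ Icc (0:ℝ) (dist x y) := ⟨by positivity, by nlinarith⟩
  refine ⟨γ (l * dist x y), ?_, ?_⟩
  · have := hγ _ m0 _ ml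
    rw [hx] at this
    rw [this, zero_sub, abs_neg, abs_of_nonneg ml.1]
  · have := hγ _ ml _ m1
    rw [hy] at this
    rw [this, abs_sub_comm, abs_of_nonneg (by linarith [ml.2])]; ring

lemma sinh_ratio {l t R : ℝ} (h0 : 0 ≤ l) (h1 : l ≤ 1) (ht : 0 ≤ t) (htR : t ≤ R) :
    sinh (l * R) * sinh t ≤ sinh (l * t) * sinh R := by
  rcases ht.eq_or_lt with rfl | ht
  · simp
  have hk : ∀ s, 0 ≤ s → 0 ≤ sinh (l * s) * cosh s - l * cosh (l * s) * sinh s := by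
    have hd : ∀ s, HasDerivAt (fun s => sinh (l * s) * cosh s - l * cosh (l * s) * sinh s)
        ((1 - l ^ 2) * (sinh (l * s) * sinh s)) s := by
      intro s
      have a1 : HasDerivAt (fun s => l * s) l s := by simpa using (hasDerivAt_id s).const_mul l
      have a2 := (a1.sinh.mul (hasDerivAt_cosh s)).sub ((a1.cosh.const_mul l).mul (hasDerivAt_sinh s))
      exact a2.congr_deriv (by ring)
    have hm : MonotoneOn (fun s => sinh (l * s) * cosh s - l * cosh (l * s) * sinh s) (Ici 0) := by
      apply monotoneOn_of_deriv_nonneg (convex_Ici 0)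
      · exact fun s _ => (hd s).continuousAt.continuousWithinAt
      · exact fun s _ => (hd s).differentiableAt.differentiableWithinAt
      · intro s hs
        rw [interior_Ici] at hs
        rw [(hd s).deriv]
        have : 0 ≤ sinh (l * s) := sinh_nonneg_iff.2 (mul_nonneg h0 (le_of_lt hs))
        have : 0 ≤ sinh s := sinh_nonneg_iff.2 (le_of_lt hs)
        have : 0 ≤ 1 - l ^ 2 := by nlinarith
        positivity
    intro s hs
    have := hm (self_mem_Ici) hs hs
    simpa using this
  have hd : ∀ s, 0 < s → HasDerivAt (fun s => sinh (l * s) / sinh s)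
      ((l * cosh (l * s) * sinh s - sinh (l * s) * cosh s) / sinh s ^ 2) s := by
    intro s hs
    have a1 : HasDerivAt (fun s => l * s) l s := by simpa using (hasDerivAt_id s).const_mul l
    have a2 := a1.sinh.div (hasDerivAt_sinh s) (sinh_pos_iff.2 hs).ne'
    exact a2.congr_deriv (by ring)
  have ha : AntitoneOn (fun s => sinh (l * s) / sinh s) (Ioi 0) := by
    apply antitoneOn_of_deriv_nonpos (convex_Ioi 0)
    · exact fun s hs => (hd s hs).continuousAt.continuousWithinAt
    · intro s hs
      rw [interior_Ioi] at hs
      exact (hd s hs).differentiableAt.differentiableWithinAt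
    · intro s hs
      rw [interior_Ioi] at hs
      rw [(hd s hs).deriv]
      apply div_nonpos_of_nonpos_of_nonneg _ (sq_nonneg _)
      linarith [hk s (le_of_lt hs)]
  have := ha ht (ht.trans_le htR) htR
  simp only at this
  rwa [div_le_div_iff₀ (sinh_pos_iff.2 (ht.trans_le htR)) (sinh_pos_iff.2 ht)] at this

/-- The point at fraction `l` between `p` and `y`. -/
def IsFrac (p y : X) (l : ℝ) (y' : X) : Prop :=
  dist p y' = l * dist p y ∧ dist y' y = (1 - l) * dist p y

lemma cosh_eq_half (d : ℝ) : cosh d = 1 + 2 * sinh (d / 2) ^ 2 := by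
  have := cosh_two_mul (d / 2)
  rw [show 2 * (d / 2) = d by ring] at this
  rw [this, cosh_sq]; ring

lemma CoshCmp.contraction (hc : CoshCmp X) {p y z y' z' : X} {l R : ℝ} (h0 : 0 ≤ l)
    (h1 : l ≤ 1) (hR : 0 < R) (hy : dist p y ≤ R) (hz : dist p z ≤ R)
    (hy' : IsFrac p y l y') (hz' : IsFrac p z l z') :
    sinh (l * R) * sinh (dist y z / 2) ≤ sinh R * sinh (dist y' z' / 2) := by
  set a := dist p y with ha
  set b := dist p z with hb
  have ha0 : 0 ≤ a := dist_nonneg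
  have hb0 : 0 ≤ b := dist_nonneg
  have c1 := hc p y y' z (by rw [hy'.1, hy'.2]; ring)
  have c2 := hc p z z' y' (by rw [hz'.1, hz'.2]; ring)
  rw [hy'.1, hy'.2, dist_comm z p, ← ha, ← hb] at c1
  rw [hz'.1, hz'.2, dist_comm y' p, hy'.1, ← ha, ← hb, dist_comm y' z] at c2
  have e1 : sinh ((1 - l) * a) = sinh a * cosh (l * a) - cosh a * sinh (l * a) := by
    rw [← sinh_sub]; ring_nf
  have e2 : sinh ((1 - l) * b) = sinh b * cosh (l * b) - cosh b * sinh (l * b) := by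
    rw [← sinh_sub]; ring_nf
  rw [e1] at c1
  rw [e2] at c2
  have sR := sinh_pos_iff.2 hR
  have sl : 0 ≤ sinh (l * R) := sinh_nonneg_iff.2 (by positivity)
  have hd0 : 0 ≤ sinh (dist y z / 2) := sinh_nonneg_iff.2 (by positivity)
  have hd0' : 0 ≤ sinh (dist y' z' / 2) := sinh_nonneg_iff.2 (by positivity)
  rcases ha0.eq_or_lt with ha0 | ha0
  · have hpy : p = y := dist_eq_zero.1 (by rw [← ha]; exact ha0.symm)
    have hpy' : p = y' := dist_eq_zero.1 (by rw [hy'.1, ← ha, ← ha0]; ring)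
    rw [← hpy, ← hpy', hz'.1, ← hb]
    have := sinh_ratio h0 h1 (t := b / 2) (R := R) (by positivity) (by linarith)
    rw [show l * b / 2 = l * (b / 2) by ring]; linarith
  rcases hb0.eq_or_lt with hb0 | hb0
  · have hpy : p = z := dist_eq_zero.1 (by rw [← hb]; exact hb0.symm)
    have hpy' : p = z' := dist_eq_zero.1 (by rw [hz'.1, ← hb, ← hb0]; ring)
    rw [← hpy, ← hpy', dist_comm y p, dist_comm y' p, hy'.1, ← ha]
    have := sinh_ratio h0 h1 (t := a / 2) (R := R) (by positivity) (by linarith)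
    rw [show l * a / 2 = l * (a / 2) by ring]; linarith
  have sa := sinh_pos_iff.2 ha0
  have sb := sinh_pos_iff.2 hb0
  have sla : 0 ≤ sinh (l * a) := sinh_nonneg_iff.2 (by positivity)
  have slb : 0 ≤ sinh (l * b) := sinh_nonneg_iff.2 (by positivity)
  -- combined inequality
  have c3 : sinh (l * a) * sinh (l * b) * (cosh (dist y z) - cosh (a - b)) ≤
      sinh a * sinh b * (cosh (dist y' z') - cosh (l * (a - b))) := by
    rw [dist_comm z y, dist_comm z y'] at c1
    rw [dist_comm z y'] at c2
    have t1 := mul_le_mul_of_nonneg_left c1 slb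
    have t2 := mul_le_mul_of_nonneg_left c2 sa.le
    rw [show l * (a - b) = l * a - l * b by ring, cosh_sub, cosh_sub]
    linarith
  have r1 := sinh_ratio h0 h1 ha0.le hy
  have r2 := sinh_ratio h0 h1 hb0.le hz
  have hdab : |a - b| ≤ dist y z := by
    rw [ha, hb, dist_comm p y, dist_comm p z]; exact abs_dist_sub_le _ _ _
  have hcd : 0 ≤ cosh (dist y z) - cosh (a - b) := by
    have : cosh (a - b) ≤ cosh (dist y z) := cosh_le_cosh.2 (by rwa [abs_of_nonneg dist_nonneg])
    linarith
  have c4 : sinh (l * R) ^ 2 * (cosh (dist y z) - cosh (a - b)) ≤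
      sinh R ^ 2 * (cosh (dist y' z') - cosh (l * (a - b))) := by
    have m1 : sinh (l * R) ^ 2 * (sinh a * sinh b) ≤ sinh R ^ 2 * (sinh (l * a) * sinh (l * b)) := by
      have := mul_le_mul r1 r2 (by positivity) (by positivity)
      nlinarith
    have m2 := mul_le_mul_of_nonneg_right m1 hcd
    have m3 := mul_le_mul_of_nonneg_left c3 (sq_nonneg (sinh R))
    have : (sinh a * sinh b) * (sinh (l * R) ^ 2 * (cosh (dist y z) - cosh (a - b))) ≤
      (sinh a * sinh b) * (sinh R ^ 2 * (cosh (dist y' z') - cosh (l * (a - b)))) := by nlinarith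
    exact le_of_mul_le_mul_left this (by positivity)
  have r3 : sinh (l * R) * sinh (|a - b| / 2) ≤ sinh (l * (|a - b| / 2)) * sinh R :=
    sinh_ratio h0 h1 (by positivity) (by
      have : |a - b| ≤ R := abs_le.2 ⟨by linarith, by linarith⟩
      linarith [abs_nonneg (a - b)])
  have r4 : sinh (l * R) ^ 2 * sinh (|a - b| / 2) ^ 2 ≤ sinh (l * (|a - b| / 2)) ^ 2 * sinh R ^ 2 := by
    rw [← mul_pow, ← mul_pow]
    exact pow_le_pow_left₀ (mul_nonneg sl (sinh_nonneg_iff.2 (by positivity))) r3 2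
  have k1 : cosh (a - b) = 1 + 2 * sinh (|a - b| / 2) ^ 2 := by rw [← cosh_abs, cosh_eq_half]
  have k2 : cosh (l * (a - b)) = 1 + 2 * sinh (l * (|a - b| / 2)) ^ 2 := by
    rw [← cosh_abs, cosh_eq_half, abs_mul, abs_of_nonneg h0, mul_div_assoc]
  rw [k1, k2, cosh_eq_half (dist y z), cosh_eq_half (dist y' z')] at c4
  have c5 : (sinh (l * R) * sinh (dist y z / 2)) ^ 2 ≤ (sinh R * sinh (dist y' z' / 2)) ^ 2 := by
    rw [mul_pow, mul_pow]; linarith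
  exact (sq_le_sq₀ (by positivity) (by positivity)).1 c5

lemma CoshCmp.eq_of_branch (hc : CoshCmp X) {w x y y' : X} (hwx : w ≠ x)
    (h : dist x y = dist x y') (h1 : dist w x + dist x y = dist w y)
    (h2 : dist w x + dist x y' = dist w y') : y = y' := by
  have := hc w y x y' h1
  rw [← h1, dist_comm y' w, ← h2, ← h, dist_comm y' x, ← h, dist_comm y' y] at this
  have e : sinh (dist w x) = sinh (dist w x + dist x y) * cosh (dist x y) -
      cosh (dist w x + dist x y) * sinh (dist x y) := by rw [← sinh_sub]; ring_nf
  have sp := sinh_pos_iff.2 (dist_pos.2 hwx)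
  have : sinh (dist w x) * (cosh (dist y y') - 1) ≤ 0 := by linarith
  have h3 : cosh (dist y y') ≤ 1 := by nlinarith
  rw [← cosh_zero, cosh_le_cosh, abs_zero, abs_of_nonneg dist_nonneg] at h3
  exact dist_le_zero.1 h3

end Comparison

end

section

section MeasureBasics

open Real

/-- A countable measurable partition of a separable metric space into sets of small diameter. -/
lemma exists_small_partition (Y : Type*) [MetricSpace Y] [SecondCountableTopology Y]
    [MeasurableSpace Y] [OpensMeasurableSpace Y] {δ : ℝ} (hδ : 0 < δ) :
    ∃ B : ℕ → Set Y, (∀ i, MeasurableSet (B i)) ∧ Pairwise (Function.onFun Disjoint B) ∧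
      (⋃ i, B i) = univ ∧ ∀ i, ∀ x ∈ B i, ∀ y ∈ B i, dist x y < δ := by
  rcases isEmpty_or_nonempty Y with hY | hY
  · refine ⟨fun _ => ∅, fun _ => MeasurableSet.empty, fun _ _ _ => by simp [Function.onFun], ?_, ?_⟩
    · ext y; exact (hY.false y).elim
    · simp
  let u := TopologicalSpace.denseSeq Y
  refine ⟨disjointed fun k => ball (u k) (δ / 2), fun i => ?_, disjoint_disjointed _, ?_, ?_⟩
  · exact MeasurableSet.disjointed (fun k => measurableSet_ball) i
  · rw [iUnion_disjointed, eq_univ_iff_forall]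
    intro y
    obtain ⟨k, hk⟩ := (TopologicalSpace.denseRange_denseSeq Y).exists_dist_lt y (half_pos hδ)
    exact mem_iUnion.2 ⟨k, hk⟩
  · intro i x hx y hy
    have hx' := disjointed_subset _ _ hx
    have hy' := disjointed_subset _ _ hy
    rw [mem_ball] at hx' hy'
    linarith [dist_triangle_right x y (u i)]

lemma measure_eq_tsum_partition {Y : Type*} [MeasurableSpace Y] (μ : Measure Y) {B : ℕ → Set Y}
    (hm : ∀ i, MeasurableSet (B i)) (hd : Pairwise (Function.onFun Disjoint B))
    (hu : (⋃ i, B i) = univ) (C : Set Y) : μ C = ∑' i, μ (C ∩ B i) := by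
  have h1 : μ C = (μ.restrict C) (⋃ i, B i) := by rw [hu, Measure.restrict_apply_univ]
  rw [h1, measure_iUnion hd hm]
  exact tsum_congr fun i => by rw [Measure.restrict_apply (hm i), inter_comm]

/-- If a map `R` from `A` into `C` has locally `L`-Lipschitz inverse then
`μH[n] A ≤ L ^ n * μH[n] C`. -/
lemma hausdorff_le_of_local {X Y : Type*} [MetricSpace X] [MeasurableSpace X] [BorelSpace X]
    [MetricSpace Y] [SecondCountableTopology Y] [MeasurableSpace Y] [BorelSpace Y] (n : ℕ)
    {A : Set X} {C : Set Y} {L δ : ℝ} (hL : 0 ≤ L) (hδ : 0 < δ) (R : X → Y)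
    (hR : ∀ x ∈ A, R x ∈ C)
    (hLip : ∀ x ∈ A, ∀ x' ∈ A, dist (R x) (R x') < δ → dist x x' ≤ L * dist (R x) (R x')) :
    μH[(n : ℝ)] A ≤ ENNReal.ofReal (L ^ n) * μH[(n : ℝ)] C := by
  obtain ⟨B, hBm, hBd, hBu, hBs⟩ := exists_small_partition Y hδ
  have hA : A = ⋃ i, A ∩ R ⁻¹' (B i) := by
    rw [← inter_iUnion, ← preimage_iUnion, hBu, preimage_univ, inter_univ]
  rw [measure_eq_tsum_partition _ hBm hBd hBu C, ← ENNReal.tsum_mul_left]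
  calc μH[(n : ℝ)] A = μH[(n : ℝ)] (⋃ i, A ∩ R ⁻¹' (B i)) := by rw [← hA]
    _ ≤ ∑' i, μH[(n : ℝ)] (A ∩ R ⁻¹' (B i)) := measure_iUnion_le _
    _ ≤ _ := ENNReal.tsum_le_tsum fun i => ?_
  rcases (A ∩ R ⁻¹' (B i)).eq_empty_or_nonempty with he | hne
  · rw [he]; simp
  have : Nonempty X := ⟨hne.some⟩
  set D := A ∩ R ⁻¹' (B i) with hD
  have hLD : ∀ x ∈ D, ∀ x' ∈ D, dist x x' ≤ L * dist (R x) (R x') := fun x hx x' hx' =>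
    hLip x hx.1 x' hx'.1 (hBs i _ hx.2 _ hx'.2)
  have hinj : InjOn R D := fun x hx x' hx' h => by
    have := hLD x hx x' hx'
    rw [h, dist_self, mul_zero] at this
    exact dist_le_zero.1 this
  have hg : LipschitzOnWith (Real.toNNReal L) (Function.invFunOn R D) (R '' D) := by
    apply LipschitzOnWith.of_dist_le_mul
    rintro _ ⟨x, hx, rfl⟩ _ ⟨x', hx', rfl⟩
    rw [hinj.leftInvOn_invFunOn hx, hinj.leftInvOn_invFunOn hx', Real.coe_toNNReal _ hL]
    exact hLD x hx x' hx'
  have h1 := hg.hausdorffMeasure_image_le (d := (n : ℝ)) (Nat.cast_nonneg n)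
  rw [hinj.invFunOn_image Subset.rfl] at h1
  refine h1.trans ?_
  rw [ENNReal.rpow_natCast, ENNReal.ofReal_pow hL]
  refine mul_le_mul' le_rfl (measure_mono ?_)
  rintro _ ⟨x, hx, rfl⟩
  exact ⟨hR x hx.1, hx.2⟩

lemma sinh_le_mul_cosh {t : ℝ} (ht : 0 ≤ t) : sinh t ≤ t * cosh t := by
  have hd : ∀ s, HasDerivAt (fun s => s * cosh s - sinh s) (s * sinh s) s := by
    intro s
    have := ((hasDerivAt_id s).mul (hasDerivAt_cosh s)).sub (hasDerivAt_sinh s)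
    exact this.congr_deriv (by simp)
  have hm : MonotoneOn (fun s => s * cosh s - sinh s) (Ici 0) := by
    apply monotoneOn_of_deriv_nonneg (convex_Ici 0)
    · exact fun s _ => (hd s).continuousAt.continuousWithinAt
    · exact fun s _ => (hd s).differentiableAt.differentiableWithinAt
    · intro s hs
      rw [interior_Ici] at hs
      rw [(hd s).deriv]
      exact mul_nonneg (le_of_lt hs) (sinh_nonneg_iff.2 (le_of_lt hs))
  have := hm self_mem_Ici ht ht
  simp at this
  linarith

variable {X : Type*} [MetricSpace X]

lemma IsFrac.dist_le {p y y' : X} {l : ℝ} (h : IsFrac p y l y') (h1 : l ≤ 1) :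
    dist p y' ≤ dist p y := by
  rw [h.1]; nlinarith [dist_nonneg (x := p) (y := y)]

lemma CoshCmp.frac_dist_le_local (hc : CoshCmp X) {p y z y' z' : X} {l R ε : ℝ} (h0 : 0 < l)
    (h1 : l ≤ 1) (hR : 0 < R) (hy : dist p y ≤ R) (hz : dist p z ≤ R)
    (hy' : IsFrac p y l y') (hz' : IsFrac p z l z') (hε : dist y' z' ≤ ε) :
    dist y z ≤ (sinh R / sinh (l * R) * cosh ε) * dist y' z' := by
  have h := hc.contraction h0.le h1 hR hy hz hy' hz'
  have s1 : 0 < sinh (l * R) := sinh_pos_iff.2 (by positivity)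
  have s2 : 0 < sinh R := sinh_pos_iff.2 hR
  have d0 := dist_nonneg (x := y') (y := z')
  have k1 : dist y z / 2 ≤ sinh (dist y z / 2) := self_le_sinh_iff.2 (by positivity)
  have k2 : sinh (dist y' z' / 2) ≤ dist y' z' / 2 * cosh ε := by
    refine (sinh_le_mul_cosh (by positivity)).trans (mul_le_mul_of_nonneg_left ?_ (by positivity))
    rw [cosh_le_cosh, abs_of_nonneg (by positivity), abs_of_nonneg (by linarith)]
    linarith
  rw [div_mul_eq_mul_div, div_mul_eq_mul_div, le_div_iff₀ s1]
  have k3 := mul_le_mul_of_nonneg_left k1 s1.le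
  have k4 := mul_le_mul_of_nonneg_left k2 s2.le
  linarith

/-- The constant controlling contraction maps on balls of radius `R`. -/
noncomputable def contrC (R : ℝ) : ℝ := sinh R * cosh (2 * R) / R

lemma contrC_pos {R : ℝ} (hR : 0 < R) : 0 < contrC R :=
  div_pos (mul_pos (sinh_pos_iff.2 hR) (cosh_pos _)) hR

lemma CoshCmp.frac_dist_le (hc : CoshCmp X) {p y z y' z' : X} {l R : ℝ} (h0 : 0 < l)
    (h1 : l ≤ 1) (hR : 0 < R) (hy : dist p y ≤ R) (hz : dist p z ≤ R)
    (hy' : IsFrac p y l y') (hz' : IsFrac p z l z') :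
    dist y z ≤ contrC R / l * dist y' z' := by
  have h := hc.frac_dist_le_local h0 h1 hR hy hz hy' hz' (ε := 2 * R) (by
    linarith [dist_triangle_left y' z' p, hy'.dist_le h1, hz'.dist_le h1])
  refine h.trans (mul_le_mul_of_nonneg_right ?_ dist_nonneg)
  have s1 : l * R ≤ sinh (l * R) := self_le_sinh_iff.2 (by positivity)
  have s2 : 0 < sinh R := sinh_pos_iff.2 hR
  have s3 := cosh_pos (2 * R)
  unfold contrC
  rw [div_mul_eq_mul_div, div_div, mul_comm R l]
  exact div_le_div_of_nonneg_left (by positivity) (by positivity) s1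

variable [MeasurableSpace X] [BorelSpace X] [ProperSpace X] {n : ℕ}

/-- A set whose points are pushed into `Z` by contraction towards `p` is controlled by `Z`. -/
lemma CoshCmp.measure_le_of_frac (hc : CoshCmp X) {p : X} {R l : ℝ} (h0 : 0 < l) (h1 : l ≤ 1)
    (hR : 0 < R) {A Z : Set X} (hA : A ⊆ closedBall p R)
    (hZ : ∀ x ∈ A, ∃ z ∈ Z, IsFrac p x l z) :
    μH[(n : ℝ)] A ≤ ENNReal.ofReal ((contrC R / l) ^ n) * μH[(n : ℝ)] Z := by
  choose! f hf hf' using hZ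
  have := contrC_pos hR
  refine hausdorff_le_of_local n (L := contrC R / l) (δ := 1) (by positivity) one_pos f hf ?_
  intro x hx x' hx' _
  exact hc.frac_dist_le h0 h1 hR (by simpa [dist_comm] using hA hx)
    (by simpa [dist_comm] using hA hx') (hf' x hx) (hf' x' hx')

/-- Standing assumptions: a geodesic space with hyperbolic comparison and a nontrivial
`n`-dimensional Hausdorff measure. -/
structure GoodSpace (X : Type*) [MetricSpace X] [MeasurableSpace X] [BorelSpace X] (n : ℕ) :
    Prop where
  geod : IsGeodesicSpace X
  cosh : CoshCmp X
  nontriv : ∃ U : Set X, IsOpen U ∧ Bornology.IsBounded U ∧ U.Nonempty ∧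
    μH[(n : ℝ)] U ≠ 0 ∧ μH[(n : ℝ)] U ≠ ⊤

variable (G : GoodSpace X n)

include G

lemma GoodSpace.closedBall_lt_top (p : X) (R : ℝ) : μH[(n : ℝ)] (closedBall p R) < ⊤ := by
  obtain ⟨U, hUo, -, ⟨x, hx⟩, -, hUt⟩ := G.nontriv
  obtain ⟨r, hr, hrU⟩ := Metric.isOpen_iff.1 hUo x hx
  set R' := max (dist p x + R) r with hR'
  have hR0 : 0 < R' := hr.trans_le (le_max_right _ _)
  have hl0 : 0 < r / (2 * R') := by positivity
  have hl1 : r / (2 * R') ≤ 1 := by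
    rw [div_le_one (by positivity)]
    linarith [le_max_right (dist p x + R) r]
  have hsub : closedBall p R ⊆ closedBall x R' := closedBall_subset_closedBall' (by
    linarith [le_max_left (dist p x + R) r])
  refine (G.cosh.measure_le_of_frac (Z := U) (n := n) hl0 hl1 hR0 hsub ?_).trans_lt
    (ENNReal.mul_lt_top ENNReal.ofReal_lt_top (lt_top_iff_ne_top.2 hUt))
  intro y hy
  obtain ⟨z, hz, hz'⟩ := G.geod.exists_frac x y hl0.le hl1
  refine ⟨z, hrU ?_, hz, hz'⟩
  rw [mem_ball, dist_comm, hz]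
  have : dist x y ≤ R' := by simpa [dist_comm] using hsub hy
  calc r / (2 * R') * dist x y ≤ r / (2 * R') * R' := by gcongr
    _ = r / 2 := by field_simp
    _ < r := by linarith

lemma GoodSpace.isFiniteMeasureOnCompacts : IsFiniteMeasureOnCompacts (μH[(n : ℝ)] : Measure X) where
  lt_top_of_isCompact := by
    intro K hK
    rcases isEmpty_or_nonempty X with hX | hX
    · rw [eq_empty_of_isEmpty K]; simp
    obtain ⟨R, hR⟩ := hK.isBounded.subset_closedBall (Classical.arbitrary X)
    exact (measure_mono hR).trans_lt (G.closedBall_lt_top _ _)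

lemma GoodSpace.lt_top_of_bounded {s : Set X} (hs : Bornology.IsBounded s) :
    μH[(n : ℝ)] s < ⊤ := by
  rcases s.eq_empty_or_nonempty with rfl | ⟨x, -⟩
  · simp
  obtain ⟨R, hR⟩ := hs.subset_closedBall x
  exact (measure_mono hR).trans_lt (G.closedBall_lt_top _ _)

lemma GoodSpace.closedBall_pos (p : X) {r : ℝ} (hr : 0 < r) : 0 < μH[(n : ℝ)] (closedBall p r) := by
  obtain ⟨U, hUo, hUb, -, hU0, -⟩ := G.nontriv
  obtain ⟨R₀, hR₀⟩ := hUb.subset_closedBall p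
  set R := max R₀ r
  have hR0 : 0 < R := hr.trans_le (le_max_right _ _)
  have hl0 : 0 < r / R := by positivity
  have hl1 : r / R ≤ 1 := (div_le_one hR0).2 (le_max_right _ _)
  have hsub : U ⊆ closedBall p R := hR₀.trans (closedBall_subset_closedBall (le_max_left _ _))
  have h := G.cosh.measure_le_of_frac (Z := closedBall p r) (n := n) hl0 hl1 hR0 hsub (by
    intro y hy
    obtain ⟨z, hz, hz'⟩ := G.geod.exists_frac p y hl0.le hl1
    refine ⟨z, ?_, hz, hz'⟩
    rw [mem_closedBall, dist_comm, hz]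
    have : dist p y ≤ R := by simpa [dist_comm] using hsub hy
    calc r / R * dist p y ≤ r / R * R := by gcongr
      _ = r := by field_simp)
  by_contra h0
  rw [not_lt, nonpos_iff_eq_zero] at h0
  rw [h0, mul_zero] at h
  exact hU0 (nonpos_iff_eq_zero.1 h)

lemma GoodSpace.pos_of_isOpen {U : Set X} (hU : IsOpen U) (hne : U.Nonempty) :
    0 < μH[(n : ℝ)] U := by
  obtain ⟨x, hx⟩ := hne
  obtain ⟨r, hr, hrU⟩ := Metric.isOpen_iff.1 hU x hx
  exact (G.closedBall_pos x (half_pos hr)).trans_le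
    (measure_mono ((closedBall_subset_ball (by linarith)).trans hrU))

lemma GoodSpace.real_closedBall_pos (p : X) {r : ℝ} (hr : 0 < r) :
    0 < (μH[(n : ℝ)] : Measure X).real (closedBall p r) :=
  ENNReal.toReal_pos (G.closedBall_pos p hr).ne' (G.closedBall_lt_top p r).ne

/-- Doubling-type estimate. -/
lemma GoodSpace.real_closedBall_le (p : X) {R l : ℝ} (hR : 0 < R) (h0 : 0 < l) (h1 : l ≤ 1) :
    (μH[(n : ℝ)] : Measure X).real (closedBall p R) ≤
      (contrC R / l) ^ n * (μH[(n : ℝ)] : Measure X).real (closedBall p (l * R)) := by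
  have h := G.cosh.measure_le_of_frac (Z := closedBall p (l * R)) (n := n) h0 h1 hR Subset.rfl (by
    intro y hy
    obtain ⟨z, hz, hz'⟩ := G.geod.exists_frac p y h0.le h1
    refine ⟨z, ?_, hz, hz'⟩
    rw [mem_closedBall, dist_comm, hz]
    rw [mem_closedBall, dist_comm] at hy
    gcongr)
  have h2 := ENNReal.toReal_mono (ENNReal.mul_lt_top ENNReal.ofReal_lt_top
    (G.closedBall_lt_top p (l * R))).ne h
  rw [ENNReal.toReal_mul, ENNReal.toReal_ofReal (by have := contrC_pos hR; positivity)] at h2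
  exact h2

end MeasureBasics

end

section

/-- Existence of a maximal finite subset on which a symmetric relation holds pairwise, given a
cardinality bound. -/
lemma exists_maximal_pairwise {α : Type*} (S : Set α) (r : α → α → Prop)
    (hr : ∀ x y, r x y → r y x) (M : ℕ)
    (hM : ∀ s : Finset α, (s : Set α) ⊆ S → (s : Set α).Pairwise r → s.card ≤ M) :
    ∃ s : Finset α, (s : Set α) ⊆ S ∧ (s : Set α).Pairwise r ∧
      ∀ y ∈ S, y ∈ s ∨ ∃ z ∈ s, ¬ r z y := by
  classical
  let P : ℕ → Prop := fun k => ∃ s : Finset α, (s : Set α) ⊆ S ∧ (s : Set α).Pairwise r ∧ s.card = k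
  have hP0 : P 0 := ⟨∅, by simp, by simp, rfl⟩
  obtain ⟨s, hs, hp, hc⟩ : P (Nat.findGreatest P M) := Nat.findGreatest_spec (Nat.zero_le M) hP0
  refine ⟨s, hs, hp, fun y hy => ?_⟩
  by_contra! hcon
  have hcard : (insert y s).card = s.card + 1 := Finset.card_insert_of_notMem hcon.1
  have hsub : ((insert y s : Finset α) : Set α) ⊆ S := by
    rw [Finset.coe_insert]; exact insert_subset hy hs
  have hpair : ((insert y s : Finset α) : Set α).Pairwise r := by
    rw [Finset.coe_insert]
    exact hp.insert fun z hz _ => ⟨hr _ _ (hcon.2 z hz), hcon.2 z hz⟩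
  have h1 : P (s.card + 1) := ⟨_, hsub, hpair, hcard⟩
  have h2 : s.card + 1 ≤ M := hcard ▸ hM _ hsub hpair
  have h3 := Nat.le_findGreatest h2 h1
  omega

section Ahlfors

variable {X : Type*} [MetricSpace X] [MeasurableSpace X] [BorelSpace X]

/-- Disjoint balls centred at separated points: a volume count. -/
lemma card_mul_le_of_separated (μ : Measure X) {B : Set X} (hB : μ B ≠ ⊤) {s : Finset X} {δ c : ℝ}
    (hs : (s : Set X).Pairwise fun x y => δ ≤ dist x y)
    (hsub : ∀ x ∈ s, closedBall x (δ / 3) ⊆ B)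
    (hc : ∀ x ∈ s, c ≤ μ.real (closedBall x (δ / 3))) (hδ : 0 < δ) :
    s.card * c ≤ μ.real B := by
  calc (s.card : ℝ) * c = ∑ x ∈ s, c := by simp
    _ ≤ ∑ x ∈ s, μ.real (closedBall x (δ / 3)) := Finset.sum_le_sum hc
    _ = μ.real (⋃ x ∈ s, closedBall x (δ / 3)) := by
        symm
        apply measureReal_biUnion_finset
        · intro x hx y hy hxy
          apply closedBall_disjoint_closedBall
          linarith [hs hx hy hxy]
        · exact fun x _ => measurableSet_closedBall
        · exact fun x hx => measure_ne_top_of_subset (hsub x hx) hB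
    _ ≤ μ.real B := measureReal_mono (iUnion₂_subset hsub) hB

variable [ProperSpace X] {n : ℕ} (G : GoodSpace X n)

include G

lemma GoodSpace.ahlfors_lower (p : X) (R : ℝ) :
    ∃ c, 0 < c ∧ ∀ x ∈ closedBall p R, ∀ r, 0 < r → r ≤ 1 →
      c * r ^ n ≤ (μH[(n : ℝ)] : Measure X).real (closedBall x r) := by
  set R' := |R| + 2
  have hR' : 0 < R' := by positivity
  have hC := contrC_pos hR'
  have m0 := G.real_closedBall_pos p one_pos
  refine ⟨(μH[(n : ℝ)] : Measure X).real (closedBall p 1) / (contrC R' * R') ^ n,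
    by positivity, fun x hx r hr hr1 => ?_⟩
  have h := G.real_closedBall_le x (l := r / R') hR' (by positivity)
    ((div_le_one hR').2 (by simp only [R']; linarith [abs_nonneg R]))
  rw [div_mul_cancel₀ _ hR'.ne'] at h
  have hm : (μH[(n : ℝ)] : Measure X).real (closedBall p 1) ≤
      (μH[(n : ℝ)] : Measure X).real (closedBall x R') :=
    measureReal_mono (closedBall_subset_closedBall' (by
      rw [mem_closedBall, dist_comm] at hx
      simp only [R']; linarith [le_abs_self R])) (G.closedBall_lt_top _ _).ne
  have h2 := hm.trans h
  rw [div_mul_eq_mul_div, div_le_iff₀ (by positivity)]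
  have e : (contrC R' / (r / R')) ^ n = (contrC R' * R') ^ n / r ^ n := by
    rw [← div_pow]; congr 1; field_simp
  rw [e, div_mul_eq_mul_div, le_div_iff₀ (by positivity)] at h2
  linarith

lemma GoodSpace.ahlfors_upper : ∃ C, 0 < C ∧ ∀ x : X, ∀ r, 0 < r → r ≤ 1 →
      (μH[(n : ℝ)] : Measure X).real (closedBall x r) ≤ C * r ^ n := by
  have hC3 := contrC_pos (show (0 : ℝ) < 3 by norm_num)
  -- constant for packing
  set A : ℝ := contrC 3 * 9 with hA
  have hApos : 0 < A := by positivity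
  -- doubling at small scales
  have key : ∀ (y : X) (r l : ℝ), 0 < r → r ≤ 1 → 0 < l → l ≤ 1 →
      (μH[(n : ℝ)] : Measure X).real (closedBall y (3 * r)) ≤
        (A / l) ^ n * (μH[(n : ℝ)] : Measure X).real (closedBall y (l * r / 3)) := by
    intro y r l hr hr1 hl hl1
    have h := G.cosh.measure_le_of_frac (p := y) (R := 3) (l := l / 9)
      (A := closedBall y (3 * r)) (Z := closedBall y (l * r / 3)) (n := n) (by positivity)
      (by linarith) (by norm_num) (closedBall_subset_closedBall (by linarith)) (by
        intro x hx
        obtain ⟨z, hz, hz'⟩ := G.geod.exists_frac y x (l := l / 9) (by positivity) (by linarith)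
        refine ⟨z, ?_, hz, hz'⟩
        rw [mem_closedBall, dist_comm] at hx
        rw [mem_closedBall, dist_comm, hz]
        calc l / 9 * dist y x ≤ l / 9 * (3 * r) := by gcongr
          _ = l * r / 3 := by ring)
    have h2 := ENNReal.toReal_mono (ENNReal.mul_lt_top ENNReal.ofReal_lt_top
      (G.closedBall_lt_top y (l * r / 3))).ne h
    rw [ENNReal.toReal_mul, ENNReal.toReal_ofReal (by positivity)] at h2
    refine h2.trans (le_of_eq ?_)
    rw [hA]; congr 2; field_simp
  refine ⟨(2 * A) ^ n, by positivity, fun x r hr hr1 => ?_⟩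
  -- coverings
  have cover : ∀ l : ℝ, 0 < l → l ≤ 1 → ∃ s : Finset X, (s.card : ℝ) ≤ (A / l) ^ n ∧
      closedBall x r ⊆ ⋃ y ∈ s, closedBall y (l * r) := by
    intro l hl hl1
    have hcard : ∀ s : Finset X, (s : Set X) ⊆ closedBall x r →
        ((s : Set X).Pairwise fun a b => l * r ≤ dist a b) → (s.card : ℝ) ≤ (A / l) ^ n := by
      intro s hs hp
      have hm := G.real_closedBall_pos x (show 0 < 2 * r by positivity)
      have := card_mul_le_of_separated (μH[(n : ℝ)] : Measure X)
        (B := closedBall x (2 * r)) (G.closedBall_lt_top _ _).ne (s := s) (δ := l * r)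
        (c := (μH[(n : ℝ)] : Measure X).real (closedBall x (2 * r)) / (A / l) ^ n) hp (by
          intro y hy
          apply closedBall_subset_closedBall'
          have := hs hy
          rw [mem_closedBall] at this
          nlinarith) (by
          intro y hy
          rw [div_le_iff₀' (by positivity)]
          refine le_trans (measureReal_mono ?_ (G.closedBall_lt_top _ _).ne) (key y r l hr hr1 hl hl1)
          apply closedBall_subset_closedBall'
          have := hs hy
          rw [mem_closedBall, dist_comm] at this
          linarith) (by positivity)
      rw [mul_div_assoc', div_le_iff₀ (by positivity), mul_comm] at this
      exact le_of_mul_le_mul_left this hm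
    obtain ⟨s, hs, hp, hmax⟩ := exists_maximal_pairwise (closedBall x r)
      (fun a b => l * r ≤ dist a b) (fun a b h => by rwa [dist_comm]) ⌊(A / l) ^ n⌋₊
      (fun s hs hp => Nat.le_floor (hcard s hs hp))
    refine ⟨s, hcard s hs hp, fun y hy => ?_⟩
    rcases hmax y hy with h | ⟨z, hz, h⟩
    · exact mem_iUnion₂.2 ⟨y, h, mem_closedBall_self (by positivity)⟩
    · refine mem_iUnion₂.2 ⟨z, hz, ?_⟩
      rw [mem_closedBall, dist_comm]
      exact (not_le.1 h).le
  have hl : ∀ k : ℕ, (0 : ℝ) < 1 / (k + 1) ∧ (1 : ℝ) / (k + 1) ≤ 1 := fun k =>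
    ⟨by positivity, by rw [div_le_one (by positivity)]; linarith [(Nat.cast_nonneg k : (0:ℝ) ≤ k)]⟩
  choose s hs hcov using fun k : ℕ => cover (1 / (k + 1)) (hl k).1 (hl k).2
  have hdiam : ∀ (k : ℕ) (i : s k), ediam (closedBall (i : X) (1 / (k + 1) * r)) ≤
      ENNReal.ofReal (2 * (1 / (k + 1) * r)) := by
    intro k i
    refine ediam_le_of_forall_dist_le fun a ha b hb => ?_
    rw [mem_closedBall] at ha hb
    linarith [dist_triangle_right a b (i : X)]
  have h := Measure.hausdorffMeasure_le_liminf_sum (n : ℝ) (closedBall x r) (l := atTop)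
    (fun k : ℕ => ENNReal.ofReal (2 * (1 / (k + 1) * r))) (by
      rw [← ENNReal.ofReal_zero]
      apply ENNReal.tendsto_ofReal
      have := (tendsto_one_div_add_atTop_nhds_zero_nat (𝕜 := ℝ)).mul_const (2 * r)
      rw [zero_mul] at this
      exact this.congr fun k => by ring) (fun k (i : s k) => closedBall (i : X) (1 / (k + 1) * r))
    (Eventually.of_forall hdiam) (Eventually.of_forall fun k => by
      refine (hcov k).trans ?_
      intro y hy
      obtain ⟨z, hz, hyz⟩ := mem_iUnion₂.1 hy
      exact mem_iUnion.2 ⟨⟨z, hz⟩, hyz⟩)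
  have h2 : (μH[(n : ℝ)] : Measure X) (closedBall x r) ≤ ENNReal.ofReal ((2 * A) ^ n * r ^ n) := by
    refine h.trans ?_
    refine (liminf_le_liminf (v := fun _ => ENNReal.ofReal ((2 * A) ^ n * r ^ n))
      (Eventually.of_forall fun k => ?_)).trans (by rw [liminf_const])
    calc ∑ i : s k, ediam (closedBall (i : X) (1 / (k + 1) * r)) ^ (n : ℝ)
        ≤ ∑ i : s k, ENNReal.ofReal (2 * (1 / (k + 1) * r)) ^ (n : ℝ) :=
          Finset.sum_le_sum fun i _ => ENNReal.rpow_le_rpow (hdiam k i) (Nat.cast_nonneg n)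
      _ = ENNReal.ofReal ((s k).card * (2 * (1 / (k + 1) * r)) ^ n) := by
          rw [Finset.sum_const, nsmul_eq_mul, ENNReal.rpow_natCast,
            ENNReal.ofReal_mul (Nat.cast_nonneg (s k).card), ENNReal.ofReal_natCast,
            ENNReal.ofReal_pow (by have := (hl k).1; positivity)]
          simp
      _ ≤ ENNReal.ofReal ((2 * A) ^ n * r ^ n) := by
          apply ENNReal.ofReal_le_ofReal
          have hk := (hl k).1
          calc ((s k).card : ℝ) * (2 * (1 / (k + 1) * r)) ^ n
              ≤ (A / (1 / (k + 1))) ^ n * (2 * (1 / (k + 1) * r)) ^ n := by gcongr; exact hs k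
            _ = (2 * A) ^ n * r ^ n := by
                rw [← mul_pow, ← mul_pow]; congr 1; field_simp
  exact ENNReal.toReal_le_of_le_ofReal (by positivity) h2

/-- For almost every `x`, a geodesic from `p` to `x` extends beyond `x`. -/
lemma GoodSpace.ae_antipode [Nontrivial X] (p : X) :
    ∀ᵐ x ∂(μH[(n : ℝ)] : Measure X), ∃ q, q ≠ x ∧ dist p x + dist x q = dist p q := by
  set μ := (μH[(n : ℝ)] : Measure X) with hμ
  set Bad : Set X := {x | ¬ ∃ q, q ≠ x ∧ dist p x + dist x q = dist p q} with hBad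
  have key : ∀ R : ℝ, 0 < R → ∀ η : ℝ, 0 < η → ∃ E : Set X, MeasurableSet E ∧
      E ⊆ closedBall p R ∧ Disjoint E Bad ∧ μ.real (closedBall p R) ≤ (1 + η) * μ.real E := by
    intro R hR η hη
    have hlim : Tendsto (fun t : ℝ => (Real.sinh R / Real.sinh ((1 - t) * R) * Real.cosh t) ^ n)
        (𝓝[>] 0) (𝓝 1) := by
      have : ContinuousAt
          (fun t : ℝ => (Real.sinh R / Real.sinh ((1 - t) * R) * Real.cosh t) ^ n) 0 := by
        refine ContinuousAt.pow (ContinuousAt.mul (ContinuousAt.div continuousAt_const ?_ ?_) ?_) n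
        · exact (Real.continuous_sinh.comp (by fun_prop)).continuousAt
        · simpa using hR.ne'
        · exact Real.continuous_cosh.continuousAt
      have h := this.tendsto
      simp only [sub_zero, one_mul, Real.cosh_zero, mul_one,
        div_self (Real.sinh_pos_iff.2 hR).ne', one_pow] at h
      exact h.mono_left nhdsWithin_le_nhds
    obtain ⟨t, ht1, ht0, htl⟩ : ∃ t : ℝ,
        (Real.sinh R / Real.sinh ((1 - t) * R) * Real.cosh t) ^ n < 1 + η ∧ 0 < t ∧ t < 1 := by
      have h1 := hlim.eventually (gt_mem_nhds (show (1 : ℝ) < 1 + η by linarith))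
      have h2 : ∀ᶠ t : ℝ in 𝓝[>] 0, t < 1 := nhdsWithin_le_nhds (gt_mem_nhds one_pos)
      obtain ⟨t, h⟩ := (h1.and (h2.and self_mem_nhdsWithin)).exists
      exact ⟨t, h.1, h.2.2, h.2.1⟩
    set P : Set (X × X) := (closedBall p R ×ˢ closedBall p R) ∩
      {w | dist p w.2 = (1 - t) * dist p w.1 ∧ dist w.2 w.1 = (1 - (1 - t)) * dist p w.1} with hP
    have hPc : IsCompact P := by
      refine ((isCompact_closedBall p R).prod (isCompact_closedBall p R)).inter_right ?_
      exact (isClosed_eq (by fun_prop) (by fun_prop)).inter (isClosed_eq (by fun_prop) (by fun_prop))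
    have hEm : MeasurableSet (Prod.snd '' P) := (hPc.image continuous_snd).measurableSet
    have hEsub : Prod.snd '' P ⊆ closedBall p R := by
      rintro _ ⟨w, hw, rfl⟩; exact hw.1.2
    refine ⟨Prod.snd '' P, hEm, hEsub, ?_, ?_⟩
    · rw [Set.disjoint_left]
      rintro _ ⟨w, hw, rfl⟩ hb
      apply hb
      rcases eq_or_ne w.1 p with h1 | h1
      · have hw2 : p = w.2 := by
          have := hw.2.1
          rw [h1, dist_self, mul_zero] at this
          exact dist_eq_zero.1 this
        obtain ⟨q, hq⟩ := exists_ne p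
        rw [← hw2]
        exact ⟨q, hq, by simp⟩
      · have hd : 0 < dist p w.1 := dist_pos.2 h1.symm
        refine ⟨w.1, ?_, ?_⟩
        · intro h
          have := hw.2.2
          rw [← h, dist_self] at this
          nlinarith
        · rw [hw.2.1, hw.2.2]; ring
    · have hfr : ∀ y ∈ closedBall p R, ∃ z ∈ Prod.snd '' P, IsFrac p y (1 - t) z := by
        intro y hy
        obtain ⟨z, hz, hz'⟩ := G.geod.exists_frac p y (l := 1 - t) (by linarith) (by linarith)
        refine ⟨z, ⟨(y, z), ⟨⟨hy, ?_⟩, hz, hz'⟩, rfl⟩, hz, hz'⟩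
        rw [mem_closedBall, dist_comm] at hy ⊢
        exact (IsFrac.dist_le ⟨hz, hz'⟩ (by linarith)).trans hy
      choose! f hf hf' using hfr
      have hs : 0 < Real.sinh ((1 - t) * R) :=
        Real.sinh_pos_iff.2 (mul_pos (by linarith) hR)
      have hs' : 0 < Real.sinh R := Real.sinh_pos_iff.2 hR
      have hch := Real.cosh_pos t
      have h := hausdorff_le_of_local n (A := closedBall p R) (C := Prod.snd '' P)
        (L := Real.sinh R / Real.sinh ((1 - t) * R) * Real.cosh t) (by positivity) ht0 f hf (by
          intro x hx x' hx' hd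
          exact G.cosh.frac_dist_le_local (by linarith) (by linarith) hR
            (by simpa [dist_comm] using hx) (by simpa [dist_comm] using hx') (hf' x hx) (hf' x' hx')
            hd.le)
      have hfin : μ (Prod.snd '' P) ≠ ⊤ :=
        ((measure_mono hEsub).trans_lt (G.closedBall_lt_top p R)).ne
      have h2 := ENNReal.toReal_mono (ENNReal.mul_lt_top ENNReal.ofReal_lt_top hfin.lt_top).ne h
      rw [ENNReal.toReal_mul, ENNReal.toReal_ofReal (by positivity)] at h2
      exact h2.trans (mul_le_mul_of_nonneg_right ht1.le ENNReal.toReal_nonneg)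
  have hnull : ∀ R : ℝ, 0 < R → μ (Bad ∩ closedBall p R) = 0 := by
    intro R hR
    have hfin := G.closedBall_lt_top p R
    have hle : ∀ η : ℝ, 0 < η → μ.real (Bad ∩ closedBall p R) ≤ η * μ.real (closedBall p R) := by
      intro η hη
      obtain ⟨E, hEm, hEs, hEd, hE⟩ := key R hR η hη
      have h1 : μ.real (Bad ∩ closedBall p R) ≤ μ.real (closedBall p R \ E) :=
        measureReal_mono (fun x hx => ⟨hx.2, fun hxE => Set.disjoint_left.1 hEd hxE hx.1⟩)
          (measure_ne_top_of_subset sdiff_subset hfin.ne)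
      have h2 := measureReal_sdiff (μ := μ) hEs hEm hfin.ne
      have h3 : μ.real E ≤ μ.real (closedBall p R) := measureReal_mono hEs hfin.ne
      nlinarith
    have h0 : μ.real (Bad ∩ closedBall p R) ≤ 0 := by
      refine le_of_forall_pos_le_add fun ε hε => ?_
      have hm : 0 ≤ μ.real (closedBall p R) := measureReal_nonneg
      have := hle (ε / (μ.real (closedBall p R) + 1)) (by positivity)
      refine this.trans ?_
      rw [div_mul_eq_mul_div, div_le_iff₀ (by positivity)]
      nlinarith
    have h1 : μ.real (Bad ∩ closedBall p R) = 0 := le_antisymm h0 measureReal_nonneg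
    exact (measureReal_eq_zero_iff (measure_ne_top_of_subset inter_subset_right hfin.ne)).1 h1
  rw [ae_iff]
  change μ Bad = 0
  have : Bad ⊆ ⋃ k : ℕ, Bad ∩ closedBall p (k + 1) := by
    intro x hx
    obtain ⟨k, hk⟩ := exists_nat_ge (dist x p)
    exact mem_iUnion.2 ⟨k, hx, by rw [mem_closedBall]; linarith⟩
  exact measure_mono_null this (measure_iUnion_null fun k => hnull _ (by positivity))

end Ahlfors

end

section

/-- The infinitesimal structure at a point of a space with curvature bounded below through which
a family of lines passes in almost every direction. -/
structure InfinitesimalCone (K : Type*) [PseudoMetricSpace K] (P : Type*) (o : K) (l : P → ℝ → K) :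
    Prop where
  mid : ∀ a b : K, ∃ m, ∀ q, dist q a ^ 2 / 2 + dist q b ^ 2 / 2 - dist a b ^ 2 / 4 ≤ dist q m ^ 2
  concave : ∀ (p : P) (q : K) (a b t : ℝ), 0 ≤ t → t ≤ 1 →
    (1 - t) * dist q (l p a) ^ 2 + t * dist q (l p b) ^ 2 - t * (1 - t) * (a - b) ^ 2 ≤
      dist q (l p ((1 - t) * a + t * b)) ^ 2
  line : ∀ p s t, dist (l p s) (l p t) = |s - t|
  base : ∀ p, l p 0 = o
  align : ∀ y : K, ∀ η : ℝ, 0 < η → 0 < dist y o → ∃ p, dist (l p (dist y o)) y ≤ η * dist y o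

namespace InfinitesimalCone

lemma _root_.Finsupp.abs_linearCombination_le {P : Type*} (a : P →₀ ℝ) (f : P → ℝ) {c : ℝ} (hf : ∀ p, |f p| ≤ c) :
    |Finsupp.linearCombination ℝ f a| ≤ (∑ i ∈ a.support, |a i|) * c := by
  rw [Finsupp.linearCombination_apply, Finsupp.sum, Finset.sum_mul]
  refine (Finset.abs_sum_le_sum_abs _ _).trans (Finset.sum_le_sum fun i _ => ?_)
  rw [smul_eq_mul, abs_mul]
  exact mul_le_mul_of_nonneg_left (hf i) (abs_nonneg _)

variable {K : Type*} [PseudoMetricSpace K] {P : Type*} {o : K} {l : P → ℝ → K}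

/-- The Busemann function of a line, read off from the distance to its unit point. -/
noncomputable def bus (o : K) (l : P → ℝ → K) (p : P) (y : K) : ℝ :=
  (dist y (l p 1) ^ 2 - dist y o ^ 2 - 1) / 2

/-- An odd-symmetric bounded concave function on the line is affine. -/
lemma affine_of_concave {f : ℝ → ℝ}
    (hf : ∀ a b t, 0 ≤ t → t ≤ 1 → (1 - t) * f a + t * f b ≤ f ((1 - t) * a + t * b))
    (h0 : ∀ t, 0 ≤ f t + f (-t)) (t : ℝ) : f t = f 0 + t * (f 1 - f 0) := by
  have hS : ∀ t, f t + f (-t) = 2 * f 0 := by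
    intro t
    apply le_antisymm
    · have := hf t (-t) (1 / 2) (by norm_num) (by norm_num)
      ring_nf at this ⊢
      linarith
    · refine le_of_forall_pos_le_add fun ε hε => ?_
      obtain ⟨N, hN⟩ := exists_nat_ge (2 * f 0 / ε)
      have hN1 : (0 : ℝ) < N + 1 := by positivity
      have h1 := hf 0 ((N + 1) * t) (1 / (N + 1)) (by positivity)
        (by rw [div_le_one hN1]; linarith [Nat.cast_nonneg (α := ℝ) N])
      have h2 := hf 0 (-((N + 1) * t)) (1 / (N + 1)) (by positivity)
        (by rw [div_le_one hN1]; linarith [Nat.cast_nonneg (α := ℝ) N])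
      have e1 : (1 - 1 / ((N : ℝ) + 1)) * 0 + 1 / (N + 1) * ((N + 1) * t) = t := by field_simp; ring
      have e2 : (1 - 1 / ((N : ℝ) + 1)) * 0 + 1 / (N + 1) * (-((N + 1) * t)) = -t := by
        field_simp; ring
      rw [e1] at h1
      rw [e2] at h2
      have h3 := h0 ((N + 1) * t)
      have h4 : 1 / ((N : ℝ) + 1) * (2 * f 0) ≤ ε := by
        rw [div_mul_eq_mul_div, one_mul, div_le_iff₀ hN1]
        rw [div_le_iff₀ hε] at hN
        nlinarith
      have h5 : 0 ≤ 1 / ((N : ℝ) + 1) * (f ((N + 1) * t) + f (-((N + 1) * t))) := by positivity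
      nlinarith
  have hmul : ∀ t s, 0 ≤ s → s ≤ 1 → f (s * t) - f 0 = s * (f t - f 0) := by
    intro t s hs hs1
    have h1 := hf 0 t s hs hs1
    have h2 := hf 0 (-t) s hs hs1
    have h3 := hS t
    have h4 := hS (s * t)
    rw [show (1 - s) * 0 + s * t = s * t by ring] at h1
    rw [show (1 - s) * 0 + s * -t = -(s * t) by ring] at h2
    nlinarith
  have hpos : ∀ t, 0 ≤ t → f t - f 0 = t * (f 1 - f 0) := by
    intro t ht
    rcases le_total t 1 with h | h
    · simpa using hmul 1 t ht h
    · have := hmul t t⁻¹ (by positivity) (inv_le_one_of_one_le₀ h)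
      have ht' : t ≠ 0 := by linarith
      rw [inv_mul_cancel₀ ht'] at this
      rw [this]; field_simp
  rcases le_total 0 t with h | h
  · linarith [hpos t h]
  · have := hpos (-t) (by linarith)
    have := hS t
    linarith

variable (H : InfinitesimalCone K P o l)
include H

lemma dist_line_base (p : P) (t : ℝ) : dist (l p t) o = |t| := by
  rw [← H.base p, H.line]; simp

lemma dist_sq (p : P) (y : K) (t : ℝ) :
    dist y (l p t) ^ 2 = dist y o ^ 2 + t ^ 2 + 2 * t * bus o l p y := by
  have := affine_of_concave (f := fun t => dist y (l p t) ^ 2 - t ^ 2) (fun a b s hs hs1 => by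
    have := H.concave p y a b s hs hs1
    nlinarith) (fun t => by
    have h1 := dist_triangle_left (l p t) (l p (-t)) y
    rw [H.line, show t - -t = 2 * t by ring] at h1
    have h2 : (2 * t) ^ 2 ≤ (dist y (l p t) + dist y (l p (-t))) ^ 2 := by
      rw [← sq_abs]; gcongr
    nlinarith [sq_nonneg (dist y (l p t) - dist y (l p (-t)))]) t
  simp only [H.base] at this
  rw [bus]
  nlinarith

/-- Gram matrix of the directions. -/
noncomputable def gram (_ : InfinitesimalCone K P o l) (p q : P) : ℝ := -bus o l p (l q 1)

lemma bus_line (p q : P) (s : ℝ) : bus o l p (l q s) = -(s * H.gram p q) := by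
  have key : ∀ s t, s * bus o l q (l p t) = t * bus o l p (l q s) := by
    intro s t
    have h1 := H.dist_sq p (l q s) t
    have h2 := H.dist_sq q (l p t) s
    rw [dist_comm, h2, H.dist_line_base, H.dist_line_base, sq_abs, sq_abs] at h1
    linarith
  have h1 := key s 1
  have h2 := key 1 1
  rw [gram]
  linear_combination s * h2 - h1

lemma gram_symm (p q : P) : H.gram p q = H.gram q p := by
  rw [gram, gram, bus, bus, H.dist_line_base, H.dist_line_base, dist_comm]

lemma gram_self (p : P) : H.gram p p = 1 := by
  rw [gram, bus, H.dist_line_base]; norm_num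

lemma dist_line_line (p q : P) : dist (l p 1) (l q 1) ^ 2 = 2 - 2 * H.gram p q := by
  rw [H.dist_sq q, H.bus_line, H.dist_line_base, H.gram_symm]; norm_num; ring

lemma bus_mid {a b m : K}
    (h : ∀ q, dist q a ^ 2 / 2 + dist q b ^ 2 / 2 - dist a b ^ 2 / 4 ≤ dist q m ^ 2) (p : P) :
    bus o l p m = (bus o l p a + bus o l p b) / 2 := by
  have key : ∀ t, t * (bus o l p a + bus o l p b - 2 * bus o l p m) ≤
      dist m o ^ 2 - dist a o ^ 2 / 2 - dist b o ^ 2 / 2 + dist a b ^ 2 / 4 := by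
    intro t
    have := h (l p t)
    rw [dist_comm _ a, dist_comm _ b, dist_comm _ m, H.dist_sq, H.dist_sq, H.dist_sq] at this
    nlinarith
  by_contra hne
  have hz : bus o l p a + bus o l p b - 2 * bus o l p m ≠ 0 := by
    intro h; apply hne; linarith
  have := key ((dist m o ^ 2 - dist a o ^ 2 / 2 - dist b o ^ 2 / 2 + dist a b ^ 2 / 4 + 1) /
    (bus o l p a + bus o l p b - 2 * bus o l p m))
  rw [div_mul_cancel₀ _ hz] at this
  linarith

lemma bus_sub_le (p : P) (y z : K) : bus o l p y - bus o l p z ≤ dist y z := by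
  refine le_of_forall_pos_le_add fun ε hε => ?_
  set d := dist y z
  have key : ∀ t : ℝ, 0 < t → 2 * t * (bus o l p y - bus o l p z - d) ≤
      dist z o ^ 2 - dist y o ^ 2 + 2 * d * dist z o + d ^ 2 := by
    intro t ht
    have h1 := dist_triangle y z (l p t)
    have h2 := H.dist_sq p y t
    have h3 := H.dist_sq p z t
    have h4 : dist z (l p t) ≤ dist z o + t := by
      have := dist_triangle z o (l p t)
      rwa [dist_comm o, H.dist_line_base, abs_of_pos ht] at this
    have h5 : dist y (l p t) ^ 2 ≤ (d + dist z (l p t)) ^ 2 := by gcongr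
    have hd : 0 ≤ d := dist_nonneg
    nlinarith
  set C := dist z o ^ 2 - dist y o ^ 2 + 2 * d * dist z o + d ^ 2
  have := key ((|C| + 1) / (2 * ε)) (by positivity)
  by_contra hcon
  have h6 : ε < bus o l p y - bus o l p z - d := by linarith
  have h7 : 2 * ((|C| + 1) / (2 * ε)) * ε = |C| + 1 := by field_simp
  have h8 : 2 * ((|C| + 1) / (2 * ε)) * ε <
      2 * ((|C| + 1) / (2 * ε)) * (bus o l p y - bus o l p z - d) := by gcongr
  linarith [le_abs_self C]

/-- The bilinear form on formal combinations of directions. -/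
noncomputable def form : (P →₀ ℝ) →ₗ[ℝ] (P →₀ ℝ) →ₗ[ℝ] ℝ :=
  Finsupp.linearCombination ℝ fun p => Finsupp.linearCombination ℝ (H.gram p)

lemma form_single (p q : P) (s t : ℝ) :
    H.form (Finsupp.single p s) (Finsupp.single q t) = s * t * H.gram p q := by
  simp [form, mul_assoc]

lemma form_symm (a b : P →₀ ℝ) : H.form a b = H.form b a := by
  have : H.form = H.form.flip := by
    apply Finsupp.lhom_ext
    intro p s
    apply Finsupp.lhom_ext
    intro q t
    rw [LinearMap.flip_apply, form_single, form_single, H.gram_symm]; ring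
  conv_lhs => rw [this]
  rfl

/-- `v` represents the formal combination `a`. -/
def Rep (a : P →₀ ℝ) (v : K) : Prop := ∀ p, bus o l p v = -H.form (Finsupp.single p 1) a

lemma exists_rep (a : P →₀ ℝ) : ∃ v, H.Rep a v := by
  suffices ∀ a : P →₀ ℝ, ∀ s : ℝ, ∃ v, H.Rep (s • a) v by simpa using this a 1
  intro a
  induction a using Finsupp.induction_linear with
  | zero =>
    intro s
    refine ⟨o, fun p => ?_⟩
    rw [bus, dist_comm, H.dist_line_base]; simp
  | add a b iha ihb =>
    intro s
    obtain ⟨v, hv⟩ := iha (2 * s)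
    obtain ⟨w, hw⟩ := ihb (2 * s)
    obtain ⟨m, hm⟩ := H.mid v w
    refine ⟨m, fun p => ?_⟩
    rw [H.bus_mid hm, hv p, hw p]
    simp only [map_smul, map_add, smul_eq_mul]
    ring
  | single q t =>
    intro s
    refine ⟨l q (s * t), fun p => ?_⟩
    rw [H.bus_line, Finsupp.smul_single, form_single]; simp

lemma rep_mid {a b : P →₀ ℝ} {v w m : K} (hv : H.Rep a v) (hw : H.Rep b w)
    (hm : ∀ q, dist q v ^ 2 / 2 + dist q w ^ 2 / 2 - dist v w ^ 2 / 4 ≤ dist q m ^ 2) :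
    H.Rep ((1 / 2 : ℝ) • (a + b)) m := by
  intro p
  rw [H.bus_mid hm, hv p, hw p]
  simp only [map_smul, map_add, smul_eq_mul]
  ring

lemma form_eq_bus {a : P →₀ ℝ} {v : K} (hv : H.Rep a v) (b : P →₀ ℝ) :
    H.form b a = -Finsupp.linearCombination ℝ (fun p => bus o l p v) b := by
  induction b using Finsupp.induction_linear with
  | zero => simp
  | add b c hb hc => simp only [map_add, LinearMap.add_apply, hb, hc]; ring
  | single q t =>
    have h1 := hv q
    have h2 : (Finsupp.single q t : P →₀ ℝ) = t • Finsupp.single q 1 := by simp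
    rw [h2, map_smul, LinearMap.smul_apply, map_smul]
    simp only [Finsupp.linearCombination_single, smul_eq_mul, one_mul]
    rw [h1]; ring

lemma bus_le_of_align {y : K} {p : P} {η : ℝ}
    (h : dist (l p (dist y o)) y ≤ η * dist y o) (hy : 0 < dist y o) :
    (1 - η ^ 2 / 2) * dist y o ≤ -bus o l p y ∧ -bus o l p y ≤ dist y o := by
  have h1 := H.dist_sq p y (dist y o)
  rw [dist_comm] at h1
  have h2 : dist (l p (dist y o)) y ^ 2 ≤ (η * dist y o) ^ 2 := by gcongr
  constructor
  · have : dist y o * ((1 - η ^ 2 / 2) * dist y o) ≤ dist y o * -bus o l p y := by nlinarith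
    exact le_of_mul_le_mul_left this hy
  · have : dist y o * -bus o l p y ≤ dist y o * dist y o := by nlinarith [sq_nonneg (dist (l p (dist y o)) y)]
    exact le_of_mul_le_mul_left this hy

lemma form_self {a : P →₀ ℝ} {v : K} (hv : H.Rep a v) : H.form a a = dist v o ^ 2 := by
  rcases eq_or_lt_of_le (dist_nonneg (x := v) (y := o)) with h0 | h0
  · have hz : ∀ p, |bus o l p v| ≤ 0 := by
      intro p
      have hb : bus o l p o = 0 := by rw [bus, dist_comm, H.dist_line_base]; simp
      rw [abs_le]
      constructor
      · have := H.bus_sub_le p o v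
        rw [dist_comm] at this; linarith
      · have := H.bus_sub_le p v o
        linarith
    have := a.abs_linearCombination_le _ hz
    rw [H.form_eq_bus hv, ← h0]
    simp only [mul_zero, abs_nonpos_iff] at this
    rw [this]; norm_num
  · set M := ∑ i ∈ a.support, |a i|
    have hM : 0 ≤ M := Finset.sum_nonneg fun _ _ => abs_nonneg _
    set r := dist v o
    have key : ∀ η : ℝ, 0 < η → η ≤ 1 → |H.form a a - r ^ 2| ≤ (M * r + r ^ 2) * η := by
      intro η hη hη1
      obtain ⟨p, hp⟩ := H.align v η hη h0
      obtain ⟨h1, h2⟩ := H.bus_le_of_align hp h0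
      have h3 : ∀ q, |bus o l q v - bus o l q (l p r)| ≤ η * r := by
        intro q
        rw [abs_le]
        have e1 := H.bus_sub_le q (l p r) v
        have e2 := H.bus_sub_le q v (l p r)
        rw [dist_comm] at e2
        constructor <;> linarith
      have h4 := a.abs_linearCombination_le _ h3
      have h5 : Finsupp.linearCombination ℝ (fun q => bus o l q v - bus o l q (l p r)) a =
          -H.form a a - r * bus o l p v := by
        have hr : H.Rep (Finsupp.single p r) (l p r) := by
          intro q; rw [H.bus_line, form_single]; ring
        have e1 := H.form_eq_bus hv a
        have e2 := H.form_eq_bus hr a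
        have e3 := hv p
        have e4 : H.form a (Finsupp.single p r) = r * H.form (Finsupp.single p 1) a := by
          rw [H.form_symm, show (Finsupp.single p r : P →₀ ℝ) = r • Finsupp.single p 1 by simp,
            map_smul]; rfl
        have e5 : Finsupp.linearCombination ℝ (fun q => bus o l q v - bus o l q (l p r)) a =
            Finsupp.linearCombination ℝ (fun q => bus o l q v) a -
            Finsupp.linearCombination ℝ (fun q => bus o l q (l p r)) a := by
          simp only [Finsupp.linearCombination_apply, Finsupp.sum, ← Finset.sum_sub_distrib,
            smul_sub]
        rw [e5, e3]; linarith
      rw [h5, abs_le] at h4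
      rw [abs_le]
      have hη2 : η ^ 2 ≤ η := by nlinarith
      constructor <;> nlinarith [mul_le_mul_of_nonneg_left h2 h0.le, mul_le_mul_of_nonneg_left h1 h0.le, mul_le_mul_of_nonneg_right hη2 (sq_nonneg r), mul_nonneg hM h0.le, sq_nonneg r]
    have hC : 0 ≤ M * r + r ^ 2 := by positivity
    have : |H.form a a - r ^ 2| ≤ 0 := by
      refine le_of_forall_pos_le_add fun ε hε => ?_
      refine (key (min 1 (ε / (M * r + r ^ 2 + 1))) (by positivity) (min_le_left _ _)).trans ?_
      have h1 : min 1 (ε / (M * r + r ^ 2 + 1)) ≤ ε / (M * r + r ^ 2 + 1) := min_le_right _ _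
      have h2 := mul_le_mul_of_nonneg_left h1 hC
      have h3 : (M * r + r ^ 2) * (ε / (M * r + r ^ 2 + 1)) ≤ ε := by
        rw [← mul_div_assoc, div_le_iff₀ (by positivity)]; nlinarith
      linarith
    have := abs_nonpos_iff.1 this
    linarith

lemma form_nonneg (a : P →₀ ℝ) : 0 ≤ H.form a a := by
  obtain ⟨v, hv⟩ := H.exists_rep a
  rw [H.form_self hv]; positivity

lemma form_sub_le {a b : P →₀ ℝ} {v w : K} (hv : H.Rep a v) (hw : H.Rep b w) :
    H.form (a - b) (a - b) ≤ dist v w ^ 2 := by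
  obtain ⟨m, hm⟩ := H.mid v w
  have h3 := H.form_self (H.rep_mid hv hw hm)
  have h4 := hm o
  rw [dist_comm o, dist_comm o, dist_comm o, ← h3, ← H.form_self hv, ← H.form_self hw] at h4
  simp only [map_smul, map_add, map_sub, smul_eq_mul, LinearMap.add_apply, LinearMap.sub_apply,
    LinearMap.smul_apply] at h4 ⊢
  nlinarith [H.form_symm a b]

lemma form_mul_le (a b : P →₀ ℝ) : H.form a b ^ 2 ≤ H.form a a * H.form b b := by
  have key : ∀ t : ℝ, 0 ≤ H.form a a + 2 * t * H.form a b + t ^ 2 * H.form b b := by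
    intro t
    have := H.form_nonneg (a + t • b)
    simp only [map_smul, map_add, smul_eq_mul, LinearMap.add_apply, LinearMap.smul_apply] at this
    rw [H.form_symm b a] at this
    nlinarith
  rcases eq_or_lt_of_le (H.form_nonneg b) with h | h
  · rw [← h, mul_zero]
    by_contra hcon
    have hne : H.form a b ≠ 0 := by rintro h0; apply hcon; rw [h0]; norm_num
    have := key (-(H.form a a + 1) / (2 * H.form a b))
    rw [← h] at this
    have e : 2 * (-(H.form a a + 1) / (2 * H.form a b)) * H.form a b = -(H.form a a + 1) := by
      field_simp
    rw [e] at this; linarith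
  · have := key (-H.form a b / H.form b b)
    have e : H.form a a + 2 * (-H.form a b / H.form b b) * H.form a b +
        (-H.form a b / H.form b b) ^ 2 * H.form b b =
        H.form a a - H.form a b ^ 2 / H.form b b := by field_simp; ring
    rw [e, sub_nonneg, div_le_iff₀ h] at this
    exact this

end InfinitesimalCone

end

section

namespace InfinitesimalCone

variable {K : Type*} [PseudoMetricSpace K] {P : Type*} {o : K} {l : P → ℝ → K}
  (H : InfinitesimalCone K P o l)
include H

/-- Orthonormal families for the form of directions. -/
def Orthonormal {k : ℕ} (a : Fin k → P →₀ ℝ) : Prop :=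
  ∀ i j, H.form (a i) (a j) = if i = j then 1 else 0

lemma form_sum {k : ℕ} {a : Fin k → P →₀ ℝ} (ha : H.Orthonormal a) (c d : Fin k → ℝ) :
    H.form (∑ i, c i • a i) (∑ i, d i • a i) = ∑ i, c i * d i := by
  simp [map_sum, LinearMap.sum_apply, ha _ _, mul_comm]

lemma card_le_of_packing {n : ℕ} {C : ℝ} (hpack : ∀ N : ℝ, 1 ≤ N → ∀ s : Finset K,
    (∀ y ∈ s, dist y o ≤ N) → (s : Set K).Pairwise (fun y z => 1 ≤ dist y z) → s.card ≤ C * N ^ n)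
    {k : ℕ} {a : Fin k → P →₀ ℝ} (ha : H.Orthonormal a) : k ≤ n := by
  classical
  by_contra! hk
  have hk0 : (1 : ℝ) ≤ k := by exact_mod_cast (by omega : 1 ≤ k)
  choose v hv using fun c : Fin k → ℝ => H.exists_rep (∑ i, c i • a i)
  have key : ∀ N : ℕ, 1 ≤ N → (N : ℝ) ≤ C * k ^ n := by
    intro N hN
    have hN' : (1 : ℝ) ≤ N := by exact_mod_cast hN
    let w : (Fin k → Fin N) → K := fun c => v fun i => ((c i : ℕ) : ℝ)
    have hw : ∀ c d, c ≠ d → 1 ≤ dist (w c) (w d) := by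
      intro c d hcd
      have h1 := H.form_sub_le (hv fun i => ((c i : ℕ) : ℝ)) (hv fun i => ((d i : ℕ) : ℝ))
      rw [← Finset.sum_sub_distrib] at h1
      simp_rw [← sub_smul] at h1
      rw [H.form_sum ha] at h1
      obtain ⟨i, hi⟩ := Function.ne_iff.1 hcd
      have h2 : (1 : ℝ) ≤ (((c i : ℕ) : ℝ) - ((d i : ℕ) : ℝ)) * (((c i : ℕ) : ℝ) - ((d i : ℕ) : ℝ)) := by
        have h3 : ((c i : ℕ) : ℤ) - ((d i : ℕ) : ℤ) ≠ 0 := by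
          intro h; apply hi; apply Fin.ext; omega
        have h4 : (1 : ℤ) ≤ (((c i : ℕ) : ℤ) - ((d i : ℕ) : ℤ)) * (((c i : ℕ) : ℤ) - ((d i : ℕ) : ℤ)) := by
          have := mul_self_pos.2 h3
          omega
        exact_mod_cast h4
      have h5 := Finset.single_le_sum (f := fun i => (((c i : ℕ) : ℝ) - ((d i : ℕ) : ℝ)) *
        (((c i : ℕ) : ℝ) - ((d i : ℕ) : ℝ))) (fun i _ => mul_self_nonneg _) (Finset.mem_univ i)
      have h6 : (1 : ℝ) ≤ dist (w c) (w d) ^ 2 := (h2.trans h5).trans h1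
      nlinarith [dist_nonneg (x := w c) (y := w d)]
    have hinj : Function.Injective w := by
      intro c d hcd
      by_contra hne
      have := hw c d hne
      rw [hcd, dist_self] at this
      linarith
    have h1 := hpack (k * N) (by nlinarith) (Finset.univ.image w) (by
      intro y hy
      obtain ⟨c, -, rfl⟩ := Finset.mem_image.1 hy
      have h1 := H.form_self (hv fun i => ((c i : ℕ) : ℝ))
      rw [H.form_sum ha] at h1
      have h2 : ∑ i, ((c i : ℕ) : ℝ) * ((c i : ℕ) : ℝ) ≤ ∑ _i : Fin k, (N : ℝ) * N := by
        gcongr with i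
        · exact (c i).2.le
        · exact (c i).2.le
      rw [h1] at h2
      simp only [Finset.sum_const, Finset.card_univ, Fintype.card_fin, nsmul_eq_mul] at h2
      change dist (v fun i => ((c i : ℕ) : ℝ)) o ≤ k * N
      apply abs_le_of_sq_le_sq' _ (by positivity) |>.2
      nlinarith [mul_nonneg (show (0 : ℝ) ≤ N * N by positivity) (show (0 : ℝ) ≤ k * (k - 1) by nlinarith)])
      (by
        intro y hy z hz hyz
        obtain ⟨c, -, rfl⟩ := Finset.mem_image.1 hy
        obtain ⟨d, -, rfl⟩ := Finset.mem_image.1 hz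
        exact hw c d fun h => hyz (by rw [h]))
    rw [Finset.card_image_of_injective _ hinj] at h1
    simp only [Finset.card_univ, Fintype.card_fun, Fintype.card_fin, Nat.cast_pow] at h1
    have h2 : (N : ℝ) ^ (n + 1) ≤ (N : ℝ) ^ k := pow_le_pow_right₀ hN' hk
    have h3 : (N : ℝ) ^ n * N ≤ N ^ n * (C * k ^ n) := by
      rw [← pow_succ]
      calc _ ≤ _ := h2.trans h1
        _ = _ := by rw [mul_pow]; ring
    exact le_of_mul_le_mul_left h3 (by positivity)
  obtain ⟨N, hN⟩ := exists_nat_gt (max 1 (C * k ^ n))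
  have h1 := key N (by exact_mod_cast ((le_max_left _ _).trans hN.le))
  linarith [le_max_right 1 (C * (k : ℝ) ^ n)]

lemma exists_basis {n : ℕ} {C : ℝ} (hpack : ∀ N : ℝ, 1 ≤ N → ∀ s : Finset K,
    (∀ y ∈ s, dist y o ≤ N) → (s : Set K).Pairwise (fun y z => 1 ≤ dist y z) → s.card ≤ C * N ^ n) :
    ∃ k ≤ n, ∃ a : Fin k → P →₀ ℝ, H.Orthonormal a ∧
      ∀ b, H.form b b = ∑ i, H.form b (a i) ^ 2 := by
  classical
  let Q : ℕ → Prop := fun k => ∃ a : Fin k → P →₀ ℝ, H.Orthonormal a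
  have hQ0 : Q 0 := ⟨fun i => i.elim0, fun i => i.elim0⟩
  obtain ⟨k, hkn, ⟨a, ha⟩, hmax⟩ : ∃ k ≤ n, Q k ∧ ∀ m ≤ n, Q m → m ≤ k :=
    ⟨Nat.findGreatest Q n, Nat.findGreatest_le n, Nat.findGreatest_spec (Nat.zero_le n) hQ0,
      fun m hm h => Nat.le_findGreatest hm h⟩
  refine ⟨k, hkn, a, ha, fun b => ?_⟩
  by_contra hne
  set r : P →₀ ℝ := b - ∑ i, H.form b (a i) • a i
  have hra : ∀ j, H.form r (a j) = 0 := by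
    intro j
    simp [r, map_sum, LinearMap.sum_apply, ha _ _]
  have hrr : H.form r r = H.form b b - ∑ i, H.form b (a i) ^ 2 := by
    have h1 : H.form r r = H.form r b := by
      have h0 : H.form r (∑ i, H.form b (a i) • a i) = 0 := by
        rw [map_sum]
        exact Finset.sum_eq_zero fun i _ => by rw [map_smul, hra, smul_zero]
      have h2 : H.form r r = H.form r b - H.form r (∑ i, H.form b (a i) • a i) := by
        rw [← map_sub]
      rw [h2, h0, sub_zero]
    rw [h1]
    simp only [r, map_sub, LinearMap.sub_apply, map_sum, LinearMap.sum_apply, map_smul,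
      LinearMap.smul_apply, smul_eq_mul]
    congr 1
    refine Finset.sum_congr rfl fun i _ => ?_
    rw [H.form_symm (a i) b]; ring
  have hpos : 0 < H.form r r := by
    refine lt_of_le_of_ne (H.form_nonneg r) fun h => hne ?_
    linarith
  set s := Real.sqrt (H.form r r)
  have hs : 0 < s := Real.sqrt_pos.2 hpos
  have hss : s * s = H.form r r := Real.mul_self_sqrt hpos.le
  have hnew : Q (k + 1) := by
    refine ⟨Fin.cons (s⁻¹ • r) a, fun i j => ?_⟩
    refine Fin.cases ?_ (fun i => ?_) i <;> refine Fin.cases ?_ (fun j => ?_) j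
    · simp only [Fin.cons_zero, map_smul, LinearMap.smul_apply, smul_eq_mul, ← hss]
      field_simp; simp
    · simp [hra, (Fin.succ_ne_zero j).symm]
    · simp [H.form_symm (a i) r, hra, Fin.succ_ne_zero i]
    · simp [ha i j, Fin.succ_inj]
  have h1 : k + 1 ≤ n := by
    obtain ⟨a', ha'⟩ := hnew
    exact H.card_le_of_packing hpack ha'
  have := hmax _ h1 hnew
  omega

lemma exists_frame {n : ℕ} {C : ℝ} (hpack : ∀ N : ℝ, 1 ≤ N → ∀ s : Finset K,
    (∀ y ∈ s, dist y o ≤ N) → (s : Set K).Pairwise (fun y z => 1 ≤ dist y z) → s.card ≤ C * N ^ n)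
    {ε : ℝ} (hε : 0 < ε) :
    ∃ k ≤ n, ∃ p : Fin k → P, ∀ q, |∑ i, H.gram (p i) q ^ 2 - 1| ≤ ε := by
  obtain ⟨k, hk, a, ha, hb⟩ := H.exists_basis hpack
  refine ⟨k, hk, ?_⟩
  set η := ε / (2 * k + 1)
  have hη : 0 < η := by positivity
  have hp : ∀ i, ∃ p, H.form (Finsupp.single p 1 - a i) (Finsupp.single p 1 - a i) ≤ η ^ 2 := by
    intro i
    obtain ⟨v, hv⟩ := H.exists_rep (a i)
    have h1 := H.form_self hv
    have h2 := ha i i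
    rw [if_pos rfl] at h2
    have h3 : dist v o = 1 := by
      have : (dist v o - 1) * (dist v o + 1) = 0 := by linarith
      rcases mul_eq_zero.1 this with h | h
      · linarith
      · linarith [dist_nonneg (x := v) (y := o)]
    obtain ⟨p, hp⟩ := H.align v η hη (by rw [h3]; norm_num)
    refine ⟨p, ?_⟩
    have h4 := (H.bus_le_of_align hp (by rw [h3]; norm_num)).1
    rw [hv p, h3] at h4
    have h5 : H.form (Finsupp.single p 1) (Finsupp.single p 1) = 1 := by
      rw [form_single, H.gram_self]; norm_num
    simp only [map_sub, LinearMap.sub_apply]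
    rw [H.form_symm (a i) (Finsupp.single p 1)]
    linarith
  choose p hp using hp
  refine ⟨p, fun q => ?_⟩
  have hq : H.form (Finsupp.single q 1) (Finsupp.single q 1) = 1 := by
    rw [form_single, H.gram_self]; norm_num
  have hle : ∀ b, |H.form (Finsupp.single q 1) b| ≤ Real.sqrt (H.form b b) := by
    intro b
    have := H.form_mul_le (Finsupp.single q 1) b
    rw [hq, one_mul] at this
    rw [← Real.sqrt_sq_eq_abs]
    exact Real.sqrt_le_sqrt this
  have h1 : ∀ i, |H.gram (p i) q ^ 2 - H.form (Finsupp.single q 1) (a i) ^ 2| ≤ 2 * η := by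
    intro i
    have e1 := hle (Finsupp.single (p i) 1 - a i)
    have e2 : Real.sqrt (H.form (Finsupp.single (p i) 1 - a i) (Finsupp.single (p i) 1 - a i)) ≤ η := by
      rw [← Real.sqrt_sq hη.le]; exact Real.sqrt_le_sqrt (hp i)
    have e3 := hle (a i)
    rw [ha i i, if_pos rfl, Real.sqrt_one] at e3
    have e4 := hle (Finsupp.single (p i) 1)
    rw [form_single (p := p i) (q := p i), H.gram_self] at e4
    norm_num at e4
    rw [map_sub, form_single, one_mul, one_mul, H.gram_symm] at e1
    rw [form_single, one_mul, one_mul, H.gram_symm] at e4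
    rw [sq_sub_sq, abs_mul, mul_comm]
    rw [show 2 * η = η * 2 by ring]
    gcongr
    · exact e1.trans e2
    · exact (abs_add_le _ _).trans (by linarith)
  have h2 : ∑ i, H.gram (p i) q ^ 2 - 1 =
      ∑ i, (H.gram (p i) q ^ 2 - H.form (Finsupp.single q 1) (a i) ^ 2) := by
    rw [Finset.sum_sub_distrib, ← hb, hq]
  rw [h2]
  calc _ ≤ ∑ i : Fin k, 2 * η := (Finset.abs_sum_le_sum_abs _ _).trans (Finset.sum_le_sum fun i _ => h1 i)
    _ = 2 * k * η := by simp; ring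
    _ ≤ ε := by
      rw [← mul_div_assoc, div_le_iff₀ (by positivity)]
      nlinarith

/-- Busemann coordinates of a frame almost compute the distance to the base point. -/
lemma sum_bus_sq {k : ℕ} {p : Fin k → P} {ε : ℝ}
    (hp : ∀ q, |∑ i, H.gram (p i) q ^ 2 - 1| ≤ ε) (y : K) :
    |∑ i, bus o l (p i) y ^ 2 - dist y o ^ 2| ≤ ε * dist y o ^ 2 := by
  have hb : ∀ i, |bus o l (p i) y| ≤ dist y o := by
    intro i
    have hb : bus o l (p i) o = 0 := by rw [bus, dist_comm, H.dist_line_base]; simp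
    rw [abs_le]
    constructor
    · have := H.bus_sub_le (p i) o y
      rw [dist_comm] at this; linarith
    · have := H.bus_sub_le (p i) y o
      linarith
  rcases eq_or_lt_of_le (dist_nonneg (x := y) (y := o)) with h0 | h0
  · rw [← h0]
    have : ∀ i, bus o l (p i) y = 0 := fun i => abs_nonpos_iff.1 (h0 ▸ hb i)
    simp [this]
  set r := dist y o
  refine le_of_forall_pos_le_add fun δ hδ => ?_
  set η := δ / (2 * k * r ^ 2 + 1)
  have hη : 0 < η := by positivity
  obtain ⟨q, hq⟩ := H.align y η hη h0
  have h1 : ∀ i, |bus o l (p i) y ^ 2 - (r * H.gram (p i) q) ^ 2| ≤ 2 * η * r ^ 2 := by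
    intro i
    have e1 := H.bus_sub_le (p i) y (l q r)
    have e2 := H.bus_sub_le (p i) (l q r) y
    have e3 := H.bus_sub_le (p i) (l q r) o
    have e4 := H.bus_sub_le (p i) o (l q r)
    have e5 : bus o l (p i) o = 0 := by rw [bus, dist_comm, H.dist_line_base]; simp
    rw [dist_comm o] at e4
    rw [dist_comm y] at e1
    rw [H.bus_line] at e1 e2 e3 e4
    rw [H.dist_line_base, abs_of_pos h0] at e3 e4
    have e6 : |bus o l (p i) y + r * H.gram (p i) q| ≤ η * r := by
      rw [abs_le]; constructor <;> linarith
    have e7 : |bus o l (p i) y - r * H.gram (p i) q| ≤ 2 * r := by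
      have := abs_le.1 (hb i)
      rw [abs_le]; constructor <;> linarith
    rw [sq_sub_sq, abs_mul]
    calc _ ≤ (η * r) * (2 * r) := by gcongr
      _ = _ := by ring
  have h2 : ∑ i, bus o l (p i) y ^ 2 - r ^ 2 =
      ∑ i, (bus o l (p i) y ^ 2 - (r * H.gram (p i) q) ^ 2) +
        r ^ 2 * (∑ i, H.gram (p i) q ^ 2 - 1) := by
    rw [Finset.sum_sub_distrib, mul_sub, Finset.mul_sum]
    simp only [mul_pow]; ring
  rw [h2]
  refine (abs_add_le _ _).trans ?_
  have h3 : |∑ i, (bus o l (p i) y ^ 2 - (r * H.gram (p i) q) ^ 2)| ≤ δ := by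
    calc _ ≤ ∑ i : Fin k, 2 * η * r ^ 2 :=
          (Finset.abs_sum_le_sum_abs _ _).trans (Finset.sum_le_sum fun i _ => h1 i)
      _ = 2 * k * r ^ 2 * η := by simp; ring
      _ ≤ δ := by
        rw [← mul_div_assoc, div_le_iff₀ (by positivity)]
        nlinarith
  have h4 : |r ^ 2 * (∑ i, H.gram (p i) q ^ 2 - 1)| ≤ ε * r ^ 2 := by
    rw [abs_mul, abs_of_nonneg (sq_nonneg r), mul_comm]
    gcongr
    exact hp q
  linarith

end InfinitesimalCone

end

section

section UltraLimits

/-- A fixed nonprincipal ultrafilter. -/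
noncomputable abbrev ultra : Ultrafilter ℕ := hyperfilter ℕ

lemma ultra_le_atTop : (ultra : Filter ℕ) ≤ atTop := by
  rw [← Nat.cofinite_eq_atTop]; exact hyperfilter_le_cofinite

/-- Limit of a bounded sequence along the ultrafilter. -/
noncomputable def ulim (f : ℕ → ℝ) : ℝ := limUnder (ultra : Filter ℕ) f

lemma tendsto_ulim {f : ℕ → ℝ} {C : ℝ} (h : ∀ i, |f i| ≤ C) :
    Tendsto f ultra (𝓝 (ulim f)) := by
  apply tendsto_nhds_limUnder
  have hc : IsCompact (Icc (-C) C) := isCompact_Icc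
  have hm : ((ultra.map f : Ultrafilter ℝ) : Filter ℝ) ≤ 𝓟 (Icc (-C) C) := by
    rw [le_principal_iff]
    exact Filter.mem_map.2 (Eventually.of_forall fun i => abs_le.1 (h i))
  obtain ⟨x, -, hx⟩ := hc.ultrafilter_le_nhds _ hm
  exact ⟨x, hx⟩

lemma tendsto_sinh_div {s v : ℕ → ℝ} {L : ℝ} (hs : ∀ i, 0 < s i) (hs0 : Tendsto s ultra (𝓝 0))
    (hv : Tendsto (fun i => v i / s i) ultra (𝓝 L)) :
    Tendsto (fun i => Real.sinh (v i) / s i) ultra (𝓝 L) := by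
  have hc : Tendsto (dslope Real.sinh 0) (𝓝 0) (𝓝 1) := by
    have h1 : ContinuousAt (dslope Real.sinh 0) 0 :=
      continuousAt_dslope_same.2 Real.differentiable_sinh.differentiableAt
    have h2 : dslope Real.sinh 0 0 = 1 := by simp
    rw [← h2]; exact h1
  have hv0 : Tendsto v ultra (𝓝 0) := by
    have := hv.mul hs0
    rw [mul_zero] at this
    refine this.congr fun i => ?_
    rw [div_mul_cancel₀ _ (hs i).ne']
  have := hv.mul (hc.comp hv0)
  rw [mul_one] at this
  refine this.congr fun i => ?_
  have h := sub_smul_dslope Real.sinh 0 (v i)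
  simp only [sub_zero, Real.sinh_zero, smul_eq_mul] at h
  rw [← h, Function.comp]; ring

end UltraLimits

variable {X : Type*} [MetricSpace X]

/-- Sequences of points at distance `O(s i)` from `x`. -/
def Blowup (x : X) (s : ℕ → ℝ) (_ : ∀ i, 0 < s i) : Type _ :=
  {y : ℕ → X // ∃ C, ∀ i, dist (y i) x ≤ C * s i}

namespace Blowup

variable {x : X} {s : ℕ → ℝ} {hs : ∀ i, 0 < s i}

lemma bounded (y z : Blowup x s hs) : ∃ C, ∀ i, |dist (y.1 i) (z.1 i) / s i| ≤ C := by
  obtain ⟨C, hC⟩ := y.2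
  obtain ⟨C', hC'⟩ := z.2
  refine ⟨C + C', fun i => ?_⟩
  rw [abs_of_nonneg (div_nonneg dist_nonneg (hs i).le), div_le_iff₀ (hs i)]
  have := dist_triangle_right (y.1 i) (z.1 i) x
  nlinarith [hC i, hC' i]

noncomputable instance : Dist (Blowup x s hs) where
  dist y z := ulim fun i => dist (y.1 i) (z.1 i) / s i

lemma tendsto_dist (y z : Blowup x s hs) :
    Tendsto (fun i => dist (y.1 i) (z.1 i) / s i) ultra (𝓝 (dist y z)) := by
  obtain ⟨C, hC⟩ := bounded y z
  exact tendsto_ulim hC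

noncomputable instance : PseudoMetricSpace (Blowup x s hs) where
  dist_self y := by
    refine tendsto_nhds_unique (tendsto_dist y y) ?_
    simp
  dist_comm y z := by
    refine tendsto_nhds_unique (tendsto_dist y z) ?_
    simp_rw [dist_comm (y.1 _)]
    exact tendsto_dist z y
  dist_triangle a b c := by
    refine le_of_tendsto_of_tendsto' (tendsto_dist a c) ((tendsto_dist a b).add (tendsto_dist b c))
      fun i => ?_
    rw [← add_div]
    exact div_le_div_of_nonneg_right (dist_triangle _ _ _) (hs i).le

/-- The constant sequence. -/
def base (x : X) (s : ℕ → ℝ) (hs : ∀ i, 0 < s i) : Blowup x s hs := ⟨fun _ => x, 0, by simp⟩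

lemma concave (hc : CoshCmp X) (hs0 : Tendsto s ultra (𝓝 0)) {a b m : Blowup x s hs} {t : ℝ}
    (ht : 0 ≤ t) (_ht1 : t ≤ 1)
    (hm : ∀ᶠ i in (ultra : Filter ℕ), dist (a.1 i) (m.1 i) = t * dist (a.1 i) (b.1 i) ∧
      dist (m.1 i) (b.1 i) = (1 - t) * dist (a.1 i) (b.1 i)) (q : Blowup x s hs) :
    (1 - t) * dist q a ^ 2 + t * dist q b ^ 2 - t * (1 - t) * dist a b ^ 2 ≤ dist q m ^ 2 := by
  have hlim : ∀ (y z : Blowup x s hs) (c : ℝ),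
      Tendsto (fun i => Real.sinh (c * dist (y.1 i) (z.1 i)) / s i) ultra (𝓝 (c * dist y z)) := by
    intro y z c
    refine tendsto_sinh_div hs hs0 (((tendsto_dist y z).const_mul c).congr fun i => ?_)
    rw [mul_div_assoc]
  have hlen : dist a m = t * dist a b := by
    refine tendsto_nhds_unique (tendsto_dist a m) (((tendsto_dist a b).const_mul t).congr' ?_)
    filter_upwards [hm] with i hi
    rw [hi.1, mul_div_assoc]
  rcases eq_or_lt_of_le (dist_nonneg (x := a) (y := b)) with h0 | h0
  · have h1 : dist a m = 0 := by rw [hlen, ← h0, mul_zero]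
    have h2 : dist q b ≤ dist q a := by linarith [dist_triangle q a b]
    have h3 : dist q a ≤ dist q m := by linarith [dist_triangle_right q a m]
    rw [← h0]
    have h4 : dist q b ^ 2 ≤ dist q a ^ 2 := by gcongr
    have h5 : dist q a ^ 2 ≤ dist q m ^ 2 := by gcongr
    nlinarith
  -- the comparison inequality divided by the third power of the scale
  have hineq : ∀ᶠ i in (ultra : Filter ℕ),
      2 * (Real.sinh ((1 - t) * dist (a.1 i) (b.1 i)) / s i) *
          (Real.sinh (1 / 2 * dist (q.1 i) (a.1 i)) / s i) ^ 2 +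
        2 * (Real.sinh (t * dist (a.1 i) (b.1 i)) / s i) *
          (Real.sinh (1 / 2 * dist (q.1 i) (b.1 i)) / s i) ^ 2 -
        4 * (Real.sinh (t / 2 * dist (a.1 i) (b.1 i)) / s i) *
          (Real.sinh ((1 - t) / 2 * dist (a.1 i) (b.1 i)) / s i) *
          (Real.sinh (1 / 2 * dist (a.1 i) (b.1 i)) / s i) ≤
      2 * (Real.sinh (1 * dist (a.1 i) (b.1 i)) / s i) *
        (Real.sinh (1 / 2 * dist (q.1 i) (m.1 i)) / s i) ^ 2 := by
    filter_upwards [hm] with i hi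
    have h := hc (a.1 i) (b.1 i) (m.1 i) (q.1 i) (by rw [hi.1, hi.2]; ring)
    rw [hi.1, hi.2, cosh_eq_half (dist (q.1 i) (a.1 i)), cosh_eq_half (dist (q.1 i) (b.1 i)),
      cosh_eq_half (dist (q.1 i) (m.1 i))] at h
    have hs' := hs i
    generalize dist (a.1 i) (b.1 i) = D at *
    have hid : Real.sinh ((1 - t) * D) + Real.sinh (t * D) - Real.sinh D =
        -(4 * Real.sinh (t / 2 * D) * Real.sinh ((1 - t) / 2 * D) * Real.sinh (1 / 2 * D)) := by
      have e1 : (1 - t) * D = 2 * ((1 - t) / 2 * D) := by ring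
      have e2 : t * D = 2 * (t / 2 * D) := by ring
      have e3 : D = 2 * ((1 - t) / 2 * D + t / 2 * D) := by ring
      have e4 : 1 / 2 * D = (1 - t) / 2 * D + t / 2 * D := by ring
      rw [e1, e2, e4]
      conv_lhs => rw [e3]
      rw [show 2 * ((1 - t) / 2 * (2 * ((1 - t) / 2 * D + t / 2 * D))) = 2 * ((1 - t) / 2 * D) by ring]
      rw [show 2 * (t / 2 * (2 * ((1 - t) / 2 * D + t / 2 * D))) = 2 * (t / 2 * D) by ring]
      generalize (1 - t) / 2 * D = A
      generalize t / 2 * D = B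
      rw [Real.sinh_two_mul, Real.sinh_two_mul, Real.sinh_two_mul, Real.sinh_add, Real.cosh_add]
      have hA := Real.cosh_sq A
      have hB := Real.cosh_sq B
      linear_combination (-2 * Real.sinh B * Real.cosh B) * hA + (-2 * Real.sinh A * Real.cosh A) * hB
    rw [one_mul]
    have e : ∀ u v w : ℝ, u / s i * (v / s i) ^ 2 = u * v ^ 2 / s i ^ 3 := by
      intro u v w; field_simp
    have h' : 2 * Real.sinh ((1 - t) * D) * Real.sinh (dist (q.1 i) (a.1 i) / 2) ^ 2 +
        2 * Real.sinh (t * D) * Real.sinh (dist (q.1 i) (b.1 i) / 2) ^ 2 -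
        4 * Real.sinh (t / 2 * D) * Real.sinh ((1 - t) / 2 * D) * Real.sinh (1 / 2 * D) ≤
        2 * Real.sinh D * Real.sinh (dist (q.1 i) (m.1 i) / 2) ^ 2 := by linarith
    have h3 := div_le_div_of_nonneg_right h' (pow_pos hs' 3).le
    simp only [one_div_mul_eq_div] at h3 ⊢
    refine le_trans (le_of_eq ?_) (h3.trans (le_of_eq ?_))
    · field_simp
    · field_simp
  have hfin := le_of_tendsto_of_tendsto
    (((((hlim a b (1 - t)).const_mul 2).mul ((hlim q a (1 / 2)).pow 2)).add
      (((hlim a b t).const_mul 2).mul ((hlim q b (1 / 2)).pow 2))).sub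
      ((((hlim a b (t / 2)).const_mul 4).mul (hlim a b ((1 - t) / 2))).mul (hlim a b (1 / 2))))
    (((hlim a b 1).const_mul 2).mul ((hlim q m (1 / 2)).pow 2)) hineq
  have h2 : dist a b * ((1 - t) * dist q a ^ 2 + t * dist q b ^ 2 - t * (1 - t) * dist a b ^ 2) ≤
      dist a b * dist q m ^ 2 := by nlinarith
  exact le_of_mul_le_mul_left h2 h0

lemma exists_mid (hg : IsGeodesicSpace X) (hc : CoshCmp X) (hs0 : Tendsto s ultra (𝓝 0))
    (a b : Blowup x s hs) :
    ∃ m : Blowup x s hs, ∀ q,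
      dist q a ^ 2 / 2 + dist q b ^ 2 / 2 - dist a b ^ 2 / 4 ≤ dist q m ^ 2 := by
  choose m hm1 hm2 using fun i => hg.exists_frac (a.1 i) (b.1 i) (l := 1 / 2) (by norm_num) (by norm_num)
  obtain ⟨C, hC⟩ := a.2
  obtain ⟨C', hC'⟩ := b.2
  have hmb : ∃ C, ∀ i, dist (m i) x ≤ C * s i := by
    refine ⟨C + (C + C'), fun i => ?_⟩
    have h1 := dist_triangle_left (m i) x (a.1 i)
    have h2 := dist_triangle_right (a.1 i) (b.1 i) x
    have := hC i
    have := hC' i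
    rw [hm1] at h1
    have := dist_nonneg (x := a.1 i) (y := b.1 i)
    nlinarith
  refine ⟨⟨m, hmb⟩, fun q => ?_⟩
  have := concave hc hs0 (a := a) (b := b) (m := ⟨m, hmb⟩) (t := 1 / 2) (by norm_num) (by norm_num)
    (Eventually.of_forall fun i => ⟨hm1 i, by rw [hm2 i]⟩) q
  linarith

end Blowup

end

section

/-- `c` is a geodesic through `x`, ending at `p` and continuing backwards beyond `x`. -/
structure IsSpoke {X : Type*} [MetricSpace X] (x p : X) (c : ℝ → X) (τ : ℝ) : Prop where
  pos : 0 < τ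
  ne : 0 < dist x p
  zero : c 0 = x
  top : c (dist x p) = p
  isom : ∀ s ∈ Icc (-τ) (dist x p), ∀ t ∈ Icc (-τ) (dist x p), dist (c s) (c t) = |s - t|

lemma IsGeodesicSpace.exists_spoke {X : Type*} [MetricSpace X] (hg : IsGeodesicSpace X) {x p q : X}
    (hp : p ≠ x) (hq : q ≠ x) (h : dist p x + dist x q = dist p q) :
    ∃ c τ, IsSpoke x p c τ := by
  obtain ⟨c₁, ⟨-, h1⟩, h10, h11⟩ := hg x p
  obtain ⟨c₂, ⟨-, h2⟩, h20, h21⟩ := hg x q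
  have hmix : ∀ s ∈ Icc 0 (dist x p), ∀ t ∈ Icc 0 (dist x q), dist (c₁ s) (c₂ t) = s + t := by
    intro s hs t ht
    have e1 := h1 s hs 0 ⟨le_rfl, dist_nonneg⟩
    have e2 := h1 s hs (dist x p) ⟨dist_nonneg, le_rfl⟩
    have e3 := h2 t ht 0 ⟨le_rfl, dist_nonneg⟩
    have e4 := h2 t ht (dist x q) ⟨dist_nonneg, le_rfl⟩
    rw [h10, sub_zero, abs_of_nonneg hs.1] at e1
    rw [h11, abs_of_nonpos (by linarith [hs.2])] at e2
    rw [h20, sub_zero, abs_of_nonneg ht.1] at e3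
    rw [h21, abs_of_nonpos (by linarith [ht.2])] at e4
    have t1 := dist_triangle_right (c₁ s) (c₂ t) x
    have t2 := dist_triangle4 p (c₁ s) (c₂ t) q
    rw [dist_comm p (c₁ s)] at t2
    rw [dist_comm p x] at h
    linarith
  refine ⟨fun t => if 0 ≤ t then c₁ t else c₂ (-t), dist x q, dist_pos.2 hq.symm,
    dist_pos.2 hp.symm, by simp [h10], by simp [h11], fun s hs t ht => ?_⟩
  by_cases h0s : 0 ≤ s <;> by_cases h0t : 0 ≤ t
  · simp only [h0s, h0t, if_true]; exact h1 s ⟨h0s, hs.2⟩ t ⟨h0t, ht.2⟩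
  · simp only [h0s, h0t, if_true, if_false]
    push Not at h0t
    rw [hmix s ⟨h0s, hs.2⟩ (-t) ⟨by linarith, by linarith [ht.1]⟩, abs_of_nonneg (by linarith)]
    ring
  · simp only [h0s, h0t, if_true, if_false]
    push Not at h0s
    rw [dist_comm, hmix t ⟨h0t, ht.2⟩ (-s) ⟨by linarith, by linarith [hs.1]⟩,
      abs_of_nonpos (by linarith)]
    ring
  · simp only [h0s, h0t, if_false]
    push Not at h0s h0t
    rw [h2 (-s) ⟨by linarith, by linarith [hs.1]⟩ (-t) ⟨by linarith, by linarith [ht.1]⟩, abs_sub_comm]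
    congr 1; ring

namespace IsSpoke

variable {X : Type*} [MetricSpace X] {x p q : X} {c c' : ℝ → X} {τ τ' : ℝ}

lemma dist_zero (h : IsSpoke x p c τ) {t : ℝ} (ht : t ∈ Icc (-τ) (dist x p)) :
    dist (c t) x = |t| := by
  have := h.isom t ht 0 ⟨by linarith [h.pos], dist_nonneg⟩
  rwa [h.zero, sub_zero] at this

lemma dist_top (h : IsSpoke x p c τ) {t : ℝ} (ht : t ∈ Icc (-τ) (dist x p)) :
    dist p (c t) = dist x p - t := by
  have := h.isom (dist x p) ⟨by linarith [h.pos, h.ne], le_rfl⟩ t ht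
  rwa [h.top, abs_of_nonneg (by linarith [ht.2])] at this

lemma isFrac (h : IsSpoke x p c τ) {s t : ℝ} (hs : 0 < s) (hst : s ≤ t) (ht : t ≤ dist x p) :
    IsFrac x (c t) (s / t) (c s) := by
  have hτ := h.pos
  have e1 := h.dist_zero (t := s) ⟨by linarith, by linarith⟩
  have e2 := h.dist_zero (t := t) ⟨by linarith, by linarith⟩
  have e3 := h.isom s ⟨by linarith, by linarith⟩ t ⟨by linarith, by linarith⟩
  rw [abs_of_nonneg (by linarith)] at e1 e2
  rw [abs_of_nonpos (by linarith)] at e3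
  have ht0 : t ≠ 0 := by linarith
  refine ⟨?_, ?_⟩
  · rw [dist_comm, e1, dist_comm, e2]; field_simp
  · rw [e3, dist_comm, e2]; field_simp; ring

/-- The ratio comparing the opening of two spokes to the hyperbolic model. -/
noncomputable def opening (c c' : ℝ → X) (t : ℝ) : ℝ :=
  Real.sinh (dist (c t) (c' t) / 2) / Real.sinh t

lemma opening_antitone (hc : CoshCmp X) (h : IsSpoke x p c τ) (h' : IsSpoke x q c' τ') :
    AntitoneOn (opening c c') (Ioc 0 (min (dist x p) (dist x q))) := by
  intro s hs t ht hst
  have hs0 : 0 < s := hs.1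
  have ht0 : 0 < t := ht.1
  have htp := ht.2.trans (min_le_left _ _)
  have htq := ht.2.trans (min_le_right _ _)
  have e1 := h.dist_zero (t := t) ⟨by linarith [h.pos], htp⟩
  have e2 := h'.dist_zero (t := t) ⟨by linarith [h'.pos], htq⟩
  rw [abs_of_pos ht0, dist_comm] at e1 e2
  have := hc.contraction (by positivity) ((div_le_one ht0).2 hst) ht0 e1.le e2.le
    (h.isFrac hs0 hst htp) (h'.isFrac hs0 hst htq)
  rw [div_mul_cancel₀ _ ht0.ne'] at this
  rw [opening, opening, div_le_div_iff₀ (Real.sinh_pos_iff.2 ht0) (Real.sinh_pos_iff.2 hs0)]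
  linarith

lemma opening_le_one (h : IsSpoke x p c τ) (h' : IsSpoke x q c' τ') {t : ℝ} (h0 : 0 < t)
    (ht : t ≤ min (dist x p) (dist x q)) : opening c c' t ≤ 1 := by
  have e1 := h.dist_zero (t := t) ⟨by linarith [h.pos], ht.trans (min_le_left _ _)⟩
  have e2 := h'.dist_zero (t := t) ⟨by linarith [h'.pos], ht.trans (min_le_right _ _)⟩
  rw [abs_of_pos h0] at e1 e2
  rw [opening, div_le_one (Real.sinh_pos_iff.2 h0), Real.sinh_le_sinh]
  linarith [dist_triangle_right (c t) (c' t) x]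

lemma exists_tendsto_opening (hc : CoshCmp X) (h : IsSpoke x p c τ) (h' : IsSpoke x q c' τ') :
    ∃ A, Tendsto (opening c c') (𝓝[>] 0) (𝓝 A) := by
  have hm : 0 < min (dist x p) (dist x q) := lt_min h.ne h'.ne
  have hanti := (opening_antitone hc h h').mono Ioo_subset_Ioc_self
  have hb : BddAbove (opening c c' '' Ioo 0 (min (dist x p) (dist x q))) := by
    refine ⟨1, ?_⟩
    rintro _ ⟨t, ht, rfl⟩
    exact opening_le_one h h' ht.1 ht.2.le
  have := hanti.tendsto_nhdsWithin_Ioo_right (nonempty_Ioo.2 hm) hb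
  exact ⟨_, this⟩

end IsSpoke

namespace Blowup

variable {X : Type*} [MetricSpace X] {x p q : X} {c c' : ℝ → X} {τ τ' : ℝ} {s : ℕ → ℝ}
  {hs : ∀ i, 0 < s i}

/-- The line in the blowup determined by a spoke. -/
def line (hs : ∀ i, 0 < s i) (h : IsSpoke x p c τ) (t : ℝ) : Blowup x s hs :=
  ⟨fun i => c (max (-τ) (min (dist x p) (t * s i))), |t|, fun i => by
    have hτ := h.pos
    have hp := h.ne
    have hm : max (-τ) (min (dist x p) (t * s i)) ∈ Icc (-τ) (dist x p) :=
      ⟨le_max_left _ _, max_le (by linarith) (min_le_left _ _)⟩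
    rw [h.dist_zero hm, ← abs_of_pos (hs i), ← abs_mul, abs_of_pos (hs i)]
    rcases le_total 0 (t * s i) with h0 | h0
    · rw [abs_of_nonneg h0, abs_of_nonneg (le_max_of_le_right (le_min hp.le h0))]
      exact max_le (by linarith) (min_le_right _ _)
    · rw [abs_of_nonpos h0, abs_of_nonpos (max_le (by linarith) ((min_le_right _ _).trans h0))]
      exact neg_le_neg (le_max_of_le_right (le_min (by linarith) le_rfl))⟩

lemma eventually_line (hs0 : Tendsto s ultra (𝓝 0)) (h : IsSpoke x p c τ) (t : ℝ) :
    ∀ᶠ i in (ultra : Filter ℕ), t * s i ∈ Icc (-τ) (dist x p) ∧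
      (line hs h t).1 i = c (t * s i) := by
  have h0 := hs0.const_mul t
  rw [mul_zero] at h0
  filter_upwards [h0.eventually (Icc_mem_nhds (show -τ < 0 by linarith [h.pos]) h.ne)] with i hi
  refine ⟨hi, ?_⟩
  rw [line]
  simp only
  rw [min_eq_right hi.2, max_eq_right hi.1]

lemma dist_line (hs0 : Tendsto s ultra (𝓝 0)) (h : IsSpoke x p c τ) (a b : ℝ) :
    dist (line hs h a) (line hs h b) = |a - b| := by
  refine tendsto_nhds_unique (tendsto_dist _ _) (tendsto_const_nhds.congr' ?_)
  filter_upwards [eventually_line (hs := hs) hs0 h a, eventually_line (hs := hs) hs0 h b] with i ha hb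
  rw [ha.2, hb.2, h.isom _ ha.1 _ hb.1, ← sub_mul, abs_mul, abs_of_pos (hs i),
    mul_div_cancel_right₀ _ (hs i).ne']

lemma line_zero (h : IsSpoke x p c τ) : line hs h 0 = base x s hs := by
  apply Subtype.ext
  funext i
  simp only [line, base, zero_mul, min_eq_right h.ne.le,
    max_eq_right (show -τ ≤ 0 by linarith [h.pos]), h.zero]

lemma line_concave (hc : CoshCmp X) (hs0 : Tendsto s ultra (𝓝 0)) (h : IsSpoke x p c τ)
    (r : Blowup x s hs) {a b t : ℝ} (ht : 0 ≤ t) (ht1 : t ≤ 1) :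
    (1 - t) * dist r (line hs h a) ^ 2 + t * dist r (line hs h b) ^ 2 - t * (1 - t) * (a - b) ^ 2 ≤
      dist r (line hs h ((1 - t) * a + t * b)) ^ 2 := by
  have := concave hc hs0 (a := line hs h a) (b := line hs h b)
    (m := line hs h ((1 - t) * a + t * b)) ht ht1 ?_ r
  · rwa [dist_line hs0, sq_abs] at this
  filter_upwards [eventually_line (hs := hs) hs0 h a, eventually_line (hs := hs) hs0 h b,
    eventually_line (hs := hs) hs0 h ((1 - t) * a + t * b)] with i ha hb hm
  rw [ha.2, hb.2, hm.2, h.isom _ ha.1 _ hb.1, h.isom _ ha.1 _ hm.1, h.isom _ hm.1 _ hb.1]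
  constructor
  · rw [← abs_of_nonneg ht, ← abs_mul, abs_of_nonneg ht]; congr 1; ring
  · rw [← abs_of_nonneg (sub_nonneg.2 ht1), ← abs_mul, abs_of_nonneg (sub_nonneg.2 ht1)]
    congr 1; ring

lemma tendsto_opening (hs0 : Tendsto s ultra (𝓝 0)) (h : IsSpoke x p c τ) (h' : IsSpoke x q c' τ')
    {A : ℝ} (hA : Tendsto (IsSpoke.opening c c') (𝓝[>] 0) (𝓝 A)) {t : ℝ} (ht : 0 < t) :
    dist (line hs h t) (line hs h' t) = 2 * t * A := by
  have h0 : Tendsto (fun i => t * s i) ultra (𝓝[>] 0) := by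
    refine tendsto_nhdsWithin_iff.2 ⟨?_, Eventually.of_forall fun i => mul_pos ht (hs i)⟩
    simpa using hs0.const_mul t
  have h1 := hA.comp h0
  have hden : Tendsto (fun i => Real.sinh (t * s i) / s i) ultra (𝓝 t) :=
    tendsto_sinh_div hs hs0 (tendsto_const_nhds.congr fun i => by
      rw [mul_div_cancel_right₀ _ (hs i).ne'])
  have hnum : Tendsto (fun i => Real.sinh (dist ((line hs h t).1 i) ((line hs h' t).1 i) / 2) / s i)
      ultra (𝓝 (dist (line hs h t) (line hs h' t) / 2)) := by
    refine tendsto_sinh_div hs hs0 (((tendsto_dist (line hs h t) (line hs h' t)).div_const 2).congr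
      fun i => ?_)
    ring
  have h2 := h1.mul hden
  have h3 := tendsto_nhds_unique hnum (h2.congr' ?_)
  · linarith
  filter_upwards [eventually_line (hs := hs) hs0 h t, eventually_line (hs := hs) hs0 h' t] with i ha hb
  have hpos := Real.sinh_pos_iff.2 (mul_pos ht (hs i))
  have := hs i
  simp only [Function.comp, IsSpoke.opening]
  rw [ha.2, hb.2]
  field_simp

end Blowup

end

section

variable {X : Type*} [MetricSpace X] [MeasurableSpace X] [BorelSpace X] [ProperSpace X]

namespace Blowup

variable {n : ℕ}

lemma exists_packing (G : GoodSpace X n) (x : X) : ∃ C : ℝ, 0 < C ∧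
    ∀ (s : ℕ → ℝ) (hs : ∀ i, 0 < s i), Tendsto s ultra (𝓝 0) → ∀ N : ℝ, 1 ≤ N →
      ∀ F : Finset (Blowup x s hs), (∀ y ∈ F, dist y (base x s hs) ≤ N) →
        (F : Set (Blowup x s hs)).Pairwise (fun y z => 1 ≤ dist y z) → F.card ≤ C * N ^ n := by
  classical
  have := G.isFiniteMeasureOnCompacts
  obtain ⟨c, hc, hlow⟩ := G.ahlfors_lower x 1
  obtain ⟨C, hC, hup⟩ := G.ahlfors_upper
  refine ⟨C / c * 18 ^ n, by positivity, fun s hs hs0 N hN F hF hsep => ?_⟩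
  have hN0 : 0 < N := by linarith
  have e1 : ∀ᶠ i in (ultra : Filter ℕ), ∀ y ∈ F, dist (y.1 i) x ≤ 2 * N * s i := by
    rw [eventually_all_finset]
    intro y hy
    have := (tendsto_dist y (base x s hs)).eventually
      (eventually_lt_nhds (show dist y (base x s hs) < 2 * N by linarith [hF y hy]))
    filter_upwards [this] with i hi
    exact ((div_lt_iff₀ (hs i)).1 hi).le
  have e2 : ∀ᶠ i in (ultra : Filter ℕ), ∀ y ∈ F, ∀ z ∈ F, y ≠ z →
      s i / 2 ≤ dist (y.1 i) (z.1 i) := by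
    rw [eventually_all_finset]
    intro y hy
    rw [eventually_all_finset]
    intro z hz
    by_cases hyz : y = z
    · exact Eventually.of_forall fun i h => absurd hyz h
    have := (tendsto_dist y z).eventually
      (eventually_gt_nhds (show 1 / 2 < dist y z by linarith [hsep hy hz hyz]))
    filter_upwards [this] with i hi _
    have := (lt_div_iff₀ (hs i)).1 hi
    linarith
  have e3 := hs0.eventually (eventually_lt_nhds (show (0 : ℝ) < 1 / (3 * N) by positivity))
  obtain ⟨i, h1, h2, h3⟩ := (e1.and (e2.and e3)).exists
  have hsi := hs i
  have h3' : 3 * N * s i ≤ 1 := by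
    rw [lt_div_iff₀ (by positivity)] at h3; linarith
  have hs1 : s i ≤ 1 := by nlinarith
  have hinj : Set.InjOn (fun y : Blowup x s hs => y.1 i) F := by
    intro y hy z hz hyz
    by_contra hne
    have := h2 y hy z hz hne
    simp only at hyz
    rw [hyz, dist_self] at this
    linarith
  have key := card_mul_le_of_separated (μH[(n : ℝ)] : Measure X) (B := closedBall x (3 * N * s i))
    (s := F.image fun y => y.1 i) (δ := s i / 2) (c := c * (s i / 6) ^ n)
    (isCompact_closedBall _ _).measure_lt_top.ne ?_ ?_ ?_ (by positivity)
  · rw [Finset.card_image_of_injOn hinj] at key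
    have h4 := key.trans (hup x _ (by positivity) h3')
    have h5 : (F.card : ℝ) * (c * (s i / 6) ^ n) ≤ (C / c * 18 ^ n * N ^ n) * (c * (s i / 6) ^ n) := by
      refine h4.trans (le_of_eq ?_)
      have e : 3 * N * s i = 18 * N * (s i / 6) := by ring
      rw [e, mul_pow, mul_pow]
      field_simp
    exact le_of_mul_le_mul_right h5 (by positivity)
  · intro a ha b hb hab
    simp only [Finset.coe_image, mem_image, Finset.mem_coe] at ha hb
    obtain ⟨y, hy, rfl⟩ := ha
    obtain ⟨z, hz, rfl⟩ := hb
    exact h2 y hy z hz (fun h => hab (by rw [h]))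
  · intro a ha
    obtain ⟨y, hy, rfl⟩ := Finset.mem_image.1 ha
    refine closedBall_subset_closedBall' ?_
    have := h1 y hy
    nlinarith
  · intro a ha
    obtain ⟨y, hy, rfl⟩ := Finset.mem_image.1 ha
    have := hlow (y.1 i) (mem_closedBall.2 ?_) (s i / 6) (by positivity) (by linarith)
    · rw [show s i / 2 / 3 = s i / 6 by ring]; exact this
    · have := h1 y hy
      nlinarith

section Cone

variable {x : X} {s : ℕ → ℝ} {hs : ∀ i, 0 < s i}

variable {ι : Type*} {pt : ι → X} {c : ι → ℝ → X} {τ : ι → ℝ}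

omit [MeasurableSpace X] [BorelSpace X] [ProperSpace X] in
lemma exists_align (hc : CoshCmp X) (hs0 : Tendsto s ultra (𝓝 0)) {C : ℝ}
    (hpack : ∀ N : ℝ, 1 ≤ N → ∀ F : Finset (Blowup x s hs), (∀ y ∈ F, dist y (base x s hs) ≤ N) →
        (F : Set (Blowup x s hs)).Pairwise (fun y z => 1 ≤ dist y z) → F.card ≤ C * N ^ n)
    (hd : DenseRange pt) (h : ∀ p, IsSpoke x (pt p) (c p) (τ p)) (y : Blowup x s hs) {η : ℝ}
    (hη : 0 < η) (hy : 0 < dist y (base x s hs)) :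
    ∃ p, dist (line hs (h p) (dist y (base x s hs))) y ≤ η * dist y (base x s hs) := by
  classical
  wlog hη1 : η ≤ 1 generalizing η
  · obtain ⟨p, hp⟩ := this one_pos le_rfl
    exact ⟨p, hp.trans (by gcongr; linarith)⟩
  set D := dist y (base x s hs)
  let far : ι → ι → Prop := fun p q => ∃ t, 0 < t ∧ t ≤ min (dist x (pt p)) (dist x (pt q)) ∧
    η / 2 < IsSpoke.opening (c p) (c q) t
  have hsymm : ∀ p q, IsSpoke.opening (c p) (c q) = IsSpoke.opening (c q) (c p) := by
    intro p q; funext t; rw [IsSpoke.opening, IsSpoke.opening, dist_comm]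
  have hfar : ∀ p q, far p q → 1 ≤ dist (line hs (h p) (1 / η)) (line hs (h q) (1 / η)) := by
    rintro p q ⟨t, ht0, ht, hlt⟩
    obtain ⟨A, hA⟩ := IsSpoke.exists_tendsto_opening hc (h p) (h q)
    rw [tendsto_opening hs0 (h p) (h q) hA (by positivity)]
    have : η / 2 ≤ A := by
      refine ge_of_tendsto hA ?_
      filter_upwards [Ioc_mem_nhdsGT ht0] with t' ht'
      exact hlt.le.trans (IsSpoke.opening_antitone hc (h p) (h q) ⟨ht'.1, ht'.2.trans ht⟩
        ⟨ht0, ht⟩ ht'.2)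
    calc (1 : ℝ) = 2 * (1 / η) * (η / 2) := by field_simp
      _ ≤ _ := by gcongr
  obtain ⟨J, -, -, hJ⟩ := exists_maximal_pairwise (univ : Set ι) far
    (fun p q ⟨t, h0, h1, h2⟩ => ⟨t, h0, by rwa [min_comm], by rwa [hsymm]⟩)
    ⌊C * (1 / η) ^ n⌋₊ (by
      intro F _ hF
      have hinj : Set.InjOn (fun p => line hs (h p) (1 / η)) F := by
        intro p hp q hq hpq
        by_contra hne
        have := hfar p q (hF hp hq hne)
        simp only at hpq
        rw [hpq, dist_self] at this
        linarith
      have := hpack (1 / η) (by rw [le_div_iff₀ hη]; linarith)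
        (F.image fun p => line hs (h p) (1 / η)) ?_ ?_
      · rw [Finset.card_image_of_injOn hinj] at this
        exact Nat.le_floor this
      · intro z hz
        obtain ⟨p, -, rfl⟩ := Finset.mem_image.1 hz
        rw [← line_zero (hs := hs) (h p), dist_line hs0, sub_zero, abs_of_pos (by positivity)]
      · intro a ha b hb hab
        simp only [Finset.coe_image, mem_image, Finset.mem_coe] at ha hb
        obtain ⟨p, hp, rfl⟩ := ha
        obtain ⟨q, hq, rfl⟩ := hb
        exact hfar p q (hF hp hq (fun h => hab (by rw [h]))))
  have hclose : ∀ i, ∃ p, dist (y.1 i) (pt p) < s i ^ 2 := fun i =>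
    hd.exists_dist_lt _ (pow_pos (hs i) 2)
  choose p hp using hclose
  have hex : ∀ᶠ i in (ultra : Filter ℕ), ∃ z ∈ (J : Set ι), ¬ far z (p i) := by
    refine Eventually.of_forall fun i => ?_
    rcases hJ (p i) (mem_univ _) with h1 | h1
    · refine ⟨p i, h1, ?_⟩
      rintro ⟨t, -, -, hlt⟩
      rw [IsSpoke.opening, dist_self] at hlt
      simp at hlt
      linarith
    · exact h1
  obtain ⟨z, -, hz⟩ := (Ultrafilter.eventually_exists_mem_iff J.finite_toSet).1 hex
  refine ⟨z, ?_⟩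
  set t : ℕ → ℝ := fun i => dist x (pt (p i)) with ht
  have htD : Tendsto (fun i => t i / s i) ultra (𝓝 D) := by
    have h1 : Tendsto (fun i => t i / s i - dist (y.1 i) x / s i) ultra (𝓝 0) := by
      refine squeeze_zero_norm (fun i => ?_) hs0
      rw [Real.norm_eq_abs, ← sub_div, abs_div, abs_of_pos (hs i), div_le_iff₀ (hs i), ht,
        dist_comm (y.1 i)]
      have := hp i
      have h2 := abs_dist_sub_le (pt (p i)) (y.1 i) x
      rw [dist_comm (pt (p i)), dist_comm (y.1 i) x, dist_comm (pt (p i))] at h2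
      nlinarith
    have := h1.add (tendsto_dist y (base x s hs))
    rw [zero_add] at this
    exact this.congr fun i => by simp [base]
  have ht0 : Tendsto t ultra (𝓝 0) := by
    have := htD.mul hs0
    rw [mul_zero] at this
    exact this.congr fun i => div_mul_cancel₀ _ (hs i).ne'
  have hsinh : Tendsto (fun i => Real.sinh (t i) / s i) ultra (𝓝 D) := tendsto_sinh_div hs hs0 htD
  have hbound : ∀ᶠ i in (ultra : Filter ℕ),
      dist ((line hs (h z) D).1 i) (y.1 i) / s i ≤
        |D - t i / s i| + (η * (Real.sinh (t i) / s i) + s i) := by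
    filter_upwards [hz, eventually_line (hs := hs) hs0 (h z) D,
      ht0.eventually (eventually_lt_nhds (h z).ne)] with i h1 h2 h3
    have htpos : 0 < t i := (h (p i)).ne
    have h4 : IsSpoke.opening (c z) (c (p i)) (t i) ≤ η / 2 := by
      by_contra hcon
      exact h1 ⟨t i, htpos, le_min h3.le le_rfl, not_le.1 hcon⟩
    rw [IsSpoke.opening, div_le_iff₀ (Real.sinh_pos_iff.2 htpos), (h (p i)).top] at h4
    have h5 := (Real.self_le_sinh_iff.2 (by positivity : 0 ≤ dist (c z (t i)) (pt (p i)) / 2)).trans h4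
    have h6 := (h z).isom (D * s i) h2.1 (t i) ⟨by linarith [(h z).pos], h3.le⟩
    have h7 := dist_triangle4 (c z (D * s i)) (c z (t i)) (pt (p i)) (y.1 i)
    have h8 := hp i
    rw [dist_comm] at h8
    have hsi := hs i
    rw [h2.2, div_le_iff₀ hsi]
    have e : |D - t i / s i| * s i = |D * s i - t i| := by
      rw [← abs_of_pos hsi, ← abs_mul, abs_of_pos hsi, sub_mul, div_mul_cancel₀ _ hsi.ne']
    have e2 : Real.sinh (t i) / s i * s i = Real.sinh (t i) := div_mul_cancel₀ _ hsi.ne'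
    nlinarith
  have hlim : Tendsto (fun i => |D - t i / s i| + (η * (Real.sinh (t i) / s i) + s i)) ultra
      (𝓝 (|D - D| + (η * D + 0))) :=
    ((tendsto_const_nhds.sub htD).abs).add ((hsinh.const_mul η).add hs0)
  have := le_of_tendsto_of_tendsto (tendsto_dist (line hs (h z) D) y) hlim hbound
  simpa using this

omit [MeasurableSpace X] [BorelSpace X] [ProperSpace X] in
lemma infinitesimalCone (hg : IsGeodesicSpace X) (hc : CoshCmp X) (hs0 : Tendsto s ultra (𝓝 0)) {C : ℝ}
    (hpack : ∀ N : ℝ, 1 ≤ N → ∀ F : Finset (Blowup x s hs), (∀ y ∈ F, dist y (base x s hs) ≤ N) →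
        (F : Set (Blowup x s hs)).Pairwise (fun y z => 1 ≤ dist y z) → F.card ≤ C * N ^ n)
    (hd : DenseRange pt) (h : ∀ p, IsSpoke x (pt p) (c p) (τ p)) :
    InfinitesimalCone (Blowup x s hs) ι (base x s hs) (fun p t => line hs (h p) t) where
  mid := exists_mid hg hc hs0
  concave p q _ _ _ ht ht1 := line_concave hc hs0 (h p) q ht ht1
  line p a b := dist_line hs0 (h p) a b
  base p := line_zero (h p)
  align y _ hη hy := exists_align hc hs0 hpack hd h y hη hy

omit [MeasurableSpace X] [BorelSpace X] [ProperSpace X] in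
/-- The Busemann functions of the lines are the infinitesimal distance functions. -/
lemma tendsto_bus (hs0 : Tendsto s ultra (𝓝 0)) {h : ∀ p, IsSpoke x (pt p) (c p) (τ p)}
    (H : InfinitesimalCone (Blowup x s hs) ι (base x s hs) (fun p t => line hs (h p) t))
    (p : ι) (y : Blowup x s hs) :
    Tendsto (fun i => (dist (pt p) (y.1 i) - dist (pt p) x) / s i) ultra
      (𝓝 (InfinitesimalCone.bus (base x s hs) (fun p t => line hs (h p) t) p y)) := by
  set b := InfinitesimalCone.bus (base x s hs) (fun p t => line hs (h p) t) p y
  obtain ⟨C, hC⟩ := y.2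
  have hlim := tendsto_ulim (f := fun i => (dist (pt p) (y.1 i) - dist (pt p) x) / s i) (C := C)
    (fun i => by
      rw [abs_div, abs_of_pos (hs i), div_le_iff₀ (hs i), dist_comm (pt p), dist_comm (pt p)]
      exact (abs_dist_sub_le _ _ _).trans (hC i))
  set L := ulim fun i => (dist (pt p) (y.1 i) - dist (pt p) x) / s i
  have hup : ∀ T, L ≤ -T + dist y (line hs (h p) T) := by
    intro T
    refine le_of_tendsto_of_tendsto hlim ((tendsto_dist y (line hs (h p) T)).const_add (-T)) ?_
    filter_upwards [eventually_line (hs := hs) hs0 (h p) T] with i hi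
    have hsi := hs i
    have h1 := (h p).dist_top hi.1
    have h2 := dist_triangle_right (pt p) (y.1 i) (c p (T * s i))
    have e : -T + dist (y.1 i) ((line hs (h p) T).1 i) / s i =
        (-(T * s i) + dist (y.1 i) ((line hs (h p) T).1 i)) / s i := by field_simp
    rw [e, hi.2]
    refine div_le_div_of_nonneg_right ?_ hsi.le
    rw [dist_comm (pt p) x]; linarith
  have hlo : ∀ T, T ≤ L + dist y (line hs (h p) (-T)) := by
    intro T
    refine le_of_tendsto_of_tendsto tendsto_const_nhds
      (hlim.add (tendsto_dist y (line hs (h p) (-T)))) ?_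
    filter_upwards [eventually_line (hs := hs) hs0 (h p) (-T)] with i hi
    have hsi := hs i
    have h1 := (h p).dist_top hi.1
    have h2 := dist_triangle (pt p) (y.1 i) (c p (-T * s i))
    rw [← add_div, hi.2, le_div_iff₀ hsi, dist_comm (pt p) x]
    linarith
  have hsq : ∀ T, dist y (line hs (h p) T) ^ 2 = dist y (base x s hs) ^ 2 + T ^ 2 + 2 * T * b :=
    fun T => H.dist_sq p y T
  have hle : ∀ T, 0 < T → |L| ≤ T → 2 * T * |L - b| ≤ dist y (base x s hs) ^ 2 := by
    intro T hT hLT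
    have hL := abs_le.1 hLT
    have h1 : (T + L) ^ 2 ≤ dist y (line hs (h p) T) ^ 2 :=
      pow_le_pow_left₀ (by linarith) (by linarith [hup T]) 2
    have h2 : (T - L) ^ 2 ≤ dist y (line hs (h p) (-T)) ^ 2 :=
      pow_le_pow_left₀ (by linarith) (by linarith [hlo T]) 2
    rw [hsq] at h1 h2
    rw [← abs_of_pos (show 0 < 2 * T by positivity), ← abs_mul, abs_le]
    constructor <;> nlinarith [sq_nonneg L]
  have hLb : L = b := by
    by_contra hne
    have hpos : 0 < |L - b| := abs_pos.2 (sub_ne_zero.2 hne)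
    set T := |L| + (dist y (base x s hs) ^ 2 + 1) / |L - b| with hTdef
    have hT : 0 < T := by positivity
    have h1 := hle T hT (by rw [hTdef]; linarith [show 0 ≤ (dist y (base x s hs) ^ 2 + 1) / |L - b| by positivity])
    have h2 : T * |L - b| = |L| * |L - b| + (dist y (base x s hs) ^ 2 + 1) := by
      rw [hTdef, add_mul, div_mul_cancel₀ _ hpos.ne']
    have h3 : 0 ≤ |L| * |L - b| := by positivity
    nlinarith [sq_nonneg (dist y (base x s hs))]
  rwa [hLb] at hlim

end Cone

end Blowup

/-- Around almost every point finitely many distance functions form almost isometric coordinates. -/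
theorem GoodSpace.exists_frame_at {n : ℕ} (G : GoodSpace X n) {ι : Type*} {pt : ι → X}
    (hd : DenseRange pt) {x : X} (hpx : ∀ p, pt p ≠ x)
    (hanti : ∀ p, ∃ q, q ≠ x ∧ dist (pt p) x + dist x q = dist (pt p) q) {ε : ℝ} (hε : 0 < ε) :
    ∃ k ≤ n, ∃ p : Fin k → ι, ∃ r > 0, ∀ y, dist y x < r →
      |∑ i, (dist (pt (p i)) y - dist (pt (p i)) x) ^ 2 - dist y x ^ 2| ≤ ε * dist y x ^ 2 := by
  have hsp : ∀ p, ∃ c τ, IsSpoke x (pt p) c τ := fun p => by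
    obtain ⟨q, hq, h⟩ := hanti p
    exact G.geod.exists_spoke (hpx p) hq h
  choose c τ h using hsp
  obtain ⟨C, -, hpack⟩ := Blowup.exists_packing G x
  choose A hA using fun p q => IsSpoke.exists_tendsto_opening G.cosh (h p) (h q)
  have hcone : ∀ (s : ℕ → ℝ) (hs : ∀ i, 0 < s i) (hs0 : Tendsto s ultra (𝓝 0)),
      ∃ H : InfinitesimalCone (Blowup x s hs) ι (Blowup.base x s hs) (fun p t => Blowup.line hs (h p) t),
      ∀ p q, H.gram p q = 1 - 2 * A p q ^ 2 := by
    intro s hs hs0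
    have H := Blowup.infinitesimalCone G.geod G.cosh hs0 (hpack s hs hs0) hd h
    refine ⟨H, fun p q => ?_⟩
    have h1 := H.dist_line_line p q
    rw [Blowup.tendsto_opening hs0 (h p) (h q) (hA p q) one_pos] at h1
    nlinarith
  have hs1 : ∀ i : ℕ, (0 : ℝ) < 1 / ((i : ℝ) + 1) := fun i => by positivity
  have hs10 : Tendsto (fun i : ℕ => (1 : ℝ) / ((i : ℝ) + 1)) ultra (𝓝 0) :=
    tendsto_one_div_add_atTop_nhds_zero_nat.mono_left ultra_le_atTop
  obtain ⟨H, hH⟩ := hcone _ hs1 hs10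
  obtain ⟨k, hk, p, hp⟩ := H.exists_frame (hpack _ hs1 hs10) (show 0 < ε / 2 by positivity)
  refine ⟨k, hk, p, ?_⟩
  by_contra! hcon
  choose y hy hyε using fun i => hcon _ (hs1 i)
  set s : ℕ → ℝ := fun i => dist (y i) x with hsdef
  have hs : ∀ i, 0 < s i := by
    intro i
    rcases (dist_nonneg (x := y i) (y := x)).eq_or_lt with h0 | h0
    · have := hyε i
      rw [← h0, dist_eq_zero.1 h0.symm] at this
      simp at this
    · exact h0
  have hs0 : Tendsto s ultra (𝓝 0) :=
    squeeze_zero (fun i => (hs i).le) (fun i => (hy i).le) hs10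
  obtain ⟨H', hH'⟩ := hcone s hs hs0
  let Y : Blowup x s hs := ⟨y, 1, fun i => by rw [one_mul]⟩
  have hY : dist Y (Blowup.base x s hs) = 1 := by
    refine tendsto_nhds_unique (Blowup.tendsto_dist _ _) (tendsto_const_nhds.congr fun i => ?_)
    exact (div_self (hs i).ne').symm
  have hsum := H'.sum_bus_sq (p := p) (ε := ε / 2) (fun q => by
    have := hp q
    simp only [hH, hH'] at this ⊢
    exact this) Y
  rw [hY] at hsum
  have hlim : Tendsto (fun i => |∑ j, ((dist (pt (p j)) (y i) - dist (pt (p j)) x) / s i) ^ 2 - 1 ^ 2|)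
      ultra (𝓝 _) :=
    ((tendsto_finsetSum _ fun j _ => (Blowup.tendsto_bus hs0 H' (p j) Y).pow 2).sub_const _).abs
  have := ge_of_tendsto hlim (b := ε) (Eventually.of_forall fun i => by
    have h1 := hyε i
    have hsi := hs i
    simp only [div_pow]
    rw [← Finset.sum_div, one_pow, div_sub_one (by positivity), abs_div, abs_of_pos (by positivity : 0 < s i ^ 2),
      le_div_iff₀ (by positivity)]
    exact h1.le)
  have h2 := this.trans hsum
  linarith

end

section

lemma ae_eventually_inter_closedBall {α : Type*} [MetricSpace α] [MeasurableSpace α]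
    [BorelSpace α] [SecondCountableTopology α] (μ : Measure α) [IsUnifLocDoublingMeasure μ]
    [IsLocallyFiniteMeasure μ] (hfin : ∀ x r, μ (closedBall x r) ≠ ⊤) (S : Set α) {q : ℝ}
    (hq : q < 1) :
    μ ({x | ¬ ∀ᶠ r in 𝓝[>] (0 : ℝ),
      q * μ.real (closedBall x r) ≤ μ.real (S ∩ closedBall x r)} ∩ S) = 0 := by
  refine le_antisymm (((Measure.le_restrict_apply S _)).trans (le_of_eq ?_)) zero_le
  change ∀ᵐ x ∂μ.restrict S, ∀ᶠ r in 𝓝[>] (0 : ℝ),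
      q * μ.real (closedBall x r) ≤ μ.real (S ∩ closedBall x r)
  filter_upwards [IsUnifLocDoublingMeasure.ae_tendsto_measure_inter_div μ S 1] with x hx
  have h := hx (ι := ℝ) (l := 𝓝[>] 0) (fun _ => x) id tendsto_id
    (eventually_mem_nhdsWithin.mono fun r hr => mem_closedBall_self (by
      rw [one_mul]; exact (mem_Ioi.1 hr).le))
  filter_upwards [h.eventually (lt_mem_nhds (show ENNReal.ofReal q < 1 by
    rwa [ENNReal.ofReal_lt_one]))] with r hr
  rcases le_total q 0 with h0 | h0
  · exact (mul_nonpos_of_nonpos_of_nonneg h0 measureReal_nonneg).trans measureReal_nonneg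
  have h1 := ENNReal.mul_le_of_le_div hr.le
  have h2 := ENNReal.toReal_mono (ne_top_of_le_ne_top (hfin x r) (measure_mono inter_subset_right)) h1
  rwa [ENNReal.toReal_mul, ENNReal.toReal_ofReal h0] at h2

/-- Volume of the Euclidean unit ball for the Hausdorff measure. -/
noncomputable def kappa (n : ℕ) : ℝ :=
  (μH[(n : ℝ)] : Measure (EuclideanSpace ℝ (Fin n))).real (ball 0 1)

section Euclid

variable (n : ℕ)

lemma isAddHaar_hausdorff_euclid :
    Measure.IsAddHaarMeasure (μH[(n : ℝ)] : Measure (EuclideanSpace ℝ (Fin n))) := by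
  simpa using MeasureTheory.isAddHaarMeasure_hausdorffMeasure (E := EuclideanSpace ℝ (Fin n))

lemma kappa_pos : 0 < kappa n := by
  have := isAddHaar_hausdorff_euclid n
  exact ENNReal.toReal_pos (isOpen_ball.measure_pos _ ⟨0, by simp⟩).ne' measure_ball_lt_top.ne

lemma real_closedBall_euclid (x : EuclideanSpace ℝ (Fin n)) {r : ℝ} (hr : 0 ≤ r) :
    (μH[(n : ℝ)] : Measure (EuclideanSpace ℝ (Fin n))).real (closedBall x r) = r ^ n * kappa n := by
  have := isAddHaar_hausdorff_euclid n
  have h := Measure.addHaar_real_closedBall (μH[(n : ℝ)] : Measure (EuclideanSpace ℝ (Fin n))) x hr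
  rw [kappa]
  simpa using h

lemma hausdorff_euclid_eq_zero {k : ℕ} (h : k < n) (S : Set (EuclideanSpace ℝ (Fin k))) :
    μH[(n : ℝ)] S = 0 := by
  refine measure_mono_null (subset_univ S) ?_
  have : dimH (univ : Set (EuclideanSpace ℝ (Fin k))) = k := by
    rw [Real.dimH_univ_eq_finrank]; simp
  have h2 := hausdorffMeasure_of_dimH_lt (d := (n : ℝ≥0)) (s := (univ : Set (EuclideanSpace ℝ (Fin k))))
    (by rw [this]; exact_mod_cast h)
  simpa using h2

end Euclid

variable {X : Type*} [MetricSpace X] [MeasurableSpace X] [BorelSpace X]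

/-- Approximate Euclidean volume growth at `x` with multiplicative error `θ`. -/
def NearDensity (n : ℕ) (θ : ℝ) (x : X) : Prop :=
  ∀ᶠ r in 𝓝[>] (0 : ℝ), kappa n * r ^ n ≤ θ * (μH[(n : ℝ)] : Measure X).real (closedBall x r) ∧
    (μH[(n : ℝ)] : Measure X).real (closedBall x r) ≤ θ * (kappa n * r ^ n)

variable [ProperSpace X] {n : ℕ} (G : GoodSpace X n)

include G

lemma GoodSpace.isUnifLocDoubling : IsUnifLocDoublingMeasure (μH[(n : ℝ)] : Measure X) := by
  refine ⟨((Real.cosh 2 ^ 2 / (1 / 2)) ^ n).toNNReal, ?_⟩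
  filter_upwards [Ioc_mem_nhdsGT (show (0 : ℝ) < 1 / 2 by norm_num)] with r hr x
  have hr0 : 0 < r := hr.1
  have hr1 := hr.2
  refine (G.cosh.measure_le_of_frac (n := n) (l := 1 / 2) (R := 2 * r) (by norm_num) (by norm_num)
    (by positivity) Subset.rfl (Z := closedBall x r) fun y hy => ?_).trans ?_
  · obtain ⟨z, h1, h2⟩ := G.geod.exists_frac x y (l := 1 / 2) (by norm_num) (by norm_num)
    refine ⟨z, ?_, h1, h2⟩
    rw [mem_closedBall, dist_comm] at hy ⊢
    linarith
  · refine mul_le_mul_left ?_ _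
    rw [← ENNReal.ofReal]
    refine ENNReal.ofReal_le_ofReal ?_
    have h0 := contrC_pos (show 0 < 2 * r by positivity)
    gcongr
    rw [contrC, div_le_iff₀ (by positivity)]
    have h1 := sinh_le_mul_cosh (show 0 ≤ 2 * r by positivity)
    have h2 : Real.cosh (2 * r) ≤ Real.cosh 2 := Real.cosh_le_cosh.2 (by
      rw [abs_of_pos (by positivity), abs_of_pos (by norm_num)]; linarith)
    have h3 : Real.cosh (2 * (2 * r)) ≤ Real.cosh 2 := Real.cosh_le_cosh.2 (by
      rw [abs_of_pos (by positivity), abs_of_pos (by norm_num)]; linarith)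
    have h4 : 0 < Real.cosh 2 := Real.cosh_pos 2
    calc Real.sinh (2 * r) * Real.cosh (2 * (2 * r))
        ≤ (2 * r * Real.cosh 2) * Real.cosh 2 :=
          mul_le_mul (h1.trans (mul_le_mul_of_nonneg_left h2 (by positivity))) h3
            (Real.cosh_pos _).le (by positivity)
      _ = _ := by ring

lemma GoodSpace.ae_nearDensity_of_bilipschitz {S : Set X}
    (φ : X → EuclideanSpace ℝ (Fin n)) {a b θ : ℝ} (ha : 0 < a) (hb : 0 < b)
    (h1 : ∀ x ∈ S, ∀ y ∈ S, a * dist x y ≤ dist (φ x) (φ y))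
    (h2 : ∀ x ∈ S, ∀ y ∈ S, dist (φ x) (φ y) ≤ b * dist x y) (hθ : (b / a) ^ n < θ) :
    ∀ᵐ x ∂(μH[(n : ℝ)] : Measure X), x ∈ S → NearDensity n θ x := by
  have := G.isFiniteMeasureOnCompacts
  have := G.isUnifLocDoubling
  have := isAddHaar_hausdorff_euclid n
  set μ := (μH[(n : ℝ)] : Measure X)
  set ν := (μH[(n : ℝ)] : Measure (EuclideanSpace ℝ (Fin n)))
  have hκ := kappa_pos n
  have hba : 0 < (b / a) ^ n := by positivity
  have hθ0 : 0 < θ := hba.trans hθ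
  set q := (b / a) ^ n / θ with hqdef
  have hq : q < 1 := (div_lt_one hθ0).2 hθ
  have hq0 : 0 < q := by positivity
  have hfinX : ∀ (x : X) r, μ (closedBall x r) ≠ ⊤ := fun x r => (G.closedBall_lt_top x r).ne
  have hfinE : ∀ (x : EuclideanSpace ℝ (Fin n)) r, ν (closedBall x r) ≠ ⊤ := fun x r =>
    measure_closedBall_lt_top.ne
  have n1 := ae_eventually_inter_closedBall μ hfinX S hq
  have n2 := ae_eventually_inter_closedBall ν hfinE (φ '' S) hq
  set Bad := {y | ¬ ∀ᶠ r in 𝓝[>] (0 : ℝ),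
    q * ν.real (closedBall y r) ≤ ν.real (φ '' S ∩ closedBall y r)} with hBad
  have hback : ∀ A ⊆ S, μ A ≤ ENNReal.ofReal ((1 / a) ^ n) * ν (φ '' A) := by
    intro A hA
    refine hausdorff_le_of_local n (by positivity) one_pos φ (fun x hx => mem_image_of_mem φ hx)
      fun x hx y hy _ => ?_
    have := h1 x (hA hx) y (hA hy)
    rw [one_div_mul_eq_div, le_div_iff₀ ha]; linarith
  have hforw : ∀ A ⊆ S, ν (φ '' A) ≤ ENNReal.ofReal (b ^ n) * μ A := by
    intro A hA
    have hl : LipschitzOnWith b.toNNReal φ A := LipschitzOnWith.of_dist_le_mul fun x hx y hy => by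
      rw [Real.coe_toNNReal _ hb.le]; exact h2 x (hA hx) y (hA hy)
    have := hl.hausdorffMeasure_image_le (d := n) (by positivity)
    rwa [ENNReal.rpow_natCast, ← ENNReal.ofReal, ← ENNReal.ofReal_pow hb.le] at this
  have n3 : μ (S ∩ φ ⁻¹' Bad) = 0 := by
    refine le_antisymm ((hback _ inter_subset_left).trans ?_) zero_le
    have : ν (φ '' (S ∩ φ ⁻¹' Bad)) = 0 := by
      refine measure_mono_null ?_ n2
      rintro _ ⟨x, ⟨hx, hx'⟩, rfl⟩
      exact ⟨hx', mem_image_of_mem φ hx⟩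
    rw [this, mul_zero]
  filter_upwards [measure_eq_zero_iff_ae_notMem.1 n1, measure_eq_zero_iff_ae_notMem.1 n3] with x hx1 hx2 hxS
  have e1 : ∀ᶠ r in 𝓝[>] (0 : ℝ), q * μ.real (closedBall x r) ≤ μ.real (S ∩ closedBall x r) := by
    by_contra h; exact hx1 ⟨h, hxS⟩
  have e2 : ∀ᶠ r in 𝓝[>] (0 : ℝ),
      q * ν.real (closedBall (φ x) r) ≤ ν.real (φ '' S ∩ closedBall (φ x) r) := by
    by_contra h; exact hx2 ⟨hxS, h⟩
  have e3 : Tendsto (fun r : ℝ => a * r) (𝓝[>] 0) (𝓝[>] 0) := by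
    refine tendsto_nhdsWithin_iff.2 ⟨?_, eventually_mem_nhdsWithin.mono fun r hr => mul_pos ha hr⟩
    have : Tendsto (fun r : ℝ => a * r) (𝓝 0) (𝓝 (a * 0)) := tendsto_id.const_mul a
    rw [mul_zero] at this
    exact this.mono_left nhdsWithin_le_nhds
  filter_upwards [e1, e3.eventually e2, self_mem_nhdsWithin] with r hr1 hr2 hr
  have hr0 : 0 < r := hr
  constructor
  · rw [real_closedBall_euclid _ _ (by positivity)] at hr2
    have hsub : φ '' S ∩ closedBall (φ x) (a * r) ⊆ φ '' (S ∩ closedBall x r) := by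
      rintro _ ⟨⟨y, hy, rfl⟩, hy2⟩
      refine mem_image_of_mem φ ⟨hy, ?_⟩
      rw [mem_closedBall] at hy2 ⊢
      have := h1 y hy x hxS
      exact le_of_mul_le_mul_left (this.trans hy2) ha
    have h3 : ν.real (φ '' S ∩ closedBall (φ x) (a * r)) ≤ b ^ n * μ.real (closedBall x r) := by
      have := ENNReal.toReal_mono (ENNReal.mul_ne_top ENNReal.ofReal_ne_top (hfinX x r))
        ((measure_mono hsub).trans ((hforw _ inter_subset_left).trans
          (mul_le_mul_right (measure_mono inter_subset_right) _)))
      rwa [ENNReal.toReal_mul, ENNReal.toReal_ofReal (by positivity)] at this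
    have h4 := hr2.trans h3
    have e : q * ((a * r) ^ n * kappa n) = b ^ n / θ * (kappa n * r ^ n) := by
      rw [hqdef, div_pow, mul_pow]; field_simp
    rw [e, div_mul_eq_mul_div, div_le_iff₀ hθ0] at h4
    have hbn : 0 < b ^ n := by positivity
    refine le_of_mul_le_mul_left (h4.trans (le_of_eq ?_)) hbn
    ring
  · have hsub : φ '' (S ∩ closedBall x r) ⊆ closedBall (φ x) (b * r) := by
      rintro _ ⟨y, ⟨hy, hy2⟩, rfl⟩
      rw [mem_closedBall] at hy2 ⊢
      exact (h2 y hy x hxS).trans (by gcongr)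
    have h3 : μ.real (S ∩ closedBall x r) ≤ (1 / a) ^ n * ((b * r) ^ n * kappa n) := by
      have := ENNReal.toReal_mono (ENNReal.mul_ne_top ENNReal.ofReal_ne_top (hfinE (φ x) (b * r)))
        ((hback (S ∩ closedBall x r) inter_subset_left).trans
          (mul_le_mul_right (measure_mono hsub) _))
      rw [ENNReal.toReal_mul, ENNReal.toReal_ofReal (by positivity)] at this
      change μ.real _ ≤ _ * ν.real _ at this
      rwa [real_closedBall_euclid _ _ (by positivity)] at this
    have h4 := hr1.trans h3
    have e : (1 / a) ^ n * ((b * r) ^ n * kappa n) = q * (θ * (kappa n * r ^ n)) := by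
      rw [hqdef, div_pow, div_pow, mul_pow, one_pow]; field_simp
    rw [e] at h4
    exact le_of_mul_le_mul_left h4 hq0

lemma GoodSpace.ae_nearDensity (hn : 0 < n) {θ : ℝ} (hθ : 1 < θ) :
    ∀ᵐ x ∂(μH[(n : ℝ)] : Measure X), NearDensity n θ x := by
  obtain ⟨U, -, -, ⟨x₀, -⟩, -⟩ := G.nontriv
  have : Nonempty X := ⟨x₀⟩
  have : NullSingletonClass (μH[(n : ℝ)] : Measure X) := Measure.nullSingletonClass_hausdorff X (by exact_mod_cast hn)
  have : Nontrivial X := by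
    by_contra h
    rw [not_nontrivial_iff_subsingleton] at h
    have h1 := G.closedBall_pos x₀ one_pos
    rw [(closedBall x₀ 1).toFinite.countable.measure_zero] at h1
    exact lt_irrefl _ h1
  -- distortion allowed for the frames
  obtain ⟨ε, hε0, hε1, hεθ⟩ : ∃ ε : ℝ, 0 < ε ∧ ε < 1 ∧ (√(1 + ε) / √(1 - ε)) ^ n < θ := by
    have hc : ContinuousAt (fun ε : ℝ => (√(1 + ε) / √(1 - ε)) ^ n) 0 :=
      ((Continuous.continuousAt (by fun_prop)).div (Continuous.continuousAt (by fun_prop))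
        (by simp)).pow n
    have h1 : ∀ᶠ ε in 𝓝 (0 : ℝ), (√(1 + ε) / √(1 - ε)) ^ n < θ :=
      hc.eventually (gt_mem_nhds (by simpa using hθ))
    have h2 : ∀ᶠ ε in 𝓝[>] (0 : ℝ), (√(1 + ε) / √(1 - ε)) ^ n < θ := h1.filter_mono nhdsWithin_le_nhds
    obtain ⟨ε, h3, h4⟩ := (h2.and (Ioo_mem_nhdsGT (one_pos (α := ℝ)))).exists
    exact ⟨ε, h4.1, h4.2, h3⟩
  set a := √(1 - ε) with ha
  set b := √(1 + ε) with hb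
  have ha0 : 0 < a := Real.sqrt_pos.2 (by linarith)
  have hb0 : 0 < b := Real.sqrt_pos.2 (by linarith)
  have ha2 : a ^ 2 = 1 - ε := Real.sq_sqrt (by linarith)
  have hb2 : b ^ 2 = 1 + ε := Real.sq_sqrt (by linarith)
  set pt := TopologicalSpace.denseSeq X
  let S : (k : ℕ) → (Fin k → ℕ) → ℕ → ℕ → Set X := fun k p m j =>
    {x : X | ∀ y, dist y x < 1 / ((m : ℝ) + 1) →
      |∑ i, (dist (pt (p i)) y - dist (pt (p i)) x) ^ 2 - dist y x ^ 2| ≤ ε * dist y x ^ 2} ∩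
      ball (pt j) (1 / (2 * ((m : ℝ) + 1)))
  have hbil : ∀ k (p : Fin k → ℕ) m j, ∃ φ : X → EuclideanSpace ℝ (Fin k),
      (∀ x ∈ S k p m j, ∀ y ∈ S k p m j, a * dist x y ≤ dist (φ x) (φ y)) ∧
      ∀ x ∈ S k p m j, ∀ y ∈ S k p m j, dist (φ x) (φ y) ≤ b * dist x y := by
    intro k p m j
    refine ⟨fun x => WithLp.toLp 2 fun i => dist (pt (p i)) x, ?_⟩
    have key : ∀ x ∈ S k p m j, ∀ y ∈ S k p m j,
        |dist (WithLp.toLp 2 fun i => dist (pt (p i)) x : EuclideanSpace ℝ (Fin k))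
          (WithLp.toLp 2 fun i => dist (pt (p i)) y) ^ 2 - dist x y ^ 2| ≤ ε * dist x y ^ 2 := by
      intro x hx y hy
      have hxy : dist x y < 1 / ((m : ℝ) + 1) := by
        have h1 := mem_ball.1 hx.2
        have h2 := mem_ball.1 hy.2
        have h3 := dist_triangle_right x y (pt j)
        have : 1 / (2 * ((m : ℝ) + 1)) + 1 / (2 * ((m : ℝ) + 1)) = 1 / ((m : ℝ) + 1) := by
          field_simp; norm_num
        linarith
      have := hy.1 x hxy
      rw [EuclideanSpace.dist_sq_eq]
      simpa only [Real.dist_eq, sq_abs] using this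
    constructor
    · intro x hx y hy
      have := abs_le.1 (key x hx y hy)
      refine le_of_sq_le_sq ?_ dist_nonneg
      rw [mul_pow, ha2]; linarith
    · intro x hx y hy
      have := abs_le.1 (key x hx y hy)
      refine le_of_sq_le_sq ?_ (by positivity)
      rw [mul_pow, hb2]; linarith
  have hpiece : ∀ k ≤ n, ∀ (p : Fin k → ℕ) m j,
      ∀ᵐ x ∂(μH[(n : ℝ)] : Measure X), x ∈ S k p m j → NearDensity n θ x := by
    intro k hk p m j
    obtain ⟨φ, h1, h2⟩ := hbil k p m j
    rcases hk.eq_or_lt with rfl | hk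
    · exact G.ae_nearDensity_of_bilipschitz φ ha0 hb0 h1 h2 hεθ
    · have h3 : μH[(n : ℝ)] (S k p m j) = 0 := by
        refine le_antisymm ((hausdorff_le_of_local (C := univ) n (L := 1 / a) (δ := 1)
          (by positivity) one_pos φ (fun x _ => mem_univ _) fun x hx y hy _ => ?_).trans
          (le_of_eq ?_)) zero_le
        · have := h1 x hx y hy
          rw [one_div_mul_eq_div, le_div_iff₀ ha0]; linarith
        · rw [hausdorff_euclid_eq_zero n hk, mul_zero]
      filter_upwards [measure_eq_zero_iff_ae_notMem.1 h3] with x hx hx'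
      exact absurd hx' hx
  have hall : ∀ᵐ x ∂(μH[(n : ℝ)] : Measure X), ∀ k (p : Fin k → ℕ) m j, k ≤ n →
      x ∈ S k p m j → NearDensity n θ x := by
    simp only [ae_all_iff]
    exact fun k p m j hk => hpiece k hk p m j
  have hanti : ∀ᵐ x ∂(μH[(n : ℝ)] : Measure X), ∀ i, ∃ q, q ≠ x ∧
      dist (pt i) x + dist x q = dist (pt i) q := ae_all_iff.2 fun i => G.ae_antipode (pt i)
  have hne : ∀ᵐ x ∂(μH[(n : ℝ)] : Measure X), ∀ i, pt i ≠ x := by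
    refine ae_all_iff.2 fun i => ?_
    filter_upwards [measure_eq_zero_iff_ae_notMem.1
      (measure_singleton (μ := (μH[(n : ℝ)] : Measure X)) (pt i))] with x hx h
    exact hx h.symm
  filter_upwards [hall, hanti, hne] with x h1 h2 h3
  obtain ⟨k, hk, p, r, hr, hfr⟩ := G.exists_frame_at (TopologicalSpace.denseRange_denseSeq X) h3 h2 hε0
  obtain ⟨m, hm⟩ := exists_nat_one_div_lt hr
  obtain ⟨j, hj⟩ := (TopologicalSpace.denseRange_denseSeq X).exists_dist_lt x
    (show 0 < 1 / (2 * ((m : ℝ) + 1)) by positivity)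
  exact h1 k p m j hk ⟨fun y hy => hfr y (hy.trans hm), hj⟩

/-- Almost every point has the Euclidean density. -/
theorem GoodSpace.ae_density (hn : 0 < n) :
    ∀ᵐ x ∂(μH[(n : ℝ)] : Measure X), ∀ θ > 1, NearDensity n θ x := by
  have h : ∀ᵐ x ∂(μH[(n : ℝ)] : Measure X), ∀ m : ℕ, NearDensity n (1 + 1 / ((m : ℝ) + 1)) x :=
    ae_all_iff.2 fun m => G.ae_nearDensity hn (by
      have : 0 < 1 / ((m : ℝ) + 1) := by positivity
      linarith)
  filter_upwards [h] with x hx θ hθ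
  obtain ⟨m, hm⟩ := exists_nat_one_div_lt (sub_pos.2 hθ)
  have hκ := kappa_pos n
  filter_upwards [hx m, self_mem_nhdsWithin] with r hr hr0
  have hr0 : 0 < r := hr0
  exact ⟨hr.1.trans (by gcongr; linarith), hr.2.trans (by gcongr; linarith)⟩

end

section

section Rayleigh

variable {X : Type*} [MetricSpace X] [MeasurableSpace X]

omit [MeasurableSpace X] in
lemma lipConst_mem {f : X → ℝ} {x : X} {c : ℝ} (hc : 0 ≤ c)
    (h : ∀ᶠ y in 𝓝 x, |f y - f x| ≤ c * dist y x) : 0 ≤ lipConst f x ∧ lipConst f x ≤ c := by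
  have h' : ∀ᶠ y in 𝓝[≠] x, |f y - f x| / dist y x ≤ c := by
    filter_upwards [h.filter_mono nhdsWithin_le_nhds, self_mem_nhdsWithin] with y hy hne
    rwa [div_le_iff₀ (dist_pos.2 hne)]
  have h0 : ∀ y, 0 ≤ |f y - f x| / dist y x := fun y => by positivity
  rcases (𝓝[≠] x).eq_or_neBot with hb | hb
  · have : lipConst f x = 0 := by
      rw [lipConst, hb, limsup, map_bot, limsSup]
      simp
    exact ⟨this.ge, this.le.trans hc⟩
  · have hbdd : IsBoundedUnder (· ≤ ·) (𝓝[≠] x) fun y => |f y - f x| / dist y x := ⟨c, h'⟩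
    have hcob : IsCoboundedUnder (· ≤ ·) (𝓝[≠] x) fun y => |f y - f x| / dist y x :=
      IsBoundedUnder.isCoboundedUnder_le ⟨0, eventually_map.2 (Eventually.of_forall h0)⟩
    exact ⟨le_limsup_of_frequently_le (Eventually.of_forall h0).frequently hbdd,
      limsup_le_of_le hcob h'⟩

lemma lambda0_mul_le (μ : Measure X) {f : X → ℝ} (hf : TestFun f) :
    lambda0 μ univ * ∫ x, f x ^ 2 ∂μ ≤ ∫ x, lipConst f x ^ 2 ∂μ := by
  have h0 : 0 ≤ ∫ x, f x ^ 2 ∂μ := integral_nonneg fun x => sq_nonneg _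
  have h1 : 0 ≤ ∫ x, lipConst f x ^ 2 ∂μ := integral_nonneg fun x => sq_nonneg _
  rcases h0.eq_or_lt with h | h
  · rw [← h, mul_zero]; exact h1
  rw [← le_div_iff₀ h]
  refine csInf_le ⟨0, ?_⟩ ⟨f, hf, subset_univ _, h.ne', rfl⟩
  rintro _ ⟨g, -, -, -, rfl⟩
  exact div_nonneg (integral_nonneg fun x => sq_nonneg _) (integral_nonneg fun x => sq_nonneg _)

lemma goodSpace_of_lambda0 [BorelSpace X] [ProperSpace X] {n : ℕ} (hX : CurvGeNegK X 1)
    (h : lambda0 (μH[(n : ℝ)] : Measure X) univ ≠ 0) : GoodSpace X n := by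
  refine ⟨hX.1, hX.coshCmp, ?_⟩
  have hne : ∃ f : X → ℝ, TestFun f ∧ (∫ x, f x ^ 2 ∂(μH[(n : ℝ)] : Measure X)) ≠ 0 := by
    by_contra! hcon
    refine h ?_
    rw [lambda0, show { r : ℝ | ∃ f : X → ℝ, TestFun f ∧ tsupport f ⊆ univ ∧
      (∫ x, f x ^ 2 ∂(μH[(n : ℝ)] : Measure X)) ≠ 0 ∧
      r = (∫ x, lipConst f x ^ 2 ∂(μH[(n : ℝ)] : Measure X)) /
        ∫ x, f x ^ 2 ∂(μH[(n : ℝ)] : Measure X) } = ∅ from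
      eq_empty_of_forall_notMem fun r ⟨f, hf, _, h1, _⟩ => h1 (hcon f hf), Real.sInf_empty]
  obtain ⟨f, ⟨⟨K, hK⟩, hsupp⟩, hint⟩ := hne
  have hI : Integrable (fun x => f x ^ 2) (μH[(n : ℝ)] : Measure X) := by
    by_contra hn; exact hint (integral_undef hn)
  obtain ⟨ε, hε, hμ⟩ : ∃ ε : ℝ, 0 < ε ∧ μH[(n : ℝ)] {x | ε < f x ^ 2} ≠ 0 := by
    by_contra! hcon
    refine hint (integral_eq_zero_of_ae ?_)
    have : ∀ᵐ x ∂(μH[(n : ℝ)] : Measure X), ∀ k : ℕ, ¬ (1 / ((k : ℝ) + 1) < f x ^ 2) :=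
      ae_all_iff.2 fun k => measure_eq_zero_iff_ae_notMem.1 (hcon _ (by positivity))
    filter_upwards [this] with x hx
    by_contra hx0
    obtain ⟨k, hk⟩ := exists_nat_one_div_lt (show 0 < f x ^ 2 by
      exact (sq_nonneg _).lt_of_ne fun h => hx0 h.symm)
    exact hx k hk
  refine ⟨{x | ε < f x ^ 2}, isOpen_lt continuous_const (hK.continuous.pow 2), ?_, ?_, hμ,
    (hI.measure_gt_lt_top hε).ne⟩
  · refine (hsupp.isCompact.isBounded).subset fun x hx => subset_tsupport f ?_
    intro h0
    have : ε < f x ^ 2 := hx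
    rw [h0] at this
    linarith
  · exact nonempty_of_measure_ne_zero hμ

end Rayleigh

/-- Function with the properties of a Busemann function: `1`-Lipschitz, and every point starts a
descending unit speed path. -/
structure Horo {X : Type*} [MetricSpace X] (β : X → ℝ) : Prop where
  sub_le : ∀ x y, β x - β y ≤ dist x y
  desc : ∀ x s, 0 ≤ s → ∃ y, dist x y = s ∧ β x - β y = s

section Busemann

variable {X : Type*} [MetricSpace X] [ProperSpace X]

lemma exists_tendsto_ultra {y : ℕ → X} {p : X} {r : ℝ} (h : ∀ i, dist p (y i) ≤ r) :
    ∃ z, Tendsto y ultra (𝓝 z) := by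
  have hm : ((ultra.map y : Ultrafilter X) : Filter X) ≤ 𝓟 (closedBall p r) := by
    rw [le_principal_iff]
    exact Filter.mem_map.2 (univ_mem' fun i => by
      change y i ∈ closedBall p r
      rw [mem_closedBall, dist_comm]; exact h i)
  obtain ⟨z, -, hz⟩ := (isCompact_closedBall p r).ultrafilter_le_nhds _ hm
  exact ⟨z, hz⟩

/-- Horofunction attached to an end. -/
lemma IsGeodesicSpace.exists_horo (hg : IsGeodesicSpace X) {p : X} {R₀ : ℝ} {E : Set X}
    (hE : IsEnd p R₀ E) :
    ∃ β : X → ℝ, Horo β ∧ ∀ c, ∃ r, {x | β x ≤ c} ⊆ E ∪ closedBall p r := by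
  obtain ⟨⟨e, he, rfl⟩, hunb⟩ := hE
  set E := connectedComponentIn (closedBall p R₀)ᶜ e with hEdef
  have hx : ∀ i : ℕ, ∃ x ∈ E, (i : ℝ) ≤ dist p x := by
    intro i
    by_contra! hcon
    exact hunb (isBounded_closedBall.subset fun x hx => by
      rw [mem_closedBall, dist_comm]; exact (hcon x hx).le)
  choose x hxE hxi using hx
  have hb : ∀ q, ∀ i, |dist q (x i) - dist p (x i)| ≤ dist q p := fun q i =>
    abs_dist_sub_le q p (x i)
  have hlim : ∀ q, Tendsto (fun i => dist q (x i) - dist p (x i)) ultra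
      (𝓝 (ulim fun i => dist q (x i) - dist p (x i))) := fun q => tendsto_ulim (hb q)
  refine ⟨fun q => ulim fun i => dist q (x i) - dist p (x i), ⟨fun q y => ?_, fun q s hs => ?_⟩,
    fun c => ⟨max R₀ (c + 2 * R₀), fun q hq => ?_⟩⟩
  · refine le_of_tendsto ((hlim q).sub (hlim y)) (Eventually.of_forall fun i => ?_)
    have := dist_triangle q y (x i)
    linarith
  · have hex : ∀ i, ∃ y, dist q y ≤ s ∧ (s ≤ dist q (x i) → dist q y = s ∧
        dist y (x i) = dist q (x i) - s) := by
      intro i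
      by_cases h : s ≤ dist q (x i)
      · obtain ⟨γ, ⟨-, hγ⟩, h0, h1⟩ := hg q (x i)
        refine ⟨γ s, ?_, fun _ => ⟨?_, ?_⟩⟩
        · have := hγ 0 ⟨le_rfl, dist_nonneg⟩ s ⟨hs, h⟩
          rw [h0, zero_sub, abs_neg, abs_of_nonneg hs] at this
          exact this.le
        · have := hγ 0 ⟨le_rfl, dist_nonneg⟩ s ⟨hs, h⟩
          rwa [h0, zero_sub, abs_neg, abs_of_nonneg hs] at this
        · have := hγ s ⟨hs, h⟩ _ ⟨dist_nonneg, le_rfl⟩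
          rwa [h1, abs_sub_comm, abs_of_nonneg (by linarith)] at this
      · exact ⟨q, by simpa using hs, fun h' => absurd h' h⟩
    choose y hy1 hy2 using hex
    obtain ⟨z, hz⟩ := exists_tendsto_ultra hy1
    have hev : ∀ᶠ i in (ultra : Filter ℕ), s ≤ dist q (x i) := by
      refine ultra_le_atTop ?_
      obtain ⟨N, hN⟩ := exists_nat_ge (s + dist q p)
      filter_upwards [eventually_ge_atTop N] with i hi
      have h1 : (N : ℝ) ≤ i := by exact_mod_cast hi
      have h2 := dist_triangle_left p (x i) q
      have := hxi i
      linarith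
    refine ⟨z, ?_, ?_⟩
    · refine tendsto_nhds_unique (tendsto_const_nhds.dist hz) ?_
      exact tendsto_const_nhds.congr' (hev.mono fun i hi => ((hy2 i hi).1).symm)
    · have h1 := (hlim q).sub (hlim z)
      have h2 : Tendsto (fun i => dist (y i) z) ultra (𝓝 0) := by
        have := hz.dist (tendsto_const_nhds (x := z)); rwa [dist_self] at this
      refine le_antisymm ?_ ?_
      · have := le_of_tendsto_of_tendsto h1 (h2.const_add s) (hev.mono fun i hi => by
          have := (hy2 i hi).2
          have := dist_triangle (y i) z (x i)
          simp only; linarith)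
        simpa using this
      · have := le_of_tendsto_of_tendsto (h2.const_sub s) h1 (hev.mono fun i hi => by
          have := (hy2 i hi).2
          have := dist_triangle_left z (x i) (y i)
          simp only; linarith)
        simpa using this
  · by_contra hcon
    rw [mem_union, not_or, mem_closedBall, not_le, max_lt_iff, dist_comm] at hcon
    obtain ⟨hqE, hq1, hq2⟩ := hcon
    have hlow : ∀ i, dist p q - 2 * R₀ ≤ dist q (x i) - dist p (x i) := by
      intro i
      obtain ⟨γ, ⟨-, hγ⟩, h0, h1⟩ := hg q (x i)
      have hcont : ContinuousOn γ (Icc 0 (dist q (x i))) := by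
        refine (LipschitzOnWith.of_dist_le_mul (K := 1) fun s hs t ht => ?_).continuousOn
        rw [hγ s hs t ht, NNReal.coe_one, one_mul, Real.dist_eq]
      have hpre : IsPreconnected (γ '' Icc 0 (dist q (x i))) := isPreconnected_Icc.image _ hcont
      by_cases hsub : γ '' Icc 0 (dist q (x i)) ⊆ (closedBall p R₀)ᶜ
      · refine absurd ?_ hqE
        have h3 := hpre.subset_connectedComponentIn
          (⟨_, ⟨dist_nonneg, le_rfl⟩, h1⟩ : x i ∈ γ '' Icc 0 (dist q (x i))) hsub
        rw [← connectedComponentIn_eq (hxE i)] at h3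
        exact h3 ⟨0, ⟨le_rfl, dist_nonneg⟩, h0⟩
      · obtain ⟨_, ⟨s, hs, rfl⟩, hsb⟩ := not_subset.1 hsub
        have hsb' : dist p (γ s) ≤ R₀ := by
          rw [dist_comm]; exact not_not.1 hsb
        have e1 := hγ 0 ⟨le_rfl, dist_nonneg⟩ s hs
        have e2 := hγ s hs _ ⟨dist_nonneg, le_rfl⟩
        rw [h0, zero_sub, abs_neg, abs_of_nonneg hs.1] at e1
        rw [h1, abs_sub_comm, abs_of_nonneg (by linarith [hs.2])] at e2
        have t1 := dist_triangle_right p q (γ s)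
        have t2 := dist_triangle p (γ s) (x i)
        linarith
    have := ge_of_tendsto (hlim q) (Eventually.of_forall hlow)
    have hq' : (ulim fun i => dist q (x i) - dist p (x i)) ≤ c := hq
    linarith

end Busemann

end

section

section Defect

variable {X : Type*} [MetricSpace X]

/-- `y` lies on a descending unit speed path issuing from `x`. -/
def Desc (β : X → ℝ) (x y : X) : Prop := dist x y = β x - β y

/-- The height function of a horofunction. -/
noncomputable def hgt (β : X → ℝ) (x : X) : ℝ := Real.exp (-β x)

/-- Squared horospherical distance of the projections in the warped product model. -/
noncomputable def defect (β : X → ℝ) (x y : X) : ℝ :=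
  2 * hgt β x * hgt β y * (Real.cosh (dist x y) - Real.cosh (β x - β y))

variable {β : X → ℝ}

omit [MetricSpace X] in
lemma hgt_pos (β : X → ℝ) (x : X) : 0 < hgt β x := Real.exp_pos _

omit [MetricSpace X] in
lemma log_hgt (β : X → ℝ) (x : X) : Real.log (hgt β x) = -β x := Real.log_exp _

omit [MetricSpace X] in
lemma hgt_eq_iff {x y : X} : hgt β x = hgt β y ↔ β x = β y := by
  rw [hgt, hgt, Real.exp_eq_exp, neg_inj]

lemma defect_comm (x y : X) : defect β x y = defect β y x := by
  rw [defect, defect, dist_comm, ← neg_sub (β x), Real.cosh_neg]; ring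

omit [MetricSpace X] in
lemma two_mul_cosh_sub (x y : X) :
    2 * hgt β x * hgt β y * Real.cosh (β x - β y) = hgt β x ^ 2 + hgt β y ^ 2 := by
  rw [Real.cosh_eq, hgt, hgt]
  have h1 : Real.exp (β x - β y) = Real.exp (-β y) / Real.exp (-β x) := by
    rw [← Real.exp_sub]; congr 1; ring
  have h2 : Real.exp (-(β x - β y)) = Real.exp (-β x) / Real.exp (-β y) := by
    rw [← Real.exp_sub]; congr 1; ring
  rw [h1, h2]
  field_simp
  ring

lemma cosh_sub_one_eq (t : ℝ) : 2 * (Real.cosh t - 1) = (2 * Real.sinh (t / 2)) ^ 2 := by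
  rw [cosh_eq_half t]; ring

lemma hgt_mul_sinh_sq (x y : X) :
    hgt β x * hgt β y * (2 * Real.sinh (dist x y / 2)) ^ 2 =
      defect β x y + (hgt β x - hgt β y) ^ 2 := by
  rw [← cosh_sub_one_eq, defect]
  linear_combination two_mul_cosh_sub (β := β) x y

lemma Desc.refl (x : X) : Desc β x x := by simp [Desc]

lemma Desc.le {x y : X} (h : Desc β x y) : β y ≤ β x := by
  have := dist_nonneg (x := x) (y := y); rw [h] at this; linarith

variable (H : Horo β)
include H

lemma Horo.abs_sub_le (x y : X) : |β x - β y| ≤ dist x y :=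
  abs_sub_le_iff.2 ⟨H.sub_le x y, by rw [dist_comm]; exact H.sub_le y x⟩

lemma Horo.continuous : Continuous β :=
  (LipschitzWith.of_dist_le_mul (K := 1) fun x y => by
    rw [Real.dist_eq, NNReal.coe_one, one_mul]; exact H.abs_sub_le x y).continuous

lemma Horo.continuous_hgt : Continuous (hgt β) := Real.continuous_exp.comp H.continuous.neg

lemma Horo.desc_trans {x y z : X} (h1 : Desc β x y) (h2 : Desc β y z) : Desc β x z := by
  have := dist_triangle x y z
  have := H.sub_le x z
  unfold Desc at *; linarith

lemma Horo.defect_nonneg (x y : X) : 0 ≤ defect β x y := by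
  have h1 : Real.cosh (β x - β y) ≤ Real.cosh (dist x y) :=
    Real.cosh_le_cosh.2 ((H.abs_sub_le x y).trans (le_abs_self _))
  have := hgt_pos β x; have := hgt_pos β y
  exact mul_nonneg (by positivity) (sub_nonneg.2 h1)

omit H in
lemma eq_of_defect_le_zero {x y : X} (h : β x = β y) (hd : defect β x y ≤ 0) : x = y := by
  by_contra hne
  have h1 : 1 < Real.cosh (dist x y) := Real.one_lt_cosh.2 (dist_pos.2 hne).ne'
  rw [defect, h, sub_self, Real.cosh_zero] at hd
  have := mul_pos (mul_pos (mul_pos two_pos (hgt_pos β x)) (hgt_pos β y)) (sub_pos.2 h1)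
  linarith

lemma Horo.defect_mono (hc : CoshCmp X) {x y : X} (hxy : Desc β x y) (q : X) :
    defect β q x ≤ defect β q y := by
  set s := β x - β y with hs
  set u := β q - β x with hu
  set A := Real.cosh (dist q x) - Real.cosh u with hA
  set B := Real.cosh (dist q y) - Real.cosh (u + s) with hB
  have hkey : ∀ T : ℝ, 0 < T → Real.sinh T * A ≤ Real.sinh (s + T) * B := by
    intro T hT
    obtain ⟨b, hb1, hb2⟩ := H.desc y T hT.le
    have hxb : dist x b = s + T := by
      have h1 := dist_triangle x y b
      have h2 := H.sub_le x b
      have h3 : dist x y = s := hxy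
      linarith
    have h4 := hc x b y q (by rw [hxy, hb1, hxb])
    rw [hb1, hxb, show dist x y = s from hxy] at h4
    have h5 : Real.cosh (u + s + T) ≤ Real.cosh (dist q b) := by
      refine Real.cosh_le_cosh.2 ?_
      rw [abs_of_nonneg (dist_nonneg (x := q)), show u + s + T = β q - β b by linarith]
      exact H.abs_sub_le q b
    have hs0 : 0 ≤ Real.sinh s := Real.sinh_nonneg_iff.2 (by rw [hs, ← hxy]; exact dist_nonneg)
    have h6 := mul_le_mul_of_nonneg_left h5 hs0
    have e : Real.sinh T * Real.cosh u + Real.sinh s * Real.cosh (u + s + T) =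
        Real.cosh (u + s) * Real.sinh (s + T) := by
      rw [show u + s + T = (u + s) + T by ring, show u = (u + s) - s by ring]
      generalize u + s = v
      rw [show v - s + s = v by ring, Real.cosh_sub, Real.cosh_add, Real.sinh_add]
      ring
    rw [hA, hB]; nlinarith
  have hlim : Tendsto (fun T : ℝ => Real.exp (-2 * T)) atTop (𝓝 0) := by
    refine Real.tendsto_exp_atBot.comp (tendsto_id.const_mul_atTop_of_neg (by norm_num))
  have hle : A ≤ Real.exp s * B := by
    have l1 : Tendsto (fun T : ℝ => (1 - Real.exp (-2 * T)) * A) atTop (𝓝 ((1 - 0) * A)) :=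
      (hlim.const_sub 1).mul_const A
    have l2 : Tendsto (fun T : ℝ => (Real.exp s - Real.exp (-s) * Real.exp (-2 * T)) * B) atTop
        (𝓝 ((Real.exp s - Real.exp (-s) * 0) * B)) :=
      ((hlim.const_mul _).const_sub _).mul_const B
    have := le_of_tendsto_of_tendsto l1 l2 ((eventually_gt_atTop 0).mono fun T hT => by
      have h1 := hkey T hT
      have e1 : (1 - Real.exp (-2 * T)) = 2 * Real.exp (-T) * Real.sinh T := by
        rw [Real.sinh_eq]
        have : Real.exp (-2 * T) = Real.exp (-T) * Real.exp (-T) := by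
          rw [← Real.exp_add]; congr 1; ring
        have h2 : Real.exp (-T) * Real.exp T = 1 := by rw [← Real.exp_add]; simp
        linear_combination -this - h2
      have e2 : (Real.exp s - Real.exp (-s) * Real.exp (-2 * T)) =
          2 * Real.exp (-T) * Real.sinh (s + T) := by
        rw [Real.sinh_eq]
        have h2 : Real.exp (-s) * Real.exp (-2 * T) = Real.exp (-T) * Real.exp (-(s + T)) := by
          rw [← Real.exp_add, ← Real.exp_add]; congr 1; ring
        have h3 : Real.exp (-T) * Real.exp (s + T) = Real.exp s := by
          rw [← Real.exp_add]; congr 1; ring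
        linear_combination -h2 - h3
      simp only
      rw [e1, e2, mul_assoc, mul_assoc (2 * Real.exp (-T))]
      exact mul_le_mul_of_nonneg_left h1 (by positivity))
    simpa using this
  have e1 : hgt β y = hgt β x * Real.exp s := by
    rw [hgt, hgt, ← Real.exp_add]; congr 1; linarith
  have hpos : 0 ≤ 2 * hgt β q * hgt β x := by
    have := hgt_pos β x; have := hgt_pos β q; positivity
  have := mul_le_mul_of_nonneg_left hle hpos
  rw [defect, defect, e1, show β q - β y = u + s by linarith]
  linarith

lemma Horo.defect_mono₂ (hc : CoshCmp X) {x y x' y' : X} (h : Desc β x y) (h' : Desc β x' y') :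
    defect β x x' ≤ defect β y y' :=
  (H.defect_mono hc h' x).trans (by
    rw [defect_comm x, defect_comm y]; exact H.defect_mono hc h y')

lemma Horo.sinh_half_le (hc : CoshCmp X) {κ : ℝ} {x y x' y' : X} (h : Desc β x y)
    (h' : Desc β x' y') (hy : hgt β y = hgt β x + κ) (hy' : hgt β y' = hgt β x' + κ) :
    hgt β x * hgt β x' * (2 * Real.sinh (dist x x' / 2)) ^ 2 ≤
      hgt β y * hgt β y' * (2 * Real.sinh (dist y y' / 2)) ^ 2 := by
  rw [hgt_mul_sinh_sq, hgt_mul_sinh_sq]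
  have := H.defect_mono₂ hc h h'
  rw [hy, hy', show hgt β x + κ - (hgt β x' + κ) = hgt β x - hgt β x' by ring]
  linarith

lemma Horo.exists_desc_add {κ : ℝ} (hκ : 0 ≤ κ) (x : X) :
    ∃ y, Desc β x y ∧ hgt β y = hgt β x + κ := by
  have h0 := hgt_pos β x
  obtain ⟨y, h1, h2⟩ := H.desc x (Real.log ((hgt β x + κ) / hgt β x))
    (Real.log_nonneg (by rw [le_div_iff₀ h0]; linarith))
  refine ⟨y, h1.trans h2.symm, ?_⟩
  rw [Real.log_div (by positivity) h0.ne', log_hgt] at h2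
  rw [hgt, show -β y = Real.log (hgt β x + κ) by linarith, Real.exp_log (by positivity)]

end Defect

section Volume

variable {X : Type*} [MetricSpace X] [MeasurableSpace X] [BorelSpace X]

/-- Hausdorff measure with density `h ^ n`. -/
noncomputable def horoVol (n : ℕ) (β : X → ℝ) : Measure X :=
  (μH[(n : ℝ)] : Measure X).withDensity fun x => ENNReal.ofReal (hgt β x ^ n)

variable {n : ℕ} {β : X → ℝ}

lemma horoVol_le {A : Set X} (hA : MeasurableSet A) {c : ℝ} (h : ∀ x ∈ A, hgt β x ≤ c) :
    horoVol n β A ≤ ENNReal.ofReal (c ^ n) * μH[(n : ℝ)] A := by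
  rw [horoVol, withDensity_apply _ hA, ← setLIntegral_const]
  refine setLIntegral_mono' hA fun x hx => ENNReal.ofReal_le_ofReal ?_
  have := hgt_pos β x
  gcongr
  exact h x hx

lemma le_horoVol {A : Set X} (hA : MeasurableSet A) {c : ℝ} (hc : 0 ≤ c)
    (h : ∀ x ∈ A, c ≤ hgt β x) :
    ENNReal.ofReal (c ^ n) * μH[(n : ℝ)] A ≤ horoVol n β A := by
  rw [horoVol, withDensity_apply _ hA, ← setLIntegral_const]
  refine setLIntegral_mono' hA fun x hx => ENNReal.ofReal_le_ofReal ?_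
  gcongr
  exact h x hx

variable [ProperSpace X] (H : Horo β)
include H

/-- Descending by a fixed height does not decrease the weighted volume. -/
lemma Horo.vol_le_of_desc (hc : CoshCmp X) {κ : ℝ} (hκ : 0 ≤ κ) {A C : Set X}
    (hA : MeasurableSet A) (hC : MeasurableSet C)
    (hAC : ∀ x ∈ A, ∃ z ∈ C, Desc β x z ∧ hgt β z = hgt β x + κ) :
    horoVol n β A ≤ horoVol n β C := by
  classical
  have key : ∀ ε : ℝ, 0 < ε → horoVol n β A ≤
      ENNReal.ofReal ((Real.exp (2 * ε) * Real.cosh ε) ^ n) * horoVol n β C := by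
    intro ε hε
    let f : ℝ → ℤ := fun t => ⌊Real.log t / ε⌋
    have hf : Measurable f := Int.measurable_floor.comp (Real.measurable_log.div_const ε)
    have hfl : ∀ t, 0 < t → Real.exp (f t * ε) ≤ t ∧ t ≤ Real.exp ((f t + 1) * ε) := by
      intro t ht
      constructor
      · rw [← Real.le_log_iff_exp_le ht, ← le_div_iff₀ hε]; exact Int.floor_le _
      · rw [← Real.log_le_iff_le_exp ht, ← div_le_iff₀ hε]; exact (Int.lt_floor_add_one _).le
    have hm := H.continuous_hgt.measurable
    let A' : ℤ → Set X := fun i => A ∩ (fun x => f (hgt β x)) ⁻¹' {i}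
    let C' : ℤ → Set X := fun i => C ∩ ({z | κ < hgt β z} ∩ (fun x => f (hgt β x - κ)) ⁻¹' {i})
    have hAm : ∀ i, MeasurableSet (A' i) := fun i =>
      hA.inter ((hf.comp hm) (measurableSet_singleton i))
    have hCm : ∀ i, MeasurableSet (C' i) := fun i =>
      hC.inter ((measurableSet_lt measurable_const hm).inter
        ((hf.comp (hm.sub_const κ)) (measurableSet_singleton i)))
    have hAu : A = ⋃ i, A' i := by
      ext x; simp [A']
    have hCu : (⋃ i, C' i) ⊆ C := iUnion_subset fun i => inter_subset_left
    have hCd : Pairwise (Function.onFun Disjoint C') := by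
      intro i j hij
      refine disjoint_left.2 fun x hx hx' => hij ?_
      exact (hx.2.2 : f (hgt β x - κ) = i).symm.trans hx'.2.2
    have hstep : ∀ i, horoVol n β (A' i) ≤
        ENNReal.ofReal ((Real.exp (2 * ε) * Real.cosh ε) ^ n) * horoVol n β (C' i) := by
      intro i
      set E := Real.exp (i * ε) with hE
      have hE0 : 0 < E := Real.exp_pos _
      have hE1 : Real.exp ((i + 1) * ε) = Real.exp ε * E := by
        rw [hE, ← Real.exp_add]; congr 1; ring
      have hA1 : ∀ x ∈ A' i, E ≤ hgt β x ∧ hgt β x ≤ Real.exp ε * E := by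
        intro x hx
        have h1 : f (hgt β x) = i := hx.2
        have := hfl _ (hgt_pos β x)
        rwa [h1, hE1] at this
      have hC1 : ∀ x ∈ C' i, E + κ ≤ hgt β x := by
        intro x hx
        have h1 : f (hgt β x - κ) = i := hx.2.2
        have h2 : κ < hgt β x := hx.2.1
        have := (hfl _ (sub_pos.2 h2)).1
        rw [h1] at this
        linarith
      choose! R hR1 hR2 hR3 using hAC
      set L := (Real.exp ε * E + κ) / E * Real.cosh ε with hL
      have hcosh := Real.cosh_pos ε
      have hexp : 1 ≤ Real.exp ε := Real.one_le_exp hε.le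
      have hL0 : 0 ≤ L := by positivity
      have h1 : μH[(n : ℝ)] (A' i) ≤ ENNReal.ofReal (L ^ n) * μH[(n : ℝ)] (C' i) := by
        refine hausdorff_le_of_local n hL0 hε R (fun x hx => ?_) fun x hx x' hx' hd => ?_
        · have e : hgt β (R x) - κ = hgt β x := by rw [hR3 x hx.1]; ring
          refine ⟨hR1 x hx.1, ?_, ?_⟩
          · change κ < hgt β (R x)
            have := hgt_pos β x
            rw [hR3 x hx.1]; linarith
          · change f (hgt β (R x) - κ) = i
            rw [e]; exact hx.2
        · have h2 := H.sinh_half_le hc (hR2 x hx.1) (hR2 x' hx'.1) (hR3 x hx.1) (hR3 x' hx'.1)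
          obtain ⟨a1, a2⟩ := hA1 x hx
          obtain ⟨b1, b2⟩ := hA1 x' hx'
          have s1 : dist x x' ≤ 2 * Real.sinh (dist x x' / 2) := by
            have := Real.self_le_sinh_iff.2 (show 0 ≤ dist x x' / 2 by positivity)
            linarith
          have s2 : 2 * Real.sinh (dist (R x) (R x') / 2) ≤
              Real.cosh ε * dist (R x) (R x') := by
            have h3 := sinh_le_mul_cosh (show 0 ≤ dist (R x) (R x') / 2 by positivity)
            have h4 : Real.cosh (dist (R x) (R x') / 2) ≤ Real.cosh ε := by
              refine Real.cosh_le_cosh.2 ?_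
              rw [abs_of_nonneg (by positivity), abs_of_pos hε]
              linarith [dist_nonneg (x := R x) (y := R x')]
            nlinarith [dist_nonneg (x := R x) (y := R x')]
          have p1 := hgt_pos β x
          have p2 := hgt_pos β x'
          have h5 : (E * dist x x') ^ 2 ≤
              ((Real.exp ε * E + κ) * (Real.cosh ε * dist (R x) (R x'))) ^ 2 := by
            calc (E * dist x x') ^ 2 = E * E * dist x x' ^ 2 := by ring
              _ ≤ hgt β x * hgt β x' * (2 * Real.sinh (dist x x' / 2)) ^ 2 := by gcongr
              _ ≤ _ := h2
              _ ≤ (Real.exp ε * E + κ) * (Real.exp ε * E + κ) *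
                  (Real.cosh ε * dist (R x) (R x')) ^ 2 := by
                rw [hR3 x hx.1, hR3 x' hx'.1]
                have : 0 ≤ 2 * Real.sinh (dist (R x) (R x') / 2) :=
                  mul_nonneg zero_le_two (Real.sinh_nonneg_iff.2 (by positivity))
                gcongr
              _ = _ := by ring
          have h6 := (pow_le_pow_iff_left₀ (by positivity) (by positivity) two_ne_zero).1 h5
          rw [hL, div_mul_eq_mul_div, div_mul_eq_mul_div, le_div_iff₀ hE0]
          linarith
      calc horoVol n β (A' i) ≤ ENNReal.ofReal ((Real.exp ε * E) ^ n) * μH[(n : ℝ)] (A' i) :=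
            horoVol_le (hAm i) fun x hx => (hA1 x hx).2
        _ ≤ ENNReal.ofReal ((Real.exp ε * E) ^ n) *
            (ENNReal.ofReal (L ^ n) * μH[(n : ℝ)] (C' i)) := by gcongr
        _ ≤ ENNReal.ofReal ((Real.exp (2 * ε) * Real.cosh ε) ^ n) *
            (ENNReal.ofReal ((E + κ) ^ n) * μH[(n : ℝ)] (C' i)) := by
          rw [← mul_assoc, ← mul_assoc, ← ENNReal.ofReal_mul (by positivity),
            ← ENNReal.ofReal_mul (by positivity), ← mul_pow, ← mul_pow]
          have e2 : Real.exp (2 * ε) = Real.exp ε * Real.exp ε := by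
            rw [← Real.exp_add]; congr 1; ring
          have : Real.exp ε * E * L ≤ Real.exp (2 * ε) * Real.cosh ε * (E + κ) := by
            have e3 : Real.exp ε * E * L = Real.exp ε * Real.cosh ε * (Real.exp ε * E + κ) := by
              rw [hL]; field_simp
            rw [e2, e3]
            have : Real.exp ε * E + κ ≤ Real.exp ε * (E + κ) := by nlinarith
            calc _ ≤ Real.exp ε * Real.cosh ε * (Real.exp ε * (E + κ)) := by gcongr
              _ = _ := by ring
          gcongr
        _ ≤ _ := by
          gcongr
          exact le_horoVol (hCm i) (by positivity) hC1
    calc horoVol n β A = horoVol n β (⋃ i, A' i) := by rw [← hAu]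
      _ ≤ ∑' i, horoVol n β (A' i) := measure_iUnion_le _
      _ ≤ ∑' i, ENNReal.ofReal ((Real.exp (2 * ε) * Real.cosh ε) ^ n) * horoVol n β (C' i) :=
        ENNReal.tsum_le_tsum hstep
      _ = ENNReal.ofReal ((Real.exp (2 * ε) * Real.cosh ε) ^ n) * horoVol n β (⋃ i, C' i) := by
        rw [ENNReal.tsum_mul_left, measure_iUnion hCd hCm]
      _ ≤ _ := by gcongr
  have hlim : Tendsto (fun ε : ℝ => ENNReal.ofReal ((Real.exp (2 * ε) * Real.cosh ε) ^ n) *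
      horoVol n β C) (𝓝[>] 0) (𝓝 (1 * horoVol n β C)) := by
    refine ENNReal.Tendsto.mul_const ?_ (Or.inl one_ne_zero)
    have hcont : Continuous fun ε : ℝ => (Real.exp (2 * ε) * Real.cosh ε) ^ n := by fun_prop
    have := (ENNReal.continuous_ofReal.comp hcont).tendsto 0
    simp only [Function.comp_def, mul_zero, Real.exp_zero, Real.cosh_zero, one_mul, one_pow,
      ENNReal.ofReal_one] at this
    exact this.mono_left nhdsWithin_le_nhds
  rw [one_mul] at hlim
  exact ge_of_tendsto hlim (eventually_mem_nhdsWithin.mono fun ε hε => key ε hε)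

end Volume

end

section

/-- `Γ` bounds the one-sided derivatives of `F`. -/
def HasSlope (F Γ : ℝ → ℝ) : Prop :=
  ∀ t, ∃ d₁ d₂, HasDerivWithinAt F d₁ (Iic t) t ∧ HasDerivWithinAt F d₂ (Ici t) t ∧
    |d₁| ≤ Γ t ∧ |d₂| ≤ Γ t

namespace HasSlope

variable {F Γ : ℝ → ℝ}

lemma nonneg (h : HasSlope F Γ) (t : ℝ) : 0 ≤ Γ t := by
  obtain ⟨d, _, -, -, h1, -⟩ := h t
  exact (abs_nonneg _).trans h1

lemma continuous (h : HasSlope F Γ) : Continuous F :=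
  continuous_iff_continuousAt.2 fun t => by
    obtain ⟨d₁, d₂, h1, h2, -, -⟩ := h t
    exact continuousAt_iff_continuous_left_right.2
      ⟨h1.continuousWithinAt, h2.continuousWithinAt⟩

lemma eventually_le (h : HasSlope F Γ) (t : ℝ) {ε : ℝ} (hε : 0 < ε) :
    ∀ᶠ s in 𝓝 t, |F s - F t| ≤ (Γ t + ε) * |s - t| := by
  obtain ⟨d₁, d₂, h1, h2, h3, h4⟩ := h t
  have key : ∀ {d : ℝ} {S : Set ℝ}, HasDerivWithinAt F d S t → |d| ≤ Γ t →
      ∀ᶠ s in 𝓝[S] t, |F s - F t| ≤ (Γ t + ε) * |s - t| := by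
    intro d S hd hdΓ
    filter_upwards [(hasDerivWithinAt_iff_isLittleO.1 hd).def hε] with s hs
    rw [Real.norm_eq_abs, Real.norm_eq_abs, smul_eq_mul] at hs
    calc |F s - F t| = |(F s - F t - (s - t) * d) + (s - t) * d| := by ring_nf
      _ ≤ |F s - F t - (s - t) * d| + |(s - t) * d| := abs_add_le _ _
      _ ≤ ε * |s - t| + |s - t| * Γ t := by
        rw [abs_mul]; gcongr
      _ = _ := by ring
  rw [← nhdsLE_sup_nhdsGE t]
  exact eventually_sup.2 ⟨key h1 h3, key h2 h4⟩

lemma abs_sub_le (h : HasSlope F Γ) {M : ℝ} (hM : ∀ t, Γ t ≤ M) (s t : ℝ) :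
    |F s - F t| ≤ M * |s - t| := by
  wlog hst : t ≤ s generalizing s t
  · rw [abs_sub_comm, abs_sub_comm s]; exact this t s (le_of_not_ge hst)
  choose d₁ d₂ h1 h2 h3 h4 using h
  have h := norm_image_sub_le_of_norm_deriv_right_le_segment (f := F) (f' := d₂) (a := t) (b := s)
    (C := M) (HasSlope.continuous (Γ := Γ) fun t => ⟨d₁ t, d₂ t, h1 t, h2 t, h3 t, h4 t⟩).continuousOn
    (fun x _ => h2 x) (fun x _ => (h4 x).trans (hM x)) s ⟨hst, le_rfl⟩
  rwa [abs_of_nonneg (sub_nonneg.2 hst)]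

end HasSlope

section Rayleigh

variable {X : Type*} [MetricSpace X] [MeasurableSpace X] [BorelSpace X] [ProperSpace X]
  {μ : Measure X} {β : X → ℝ}

/-- Rayleigh quotient bound for functions of a horofunction. -/
lemma Horo.rayleigh (H : Horo β) (hfin : ∀ c, μ {x | β x ≤ c} ≠ ⊤)
    {F Γ : ℝ → ℝ} (h : HasSlope F Γ) {M T : ℝ} (hΓm : Measurable Γ) (hΓM : ∀ t, Γ t ≤ M)
    (hFM : ∀ t, |F t| ≤ M) (hFT : ∀ t, T < t → F t = 0) (hΓT : ∀ t, T < t → Γ t = 0) :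
    lambda0 μ univ * ∫ x, F (β x) ^ 2 ∂μ ≤ ∫ x, Γ (β x) ^ 2 ∂μ := by
  rcases isEmpty_or_nonempty X with hX | ⟨⟨p⟩⟩
  · simp [Measure.eq_zero_of_isEmpty μ]
  have hM0 : 0 ≤ M := (abs_nonneg _).trans (hFM 0)
  have hβ := H.continuous
  have hFc := h.continuous
  set S := {x | β x ≤ T} with hS
  have hSm : MeasurableSet S := measurableSet_le hβ.measurable measurable_const
  have hSI : ∀ c : ℝ, Integrable (S.indicator fun _ => c) μ := fun c =>
    (integrable_indicator_iff hSm).2 (integrableOn_const (hfin T))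
  have hΓI : Integrable (fun x => Γ (β x) ^ 2) μ := by
    refine (hSI (M ^ 2)).mono' ((hΓm.comp hβ.measurable).pow_const 2).aestronglyMeasurable
      (Eventually.of_forall fun x => ?_)
    rw [Real.norm_eq_abs, abs_of_nonneg (sq_nonneg _)]
    by_cases hx : x ∈ S
    · rw [indicator_of_mem hx]
      have := h.nonneg (β x)
      gcongr
      exact hΓM _
    · rw [indicator_of_notMem hx, hΓT _ (not_le.1 hx)]; simp
  let χ : ℕ → X → ℝ := fun k x => max 0 (min 1 (2 - dist x p / ((k : ℝ) + 1)))
  have hχ0 : ∀ k x, 0 ≤ χ k x := fun k x => le_max_left _ _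
  have hχ1 : ∀ k x, χ k x ≤ 1 := fun k x => max_le zero_le_one (min_le_left _ _)
  have hχL : ∀ k x y, |χ k x - χ k y| ≤ dist x y / ((k : ℝ) + 1) := by
    intro k x y
    have hk : (0 : ℝ) < (k : ℝ) + 1 := by positivity
    calc |χ k x - χ k y| ≤ |min 1 (2 - dist x p / ((k : ℝ) + 1)) -
          min 1 (2 - dist y p / ((k : ℝ) + 1))| := by
          simp only [χ]
          rw [max_comm 0, max_comm 0]
          exact abs_max_sub_max_le_abs _ _ _
      _ ≤ |(2 - dist x p / ((k : ℝ) + 1)) - (2 - dist y p / ((k : ℝ) + 1))| := by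
          refine (abs_min_sub_min_le_max _ _ _ _).trans (max_le ?_ le_rfl)
          rw [sub_self, abs_zero]; exact abs_nonneg _
      _ = |dist y p - dist x p| / ((k : ℝ) + 1) := by
          rw [← abs_of_pos hk, ← abs_div, abs_of_pos hk]; congr 1; ring
      _ ≤ _ := by
          gcongr
          rw [dist_comm x y]
          exact abs_dist_sub_le y x p
  let f : ℕ → X → ℝ := fun k x => F (β x) * χ k x
  have hprod : ∀ k x y, |f k y - f k x| ≤ |F (β y) - F (β x)| + M * (dist y x / ((k : ℝ) + 1)) := by
    intro k x y
    calc |f k y - f k x| = |(F (β y) - F (β x)) * χ k y + F (β x) * (χ k y - χ k x)| := by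
          simp only [f]; ring_nf
      _ ≤ |F (β y) - F (β x)| * |χ k y| + |F (β x)| * |χ k y - χ k x| := by
          rw [← abs_mul, ← abs_mul]; exact abs_add_le _ _
      _ ≤ |F (β y) - F (β x)| * 1 + M * (dist y x / ((k : ℝ) + 1)) := by
          gcongr
          · rw [abs_of_nonneg (hχ0 k y)]; exact hχ1 k y
          · exact hFM _
          · exact hχL k y x
      _ = _ := by rw [mul_one]
  have hfT : ∀ k, TestFun (f k) := by
    intro k
    have hk : (0 : ℝ) < (k : ℝ) + 1 := by positivity
    refine ⟨⟨(M + M / ((k : ℝ) + 1)).toNNReal, LipschitzWith.of_dist_le_mul fun y x => ?_⟩, ?_⟩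
    · rw [Real.dist_eq, Real.coe_toNNReal _ (by positivity)]
      refine (hprod k x y).trans ?_
      have := (h.abs_sub_le hΓM (β y) (β x)).trans
        (mul_le_mul_of_nonneg_left (H.abs_sub_le y x) hM0)
      rw [add_mul, mul_div_assoc', div_mul_eq_mul_div]
      linarith
    · refine HasCompactSupport.intro (isCompact_closedBall p (2 * ((k : ℝ) + 1))) fun x hx => ?_
      rw [mem_closedBall, not_le, ← lt_div_iff₀ hk] at hx
      have : χ k x = 0 := max_eq_left ((min_le_right _ _).trans (by linarith))
      simp [f, this]
  have hlip : ∀ k x, lipConst (f k) x ^ 2 ≤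
      Γ (β x) ^ 2 + S.indicator (fun _ => 3 * M ^ 2 / ((k : ℝ) + 1)) x := by
    intro k x
    have hk : (1 : ℝ) ≤ (k : ℝ) + 1 := by linarith [(Nat.cast_nonneg k : (0 : ℝ) ≤ k)]
    by_cases hx : x ∈ S
    · rw [indicator_of_mem hx]
      have hle : ∀ ε > 0, 0 ≤ lipConst (f k) x ∧
          lipConst (f k) x ≤ (Γ (β x) + M / ((k : ℝ) + 1)) + ε := by
        intro ε hε
        have h0 := h.nonneg (β x)
        refine lipConst_mem (by positivity) ?_
        filter_upwards [(hβ.tendsto x).eventually (h.eventually_le (β x) hε)] with y hy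
        refine (hprod k x y).trans ?_
        have h2 := hy.trans (mul_le_mul_of_nonneg_left (H.abs_sub_le y x) (by positivity))
        rw [add_mul, add_mul, div_mul_eq_mul_div, mul_div_assoc]
        rw [add_mul] at h2
        linarith
      have h1 := (hle 1 one_pos).1
      have h2 : lipConst (f k) x ≤ Γ (β x) + M / ((k : ℝ) + 1) :=
        le_of_forall_pos_le_add fun ε hε => (hle ε hε).2
      have h3 := h.nonneg (β x)
      have h4 := hΓM (β x)
      have h5 : M / ((k : ℝ) + 1) ≤ M := div_le_self hM0 hk
      have h6 : 0 ≤ M / ((k : ℝ) + 1) := by positivity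
      calc lipConst (f k) x ^ 2 ≤ (Γ (β x) + M / ((k : ℝ) + 1)) ^ 2 := by gcongr
        _ = Γ (β x) ^ 2 + (2 * Γ (β x) + M / ((k : ℝ) + 1)) * (M / ((k : ℝ) + 1)) := by ring
        _ ≤ Γ (β x) ^ 2 + (2 * M + M) * (M / ((k : ℝ) + 1)) := by gcongr
        _ = _ := by ring
    · rw [indicator_of_notMem hx]
      have h1 : ∀ᶠ y in 𝓝 x, |f k y - f k x| ≤ 0 * dist y x := by
        filter_upwards [hβ.tendsto x (lt_mem_nhds (not_le.1 hx))] with y hy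
        have hy' : T < β y := hy
        simp [f, hFT _ hy', hFT _ (not_le.1 hx)]
      have h2 := lipConst_mem le_rfl h1
      rw [le_antisymm h2.2 h2.1, zero_pow two_ne_zero, add_zero]
      exact sq_nonneg _
  have hstep : ∀ k : ℕ, lambda0 μ univ * ∫ x, f k x ^ 2 ∂μ ≤
      (∫ x, Γ (β x) ^ 2 ∂μ) + 3 * M ^ 2 / ((k : ℝ) + 1) * μ.real S := by
    intro k
    refine (lambda0_mul_le μ (hfT k)).trans ?_
    refine (integral_mono_of_nonneg (Eventually.of_forall fun x => sq_nonneg _)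
      (hΓI.add (hSI _)) (Eventually.of_forall (hlip k))).trans (le_of_eq ?_)
    simp only [Pi.add_apply]
    rw [integral_add hΓI (hSI _), integral_indicator_const _ hSm, smul_eq_mul, mul_comm (μ.real S)]
  have hχt : ∀ x, Tendsto (fun k => f k x ^ 2) atTop (𝓝 (F (β x) ^ 2)) := by
    intro x
    refine tendsto_const_nhds.congr' ?_
    obtain ⟨N, hN⟩ := exists_nat_ge (dist x p)
    filter_upwards [eventually_ge_atTop N] with k hk
    have hk' : (N : ℝ) ≤ k := by exact_mod_cast hk
    have h1 : dist x p / ((k : ℝ) + 1) ≤ 1 := (div_le_one (by positivity)).2 (by linarith)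
    have : χ k x = 1 := by
      simp only [χ]
      rw [min_eq_left (by linarith), max_eq_right zero_le_one]
    simp [f, this]
  have l1 : Tendsto (fun k => lambda0 μ univ * ∫ x, f k x ^ 2 ∂μ) atTop
      (𝓝 (lambda0 μ univ * ∫ x, F (β x) ^ 2 ∂μ)) := by
    refine (tendsto_integral_of_dominated_convergence (S.indicator fun _ => M ^ 2)
      (fun k => ?_) (hSI _) (fun k => Eventually.of_forall fun x => ?_)
      (Eventually.of_forall hχt)).const_mul _
    · obtain ⟨K, hK⟩ := (hfT k).1
      exact (hK.continuous.pow 2).aestronglyMeasurable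
    · rw [Real.norm_eq_abs, abs_of_nonneg (sq_nonneg _)]
      by_cases hx : x ∈ S
      · rw [indicator_of_mem hx, sq_le_sq, abs_of_nonneg hM0, abs_mul]
        rw [abs_of_nonneg (hχ0 k x)]
        exact (mul_le_of_le_one_right (abs_nonneg _) (hχ1 k x)).trans (hFM _)
      · rw [indicator_of_notMem hx]
        simp [f, hFT _ (not_le.1 hx)]
  have l2 : Tendsto (fun k : ℕ => (∫ x, Γ (β x) ^ 2 ∂μ) + 3 * M ^ 2 / ((k : ℝ) + 1) * μ.real S)
      atTop (𝓝 ((∫ x, Γ (β x) ^ 2 ∂μ) + 0 * μ.real S)) := by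
    refine Tendsto.const_add _ (Tendsto.mul_const _ ?_)
    have := (tendsto_one_div_add_atTop_nhds_zero_nat (𝕜 := ℝ)).const_mul (3 * M ^ 2)
    simpa [div_eq_mul_inv] using this
  have := le_of_tendsto_of_tendsto' l1 l2 hstep
  simpa using this

end Rayleigh

end

section

namespace HasSlope

lemma of_hasDerivAt {f f' : ℝ → ℝ} (h : ∀ t, HasDerivAt f (f' t) t) :
    HasSlope f fun t => |f' t| :=
  fun t => ⟨f' t, f' t, (h t).hasDerivWithinAt, (h t).hasDerivWithinAt, le_rfl, le_rfl⟩

lemma glue {f g Γ₁ Γ₂ Γ : ℝ → ℝ} (hf : HasSlope f Γ₁) (hg : HasSlope g Γ₂) {c : ℝ}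
    (hc : f c = g c) (h₁ : ∀ t ≤ c, Γ₁ t ≤ Γ t) (h₂ : ∀ t, c ≤ t → Γ₂ t ≤ Γ t) :
    HasSlope (fun t => if t ≤ c then f t else g t) Γ := by
  have e1 : ∀ t ≤ c, (if t ≤ c then f t else g t) = f t := fun t ht => if_pos ht
  have e2 : ∀ t, c ≤ t → (if t ≤ c then f t else g t) = g t := fun t ht => by
    rcases ht.eq_or_lt with rfl | ht
    · rw [if_pos le_rfl, hc]
    · exact if_neg ht.not_ge
  intro t
  rcases lt_trichotomy t c with ht | rfl | ht
  · obtain ⟨d₁, d₂, a, b, a', b'⟩ := hf t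
    have e : (fun t => if t ≤ c then f t else g t) =ᶠ[𝓝 t] f :=
      Filter.mem_of_superset (Iic_mem_nhds ht) fun s hs => e1 s hs
    exact ⟨d₁, d₂, a.congr_of_eventuallyEq (e.filter_mono nhdsWithin_le_nhds) (e1 t ht.le),
      b.congr_of_eventuallyEq (e.filter_mono nhdsWithin_le_nhds) (e1 t ht.le),
      a'.trans (h₁ t ht.le), b'.trans (h₁ t ht.le)⟩
  · obtain ⟨d₁, -, a, -, a', -⟩ := hf t
    obtain ⟨-, d₂, -, b, -, b'⟩ := hg t
    exact ⟨d₁, d₂, a.congr (fun s hs => e1 s hs) (e1 t le_rfl),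
      b.congr (fun s hs => e2 s hs) (e2 t le_rfl), a'.trans (h₁ t le_rfl), b'.trans (h₂ t le_rfl)⟩
  · obtain ⟨d₁, d₂, a, b, a', b'⟩ := hg t
    have e : (fun t => if t ≤ c then f t else g t) =ᶠ[𝓝 t] g :=
      Filter.mem_of_superset (Ici_mem_nhds ht) fun s hs => e2 s hs
    exact ⟨d₁, d₂, a.congr_of_eventuallyEq (e.filter_mono nhdsWithin_le_nhds) (e2 t ht.le),
      b.congr_of_eventuallyEq (e.filter_mono nhdsWithin_le_nhds) (e2 t ht.le),
      a'.trans (h₂ t ht.le), b'.trans (h₂ t ht.le)⟩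

lemma zero : HasSlope (fun _ => 0) fun _ => 0 := by
  simpa using of_hasDerivAt (f := fun _ => (0 : ℝ)) (f' := fun _ => 0) fun t => hasDerivAt_const t _

end HasSlope

/-- A measure on the line whose translates to the right dominate has increasing density. -/
lemma mul_volume_le_of_shift {ω : Measure ℝ} [SFinite ω]
    (hω : ∀ κ, 0 ≤ κ → ∀ S : Set ℝ, MeasurableSet S → ω S ≤ ω ((fun t => t - κ) ⁻¹' S))
    {A B : Set ℝ} (hA : MeasurableSet A) (hB : MeasurableSet B)
    (hAB : ∀ s ∈ A, ∀ t ∈ B, s ≤ t) : ω A * volume B ≤ ω B * volume A := by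
  have hB' : MeasurableSet {p : ℝ × ℝ | p.1 + p.2 ∈ B} :=
    (measurable_fst.add measurable_snd) hB
  have hA' : MeasurableSet {p : ℝ × ℝ | p.1 - p.2 ∈ A} :=
    (measurable_fst.sub measurable_snd) hA
  have h1 : ω A * volume B = ∫⁻ κ, ω (A ∩ {t | t + κ ∈ B}) := by
    have h := lintegral_lintegral_swap (μ := ω.restrict A) (ν := (volume : Measure ℝ))
      (f := fun t κ => {p : ℝ × ℝ | p.1 + p.2 ∈ B}.indicator 1 (t, κ))
      ((measurable_one.indicator hB').aemeasurable)
    have e1 : ∀ t : ℝ, ∫⁻ κ, {p : ℝ × ℝ | p.1 + p.2 ∈ B}.indicator (1 : ℝ × ℝ → ℝ≥0∞) (t, κ) =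
        volume B := by
      intro t
      have : (fun κ => {p : ℝ × ℝ | p.1 + p.2 ∈ B}.indicator (1 : ℝ × ℝ → ℝ≥0∞) (t, κ)) =
        ((fun κ => t + κ) ⁻¹' B).indicator 1 := rfl
      rw [this, lintegral_indicator_one ((measurable_const_add t) hB), measure_preimage_add]
    have e2 : ∀ κ : ℝ, ∫⁻ t in A, {p : ℝ × ℝ | p.1 + p.2 ∈ B}.indicator (1 : ℝ × ℝ → ℝ≥0∞) (t, κ)
        ∂ω = ω (A ∩ {t | t + κ ∈ B}) := by
      intro κ
      have : (fun t => {p : ℝ × ℝ | p.1 + p.2 ∈ B}.indicator (1 : ℝ × ℝ → ℝ≥0∞) (t, κ)) =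
        ((fun t => t + κ) ⁻¹' B).indicator 1 := rfl
      rw [this, lintegral_indicator_one ((measurable_add_const κ) hB),
        Measure.restrict_apply ((measurable_add_const κ) hB), inter_comm]; rfl
    simp only [e1, e2] at h
    rw [← h, lintegral_const, Measure.restrict_apply_univ, mul_comm]
  have h2 : ω B * volume A = ∫⁻ κ, ω (B ∩ {t | t - κ ∈ A}) := by
    have h := lintegral_lintegral_swap (μ := ω.restrict B) (ν := (volume : Measure ℝ))
      (f := fun t κ => {p : ℝ × ℝ | p.1 - p.2 ∈ A}.indicator 1 (t, κ))
      ((measurable_one.indicator hA').aemeasurable)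
    have e1 : ∀ t : ℝ, ∫⁻ κ, {p : ℝ × ℝ | p.1 - p.2 ∈ A}.indicator (1 : ℝ × ℝ → ℝ≥0∞) (t, κ) =
        volume A := by
      intro t
      have : (fun κ => {p : ℝ × ℝ | p.1 - p.2 ∈ A}.indicator (1 : ℝ × ℝ → ℝ≥0∞) (t, κ)) =
        ((fun κ => t - κ) ⁻¹' A).indicator 1 := rfl
      rw [this, lintegral_indicator_one ((measurable_const_sub t) hA)]
      exact (Measure.measurePreserving_sub_left volume t).measure_preimage hA.nullMeasurableSet
    have e2 : ∀ κ : ℝ, ∫⁻ t in B, {p : ℝ × ℝ | p.1 - p.2 ∈ A}.indicator (1 : ℝ × ℝ → ℝ≥0∞) (t, κ)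
        ∂ω = ω (B ∩ {t | t - κ ∈ A}) := by
      intro κ
      have : (fun t => {p : ℝ × ℝ | p.1 - p.2 ∈ A}.indicator (1 : ℝ × ℝ → ℝ≥0∞) (t, κ)) =
        ((fun t => t - κ) ⁻¹' A).indicator 1 := rfl
      rw [this, lintegral_indicator_one ((measurable_sub_const κ) hA),
        Measure.restrict_apply ((measurable_sub_const κ) hA), inter_comm]; rfl
    simp only [e1, e2] at h
    rw [← h, lintegral_const, Measure.restrict_apply_univ, mul_comm]
  rw [h1, h2]
  refine lintegral_mono fun κ => ?_
  rcases le_or_gt 0 κ with hκ | hκ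
  · refine (hω κ hκ _ (hA.inter ((measurable_add_const κ) hB))).trans (measure_mono ?_)
    rintro t ⟨h1, h2⟩
    have h2 : t - κ + κ ∈ B := h2
    rw [sub_add_cancel] at h2
    exact ⟨h2, h1⟩
  · have : A ∩ {t | t + κ ∈ B} = ∅ := by
      refine eq_empty_of_forall_notMem fun t ht => ?_
      have : t ≤ t + κ := hAB t ht.1 _ ht.2
      linarith
    rw [this, measure_empty]
    exact zero_le

section Rayleigh

variable {X : Type*} [MetricSpace X] [MeasurableSpace X] [BorelSpace X] [ProperSpace X]
  {μ : Measure X} {β : X → ℝ}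

/-- Comparison form of the Rayleigh bound. -/
lemma Horo.rayleigh_lintegral (H : Horo β) (hfin : ∀ c, μ {x | β x ≤ c} ≠ ⊤)
    {F Γ : ℝ → ℝ} (h : HasSlope F Γ) {M T : ℝ} (hΓm : Measurable Γ) (hΓM : ∀ t, Γ t ≤ M)
    (hFM : ∀ t, |F t| ≤ M) (hFT : ∀ t, T < t → F t = 0) (hΓT : ∀ t, T < t → Γ t = 0)
    {P Q : ℝ → ℝ} (hP : Measurable P) (hQ : Measurable Q) (hP0 : ∀ t, 0 ≤ P t)
    (hQ0 : ∀ t, 0 ≤ Q t) {M' : ℝ} (hQM : ∀ t, Q t ≤ M') (hQT : ∀ t, T < t → Q t = 0)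
    (hPM : ∀ t, P t ≤ M') (hPT : ∀ t, T < t → P t = 0)
    (hPQ : ∀ t, P t + Γ t ^ 2 ≤ Q t + lambda0 μ univ * F t ^ 2) :
    ∫⁻ x, ENNReal.ofReal (P (β x)) ∂μ ≤ ∫⁻ x, ENNReal.ofReal (Q (β x)) ∂μ := by
  have hβ := H.continuous.measurable
  have hint : ∀ {f : ℝ → ℝ} {C : ℝ}, Measurable f → (∀ t, |f t| ≤ C) → (∀ t, T < t → f t = 0) →
      Integrable (fun x => f (β x)) μ := by
    intro f C hf hC hT
    set S := {x | β x ≤ T} with hS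
    have hSm : MeasurableSet S := measurableSet_le hβ measurable_const
    have hI : Integrable (S.indicator fun _ => C) μ :=
      (integrable_indicator_iff hSm).2 (integrableOn_const (hfin T))
    refine hI.mono' (hf.comp hβ).aestronglyMeasurable (Eventually.of_forall fun x => ?_)
    by_cases hx : x ∈ S
    · rw [indicator_of_mem hx]; exact hC _
    · rw [indicator_of_notMem hx, hT _ (not_le.1 hx), norm_zero]
  have hΓ0 := h.nonneg
  have iF : Integrable (fun x => F (β x) ^ 2) μ := by
    refine hint (f := fun t => F t ^ 2) (C := M ^ 2) (h.continuous.measurable.pow_const 2)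
      (fun t => ?_) fun t ht => by simp [hFT t ht]
    rw [abs_pow]; exact pow_le_pow_left₀ (abs_nonneg _) (hFM t) 2
  have iΓ : Integrable (fun x => Γ (β x) ^ 2) μ := by
    refine hint (f := fun t => Γ t ^ 2) (C := M ^ 2) (hΓm.pow_const 2)
      (fun t => ?_) fun t ht => by simp [hΓT t ht]
    rw [abs_pow, abs_of_nonneg (hΓ0 t)]; exact pow_le_pow_left₀ (hΓ0 t) (hΓM t) 2
  have iP : Integrable (fun x => P (β x)) μ :=
    hint hP (fun t => (abs_of_nonneg (hP0 t)).trans_le (hPM t)) hPT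
  have iQ : Integrable (fun x => Q (β x)) μ :=
    hint hQ (fun t => (abs_of_nonneg (hQ0 t)).trans_le (hQM t)) hQT
  have h1 := H.rayleigh hfin h hΓm hΓM hFM hFT hΓT
  have h2 : ∫ x, (P (β x) + Γ (β x) ^ 2) ∂μ ≤
      ∫ x, (Q (β x) + lambda0 μ univ * F (β x) ^ 2) ∂μ :=
    integral_mono (iP.add iΓ) (iQ.add (iF.const_mul _)) fun x => hPQ (β x)
  rw [integral_add iP iΓ, integral_add iQ (iF.const_mul _), integral_const_mul] at h2
  rw [← ofReal_integral_eq_lintegral_ofReal iP (Eventually.of_forall fun x => hP0 _),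
    ← ofReal_integral_eq_lintegral_ofReal iQ (Eventually.of_forall fun x => hQ0 _)]
  exact ENNReal.ofReal_le_ofReal (by linarith)

end Rayleigh

end

section

section Rayleigh

variable {X : Type*} [MetricSpace X] [MeasurableSpace X] [BorelSpace X] [ProperSpace X]
  {μ : Measure X} {β : X → ℝ}

lemma hasDerivAt_exp_mul (b t : ℝ) :
    HasDerivAt (fun t => Real.exp (b * t)) (b * Real.exp (b * t)) t := by
  simpa [mul_comm] using ((hasDerivAt_id t).const_mul b).exp

/-- Extremality of the spectrum forces exponential volume decay in the cusp. -/
lemma Horo.cusp_volume_le (H : Horo β) (hfin : ∀ c, μ {x | β x ≤ c} ≠ ⊤) {a : ℝ} (ha : 1 ≤ a)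
    (hlam : lambda0 μ univ = a ^ 2 / 4) :
    ∃ C : ℝ≥0∞, C ≠ ⊤ ∧ ∀ y, 0 ≤ y → ENNReal.ofReal (Real.exp (a * y)) * μ {x | β x < -y} ≤ C := by
  have hβ := H.continuous.measurable
  refine ⟨ENNReal.ofReal (4 / a ^ 2 * (a / 2 + 1) ^ 2) * μ {x | β x ≤ 1},
    ENNReal.mul_ne_top ENNReal.ofReal_ne_top (hfin 1), fun y hy => ?_⟩
  set E : ℝ → ℝ := fun t => Real.exp (-(a / 2) * t) with hE
  have hEd : ∀ t, HasDerivAt E (-(a / 2) * E t) t := hasDerivAt_exp_mul _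
  have hE0 : ∀ t, 0 < E t := fun t => Real.exp_pos _
  have hE1 : ∀ t, 0 ≤ t → E t ≤ 1 := fun t ht => Real.exp_le_one_iff.2 (by nlinarith)
  have hEy : ∀ t, -y ≤ t → E t ≤ E (-y) := fun t ht => Real.exp_le_exp.2 (by nlinarith)
  have hEy1 : 1 ≤ E (-y) := Real.one_le_exp (by nlinarith)
  let Γ₁ : ℝ → ℝ := fun t => |(-(a / 2) * E t) * (1 - t) + E t * (-1)|
  let Γ₃ : ℝ → ℝ := fun t => if t ≤ 1 then Γ₁ t else 0
  let Γ₂ : ℝ → ℝ := fun t => if t < 0 then a / 2 * E t else if t ≤ 1 then a / 2 + 1 else 0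
  let Γ : ℝ → ℝ := fun t => if t < -y then 0 else Γ₂ t
  have g1 : HasSlope (fun t => E t * (1 - t)) Γ₁ :=
    HasSlope.of_hasDerivAt fun t => (hEd t).mul ((hasDerivAt_id t).const_sub 1)
  have g3 : HasSlope (fun t => if t ≤ 1 then E t * (1 - t) else 0) Γ₃ := by
    refine g1.glue HasSlope.zero (by simp) (fun t ht => ?_) fun t ht => ?_
    · simp only [Γ₃, if_pos ht]; exact le_rfl
    · simp only [Γ₃]; split_ifs <;> simp [Γ₁]
  have hΓ₂ : ∀ t, 0 ≤ Γ₂ t := by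
    intro t; have := hE0 t
    simp only [Γ₂]; split_ifs <;> positivity
  have g2 : HasSlope (fun t => if t ≤ 0 then E t else if t ≤ 1 then E t * (1 - t) else 0) Γ₂ := by
    refine (HasSlope.of_hasDerivAt hEd).glue g3 (by simp) (fun t ht => ?_) fun t ht => ?_
    · have h0 := hE0 t
      rw [abs_mul, abs_neg, abs_of_pos h0, abs_of_pos (by positivity)]
      simp only [Γ₂]
      rcases ht.lt_or_eq with ht | rfl
      · rw [if_pos ht]
      · have := hE1 0 le_rfl
        rw [if_neg (lt_irrefl _), if_pos zero_le_one]; nlinarith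
    · simp only [Γ₂, Γ₃, if_neg ht.not_gt]
      split_ifs with h1
      · have h0 := hE0 t
        have := hE1 t ht
        simp only [Γ₁]
        have h2 : E t * (1 - t) ≤ 1 * 1 := by gcongr; linarith
        have h3 : 0 ≤ E t * (1 - t) := mul_nonneg h0.le (by linarith)
        rw [abs_le]; constructor <;> nlinarith
      · exact le_rfl
  have g0 := (HasSlope.of_hasDerivAt fun t => hasDerivAt_const t (E (-y))).glue g2
    (c := -y) (Γ := Γ) (by simp [hy]) (fun t _ => by
      simp only [abs_zero, Γ]; split_ifs
      exacts [le_rfl, hΓ₂ t]) (fun t ht => by simp only [Γ, if_neg ht.not_gt]; exact le_rfl)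
  have hEm : Measurable E := by fun_prop
  have m2 : Measurable Γ₂ := Measurable.ite measurableSet_Iio (hEm.const_mul _)
    (Measurable.ite measurableSet_Iic measurable_const measurable_const)
  have mΓ : Measurable Γ := Measurable.ite measurableSet_Iio measurable_const m2
  have hsq : ∀ t, E t ^ 2 = Real.exp (-a * t) := fun t => by
    rw [hE, ← Real.exp_nat_mul]; congr 1; push_cast; ring
  have key := H.rayleigh_lintegral hfin g0 (M := (a / 2 + 1) * E (-y)) (T := 1) mΓ
    (fun t => by
      simp only [Γ, Γ₂]; split_ifs with h1 h2 h3
      · positivity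
      · have := hEy t (not_lt.1 h1); nlinarith [hE0 t]
      · nlinarith
      · positivity)
    (fun t => by
      have := hE0 t
      have := hE0 (-y)
      split_ifs with h1 h2 h3
      · rw [abs_of_pos (by assumption)]; nlinarith
      · have := hEy t (not_le.1 h1).le
        rw [abs_of_pos (hE0 t)]; nlinarith
      · have := hEy t (not_le.1 h1).le
        rw [abs_of_nonneg (mul_nonneg (hE0 t).le (by linarith))]
        have h5 : E t * (1 - t) ≤ E (-y) * 1 := by
          gcongr; linarith
        nlinarith
      · rw [abs_zero]; positivity)
    (fun t ht => by
      rw [if_neg (by linarith), if_neg (by linarith), if_neg (by linarith)])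
    (fun t ht => by
      simp only [Γ, Γ₂]
      rw [if_neg (by linarith), if_neg (by linarith), if_neg (by linarith)])
    (P := (Iio (-y)).indicator fun _ => a ^ 2 / 4 * Real.exp (a * y))
    (Q := (Icc 0 1).indicator fun _ => (a / 2 + 1) ^ 2)
    (M' := a ^ 2 / 4 * Real.exp (a * y) + (a / 2 + 1) ^ 2)
    (measurable_const.indicator measurableSet_Iio) (measurable_const.indicator measurableSet_Icc)
    (fun t => indicator_nonneg (fun _ _ => by positivity) t)
    (fun t => indicator_nonneg (fun _ _ => by positivity) t)
    (fun t => indicator_apply_le' (fun _ => le_add_of_nonneg_left (by positivity))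
      fun _ => by positivity)
    (fun t ht => indicator_of_notMem (fun h => ht.not_ge h.2) _)
    (fun t => indicator_apply_le' (fun _ => le_add_of_nonneg_right (by positivity))
      fun _ => by positivity)
    (fun t ht => indicator_of_notMem (fun h => by linarith [show t < -y from h]) _)
    (fun t => by
      rw [hlam]
      simp only [indicator_apply, Γ, Γ₂, mem_Iio, mem_Icc]
      have e0 : E (-y) ^ 2 = Real.exp (a * y) := by rw [hsq]; congr 1; ring
      by_cases h1 : t < -y
      · rw [if_pos h1, if_pos h1, if_pos h1.le, e0]
        split_ifs <;> nlinarith [sq_nonneg (a / 2 + 1)]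
      · rw [if_neg h1, if_neg h1]
        by_cases h2 : t < 0
        · rw [if_pos h2, if_neg (by rintro ⟨h, -⟩; linarith)]
          split_ifs with h3 h4
          · obtain rfl : t = -y := le_antisymm h3 (not_lt.1 h1)
            apply le_of_eq; ring
          · apply le_of_eq; ring
          · linarith
          · linarith
        · rw [if_neg h2]
          by_cases h3 : t ≤ 1
          · rw [if_pos h3, if_pos ⟨not_lt.1 h2, h3⟩]
            nlinarith [sq_nonneg (if t ≤ -y then E (-y) else if t ≤ 0 then E t else
              if t ≤ 1 then E t * (1 - t) else 0), sq_nonneg a, mul_nonneg (sq_nonneg a)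
              (sq_nonneg (if t ≤ -y then E (-y) else if t ≤ 0 then E t else
              if t ≤ 1 then E t * (1 - t) else 0))]
          · rw [if_neg h3, if_neg (fun h => h3 h.2)]
            nlinarith [sq_nonneg (if t ≤ -y then E (-y) else if t ≤ 0 then E t else
              if t ≤ 1 then E t * (1 - t) else 0), sq_nonneg a, mul_nonneg (sq_nonneg a)
              (sq_nonneg (if t ≤ -y then E (-y) else if t ≤ 0 then E t else
              if t ≤ 1 then E t * (1 - t) else 0))])
  have l1 : ∫⁻ x, ENNReal.ofReal ((Iio (-y)).indicator (fun _ => a ^ 2 / 4 * Real.exp (a * y))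
      (β x)) ∂μ = ENNReal.ofReal (a ^ 2 / 4 * Real.exp (a * y)) * μ {x | β x < -y} := by
    rw [← lintegral_indicator_const (measurableSet_lt hβ measurable_const)]
    congr 1 with x
    simp only [indicator_apply, mem_Iio, Set.mem_ofPred_eq]
    split_ifs <;> simp
  have l2 : ∫⁻ x, ENNReal.ofReal ((Icc (0 : ℝ) 1).indicator (fun _ => (a / 2 + 1) ^ 2)
      (β x)) ∂μ ≤ ENNReal.ofReal ((a / 2 + 1) ^ 2) * μ {x | β x ≤ 1} := by
    rw [← lintegral_indicator_const (measurableSet_le hβ measurable_const)]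
    refine lintegral_mono fun x => ?_
    simp only [indicator_apply, mem_Icc, Set.mem_ofPred_eq]
    split_ifs with h1 h2
    · exact le_rfl
    · exact absurd h1.2 h2
    · simp
    · simp
  rw [l1] at key
  calc ENNReal.ofReal (Real.exp (a * y)) * μ {x | β x < -y}
      = ENNReal.ofReal (4 / a ^ 2) * (ENNReal.ofReal (a ^ 2 / 4 * Real.exp (a * y)) *
          μ {x | β x < -y}) := by
        rw [← mul_assoc, ← ENNReal.ofReal_mul (by positivity)]
        congr 2; field_simp
    _ ≤ ENNReal.ofReal (4 / a ^ 2) * (ENNReal.ofReal ((a / 2 + 1) ^ 2) * μ {x | β x ≤ 1}) := by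
        exact mul_le_mul_right (key.trans l2) _
    _ = _ := by rw [← mul_assoc, ← ENNReal.ofReal_mul (by positivity)]

end Rayleigh

end

section

section Rayleigh

variable {X : Type*} [MetricSpace X] [MeasurableSpace X] [BorelSpace X] [ProperSpace X]
  {μ : Measure X} {β : X → ℝ}

/-- The Rayleigh bound for a trapezoidal cutoff of the critical exponential. -/
lemma Horo.trapezoid (H : Horo β) (hfin : ∀ c, μ {x | β x ≤ c} ≠ ⊤) {a : ℝ} (ha : 1 ≤ a)
    (hlam : lambda0 μ univ = a ^ 2 / 4) {R : ℝ} (hR : 1 ≤ R) :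
    ∫⁻ x, ENNReal.ofReal ((Ico (-(2 * R)) (-R)).indicator
      (fun t => Real.exp (-a * t) * (a * (t + 2 * R))) (β x)) ∂μ ≤
    ∫⁻ x, ENNReal.ofReal ((Icc R (2 * R)).indicator
        (fun t => Real.exp (-a * t) * (a * (2 * R - t) + 1)) (β x) +
      (Ico (-(2 * R)) (-R)).indicator (fun t => Real.exp (-a * t)) (β x)) ∂μ := by
  set E : ℝ → ℝ := fun t => Real.exp (-(a / 2) * t) with hE
  have hEd : ∀ t, HasDerivAt E (-(a / 2) * E t) t := hasDerivAt_exp_mul _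
  have hE0 : ∀ t, 0 < E t := fun t => Real.exp_pos _
  have hsq : ∀ t, E t ^ 2 = Real.exp (-a * t) := fun t => by
    rw [hE, ← Real.exp_nat_mul]; congr 1; push_cast; ring
  set B := E (-(2 * R)) with hB
  have hB0 : 0 < B := hE0 _
  have hEB : ∀ t, -(2 * R) ≤ t → E t ≤ B := fun t ht => Real.exp_le_exp.2 (by nlinarith)
  let D₁ : ℝ → ℝ := fun t => |(-(a / 2) * E t) * (t + 2 * R) + E t * 1|
  let D₂ : ℝ → ℝ := fun t => |(-(a / 2) * E t) * R|
  let D₃ : ℝ → ℝ := fun t => |(-(a / 2) * E t) * (2 * R - t) + E t * (-1)|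
  let Γ₃ : ℝ → ℝ := fun t => if t ≤ 2 * R then D₃ t else 0
  let Γ₂ : ℝ → ℝ := fun t => if t < R then D₂ t else Γ₃ t
  let Γ₁ : ℝ → ℝ := fun t => if t < -R then D₁ t else Γ₂ t
  let Γ : ℝ → ℝ := fun t => if t < -(2 * R) then 0 else Γ₁ t
  have g3 : HasSlope (fun t => if t ≤ 2 * R then E t * (2 * R - t) else 0) Γ₃ := by
    refine (HasSlope.of_hasDerivAt fun t => (hEd t).mul ((hasDerivAt_id t).const_sub _)).glue
      HasSlope.zero (by simp) (fun t ht => ?_) fun t ht => ?_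
    · simp only [Γ₃, if_pos ht]; exact le_rfl
    · simp only [Γ₃]; split_ifs <;> simp [D₃]
  have g2 : HasSlope (fun t => if t ≤ R then E t * R else
      if t ≤ 2 * R then E t * (2 * R - t) else 0) Γ₂ := by
    refine (HasSlope.of_hasDerivAt fun t => (hEd t).mul_const R).glue g3 ?_ (fun t ht => ?_)
      fun t ht => ?_
    · rw [if_pos (by linarith)]; ring
    · simp only [Γ₂]
      rcases ht.lt_or_eq with ht | rfl
      · rw [if_pos ht]
      · rw [if_neg (lt_irrefl _)]; simp only [Γ₃, D₃]; rw [if_pos (by linarith)]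
        have h0 := hE0 t
        rw [abs_of_nonpos (by nlinarith [mul_pos h0 (show 0 < a / 2 * t by positivity)]),
          abs_of_nonpos (by nlinarith [mul_pos h0 (show 0 < a / 2 * t by positivity)])]
        nlinarith
    · simp only [Γ₂, if_neg ht.not_gt]; exact le_rfl
  have g1 : HasSlope (fun t => if t ≤ -R then E t * (t + 2 * R) else if t ≤ R then E t * R else
      if t ≤ 2 * R then E t * (2 * R - t) else 0) Γ₁ := by
    refine (HasSlope.of_hasDerivAt fun t => (hEd t).mul ((hasDerivAt_id t).add_const _)).glue g2 ?_
      (fun t ht => ?_) fun t ht => ?_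
    · rw [if_pos (by linarith)]; change E (-R) * (-R + 2 * R) = _; ring
    · simp only [Γ₁]
      rcases ht.lt_or_eq with ht | rfl
      · rw [if_pos ht]; exact le_rfl
      · rw [if_neg (lt_irrefl _)]; simp only [Γ₂, D₂, id]; rw [if_pos (by linarith)]
        have h0 := hE0 (-R)
        have h1 : 1 ≤ a * R := by nlinarith
        rw [abs_of_nonpos (a := -(a / 2) * E (-R) * R)
          (by nlinarith [mul_pos h0 (show 0 < a / 2 * R by positivity)]), abs_le]
        constructor <;> nlinarith
    · simp only [Γ₁, if_neg ht.not_gt]; exact le_rfl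
  have hΓ₁ : ∀ t, 0 ≤ Γ₁ t := g1.nonneg
  have g0 := HasSlope.zero.glue g1 (c := -(2 * R)) (Γ := Γ)
    (by rw [if_pos (by linarith)]; simp) (fun t _ => by
      simp only [Γ]; split_ifs
      exacts [le_rfl, hΓ₁ t]) (fun t ht => by simp only [Γ, if_neg ht.not_gt]; exact le_rfl)
  have hEm : Measurable E := by fun_prop
  have mΓ : Measurable Γ := by
    have m3 : Measurable Γ₃ := Measurable.ite measurableSet_Iic (by fun_prop) measurable_const
    have m2 : Measurable Γ₂ := Measurable.ite measurableSet_Iio (by fun_prop) m3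
    have m1 : Measurable Γ₁ := Measurable.ite measurableSet_Iio (by fun_prop) m2
    exact Measurable.ite measurableSet_Iio measurable_const m1
  have bd : ∀ {u w t : ℝ}, -(2 * R) ≤ t → 0 ≤ u → u ≤ R → |w| ≤ 1 →
      |-(a / 2) * E t * u + E t * w| ≤ (a / 2 * R + 1 + R) * B := by
    intro u w t ht hu0 hu hw
    have h0 := hE0 t
    calc |-(a / 2) * E t * u + E t * w| = |E t| * |-(a / 2) * u + w| := by
          rw [← abs_mul]; congr 1; ring
      _ ≤ B * (a / 2 * R + 1) := by
        rw [abs_of_pos h0]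
        have : |-(a / 2) * u + w| ≤ a / 2 * R + 1 := by
          rw [abs_le] at hw ⊢
          constructor <;> nlinarith
        exact mul_le_mul (hEB t ht) this (abs_nonneg _) hB0.le
      _ ≤ _ := by nlinarith
  have bF : ∀ {u t : ℝ}, -(2 * R) ≤ t → 0 ≤ u → u ≤ R → |E t * u| ≤ (a / 2 * R + 1 + R) * B := by
    intro u t ht hu0 hu
    have h0 := hE0 t
    rw [abs_of_nonneg (by positivity)]
    calc E t * u ≤ B * R := mul_le_mul (hEB t ht) hu hu0 hB0.le
      _ ≤ _ := by nlinarith [mul_pos hB0 (show 0 < a / 2 * R + 1 by positivity)]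
  have bQ : ∀ {u t : ℝ}, -(2 * R) ≤ t → u ≤ a * R + 1 →
      Real.exp (-a * t) * u ≤ B ^ 2 * (a * R + 1) := by
    intro u t ht hu
    rw [← hsq]
    have := hEB t ht
    have h0 := hE0 t
    calc E t ^ 2 * u ≤ E t ^ 2 * (a * R + 1) := by gcongr
      _ ≤ _ := by gcongr
  have hneg : ∀ {t : ℝ}, 2 * R < t → (Ico (-(2 * R)) (-R)).indicator
      (fun t => Real.exp (-a * t)) t = 0 := fun {t} ht =>
    indicator_of_notMem (fun h => by linarith [h.2]) _
  refine H.rayleigh_lintegral hfin g0 (M := (a / 2 * R + 1 + R) * B) (T := 2 * R) mΓ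
    (fun t => ?_) (fun t => ?_) (fun t ht => ?_) (fun t ht => ?_)
    (P := (Ico (-(2 * R)) (-R)).indicator
      (fun t => Real.exp (-a * t) * (a * (t + 2 * R))))
    (Q := fun t => (Icc R (2 * R)).indicator
        (fun t => Real.exp (-a * t) * (a * (2 * R - t) + 1)) t +
      (Ico (-(2 * R)) (-R)).indicator (fun t => Real.exp (-a * t)) t)
    (M' := B ^ 2 * (a * R + 1) + B ^ 2 * (a * R + 1))
    (Measurable.indicator (by fun_prop) measurableSet_Ico)
    ((Measurable.indicator (by fun_prop) measurableSet_Icc).add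
      (Measurable.indicator (by fun_prop) measurableSet_Ico))
    (fun t => indicator_apply_nonneg fun h => ?_)
    (fun t => add_nonneg (indicator_apply_nonneg fun h => ?_)
      (indicator_apply_nonneg fun h => by positivity))
    (fun t => add_le_add (indicator_apply_le' (fun h => bQ ?_ ?_) fun _ => by positivity)
      (indicator_apply_le' (fun h => ?_) fun _ => by positivity)) (fun t ht => ?_)
    (fun t => indicator_apply_le' (fun h => (bQ ?_ ?_).trans
      (le_add_of_nonneg_left (by positivity))) fun _ => by positivity)
    (fun t ht => ?_) fun t => ?_
  · simp only [Γ, Γ₁, Γ₂, Γ₃, D₁, D₂, D₃]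
    split_ifs with h1 h2 h3 h4
    · positivity
    · exact bd (not_lt.1 h1) (by linarith) (by linarith) (by norm_num)
    · simpa using bd (w := 0) (not_lt.1 h1) (by linarith) le_rfl (by norm_num)
    · exact bd (not_lt.1 h1) (by linarith) (by linarith) (by norm_num)
    · positivity
  · split_ifs with h1 h2 h3 h4
    · rw [abs_zero]; positivity
    · exact bF (not_le.1 h1).le (by linarith) (by linarith)
    · exact bF (not_le.1 h1).le (by linarith) le_rfl
    · exact bF (not_le.1 h1).le (by linarith) (by linarith)
    · rw [abs_zero]; positivity
  · rw [if_neg (by linarith), if_neg (by linarith), if_neg (by linarith), if_neg (by linarith)]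
  · simp only [Γ, Γ₁, Γ₂, Γ₃]
    rw [if_neg (by linarith), if_neg (by linarith), if_neg (by linarith), if_neg (by linarith)]
  · have := h.1
    have : 0 ≤ t + 2 * R := by linarith
    positivity
  · have := h.2
    have : 0 ≤ 2 * R - t := by linarith
    positivity
  · linarith [h.1]
  · nlinarith [h.1]
  · have := bQ (u := 1) h.1 (by nlinarith)
    linarith
  · rw [hneg ht, indicator_of_notMem (fun h => by linarith [h.2]), add_zero]
  · exact h.1
  · nlinarith [h.2]
  · exact indicator_of_notMem (fun h => by linarith [h.2]) _
  · rw [hlam]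
    simp only [indicator_apply, Γ, Γ₁, Γ₂, Γ₃, D₁, D₂, D₃, mem_Ico, mem_Icc, sq_abs, ite_pow,
      ← hsq]
    rcases lt_or_ge t (-(2 * R)) with h1 | h1
    · rw [if_neg (by rintro ⟨h, -⟩; linarith), if_pos h1, if_neg (by rintro ⟨h, -⟩; linarith),
        if_neg (by rintro ⟨h, -⟩; linarith), if_pos h1.le]
      simp
    rw [if_neg h1.not_gt]
    rcases lt_or_ge t (-R) with h2 | h2
    · rw [if_pos ⟨h1, h2⟩, if_pos h2, if_neg (by rintro ⟨h, -⟩; linarith), if_pos ⟨h1, h2⟩,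
        if_pos h2.le]
      split_ifs with h3
      · obtain rfl : t = -(2 * R) := le_antisymm h3 h1
        apply le_of_eq; ring
      · apply le_of_eq; ring
    rw [if_neg (by rintro ⟨-, h⟩; linarith), if_neg h2.not_gt,
      if_neg (c := -(2 * R) ≤ t ∧ t < -R) (by rintro ⟨-, h⟩; linarith),
      if_neg (c := t ≤ -(2 * R)) (by linarith)]
    rcases lt_or_ge t R with h3 | h3
    · rw [if_pos h3, if_neg (by rintro ⟨h, -⟩; linarith), if_pos h3.le]
      split_ifs with h4
      · obtain rfl : t = -R := le_antisymm h4 h2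
        apply le_of_eq; ring
      · apply le_of_eq; ring
    rw [if_neg h3.not_gt, if_neg (c := t ≤ -R) (by linarith)]
    rcases le_or_gt t (2 * R) with h4 | h4
    · rw [if_pos h4, if_pos ⟨h3, h4⟩, if_pos h4]
      split_ifs with h5
      · obtain rfl : t = R := le_antisymm h5 h3
        apply le_of_eq; ring
      · apply le_of_eq; ring
    · rw [if_neg h4.not_ge, if_neg (fun h => h4.not_ge h.2), if_neg h4.not_ge, if_neg (by linarith)]
      simp

end Rayleigh

end

section

/-- Distribution of the weighted volume over the heights. -/
noncomputable def heightMeas {X : Type*} [MetricSpace X] [MeasurableSpace X] [BorelSpace X]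
    (n : ℕ) (β : X → ℝ) : Measure ℝ :=
  (horoVol n β).map (hgt β)

section Height

variable {X : Type*} [MetricSpace X] [MeasurableSpace X] [BorelSpace X] [ProperSpace X]
  {n : ℕ} {β : X → ℝ}

omit [ProperSpace X] in
lemma Horo.heightMeas_apply (H : Horo β) {S : Set ℝ} (hS : MeasurableSet S) :
    heightMeas n β S = horoVol n β (hgt β ⁻¹' S) :=
  Measure.map_apply H.continuous_hgt.measurable hS

lemma Horo.heightMeas_shift (H : Horo β) (hc : CoshCmp X) {κ : ℝ} (hκ : 0 ≤ κ) {S : Set ℝ}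
    (hS : MeasurableSet S) :
    heightMeas n β S ≤ heightMeas n β ((fun t => t - κ) ⁻¹' S) := by
  have hS' : MeasurableSet ((fun t => t - κ) ⁻¹' S) := (measurable_sub_const κ) hS
  have hm := H.continuous_hgt.measurable
  rw [H.heightMeas_apply hS, H.heightMeas_apply hS']
  refine H.vol_le_of_desc hc hκ (hm hS) (hm hS') fun x hx => ?_
  obtain ⟨y, h1, h2⟩ := H.exists_desc_add hκ x
  refine ⟨y, ?_, h1, h2⟩
  change hgt β y - κ ∈ S
  rw [h2, add_sub_cancel_right]; exact hx

omit [ProperSpace X] in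
lemma Horo.lintegral_heightMeas (H : Horo β) {g : ℝ → ℝ≥0∞} (hg : Measurable g) :
    ∫⁻ t, g t ∂heightMeas n β =
      ∫⁻ x, ENNReal.ofReal (hgt β x ^ n) * g (hgt β x) ∂(μH[(n : ℝ)] : Measure X) := by
  have hm := H.continuous_hgt.measurable
  rw [heightMeas, lintegral_map hg hm, horoVol]
  exact lintegral_withDensity_eq_lintegral_mul _ (hm.pow_const n).ennreal_ofReal (hg.comp hm)

lemma GoodSpace.sFinite_heightMeas (G : GoodSpace X n) : SFinite (heightMeas n β) := by
  have := G.isFiniteMeasureOnCompacts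
  unfold heightMeas horoVol
  infer_instance

lemma Horo.mul_volume_le (H : Horo β) (G : GoodSpace X n) {A B : Set ℝ} (hA : MeasurableSet A)
    (hB : MeasurableSet B) (hAB : ∀ s ∈ A, ∀ t ∈ B, s ≤ t) :
    heightMeas n β A * volume B ≤ heightMeas n β B * volume A := by
  have := G.sFinite_heightMeas (β := β)
  exact mul_volume_le_of_shift (fun κ hκ S hS => H.heightMeas_shift G.cosh hκ hS) hA hB hAB

variable (hfin : ∀ c, (μH[(n : ℝ)] : Measure X) {x | β x ≤ c} ≠ ⊤)
include hfin

omit [ProperSpace X] in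
lemma Horo.heightMeas_Ioc_ne_top (H : Horo β) {c d : ℝ} (hc : 0 < c) :
    heightMeas n β (Ioc c d) ≠ ⊤ := by
  rw [H.heightMeas_apply measurableSet_Ioc]
  refine ((horoVol_le (H.continuous_hgt.measurable measurableSet_Ioc) fun x hx => hx.2).trans_lt
    (ENNReal.mul_lt_top ENNReal.ofReal_lt_top ((measure_mono fun x hx => ?_).trans_lt
      (hfin (-Real.log c)).lt_top))).ne
  have : Real.log c ≤ Real.log (hgt β x) := Real.log_le_log hc hx.1.le
  rw [log_hgt] at this
  change β x ≤ _
  linarith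

variable (hn : 2 ≤ n)
  (hlam : lambda0 (μH[(n : ℝ)] : Measure X) univ = ((n : ℝ) - 1) ^ 2 / 4)
include hn hlam

/-- The height distribution has bounded density. -/
lemma Horo.heightMeas_le (H : Horo β) (G : GoodSpace X n) :
    ∃ C : ℝ≥0, ∀ Y, ∀ A ⊆ Iic Y, MeasurableSet A → heightMeas n β A ≤ C * volume A := by
  have ha : (1 : ℝ) ≤ (n : ℝ) - 1 := by
    have : (2 : ℝ) ≤ n := by exact_mod_cast hn
    linarith
  obtain ⟨C, hC, hCy⟩ := H.cusp_volume_le hfin ha hlam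
  lift C to ℝ≥0 using hC
  refine ⟨2 ^ n * C, fun Y A hAY hA => ?_⟩
  wlog hY : 1 ≤ Y generalizing Y
  · exact this 1 (hAY.trans (Iic_subset_Iic.2 (le_of_not_ge hY))) le_rfl
  have hY0 : 0 < Y := by linarith
  have h1 := H.mul_volume_le G hA measurableSet_Ioc (B := Ioc Y (2 * Y))
    fun s hs t ht => (show s ≤ Y from hAY hs).trans ht.1.le
  have h2 : heightMeas n β (Ioc Y (2 * Y)) ≤ ENNReal.ofReal Y * (2 ^ n * C) := by
    rw [H.heightMeas_apply measurableSet_Ioc]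
    refine (horoVol_le (H.continuous_hgt.measurable measurableSet_Ioc) fun x hx => hx.2).trans ?_
    have h3 := hCy (Real.log Y) (Real.log_nonneg hY)
    have e1 : Real.exp (((n : ℝ) - 1) * Real.log Y) = Y ^ (n - 1) := by
      rw [mul_comm, Real.exp_mul, Real.exp_log hY0,
        show ((n : ℝ) - 1) = ((n - 1 : ℕ) : ℝ) by rw [Nat.cast_sub (by omega)]; simp,
        Real.rpow_natCast]
    rw [e1] at h3
    have e2 : (2 * Y) ^ n = Y * 2 ^ n * Y ^ (n - 1) := by
      obtain ⟨m, rfl⟩ : ∃ m, n = m + 1 := ⟨n - 1, by omega⟩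
      rw [Nat.add_sub_cancel, mul_pow, pow_succ Y]; ring
    have h4 : (μH[(n : ℝ)] : Measure X) (hgt β ⁻¹' Ioc Y (2 * Y)) ≤
        μH[(n : ℝ)] {x | β x < -Real.log Y} := by
      refine measure_mono fun x hx => ?_
      have : Real.log Y < Real.log (hgt β x) := Real.log_lt_log hY0 hx.1
      rw [log_hgt] at this
      change β x < _
      linarith
    calc _ ≤ ENNReal.ofReal ((2 * Y) ^ n) * μH[(n : ℝ)] {x | β x < -Real.log Y} := by gcongr
      _ = ENNReal.ofReal Y * 2 ^ n *
          (ENNReal.ofReal (Y ^ (n - 1)) * μH[(n : ℝ)] {x | β x < -Real.log Y}) := by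
        rw [e2, ENNReal.ofReal_mul (by positivity), ENNReal.ofReal_mul (by positivity),
          ENNReal.ofReal_pow (by norm_num : (0 : ℝ) ≤ 2), ENNReal.ofReal_ofNat, mul_assoc]
      _ ≤ ENNReal.ofReal Y * 2 ^ n * C := by gcongr
      _ = _ := by rw [mul_assoc]
  have hv : (volume (Ioc Y (2 * Y)) : ℝ≥0∞) = ENNReal.ofReal Y := by
    rw [Real.volume_Ioc]; congr 1; ring
  rw [hv] at h1
  have h5 : ENNReal.ofReal Y * heightMeas n β A ≤ ENNReal.ofReal Y * ((2 ^ n * C) * volume A) := by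
    rw [mul_comm, ← mul_assoc]
    exact h1.trans (mul_le_mul_left h2 _)
  have := (ENNReal.mul_le_mul_iff_right (ENNReal.ofReal_pos.2 hY0).ne' ENNReal.ofReal_ne_top).1 h5
  push_cast
  exact this

end Height

end

section

lemma lintegral_Ioc_of_hasDerivAt {f F : ℝ → ℝ} {u v : ℝ} (huv : u ≤ v)
    (hF : ∀ t ∈ Icc u v, HasDerivAt F (f t) t) (hf : ContinuousOn f (Icc u v))
    (h0 : ∀ t ∈ Icc u v, 0 ≤ f t) :
    ∫⁻ t in Ioc u v, ENNReal.ofReal (f t) = ENNReal.ofReal (F v - F u) := by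
  have hi : IntervalIntegrable f volume u v := by
    rw [← uIcc_of_le huv] at hf; exact hf.intervalIntegrable
  rw [← intervalIntegral.integral_eq_sub_of_hasDerivAt (f := F) (f' := f)
    (by rwa [uIcc_of_le huv]) hi, intervalIntegral.integral_of_le huv,
    ofReal_integral_eq_lintegral_ofReal]
  · exact (intervalIntegrable_iff_integrableOn_Ioc_of_le huv).1 hi
  · exact (ae_restrict_iff' measurableSet_Ioc).2
      (Eventually.of_forall fun t ht => h0 t (Ioc_subset_Icc_self ht))

section LogIntegrals

variable {R : ℝ}

lemma lintegral_high {a b : ℝ} (ha : 0 ≤ a) (hb : 0 ≤ b) (hR : 0 ≤ R) :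
    ∫⁻ t in Ioc (Real.exp R) (Real.exp (2 * R)),
      ENNReal.ofReal ((a * (2 * R - Real.log t) + b) / t) =
      ENNReal.ofReal (a * R ^ 2 / 2 + b * R) := by
  have hpos : ∀ t ∈ Icc (Real.exp R) (Real.exp (2 * R)), 0 < t := fun t ht =>
    (Real.exp_pos _).trans_le ht.1
  rw [lintegral_Ioc_of_hasDerivAt
    (F := fun t => -(a / 2) * (2 * R - Real.log t) ^ 2 + b * Real.log t)
    (Real.exp_le_exp.2 (by linarith)) (fun t ht => ?_) ?_ fun t ht => ?_]
  · congr 1; simp only [Real.log_exp]; ring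
  · intro t ht
    have := (hpos t ht).ne'
    exact ContinuousAt.continuousWithinAt (by fun_prop (disch := assumption))
  · have h0 := (hpos t ht).ne'
    refine HasDerivAt.congr_deriv (((((Real.hasDerivAt_log h0).const_sub (2 * R)).pow 2).const_mul (-(a / 2))).add
      ((Real.hasDerivAt_log h0).const_mul b)) ?_
    push_cast; field_simp
  · have h0 := hpos t ht
    have : Real.log t ≤ 2 * R := (Real.log_le_iff_le_exp h0).2 ht.2
    have : 0 ≤ 2 * R - Real.log t := by linarith
    positivity

lemma lintegral_low {a b : ℝ} (ha : 0 ≤ a) (hb : 0 ≤ b) (hR : 0 ≤ R) :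
    ∫⁻ t in Icc (Real.exp (-(2 * R))) (Real.exp (-R)),
      ENNReal.ofReal ((a * (2 * R + Real.log t) + b) / t) =
      ENNReal.ofReal (a * R ^ 2 / 2 + b * R) := by
  have hpos : ∀ t ∈ Icc (Real.exp (-(2 * R))) (Real.exp (-R)), 0 < t := fun t ht =>
    (Real.exp_pos _).trans_le ht.1
  rw [← Measure.restrict_congr_set Ioc_ae_eq_Icc, lintegral_Ioc_of_hasDerivAt
    (F := fun t => (a / 2) * (2 * R + Real.log t) ^ 2 + b * Real.log t)
    (Real.exp_le_exp.2 (by linarith)) (fun t ht => ?_) ?_ fun t ht => ?_]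
  · congr 1; simp only [Real.log_exp]; ring
  · intro t ht
    have := (hpos t ht).ne'
    exact ContinuousAt.continuousWithinAt (by fun_prop (disch := assumption))
  · have h0 := (hpos t ht).ne'
    refine HasDerivAt.congr_deriv (((((Real.hasDerivAt_log h0).const_add (2 * R)).pow 2).const_mul (a / 2)).add
      ((Real.hasDerivAt_log h0).const_mul b)) ?_
    push_cast; field_simp
  · have h0 := hpos t ht
    have : -(2 * R) ≤ Real.log t := (Real.le_log_iff_exp_le h0).2 ht.1
    have : 0 ≤ 2 * R + Real.log t := by linarith
    positivity

end LogIntegrals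

section Height

variable {X : Type*} [MetricSpace X] [MeasurableSpace X] [BorelSpace X] [ProperSpace X]
  {n : ℕ} {β : X → ℝ} (hfin : ∀ c, (μH[(n : ℝ)] : Measure X) {x | β x ≤ c} ≠ ⊤) (hn : 2 ≤ n)
  (hlam : lambda0 (μH[(n : ℝ)] : Measure X) univ = ((n : ℝ) - 1) ^ 2 / 4)
include hfin hn hlam

lemma Horo.trapezoid_heightMeas (H : Horo β) {R : ℝ} (hR : 1 ≤ R) :
    ∫⁻ t in Ioc (Real.exp R) (Real.exp (2 * R)),
      ENNReal.ofReal ((((n : ℝ) - 1) * (2 * R - Real.log t) + 0) / t) ∂heightMeas n β ≤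
    ∫⁻ t in Icc (Real.exp (-(2 * R))) (Real.exp (-R)),
      ENNReal.ofReal ((((n : ℝ) - 1) * (2 * R + Real.log t) + 1) / t) ∂heightMeas n β +
    ∫⁻ t in Ioc (Real.exp R) (Real.exp (2 * R)),
      ENNReal.ofReal ((0 * (2 * R - Real.log t) + 1) / t) ∂heightMeas n β := by
  have ha : (1 : ℝ) ≤ (n : ℝ) - 1 := by
    have : (2 : ℝ) ≤ n := by exact_mod_cast hn
    linarith
  have hβ := H.continuous.measurable
  have key := H.trapezoid hfin ha hlam hR
  have e1 : ∀ x, Real.exp (-((n : ℝ) - 1) * β x) = hgt β x ^ n / hgt β x := by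
    intro x
    rw [eq_div_iff (hgt_pos β x).ne', hgt, ← Real.exp_add, ← Real.exp_nat_mul]
    congr 1; ring
  have hi : ∀ x, hgt β x ∈ Ioc (Real.exp R) (Real.exp (2 * R)) ↔
      β x ∈ Ico (-(2 * R)) (-R) := by
    intro x
    simp only [mem_Ioc, mem_Ico, hgt, Real.exp_lt_exp, Real.exp_le_exp]
    constructor <;> rintro ⟨h1, h2⟩ <;> constructor <;> linarith
  have lo : ∀ x, hgt β x ∈ Icc (Real.exp (-(2 * R))) (Real.exp (-R)) ↔
      β x ∈ Icc R (2 * R) := by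
    intro x
    simp only [mem_Icc, hgt, Real.exp_le_exp]
    constructor <;> rintro ⟨h1, h2⟩ <;> constructor <;> linarith
  have conv : ∀ (f g : ℝ → ℝ) (S T : Set ℝ), MeasurableSet S → Measurable f →
      (∀ x, hgt β x ∈ S ↔ β x ∈ T) →
      (∀ x, β x ∈ T → hgt β x ^ n * f (hgt β x) = g (β x)) →
      ∫⁻ t in S, ENNReal.ofReal (f t) ∂heightMeas n β =
        ∫⁻ x, ENNReal.ofReal (T.indicator g (β x)) ∂(μH[(n : ℝ)] : Measure X) := by
    intro f g S T hS hf hST hfg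
    rw [← lintegral_indicator hS, H.lintegral_heightMeas (hf.ennreal_ofReal.indicator hS)]
    congr 1 with x
    by_cases hx : β x ∈ T
    · rw [indicator_of_mem ((hST x).2 hx), indicator_of_mem hx, ← hfg x hx,
        ENNReal.ofReal_mul (by have := hgt_pos β x; positivity)]
    · rw [indicator_of_notMem (fun h => hx ((hST x).1 h)), indicator_of_notMem hx]; simp
  rw [conv _ (fun t => Real.exp (-((n : ℝ) - 1) * t) * (((n : ℝ) - 1) * (t + 2 * R)))
      _ _ measurableSet_Ioc (by fun_prop) hi fun x _ => ?_,
    conv _ (fun t => Real.exp (-((n : ℝ) - 1) * t) * (((n : ℝ) - 1) * (2 * R - t) + 1))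
      _ _ measurableSet_Icc (by fun_prop) lo fun x _ => ?_,
    conv _ (fun t => Real.exp (-((n : ℝ) - 1) * t)) _ _ measurableSet_Ioc (by fun_prop) hi
      fun x _ => ?_, ← lintegral_add_left]
  · refine key.trans_eq (lintegral_congr fun x => ENNReal.ofReal_add ?_ ?_)
    · refine indicator_apply_nonneg fun h => ?_
      have : 0 ≤ 2 * R - β x := by linarith [h.2]
      positivity
    · exact indicator_apply_nonneg fun h => by positivity
  · exact ((Measurable.indicator (by fun_prop) measurableSet_Icc).comp hβ).ennreal_ofReal
  · rw [e1, log_hgt]; ring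
  · rw [e1, log_hgt]; ring
  · rw [e1, log_hgt]; ring

/-- The height distribution is uniform. -/
lemma Horo.heightMeas_slope_le (H : Horo β) (G : GoodSpace X n) {c d c' d' : ℝ} (hc : 0 < c)
    (hcd : c < d) (hc' : 0 < c') (hcd' : c' < d') :
    (heightMeas n β (Ioc c' d')).toReal * (d - c) ≤
      (heightMeas n β (Ioc c d)).toReal * (d' - c') := by
  have ha : (1 : ℝ) ≤ (n : ℝ) - 1 := by
    have : (2 : ℝ) ≤ n := by exact_mod_cast hn
    linarith
  obtain ⟨C, hC⟩ := H.heightMeas_le hfin hn hlam G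
  set a := (n : ℝ) - 1 with ha_def
  set s := (heightMeas n β (Ioc c d)).toReal / (d - c) with hs
  set s' := (heightMeas n β (Ioc c' d')).toReal / (d' - c') with hs'
  have h1 : 0 < d - c := sub_pos.2 hcd
  have h1' : 0 < d' - c' := sub_pos.2 hcd'
  have hs0 : 0 ≤ s := by positivity
  have hs0' : 0 ≤ s' := by positivity
  rw [← div_le_div_iff₀ h1' h1, ← hs, ← hs']
  have hlow : ∀ B ⊆ Iic c, MeasurableSet B → heightMeas n β B ≤ ENNReal.ofReal s * volume B := by
    intro B hB hBm
    have := H.mul_volume_le G hBm measurableSet_Ioc (B := Ioc c d)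
      fun u hu t ht => (show u ≤ c from hB hu).trans ht.1.le
    rw [Real.volume_Ioc] at this
    rw [hs, ENNReal.ofReal_div_of_pos h1, ENNReal.ofReal_toReal (H.heightMeas_Ioc_ne_top hfin hc),
      ENNReal.div_eq_inv_mul, mul_assoc, ← ENNReal.div_eq_inv_mul,
      ENNReal.le_div_iff_mul_le (Or.inl (ENNReal.ofReal_pos.2 h1).ne')
        (Or.inl ENNReal.ofReal_ne_top)]
    exact this
  have hhigh : ∀ B ⊆ Ioi d', MeasurableSet B →
      ENNReal.ofReal s' * volume B ≤ heightMeas n β B := by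
    intro B hB hBm
    have := H.mul_volume_le G measurableSet_Ioc hBm (A := Ioc c' d')
      fun u hu t ht => hu.2.trans (show d' < t from hB ht).le
    rw [Real.volume_Ioc] at this
    rw [hs', ENNReal.ofReal_div_of_pos h1',
      ENNReal.ofReal_toReal (H.heightMeas_Ioc_ne_top hfin hc'),
      ENNReal.div_eq_inv_mul, mul_assoc, ← ENNReal.div_eq_inv_mul]
    exact ENNReal.div_le_of_le_mul this
  have key : ∀ R : ℝ, 1 ≤ R → d' ≤ Real.exp R → Real.exp (-R) ≤ c →
      s' ≤ s + 2 * (s + C) / (a * R) := by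
    intro R hR hRd hRc
    have hR0 : 0 < R := by linarith
    have m1 : ENNReal.ofReal s' • (volume.restrict (Ioc (Real.exp R) (Real.exp (2 * R)))) ≤
        (heightMeas n β).restrict (Ioc (Real.exp R) (Real.exp (2 * R))) := by
      refine Measure.le_iff.2 fun B hB => ?_
      rw [Measure.smul_apply, Measure.restrict_apply hB, Measure.restrict_apply hB, smul_eq_mul]
      exact hhigh _ (fun t ht => hRd.trans_lt ht.2.1) (hB.inter measurableSet_Ioc)
    have m2 : (heightMeas n β).restrict (Icc (Real.exp (-(2 * R))) (Real.exp (-R))) ≤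
        ENNReal.ofReal s • (volume.restrict (Icc (Real.exp (-(2 * R))) (Real.exp (-R)))) := by
      refine Measure.le_iff.2 fun B hB => ?_
      rw [Measure.smul_apply, Measure.restrict_apply hB, Measure.restrict_apply hB, smul_eq_mul]
      exact hlow _ (fun t ht => ht.2.2.trans hRc) (hB.inter measurableSet_Icc)
    have m3 : (heightMeas n β).restrict (Ioc (Real.exp R) (Real.exp (2 * R))) ≤
        (C : ℝ≥0∞) • (volume.restrict (Ioc (Real.exp R) (Real.exp (2 * R)))) := by
      refine Measure.le_iff.2 fun B hB => ?_
      rw [Measure.smul_apply, Measure.restrict_apply hB, Measure.restrict_apply hB, smul_eq_mul]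
      exact hC (Real.exp (2 * R)) _ (fun t ht => ht.2.2) (hB.inter measurableSet_Ioc)
    have h := H.trapezoid_heightMeas hfin hn hlam hR
    have h' := ((lintegral_mono' m1 le_rfl).trans h).trans
      (add_le_add (lintegral_mono' m2 le_rfl) (lintegral_mono' m3 le_rfl))
    rw [lintegral_smul_measure, lintegral_smul_measure, lintegral_smul_measure,
      lintegral_high (by linarith) le_rfl hR0.le, lintegral_low (by linarith) zero_le_one hR0.le,
      lintegral_high le_rfl zero_le_one hR0.le, smul_eq_mul, smul_eq_mul, smul_eq_mul,
      ← ENNReal.ofReal_mul hs0', ← ENNReal.ofReal_mul hs0, ← ENNReal.ofReal_coe_nnreal,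
      ← ENNReal.ofReal_mul C.coe_nonneg, ← ENNReal.ofReal_add (by positivity) (by positivity),
      ENNReal.ofReal_le_ofReal_iff (by positivity)] at h'
    rw [← ha_def] at h'
    rw [← sub_le_iff_le_add', le_div_iff₀ (by positivity)]
    nlinarith
  have hlim : Tendsto (fun R : ℝ => s + 2 * (s + C) / (a * R)) atTop (𝓝 (s + 0)) :=
    tendsto_const_nhds.add (tendsto_const_nhds.div_atTop
      (tendsto_id.const_mul_atTop (by linarith)))
  rw [add_zero] at hlim
  refine ge_of_tendsto hlim ?_
  have t1 : ∀ᶠ R : ℝ in atTop, d' ≤ Real.exp R := Real.tendsto_exp_atTop.eventually_ge_atTop d'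
  have t2 : ∀ᶠ R : ℝ in atTop, Real.exp (-R) < c :=
    (Real.tendsto_exp_neg_atTop_nhds_zero).eventually_lt_const hc
  filter_upwards [t1, t2, eventually_ge_atTop 1] with R h1 h2 h3
  exact key R h3 h1 h2.le

end Height

end

section

/-- A horofunction whose weighted volume is uniformly distributed over the heights. -/
structure Cusp {X : Type*} [MetricSpace X] [MeasurableSpace X] [BorelSpace X] [ProperSpace X]
    (n : ℕ) (β : X → ℝ) (K : ℝ) : Prop where
  horo : Horo β
  good : GoodSpace X n
  npos : 0 < n
  pos : 0 < K
  slab : ∀ c d, 0 < c → c ≤ d →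
    horoVol n β {x | c ≤ hgt β x ∧ hgt β x ≤ d} = ENNReal.ofReal (K * (d - c))

/-- Two points on a common vertical line. -/
def Vert {X : Type*} [MetricSpace X] (β : X → ℝ) (x y : X) : Prop := dist x y = |β x - β y|

section Construction

variable {X : Type*} [MetricSpace X] [MeasurableSpace X] [BorelSpace X] [ProperSpace X]
  {n : ℕ} {β : X → ℝ}

lemma Horo.exists_cusp (H : Horo β) (G : GoodSpace X n)
    (hfin : ∀ c, (μH[(n : ℝ)] : Measure X) {x | β x ≤ c} ≠ ⊤) (hn : 2 ≤ n)
    (hlam : lambda0 (μH[(n : ℝ)] : Measure X) univ = ((n : ℝ) - 1) ^ 2 / 4) :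
    ∃ K, Cusp n β K := by
  have hm := H.continuous_hgt.measurable
  obtain ⟨C, hC⟩ := H.heightMeas_le hfin hn hlam G
  obtain ⟨-, -, -, ⟨x₀, -⟩, -, -⟩ := G.nontriv
  set K := (heightMeas n β (Ioc 1 2)).toReal with hK
  have hslope : ∀ c d, 0 < c → c < d → (heightMeas n β (Ioc c d)).toReal = K * (d - c) := by
    intro c d hc hcd
    refine le_antisymm ?_ ?_
    · have := H.heightMeas_slope_le hfin hn hlam G (c := 1) (d := 2) one_pos (by norm_num) hc hcd
      linarith
    · have := H.heightMeas_slope_le hfin hn hlam G (c' := 1) (d' := 2) hc hcd one_pos (by norm_num)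
      linarith
  have hone : ∀ c, heightMeas n β {c} = 0 := fun c => by
    have := hC c {c} (by simp) (measurableSet_singleton c)
    simpa using this
  have hpos : 0 < K := by
    set t := hgt β x₀ with ht
    have ht0 : 0 < t := hgt_pos _ _
    have h1 := hslope (t / 2) (2 * t) (by positivity) (by linarith)
    have h2 : 0 < (heightMeas n β (Ioc (t / 2) (2 * t))).toReal := by
      refine ENNReal.toReal_pos (fun h0 => ?_) (H.heightMeas_Ioc_ne_top hfin (by positivity))
      rw [H.heightMeas_apply measurableSet_Ioc] at h0
      have hU : IsOpen (hgt β ⁻¹' Ioo (t / 2) (2 * t)) := isOpen_Ioo.preimage H.continuous_hgt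
      have h3 := G.pos_of_isOpen hU ⟨x₀, by
        change _ ∧ _; constructor <;> linarith⟩
      have h4 := le_horoVol (n := n) (β := β) hU.measurableSet (c := t / 2) (by positivity)
        fun x hx => hx.1.le
      have h5 := (h4.trans (measure_mono (preimage_mono Ioo_subset_Ioc_self))).trans_eq h0
      have h6 : ENNReal.ofReal ((t / 2) ^ n) ≠ 0 := (ENNReal.ofReal_pos.2 (by positivity)).ne'
      exact (ENNReal.mul_pos h6 h3.ne').ne' (le_antisymm h5 zero_le)
    rw [h1] at h2
    exact pos_of_mul_pos_left h2 (by linarith)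
  refine ⟨K, H, G, by omega, hpos, fun c d hc hcd => ?_⟩
  change horoVol n β (hgt β ⁻¹' Icc c d) = _
  have e : heightMeas n β (Icc c d) = heightMeas n β (Ioc c d) := by
    refine le_antisymm ?_ (measure_mono Ioc_subset_Icc_self)
    rw [← Ioc_union_left hcd]
    exact (measure_union_le _ _).trans (by rw [hone, add_zero])
  rw [← H.heightMeas_apply measurableSet_Icc, e]
  rcases hcd.eq_or_lt with rfl | hcd
  · simp
  · rw [← hslope c d hc hcd, ENNReal.ofReal_toReal (H.heightMeas_Ioc_ne_top hfin hc)]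

end Construction

namespace Cusp

variable {X : Type*} [MetricSpace X] [MeasurableSpace X] [BorelSpace X] [ProperSpace X]
  {n : ℕ} {β : X → ℝ} {K : ℝ} (U : Cusp n β K)
include U

lemma horoVol_pos {V : Set X} (hV : IsOpen V) (hne : V.Nonempty) : 0 < horoVol n β V := by
  obtain ⟨x, hx⟩ := hne
  have hx0 := hgt_pos β x
  set V' := V ∩ hgt β ⁻¹' Ioi (hgt β x / 2) with hV'
  have hVo : IsOpen V' := hV.inter (isOpen_Ioi.preimage U.horo.continuous_hgt)
  have h1 := U.good.pos_of_isOpen hVo ⟨x, hx, half_lt_self hx0⟩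
  have h2 := le_horoVol (n := n) (β := β) hVo.measurableSet (c := hgt β x / 2) (by positivity)
    fun y hy => (show _ < _ from hy.2).le
  have h3 : ENNReal.ofReal ((hgt β x / 2) ^ n) ≠ 0 := (ENNReal.ofReal_pos.2 (by positivity)).ne'
  exact (ENNReal.mul_pos h3 h1.ne').trans_le (h2.trans (measure_mono inter_subset_left))

/-- Every vertical segment extends upwards to the horoball complement. -/
lemma exists_desc_sub {κ : ℝ} (hκ : 0 ≤ κ) {z : X} (hz : κ < hgt β z) :
    ∃ x, Desc β x z ∧ hgt β x = hgt β z - κ := by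
  have hh := U.horo.continuous_hgt
  have hm := hh.measurable
  set c := (hgt β z - κ) / 2 with hc
  set d := hgt β z with hd
  have hc0 : 0 < c := by rw [hc]; linarith
  have hcd : c < d := by rw [hc]; linarith
  set C : Set X := {w | ∃ x, Desc β x w ∧ hgt β w = hgt β x + κ ∧ c ≤ hgt β x ∧ hgt β x ≤ d}
    with hC
  by_contra hno
  have hzC : z ∉ C := by
    rintro ⟨x, h1, h2, -⟩
    exact hno ⟨x, h1, by linarith⟩
  have hCcl : IsClosed C := by
    refine isSeqClosed_iff_isClosed.1 fun w w' hw hlim => ?_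
    choose x hx1 hx2 hx3 hx4 using hw
    have hbd : Bornology.IsBounded (range x) := by
      obtain ⟨r, hr⟩ := (isBounded_range_of_tendsto w hlim).subset_closedBall w'
      refine isBounded_closedBall (x := w') (r := -Real.log c + Real.log (d + κ) + r) |>.subset ?_
      rintro _ ⟨i, rfl⟩
      have h1 := dist_triangle (x i) (w i) w'
      have h2 : dist (w i) w' ≤ r := hr ⟨i, rfl⟩
      have h3 : dist (x i) (w i) = β (x i) - β (w i) := hx1 i
      have h4 := Real.log_le_log hc0 (hx3 i)
      have h5 := Real.log_le_log (hgt_pos β (w i)) (by linarith [hx2 i, hx4 i] : _ ≤ d + κ)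
      rw [log_hgt] at h4 h5
      rw [mem_closedBall]
      linarith
    obtain ⟨x', -, φ, hφ, hx'⟩ := tendsto_subseq_of_bounded hbd fun i => mem_range_self i
    have hw' := hlim.comp hφ.tendsto_atTop
    have hβ := U.horo.continuous
    have l1 := (hh.tendsto x').comp hx'
    have l2 := (hh.tendsto w').comp hw'
    refine ⟨x', ?_, ?_, ?_, ?_⟩
    · exact tendsto_nhds_unique_of_eventuallyEq (hx'.dist hw')
        (((hβ.tendsto x').comp hx').sub ((hβ.tendsto w').comp hw'))
        (Eventually.of_forall fun i => hx1 (φ i))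
    · exact tendsto_nhds_unique_of_eventuallyEq l2 (l1.add_const κ)
        (Eventually.of_forall fun i => hx2 (φ i))
    · exact ge_of_tendsto' l1 fun i => hx3 (φ i)
    · exact le_of_tendsto' l1 fun i => hx4 (φ i)
  have h1 : horoVol n β {x | c ≤ hgt β x ∧ hgt β x ≤ d} ≤ horoVol n β C := by
    refine U.horo.vol_le_of_desc U.good.cosh hκ
      (hm measurableSet_Icc : MeasurableSet (hgt β ⁻¹' Icc c d)) hCcl.measurableSet fun x hx => ?_
    obtain ⟨y, hy1, hy2⟩ := U.horo.exists_desc_add hκ x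
    exact ⟨y, ⟨x, hy1, hy2, hx.1, hx.2⟩, hy1, hy2⟩
  set V := hgt β ⁻¹' Ioo (c + κ) (d + κ) \ C with hV
  have hVo : IsOpen V := (isOpen_Ioo.preimage hh).sdiff hCcl
  have hκ0 : 0 < κ := by
    refine hκ.lt_of_ne fun h0 => hno ⟨z, Desc.refl z, by rw [← h0, sub_zero]⟩
  have hVpos := U.horoVol_pos hVo ⟨z, ⟨by rw [hc]; linarith, by linarith⟩, hzC⟩
  have hsub : V ∪ C ⊆ {x | c + κ ≤ hgt β x ∧ hgt β x ≤ d + κ} := by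
    rintro w (hw | ⟨x, -, h2, h3, h4⟩)
    · exact ⟨hw.1.1.le, hw.1.2.le⟩
    · exact ⟨by linarith, by linarith⟩
  have h2 := measure_mono (μ := horoVol n β) hsub
  rw [measure_union disjoint_sdiff_left hCcl.measurableSet,
    U.slab _ _ (by positivity) (by linarith)] at h2
  rw [U.slab _ _ hc0 hcd.le] at h1
  have h3 : horoVol n β V + ENNReal.ofReal (K * (d - c)) ≤ 0 + ENNReal.ofReal (K * (d - c)) := by
    rw [zero_add]
    refine (add_le_add_right h1 _).trans (h2.trans_eq ?_)
    congr 2; ring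
  exact hVpos.not_ge ((ENNReal.add_le_add_iff_right ENNReal.ofReal_ne_top).1 h3)

end Cusp

end

section

open Classical in
/-- The point of height `t` on the vertical line through `x`. -/
noncomputable def lev {X : Type*} [MetricSpace X] (β : X → ℝ) (x : X) (t : ℝ) : X :=
  if h : ∃ y, Vert β x y ∧ hgt β y = t then h.choose else x

section Vertical

variable {X : Type*} [MetricSpace X] {β : X → ℝ} {x y z : X}

lemma Desc.vert (h : Desc β x y) : Vert β x y := by
  rw [Vert, abs_of_nonneg (sub_nonneg.2 h.le)]; exact h

lemma Vert.symm (h : Vert β x y) : Vert β y x := by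
  rw [Vert, dist_comm, abs_sub_comm]; exact h

lemma Vert.desc (h : Vert β x y) (hle : hgt β x ≤ hgt β y) : Desc β x y := by
  have : β y ≤ β x := by
    have := Real.exp_le_exp.1 hle; linarith
  rw [Vert, abs_of_nonneg (sub_nonneg.2 this)] at h; exact h

lemma Vert.eq (h : Vert β x y) (he : hgt β x = hgt β y) : x = y := by
  rw [Vert, hgt_eq_iff.1 he, sub_self, abs_zero] at h
  exact dist_eq_zero.1 h

lemma Vert.refl (x : X) : Vert β x x := (Desc.refl x).vert

lemma Horo.eq_of_desc (H : Horo β) (hc : CoshCmp X) {x x' z : X} (h : Desc β x z)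
    (h' : Desc β x' z) (he : β x = β x') : x = x' := by
  refine eq_of_defect_le_zero he ?_
  have h1 := H.defect_mono hc h' x
  have h2 := H.defect_mono hc h z
  rw [defect_comm] at h2
  have h3 : defect β z z = 0 := by simp [defect]
  linarith

end Vertical

namespace Cusp

variable {X : Type*} [MetricSpace X] [MeasurableSpace X] [BorelSpace X] [ProperSpace X]
  {n : ℕ} {β : X → ℝ} {K : ℝ} {x y z : X} (U : Cusp n β K)
include U

lemma eq_of_desc' (h : Desc β x y) (h' : Desc β x z) (he : β y = β z) : y = z := by
  obtain ⟨w, hw, hwx⟩ := U.exists_desc_sub (κ := hgt β x / 2) (by have := hgt_pos β x; positivity)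
    (half_lt_self (hgt_pos β x))
  have hne : w ≠ x := by
    rintro rfl; have := hgt_pos β w; linarith
  have aux : ∀ {v}, Desc β x v → dist w x + dist x v = dist w v := fun {v} hv => by
    have := U.horo.desc_trans hw hv
    unfold Desc at *; linarith
  exact U.good.cosh.eq_of_branch hne (by unfold Desc at *; linarith) (aux h) (aux h')

lemma vert_of_desc_desc (h : Desc β x y) (h' : Desc β x z) : Vert β y z := by
  wlog hle : β z ≤ β y generalizing y z
  · exact (this h' h (le_of_not_ge hle)).symm
  obtain ⟨v, hv1, hv2⟩ := U.horo.desc y (β y - β z) (by linarith)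
  have hyv : Desc β y v := by rw [Desc, hv1, hv2]
  have : v = z := U.eq_of_desc' (U.horo.desc_trans h hyv) h' (by linarith)
  exact this ▸ hyv.vert

lemma vert_of_desc_desc' (h : Desc β x z) (h' : Desc β y z) : Vert β x y := by
  wlog hle : β y ≤ β x generalizing x y
  · exact (this h' h (le_of_not_ge hle)).symm
  obtain ⟨v, hv1, hv2⟩ := U.horo.desc x (β x - β y) (by linarith)
  have hxv : Desc β x v := by rw [Desc, hv1, hv2]
  obtain ⟨w, hw1, hw2⟩ := U.horo.desc v (β v - β z) (by have := h'.le; linarith)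
  have hvw : Desc β v w := by rw [Desc, hw1, hw2]
  have h1 : w = z := U.eq_of_desc' (U.horo.desc_trans hxv hvw) h (by linarith)
  have h2 : v = y := U.horo.eq_of_desc U.good.cosh (h1 ▸ hvw) h' (by linarith)
  exact h2 ▸ hxv.vert

lemma vert_trans (h : Vert β x y) (h' : Vert β y z) : Vert β x z := by
  rcases le_total (hgt β x) (hgt β y) with h1 | h1 <;>
    rcases le_total (hgt β y) (hgt β z) with h2 | h2
  · exact (U.horo.desc_trans (h.desc h1) (h'.desc h2)).vert
  · exact U.vert_of_desc_desc' (h.desc h1) (h'.symm.desc h2)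
  · exact U.vert_of_desc_desc (h.symm.desc h1) (h'.desc h2)
  · exact (U.horo.desc_trans (h'.symm.desc h2) (h.symm.desc h1)).vert.symm

lemma exists_vert (x : X) {t : ℝ} (ht : 0 < t) : ∃ y, Vert β x y ∧ hgt β y = t := by
  rcases le_total (hgt β x) t with h | h
  · obtain ⟨y, h1, h2⟩ := U.horo.exists_desc_add (sub_nonneg.2 h) x
    exact ⟨y, h1.vert, by rw [h2]; ring⟩
  · obtain ⟨y, h1, h2⟩ := U.exists_desc_sub (sub_nonneg.2 h) (z := x) (by linarith)
    exact ⟨y, h1.vert.symm, by rw [h2]; ring⟩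

lemma vert_lev (x : X) {t : ℝ} (ht : 0 < t) : Vert β x (lev β x t) := by
  have h := U.exists_vert x ht
  rw [lev, dif_pos h]; exact h.choose_spec.1

lemma hgt_lev (x : X) {t : ℝ} (ht : 0 < t) : hgt β (lev β x t) = t := by
  have h := U.exists_vert x ht
  rw [lev, dif_pos h]; exact h.choose_spec.2

lemma lev_eq (h : Vert β x y) : lev β x (hgt β y) = y :=
  (U.vert_trans (U.vert_lev x (hgt_pos β y)).symm h).eq (U.hgt_lev x (hgt_pos β y))

lemma lev_self (x : X) : lev β x (hgt β x) = x := U.lev_eq (Vert.refl x)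

lemma lev_congr (h : Vert β x y) {t : ℝ} (ht : 0 < t) : lev β x t = lev β y t := by
  have := U.lev_eq (U.vert_trans h (U.vert_lev y ht))
  rwa [U.hgt_lev y ht] at this

lemma lev_lev (x : X) {s t : ℝ} (hs : 0 < s) (ht : 0 < t) : lev β (lev β x s) t = lev β x t :=
  U.lev_congr (U.vert_lev x hs).symm ht

lemma desc_lev (x : X) {s t : ℝ} (hs : 0 < s) (hst : s ≤ t) :
    Desc β (lev β x s) (lev β x t) := by
  have ht := hs.trans_le hst
  refine Vert.desc ?_ (by rwa [U.hgt_lev x hs, U.hgt_lev x ht])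
  rw [← U.lev_lev x hs ht]
  exact U.vert_lev _ ht

lemma defect_lev_mono (x y : X) {s s' t t' : ℝ} (hs : 0 < s) (hs' : s ≤ s') (ht : 0 < t)
    (ht' : t ≤ t') : defect β (lev β x s) (lev β y t) ≤ defect β (lev β x s') (lev β y t') :=
  U.horo.defect_mono₂ U.good.cosh (U.desc_lev x hs hs') (U.desc_lev y ht ht')

lemma tendsto_lev (x : X) {t : ℝ} (ht : 0 < t) :
    Tendsto (fun p : X × ℝ => lev β p.1 p.2) (𝓝 (x, t)) (𝓝 (lev β x t)) := by
  have hβ := U.horo.continuous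
  refine tendsto_of_subseq_tendsto fun ns hns => ?_
  have h1 : Tendsto (fun i => (ns i).1) atTop (𝓝 x) := (continuous_fst.tendsto _).comp hns
  have h2 : Tendsto (fun i => (ns i).2) atTop (𝓝 t) := (continuous_snd.tendsto _).comp hns
  have hpos : ∀ᶠ i in atTop, 0 < (ns i).2 := h2.eventually (lt_mem_nhds ht)
  have hbβ : Tendsto (fun i => |β (ns i).1 + Real.log (ns i).2| + dist (ns i).1 x) atTop
      (𝓝 (|β x + Real.log t| + dist x x)) :=
    ((((hβ.tendsto x).comp h1).add ((Real.continuousAt_log ht.ne').tendsto.comp h2)).abs).add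
      (h1.dist tendsto_const_nhds)
  have hlt := hbβ.eventually (gt_mem_nhds (lt_add_one _))
  have hev : ∀ᶠ i in atTop, lev β (ns i).1 (ns i).2 ∈
      closedBall x (|β x + Real.log t| + dist x x + 1) := by
    filter_upwards [hpos, hlt] with i hi hi2
    rw [mem_closedBall]
    have h3 := U.vert_lev (ns i).1 hi
    have h4 : β (lev β (ns i).1 (ns i).2) = -Real.log (ns i).2 := by
      have e := log_hgt β (lev β (ns i).1 (ns i).2)
      rw [U.hgt_lev _ hi] at e; linarith
    rw [Vert, h4, sub_neg_eq_add] at h3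
    have h5 := dist_triangle_left (lev β (ns i).1 (ns i).2) x (ns i).1
    linarith
  obtain ⟨w, -, φ, hφ, hw⟩ := (isCompact_closedBall x _).tendsto_subseq' hev.frequently
  refine ⟨φ, ?_⟩
  have k1 := h1.comp hφ.tendsto_atTop
  have k2 := h2.comp hφ.tendsto_atTop
  have kp := hφ.tendsto_atTop.eventually hpos
  have hv : Vert β x w := by
    refine tendsto_nhds_unique_of_eventuallyEq (k1.dist hw)
      ((((hβ.tendsto x).comp k1).sub ((hβ.tendsto w).comp hw)).abs) ?_
    filter_upwards [kp] with i hi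
    exact U.vert_lev _ hi
  have hh : hgt β w = t := by
    refine tendsto_nhds_unique_of_eventuallyEq ((U.horo.continuous_hgt.tendsto w).comp hw) k2 ?_
    filter_upwards [kp] with i hi
    exact U.hgt_lev _ hi
  have := U.lev_eq hv
  rw [hh] at this
  rw [this]; exact hw

end Cusp

end

section

/-- Vertical translation of heights by `κ`. -/
noncomputable def shift {X : Type*} [MetricSpace X] (β : X → ℝ) (κ : ℝ) (x : X) : X :=
  lev β x (hgt β x + κ)

/-- Euclidean distance in the upper half space model. -/
noncomputable def gap {X : Type*} [MetricSpace X] (β : X → ℝ) (x y : X) : ℝ :=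
  Real.sqrt (defect β x y + (hgt β x - hgt β y) ^ 2)

section Gap

variable {X : Type*} [MetricSpace X] {β : X → ℝ}

lemma gap_nonneg (x y : X) : 0 ≤ gap β x y := Real.sqrt_nonneg _

lemma gap_sq (x y : X) :
    gap β x y ^ 2 = hgt β x * hgt β y * (2 * Real.sinh (dist x y / 2)) ^ 2 := by
  rw [gap, ← hgt_mul_sinh_sq, Real.sq_sqrt]
  have := hgt_pos β x; have := hgt_pos β y; positivity

variable (H : Horo β)
include H

lemma Horo.continuous_gap : Continuous fun p : X × X => gap β p.1 p.2 := by
  have h1 := H.continuous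
  have h2 := H.continuous_hgt
  have h3 := Real.continuous_cosh
  unfold gap defect
  fun_prop

lemma Horo.hgt_le (x y : X) : hgt β y ≤ Real.exp (dist x y) * hgt β x := by
  rw [hgt, hgt, ← Real.exp_add]
  exact Real.exp_le_exp.2 (by linarith [H.sub_le x y])

lemma Horo.abs_hgt_sub_le (x y : X) : |hgt β x - hgt β y| ≤ gap β x y :=
  Real.abs_le_sqrt (by linarith [H.defect_nonneg x y])

lemma Horo.gap_le (x y : X) : gap β x y ≤ Real.exp (dist x y) * (hgt β x * dist x y) := by
  have hx := hgt_pos β x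
  have hd := dist_nonneg (x := x) (y := y)
  refine abs_le_of_sq_le_sq' ?_ (by positivity) |>.2
  rw [gap_sq]
  have h1 := H.hgt_le x y
  have h2 : 2 * Real.sinh (dist x y / 2) ≤ dist x y * Real.exp (dist x y / 2) := by
    have h3 := sinh_le_mul_cosh (t := dist x y / 2) (by positivity)
    have h4 : Real.cosh (dist x y / 2) ≤ Real.exp (dist x y / 2) := by
      have := Real.cosh_add_sinh (dist x y / 2)
      have := Real.sinh_nonneg_iff.2 (by positivity : 0 ≤ dist x y / 2)
      linarith
    nlinarith
  have h0 : 0 ≤ 2 * Real.sinh (dist x y / 2) :=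
    mul_nonneg two_pos.le (Real.sinh_nonneg_iff.2 (by positivity))
  have e : Real.exp (dist x y) = Real.exp (dist x y / 2) ^ 2 := by
    rw [← Real.exp_nat_mul]; congr 1; push_cast; ring
  calc hgt β x * hgt β y * (2 * Real.sinh (dist x y / 2)) ^ 2
      ≤ hgt β x * (Real.exp (dist x y) * hgt β x) * (dist x y * Real.exp (dist x y / 2)) ^ 2 := by
        gcongr
    _ = (Real.exp (dist x y) * (hgt β x * dist x y)) ^ 2 := by rw [e]; ring

lemma Horo.le_gap (x y : X) : hgt β x * dist x y ≤ Real.exp (dist x y / 2) * gap β x y := by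
  have hx := hgt_pos β x
  have hd := dist_nonneg (x := x) (y := y)
  refine abs_le_of_sq_le_sq' ?_ (mul_nonneg (Real.exp_pos _).le (gap_nonneg _ _)) |>.2
  rw [mul_pow (Real.exp _), gap_sq]
  have hy := hgt_pos β y
  have h1 := H.hgt_le y x
  rw [dist_comm] at h1
  have h2 : dist x y ≤ 2 * Real.sinh (dist x y / 2) := by
    have := Real.self_le_sinh_iff.2 (by positivity : 0 ≤ dist x y / 2); linarith
  have e : Real.exp (dist x y) = Real.exp (dist x y / 2) ^ 2 := by
    rw [← Real.exp_nat_mul]; congr 1; push_cast; ring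
  calc (hgt β x * dist x y) ^ 2 = hgt β x * hgt β x * dist x y ^ 2 := by ring
    _ ≤ hgt β x * (Real.exp (dist x y) * hgt β y) * (2 * Real.sinh (dist x y / 2)) ^ 2 := by
        gcongr
    _ = _ := by rw [e]; ring

lemma Horo.dist_le_of_gap {x y : X} {q : ℝ} (h : gap β x y ≤ q) (hq : q ≤ hgt β x / 2) :
    hgt β x * dist x y ≤ Real.exp (q / hgt β x) * q := by
  have hx := hgt_pos β x
  have hd := dist_nonneg (x := x) (y := y)
  have hy := hgt_pos β y
  have hg := gap_nonneg (β := β) x y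
  have hq0 := hg.trans h
  have h1 : hgt β x / 2 ≤ hgt β y := by
    have := (le_abs_self _).trans ((H.abs_hgt_sub_le x y).trans h); linarith
  have h2 : dist x y ≤ 2 * Real.sinh (dist x y / 2) := by
    have := Real.self_le_sinh_iff.2 (by positivity : 0 ≤ dist x y / 2); linarith
  have h3 : dist x y ≤ 2 * (q / hgt β x) := by
    refine abs_le_of_sq_le_sq' ?_ (by positivity) |>.2
    have e : (2 * (q / hgt β x)) ^ 2 = 4 * q ^ 2 / hgt β x ^ 2 := by field_simp; ring
    rw [e, le_div_iff₀ (by positivity)]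
    have : hgt β x * (hgt β x / 2) * dist x y ^ 2 ≤ q ^ 2 := calc
      _ ≤ hgt β x * hgt β y * (2 * Real.sinh (dist x y / 2)) ^ 2 := by gcongr
      _ = gap β x y ^ 2 := (gap_sq x y).symm
      _ ≤ q ^ 2 := by gcongr
    nlinarith [sq_nonneg q]
  calc _ ≤ Real.exp (dist x y / 2) * gap β x y := H.le_gap x y
    _ ≤ Real.exp (q / hgt β x) * q := by
      have h4 : dist x y / 2 ≤ q / hgt β x := by linarith
      gcongr

end Gap

namespace Cusp

variable {X : Type*} [MetricSpace X] [MeasurableSpace X] [BorelSpace X] [ProperSpace X]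
  {n : ℕ} {β : X → ℝ} {K κ : ℝ} (U : Cusp n β K)
include U

lemma hgt_shift {x : X} (h : 0 < hgt β x + κ) : hgt β (shift β κ x) = hgt β x + κ :=
  U.hgt_lev x h

lemma hgt_shift' (hκ : 0 ≤ κ) (x : X) : hgt β (shift β κ x) = hgt β x + κ :=
  U.hgt_shift (by have := hgt_pos β x; linarith)

lemma desc_shift (hκ : 0 ≤ κ) (x : X) : Desc β x (shift β κ x) := by
  have := U.desc_lev x (hgt_pos β x) (by linarith : hgt β x ≤ hgt β x + κ)
  rwa [U.lev_self] at this

lemma continuous_shift (hκ : 0 ≤ κ) : Continuous (shift β κ : X → X) :=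
  continuous_iff_continuousAt.2 fun x =>
    (U.tendsto_lev x (t := hgt β x + κ) (by have := hgt_pos β x; linarith)).comp
      (tendsto_id.prodMk_nhds ((U.horo.continuous_hgt.tendsto x).add_const κ))

lemma gap_le_gap_shift (hκ : 0 ≤ κ) (x y : X) :
    gap β x y ≤ gap β (shift β κ x) (shift β κ y) := by
  rw [gap, gap, U.hgt_shift' hκ, U.hgt_shift' hκ, add_sub_add_right_eq_sub]
  have := U.horo.defect_mono₂ U.good.cosh (U.desc_shift hκ x) (U.desc_shift hκ y)
  exact Real.sqrt_le_sqrt (by linarith)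

lemma horoVol_preimage_shift_le (hκ : 0 ≤ κ) {B : Set X} (hB : MeasurableSet B) :
    horoVol n β (shift β κ ⁻¹' B) ≤ horoVol n β B :=
  U.horo.vol_le_of_desc U.good.cosh hκ ((U.continuous_shift hκ).measurable hB) hB fun x hx =>
    ⟨_, hx, U.desc_shift hκ x, U.hgt_shift' hκ x⟩

lemma horoVol_preimage_shift (hκ : 0 ≤ κ) {B : Set X} (hB : MeasurableSet B) {c d : ℝ}
    (hc : 0 < c) (hBs : ∀ x ∈ B, c + κ ≤ hgt β x ∧ hgt β x ≤ d + κ) :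
    horoVol n β (shift β κ ⁻¹' B) = horoVol n β B := by
  rcases B.eq_empty_or_nonempty with rfl | ⟨b, hb⟩
  · simp
  have hcd : c ≤ d := by have := hBs b hb; linarith
  have hm := U.horo.continuous_hgt.measurable
  have hA := (U.continuous_shift hκ).measurable hB
  set A₀ : Set X := {x | c ≤ hgt β x ∧ hgt β x ≤ d} with hA₀
  set B₀ : Set X := {x | c + κ ≤ hgt β x ∧ hgt β x ≤ d + κ} with hB₀
  have mB₀ : MeasurableSet B₀ := hm measurableSet_Icc
  have hTB₀ : shift β κ ⁻¹' B₀ = A₀ := by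
    ext x
    simp only [hA₀, hB₀, mem_preimage, Set.mem_ofPred_eq, U.hgt_shift' hκ, add_le_add_iff_right]
  have hsubB : B ⊆ B₀ := hBs
  have h1 := U.horoVol_preimage_shift_le hκ hB
  have h2 := U.horoVol_preimage_shift_le hκ (mB₀.diff hB)
  rw [preimage_sdiff, hTB₀] at h2
  have hsubA : shift β κ ⁻¹' B ⊆ A₀ := hTB₀ ▸ preimage_mono hsubB
  have e1 := measure_sdiff_add_inter (μ := horoVol n β) A₀ hA
  have e2 := measure_sdiff_add_inter (μ := horoVol n β) B₀ hB
  rw [inter_eq_self_of_subset_right hsubA, U.slab c d hc hcd] at e1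
  rw [inter_eq_self_of_subset_right hsubB, U.slab _ _ (by linarith) (by linarith),
    show d + κ - (c + κ) = d - c by ring, ← e1] at e2
  have hfin : horoVol n β (A₀ \ shift β κ ⁻¹' B) ≠ ⊤ := fun h => by
    rw [h, top_add] at e1; exact ENNReal.ofReal_ne_top e1.symm
  refine le_antisymm h1 ?_
  refine (ENNReal.add_le_add_iff_left hfin).1 (le_trans ?_ e2.le)
  gcongr

end Cusp

end

section

/-- Closed ball for the half space distance. -/
def gball {X : Type*} [MetricSpace X] (β : X → ℝ) (z : X) (r : ℝ) : Set X := {y | gap β z y ≤ r}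

/-- Almost Euclidean volume of the half space ball of radius `r` around `z`. -/
def DensAt {X : Type*} [MetricSpace X] [MeasurableSpace X] [BorelSpace X] (n : ℕ) (β : X → ℝ)
    (θ : ℝ) (z : X) (r : ℝ) : Prop :=
  kappa n * r ^ n ≤ θ * (horoVol n β).real (gball β z r) ∧
    (horoVol n β).real (gball β z r) ≤ θ * (kappa n * r ^ n)

section Balls

variable {X : Type*} [MetricSpace X] {β : X → ℝ} (H : Horo β)
include H

lemma Horo.gball_subset {z : X} {r : ℝ} (hr : r ≤ hgt β z / 2) :
    gball β z r ⊆ closedBall z (Real.exp (r / hgt β z) * (r / hgt β z)) := by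
  intro y hy
  have h1 := H.dist_le_of_gap hy hr
  have hz := hgt_pos β z
  rw [mem_closedBall, dist_comm, ← mul_div_assoc, le_div_iff₀ hz]
  linarith

lemma Horo.closedBall_subset_gball (z : X) (s : ℝ) :
    closedBall z s ⊆ gball β z (Real.exp s * (hgt β z * s)) := by
  intro y hy
  have h1 : dist z y ≤ s := by rw [dist_comm]; exact hy
  have := hgt_pos β z
  exact (H.gap_le z y).trans (by gcongr)

lemma Horo.isClosed_gball (z : X) (r : ℝ) : IsClosed (gball β z r) :=
  isClosed_le (H.continuous_gap.comp (continuous_const.prodMk continuous_id)) continuous_const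

end Balls

namespace Cusp

variable {X : Type*} [MetricSpace X] [MeasurableSpace X] [BorelSpace X] [ProperSpace X]
  {n : ℕ} {β : X → ℝ} {K κ : ℝ} (U : Cusp n β K)
include U

lemma sFinite_horoVol : SFinite (horoVol n β) := by
  have := U.good.isFiniteMeasureOnCompacts
  unfold horoVol
  infer_instance

lemma horoVol_lt_top {A : Set X} {z : X} {s : ℝ} (hs : A ⊆ closedBall z s) :
    horoVol n β A < ⊤ := by
  refine (measure_mono hs).trans_lt ((horoVol_le measurableSet_closedBall
    (c := Real.exp s * hgt β z) fun x hx => (H_le x hx)).trans_lt ?_)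
  exact ENNReal.mul_lt_top ENNReal.ofReal_lt_top (U.good.closedBall_lt_top z s)
where
  H_le {z : X} {s : ℝ} (x : X) (hx : x ∈ closedBall z s) : hgt β x ≤ Real.exp s * hgt β z := by
    have h1 : dist z x ≤ s := by rw [dist_comm]; exact hx
    have := hgt_pos β z
    exact (U.horo.hgt_le z x).trans (by gcongr)

lemma real_horoVol_le {A : Set X} (hA : MeasurableSet A) {z : X} {s : ℝ}
    (hs : A ⊆ closedBall z s) :
    (horoVol n β).real A ≤ (Real.exp s * hgt β z) ^ n * (μH[(n : ℝ)] : Measure X).real A := by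
  have h := horoVol_le (n := n) (β := β) hA (c := Real.exp s * hgt β z) fun x hx => by
    have h1 : dist z x ≤ s := by rw [dist_comm]; exact hs hx
    have := hgt_pos β z
    exact (U.horo.hgt_le z x).trans (by gcongr)
  have hfin := (U.good.lt_top_of_bounded (isBounded_closedBall.subset hs)).ne
  have := hgt_pos β z
  have h2 := ENNReal.toReal_mono (ENNReal.mul_ne_top ENNReal.ofReal_ne_top hfin) h
  rwa [ENNReal.toReal_mul, ENNReal.toReal_ofReal (by positivity)] at h2

lemma le_real_horoVol {A : Set X} (hA : MeasurableSet A) {z : X} {s : ℝ}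
    (hs : A ⊆ closedBall z s) :
    (Real.exp (-s) * hgt β z) ^ n * (μH[(n : ℝ)] : Measure X).real A ≤
      (horoVol n β).real A := by
  have hz := hgt_pos β z
  have h := le_horoVol (n := n) (β := β) hA (c := Real.exp (-s) * hgt β z) (by positivity)
    fun x hx => by
      have h1 : dist x z ≤ s := hs hx
      have := hgt_pos β x
      rw [Real.exp_neg, inv_mul_le_iff₀ (Real.exp_pos _)]
      exact (U.horo.hgt_le x z).trans (by gcongr)
  have h2 := ENNReal.toReal_mono (U.horoVol_lt_top hs).ne h
  rwa [ENNReal.toReal_mul, ENNReal.toReal_ofReal (by positivity)] at h2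

lemma densAt_of_nearDensity {z : X} (hz : ∀ θ > 1, NearDensity n θ z) {θ : ℝ} (hθ : 1 < θ) :
    ∀ᶠ r in 𝓝[>] (0 : ℝ), DensAt n β θ z r := by
  have hκ := kappa_pos n
  have hh := hgt_pos β z
  set h := hgt β z with hhd
  set q := Real.sqrt θ with hq
  have hq1 : 1 < q := by rw [hq]; exact Real.lt_sqrt_of_sq_lt (by simpa using hθ)
  have hqq : q * q = θ := Real.mul_self_sqrt (by linarith)
  have c0 : Tendsto (fun r : ℝ => r / h) (𝓝[>] 0) (𝓝 0) := by
    have : Tendsto (fun r : ℝ => r / h) (𝓝 0) (𝓝 (0 / h)) := tendsto_id.div_const h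
    rw [zero_div] at this
    exact this.mono_left nhdsWithin_le_nhds
  have c1 : Tendsto (fun r : ℝ => Real.exp (r / h) * (r / h)) (𝓝[>] 0) (𝓝 0) := by
    have := ((Real.continuous_exp.tendsto 0).comp c0).mul c0
    simpa using this
  have c2 : Tendsto (fun r : ℝ => Real.exp (-(r / h)) * (r / h)) (𝓝[>] 0) (𝓝 0) := by
    have := ((Real.continuous_exp.tendsto (-0)).comp c0.neg).mul c0
    simpa using this
  have c3 : Tendsto (fun r : ℝ => Real.exp (Real.exp (r / h) * (r / h) + r / h) ^ n) (𝓝[>] 0)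
      (𝓝 1) := by
    have := ((Real.continuous_exp.tendsto (0 + 0)).comp (c1.add c0)).pow n
    simpa using this
  have pos : ∀ᶠ r in 𝓝[>] (0 : ℝ), 0 < r := self_mem_nhdsWithin
  have w1 := (tendsto_nhdsWithin_iff.2 ⟨c1, pos.mono fun r hr =>
    mem_Ioi.2 (by positivity)⟩).eventually (hz q hq1)
  have w2 := (tendsto_nhdsWithin_iff.2 ⟨c2, pos.mono fun r hr =>
    mem_Ioi.2 (by positivity)⟩).eventually (hz q hq1)
  have w3 := c3.eventually (gt_mem_nhds hq1)
  have w4 := c0.eventually (gt_mem_nhds (by norm_num : (0 : ℝ) < 1 / 2))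
  filter_upwards [pos, w1, w2, w3, w4] with r hr k1 k2 k3 k4
  set u := r / h with hu
  have hu0 : 0 < u := by positivity
  have hr' : r = u * h := by rw [hu]; field_simp
  have hsub := U.horo.gball_subset (z := z) (r := r) (by rw [div_lt_iff₀ hh] at k4; linarith)
  rw [← hhd, ← hu] at hsub
  have hm := (U.horo.isClosed_gball z r).measurableSet
  set ρ := Real.exp u * u with hρ
  set s := Real.exp (-u) * u with hs
  have hsρ : s ≤ ρ := by
    rw [hs, hρ]; gcongr; linarith
  constructor
  · have hsub2 : closedBall z s ⊆ gball β z r := by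
      refine (U.horo.closedBall_subset_gball z s).trans fun y hy => ?_
      refine (show gap β z y ≤ _ from hy).trans ?_
      have e : Real.exp s * (h * s) = Real.exp (s - u) * r := by
        rw [Real.exp_sub, hr', hs, Real.exp_neg]; field_simp
      rw [← hhd, e]
      refine mul_le_of_le_one_left hr.le (Real.exp_le_one_iff.2 ?_)
      have : s ≤ u := mul_le_of_le_one_left hu0.le (Real.exp_le_one_iff.2 (by linarith))
      linarith
    have m1 := U.le_real_horoVol (measurableSet_closedBall (x := z) (ε := s)) Subset.rfl
    have m2 : (horoVol n β).real (closedBall z s) ≤ (horoVol n β).real (gball β z r) :=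
      measureReal_mono hsub2 (U.horoVol_lt_top hsub).ne
    have m3 := k2.1
    have e : r ^ n = Real.exp (s + u) ^ n * ((Real.exp (-s) * h) ^ n * s ^ n) := by
      have hs' : s * Real.exp u = u := by
        rw [hs, mul_right_comm, ← Real.exp_add, neg_add_cancel, Real.exp_zero, one_mul]
      have hs'' : Real.exp s * Real.exp (-s) = 1 := by rw [← Real.exp_add]; simp
      rw [← mul_pow, ← mul_pow, hr', Real.exp_add]
      congr 1
      linear_combination (-h * s * Real.exp u) * hs'' - h * hs'
    have m4 : Real.exp (s + u) ^ n ≤ q := le_trans (by gcongr) k3.le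
    calc kappa n * r ^ n = Real.exp (s + u) ^ n * ((Real.exp (-s) * h) ^ n * (kappa n * s ^ n)) := by
          rw [e]; ring
      _ ≤ q * ((Real.exp (-s) * h) ^ n *
          (q * (μH[(n : ℝ)] : Measure X).real (closedBall z s))) := by gcongr
      _ = θ * ((Real.exp (-s) * h) ^ n * (μH[(n : ℝ)] : Measure X).real (closedBall z s)) := by
          rw [← hqq]; ring
      _ ≤ θ * (horoVol n β).real (gball β z r) := by
          gcongr
          exact m1.trans m2
  · have m1 := U.real_horoVol_le hm hsub
    have m2 : (μH[(n : ℝ)] : Measure X).real (gball β z r) ≤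
        (μH[(n : ℝ)] : Measure X).real (closedBall z ρ) :=
      measureReal_mono hsub (U.good.closedBall_lt_top z ρ).ne
    have m3 := k1.2
    have e : (Real.exp ρ * h) ^ n * ρ ^ n = Real.exp (ρ + u) ^ n * r ^ n := by
      rw [← mul_pow, ← mul_pow, hr', Real.exp_add, hρ]
      congr 1; ring
    calc (horoVol n β).real (gball β z r) ≤ (Real.exp ρ * h) ^ n * (q * (kappa n * ρ ^ n)) :=
          m1.trans (by gcongr; exact m2.trans m3)
      _ = Real.exp (ρ + u) ^ n * (q * (kappa n * r ^ n)) := by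
          linear_combination q * kappa n * e
      _ ≤ q * (q * (kappa n * r ^ n)) := by gcongr
      _ = θ * (kappa n * r ^ n) := by rw [← hqq]; ring

lemma ae_densAt : ∀ᵐ z ∂(horoVol n β), ∀ θ > 1, ∀ᶠ r in 𝓝[>] (0 : ℝ), DensAt n β θ z r := by
  have h := U.good.ae_density U.npos
  refine (withDensity_absolutelyContinuous _ _).ae_le ?_
  filter_upwards [h] with z hz θ hθ
  exact U.densAt_of_nearDensity hz hθ

lemma measurable_horoVol_gball (r : ℝ) : Measurable fun z => (horoVol n β).real (gball β z r) := by
  have := U.sFinite_horoVol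
  have : IsClosed {p : X × X | gap β p.1 p.2 ≤ r} := isClosed_le U.horo.continuous_gap continuous_const
  exact (measurable_measure_prodMk_left this.measurableSet).ennreal_toReal

end Cusp

end

section

/-- Points which, together with their shift, have almost Euclidean volume below scale `1/(k+1)`. -/
def goodSet {X : Type*} [MetricSpace X] [MeasurableSpace X] [BorelSpace X] (n : ℕ) (β : X → ℝ)
    (θ κ : ℝ) (k : ℕ) : Set X :=
  {z | ∀ r, 0 < r → r < 1 / ((k : ℝ) + 1) → 2 * r < hgt β z →
    DensAt n β θ z r ∧ DensAt n β θ (shift β κ z) r}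

namespace Cusp

variable {X : Type*} [MetricSpace X] [MeasurableSpace X] [BorelSpace X] [ProperSpace X]
  {n : ℕ} {β : X → ℝ} {K κ θ : ℝ} (U : Cusp n β K)
include U

lemma gball_lt_top {z : X} {r : ℝ} (h : 2 * r ≤ hgt β z) : horoVol n β (gball β z r) < ⊤ :=
  U.horoVol_lt_top (U.horo.gball_subset (by linarith))

lemma densAt_of_rat (hθ : 0 ≤ θ) {z : X} {a : ℝ}
    (h : ∀ q : ℚ, (0 : ℝ) < q → (q : ℝ) < a → 2 * (q : ℝ) < hgt β z → DensAt n β θ z q)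
    {r : ℝ} (h0 : 0 < r) (ha : r < a) (hr : 2 * r < hgt β z) : DensAt n β θ z r := by
  constructor
  · by_contra! hcon
    have c : ContinuousAt (fun q : ℝ => kappa n * q ^ n) r := by fun_prop
    obtain ⟨l, hl, hl2⟩ := exists_Ioc_subset_of_mem_nhds (c.eventually (lt_mem_nhds hcon))
      ⟨0, h0⟩
    obtain ⟨q, hq1, hq2⟩ := exists_rat_btwn (max_lt hl h0)
    have hq0 := (le_max_right _ _).trans_lt hq1
    have h1 := (h q hq0 (hq2.trans ha) (by linarith)).1
    have h2 : θ * (horoVol n β).real (gball β z r) < kappa n * (q : ℝ) ^ n :=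
      hl2 ⟨(le_max_left _ _).trans_lt hq1, hq2.le⟩
    have h3 : (horoVol n β).real (gball β z q) ≤ (horoVol n β).real (gball β z r) :=
      measureReal_mono (fun y hy => le_trans (show gap β z y ≤ q from hy) hq2.le)
        (U.gball_lt_top hr.le).ne
    have := mul_le_mul_of_nonneg_left h3 hθ
    linarith
  · by_contra! hcon
    have c : ContinuousAt (fun q : ℝ => θ * (kappa n * q ^ n)) r := by fun_prop
    obtain ⟨u, hu, hu2⟩ := exists_Ico_subset_of_mem_nhds (c.eventually (gt_mem_nhds hcon))
      ⟨a, ha⟩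
    obtain ⟨q, hq1, hq2⟩ := exists_rat_btwn (lt_min hu (lt_min ha (by linarith : r < hgt β z / 2)))
    have hqu := hq2.trans_le (min_le_left _ _)
    have hqa := (hq2.trans_le (min_le_right _ _)).trans_le (min_le_left _ _)
    have hqh := (hq2.trans_le (min_le_right _ _)).trans_le (min_le_right _ _)
    have h1 := (h q (h0.trans hq1) hqa (by linarith)).2
    have h2 : θ * (kappa n * (q : ℝ) ^ n) < (horoVol n β).real (gball β z r) := hu2 ⟨hq1.le, hqu⟩
    have h3 : (horoVol n β).real (gball β z r) ≤ (horoVol n β).real (gball β z q) :=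
      measureReal_mono (fun y hy => le_trans (show gap β z y ≤ r from hy) hq1.le)
        (U.gball_lt_top (by linarith)).ne
    linarith

lemma measurableSet_goodSet (hκ : 0 ≤ κ) (hθ : 0 ≤ θ) (k : ℕ) :
    MeasurableSet (goodSet n β θ κ k) := by
  have e : goodSet n β θ κ k = ⋂ q : ℚ, {z | (0 : ℝ) < q → (q : ℝ) < 1 / ((k : ℝ) + 1) →
      2 * (q : ℝ) < hgt β z → DensAt n β θ z q ∧ DensAt n β θ (shift β κ z) q} := by
    ext z
    simp only [goodSet, mem_iInter, Set.mem_ofPred_eq]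
    refine ⟨fun h q => h q, fun h r h1 h2 h3 => ⟨?_, ?_⟩⟩
    · exact U.densAt_of_rat hθ (a := min (1 / ((k : ℝ) + 1)) (hgt β z / 2))
        (fun q a1 a2 a3 => (h q a1 (a2.trans_le (min_le_left _ _)) a3).1) h1
        (lt_min h2 (by linarith)) h3
    · exact U.densAt_of_rat hθ (a := min (1 / ((k : ℝ) + 1)) (hgt β z / 2))
        (fun q a1 a2 _ => (h q a1 (a2.trans_le (min_le_left _ _))
          (by linarith [a2.trans_le (min_le_right _ _)])).2) h1
        (lt_min h2 (by linarith)) (by rw [U.hgt_shift' hκ]; linarith)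
  rw [e]
  refine MeasurableSet.iInter fun q => ?_
  have hD : MeasurableSet {z : X | DensAt n β θ z q} := by
    have := U.measurable_horoVol_gball (q : ℝ)
    exact (measurableSet_le measurable_const (this.const_mul θ)).inter
      (measurableSet_le this measurable_const)
  have hh := U.horo.continuous_hgt.measurable
  refine MeasurableSet.imp (MeasurableSet.const _) (MeasurableSet.imp (MeasurableSet.const _)
    (MeasurableSet.imp (measurableSet_lt measurable_const hh) (hD.inter ?_)))
  exact (U.continuous_shift hκ).measurable hD

omit [ProperSpace X] U in
lemma goodSet_mono {k l : ℕ} (h : k ≤ l) : goodSet n β θ κ k ⊆ goodSet n β θ κ l := by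
  intro z hz r h1 h2 h3
  refine hz r h1 (h2.trans_le ?_) h3
  have : (k : ℝ) ≤ l := by exact_mod_cast h
  gcongr

lemma ae_mem_goodSet (hκ : 0 ≤ κ) (hθ : 1 < θ) :
    ∀ᵐ z ∂(μH[(n : ℝ)] : Measure X), ∃ k, z ∈ goodSet n β θ κ k := by
  have hac : (μH[(n : ℝ)] : Measure X) ≪ horoVol n β := by
    refine withDensity_absolutelyContinuous' ?_ (ae_of_all _ fun x => ?_)
    · exact (U.horo.continuous_hgt.measurable.pow_const n).ennreal_ofReal.aemeasurable
    · exact (ENNReal.ofReal_pos.2 (pow_pos (hgt_pos β x) n)).ne'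
  refine hac.ae_le ?_
  have h1 := U.ae_densAt
  have h2 : ∀ᵐ z ∂(horoVol n β), ∀ θ > 1, ∀ᶠ r in 𝓝[>] (0 : ℝ),
      DensAt n β θ (shift β κ z) r := by
    have hnull := (measure_toMeasurable _).trans (ae_iff.1 h1)
    have h3 := (U.horoVol_preimage_shift_le hκ (measurableSet_toMeasurable _ _)).trans_eq hnull
    refine measure_mono_null (fun z hz => ?_) (le_antisymm h3 zero_le)
    exact subset_toMeasurable _ _ hz
  filter_upwards [h1, h2] with z hz1 hz2
  have h3 := (hz1 θ hθ).and (hz2 θ hθ)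
  obtain ⟨u, hu, hu2⟩ := mem_nhdsGT_iff_exists_Ioo_subset.1 h3
  obtain ⟨k, hk⟩ := exists_nat_one_div_lt (show (0 : ℝ) < u from hu)
  exact ⟨k, fun r h1 h2 _ => hu2 ⟨h1, h2.trans hk⟩⟩

lemma tendsto_bad (hκ : 0 ≤ κ) (hθ : 1 < θ) (x : X) (R : ℝ) :
    Tendsto (fun k => (μH[(n : ℝ)] : Measure X) (closedBall x R \ goodSet n β θ κ k)) atTop
      (𝓝 0) := by
  have h := tendsto_measure_iInter_atTop (μ := (μH[(n : ℝ)] : Measure X))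
    (s := fun k => closedBall x R \ goodSet n β θ κ k)
    (fun k => (measurableSet_closedBall.diff
      (U.measurableSet_goodSet hκ (by linarith) k)).nullMeasurableSet)
    (fun k l hkl => sdiff_subset_sdiff_right (goodSet_mono hkl))
    ⟨0, ((measure_mono sdiff_subset).trans_lt (U.good.closedBall_lt_top x R)).ne⟩
  have h0 : (μH[(n : ℝ)] : Measure X) (⋂ k, closedBall x R \ goodSet n β θ κ k) = 0 := by
    refine measure_mono_null (fun z hz => ?_) (ae_iff.1 (U.ae_mem_goodSet hκ hθ))
    rintro ⟨k, hk⟩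
    exact (mem_iInter.1 hz k).2 hk
  rwa [h0] at h

end Cusp

end

section

lemma Horo.hgt_bounds {X : Type*} [MetricSpace X] {β : X → ℝ} (H : Horo β) {p x : X} {R : ℝ}
    (hx : x ∈ closedBall p R) :
    Real.exp (-R) * hgt β p ≤ hgt β x ∧ hgt β x ≤ Real.exp R * hgt β p := by
  have h1 : dist x p ≤ R := hx
  have h2 := hgt_pos β p
  have h3 := hgt_pos β x
  constructor
  · rw [Real.exp_neg, inv_mul_le_iff₀ (Real.exp_pos _)]
    exact (H.hgt_le x p).trans (by gcongr)
  · rw [dist_comm] at h1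
    exact (H.hgt_le p x).trans (by gcongr)

namespace Cusp

variable {X : Type*} [MetricSpace X] [MeasurableSpace X] [BorelSpace X] [ProperSpace X]
  {n : ℕ} {β : X → ℝ} {K κ θ η : ℝ} (U : Cusp n β K)
include U

lemma real_horoVol_preimage_gball (hκ : 0 ≤ κ) {z : X} {r : ℝ} (hr : 0 < r) (h : 2 * r ≤ hgt β z) :
    (horoVol n β).real (shift β κ ⁻¹' gball β (shift β κ z) r) =
      (horoVol n β).real (gball β (shift β κ z) r) := by
  refine congrArg ENNReal.toReal (U.horoVol_preimage_shift hκ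
    (U.horo.isClosed_gball _ _).measurableSet (c := hgt β z - r) (d := hgt β z + r) (by linarith)
    fun y hy => ?_)
  have := abs_le.1 ((U.horo.abs_hgt_sub_le (shift β κ z) y).trans hy)
  rw [U.hgt_shift' hκ] at this
  constructor <;> linarith

lemma preimage_gball_subset (hκ : 0 ≤ κ) (z : X) (r : ℝ) :
    shift β κ ⁻¹' gball β (shift β κ z) r ⊆ gball β z r := fun y hy =>
  (U.gap_le_gap_shift hκ z y).trans hy

lemma inter_le_of_disjoint (hκ : 0 ≤ κ) (hθ : 0 < θ) {z w : X} {r : ℝ} (hr : 0 < r)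
    (hz : 2 * r ≤ hgt β z) (hw : 2 * r ≤ hgt β w)
    (dz : DensAt n β θ z r) (dw : DensAt n β θ w r) (dz' : DensAt n β θ (shift β κ z) r)
    (dw' : DensAt n β θ (shift β κ w) r)
    (hdisj : Disjoint (gball β (shift β κ z) r) (gball β (shift β κ w) r)) :
    θ * (horoVol n β).real (gball β z r ∩ gball β w r) ≤ 2 * (θ ^ 2 - 1) * (kappa n * r ^ n) := by
  set ν := horoVol n β
  have ez := U.real_horoVol_preimage_gball hκ hr hz
  have ew := U.real_horoVol_preimage_gball hκ hr hw
  set A := gball β z r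
  set B := gball β w r
  set A' := shift β κ ⁻¹' gball β (shift β κ z) r
  set B' := shift β κ ⁻¹' gball β (shift β κ w) r
  have hA : A' ⊆ A := U.preimage_gball_subset hκ z r
  have hB : B' ⊆ B := U.preimage_gball_subset hκ w r
  have fA : ν A ≠ ⊤ := (U.gball_lt_top hz).ne
  have fB : ν B ≠ ⊤ := (U.gball_lt_top hw).ne
  have fA' : ν A' ≠ ⊤ := ((measure_mono hA).trans_lt fA.lt_top).ne
  have fB' : ν B' ≠ ⊤ := ((measure_mono hB).trans_lt fB.lt_top).ne
  have mB : MeasurableSet B := (U.horo.isClosed_gball _ _).measurableSet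
  have mB' : MeasurableSet B' :=
    (U.continuous_shift hκ).measurable (U.horo.isClosed_gball _ _).measurableSet
  have h1 := measureReal_union_add_inter (μ := ν) (s := A) (t := B) mB fA fB
  have h2 := measureReal_union (μ := ν) (hdisj.preimage (shift β κ)) mB' fA' fB'
  have h3 : ν.real (A' ∪ B') ≤ ν.real (A ∪ B) :=
    measureReal_mono (union_subset_union hA hB) (measure_union_lt_top fA.lt_top fB.lt_top).ne
  have k1 := dz.2
  have k2 := dw.2
  have k3 := dz'.1
  have k4 := dw'.1
  rw [← ez] at k3
  rw [← ew] at k4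
  have h4 : ν.real (A ∩ B) ≤ 2 * θ * (kappa n * r ^ n) - (ν.real A' + ν.real B') := by
    rw [← h2]; linarith
  have := mul_le_mul_of_nonneg_left h4 hθ.le
  linarith

lemma disjoint_gball_shift (hκ : 0 ≤ κ) {a : ℝ} (ha : 0 < a) {z w : X} {r : ℝ} (hr : 0 < r)
    (az : a ≤ hgt β z) (aw : a ≤ hgt β w) (hra : 2 * r ≤ a) (hd : dist z w + r / a ≤ η)
    (h : 2 * r < (1 - η) * ((hgt β z + κ) * dist (shift β κ z) (shift β κ w))) :
    Disjoint (gball β (shift β κ z) r) (gball β (shift β κ w) r) := by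
  rw [Set.disjoint_left]
  intro y hy1 hy2
  have e1 := U.hgt_shift' hκ z
  have e2 := U.hgt_shift' hκ w
  have hz := hgt_pos β z
  have hw := hgt_pos β w
  have key : ∀ v : X, a ≤ hgt β v → y ∈ gball β (shift β κ v) r →
      (hgt β v + κ) * dist (shift β κ v) y ≤ Real.exp (r / a) * r := by
    intro v hv hy
    have e := U.hgt_shift' hκ v
    have := U.horo.dist_le_of_gap hy (by rw [e]; linarith)
    rw [e] at this
    refine this.trans ?_
    gcongr
    linarith
  have k1 := key z az hy1
  have k2 := key w aw hy2
  have k3 : hgt β z + κ ≤ Real.exp (dist z w) * (hgt β w + κ) := by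
    have := U.horo.hgt_le w z
    rw [dist_comm] at this
    have : 1 * κ ≤ Real.exp (dist z w) * κ := by
      gcongr; exact Real.one_le_exp dist_nonneg
    linarith
  have k4 : (hgt β z + κ) * dist (shift β κ w) y ≤ Real.exp (dist z w + r / a) * r := calc
    _ ≤ (Real.exp (dist z w) * (hgt β w + κ)) * dist (shift β κ w) y := by gcongr
    _ = Real.exp (dist z w) * ((hgt β w + κ) * dist (shift β κ w) y) := by ring
    _ ≤ Real.exp (dist z w) * (Real.exp (r / a) * r) := by gcongr
    _ = _ := by rw [Real.exp_add]; ring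
  have k5 : Real.exp (r / a) * r ≤ Real.exp (dist z w + r / a) * r := by
    gcongr; linarith [dist_nonneg (x := z) (y := w)]
  have k6 := dist_triangle_right (shift β κ z) (shift β κ w) y
  have k7 : (hgt β z + κ) * dist (shift β κ z) (shift β κ w) ≤ 2 * (Real.exp η * r) := by
    have : Real.exp (dist z w + r / a) * r ≤ Real.exp η * r := by gcongr
    have := mul_le_mul_of_nonneg_left k6 (by linarith : 0 ≤ hgt β z + κ)
    linarith
  have hη : 1 - η ≤ Real.exp (-η) := by linarith [Real.add_one_le_exp (-η)]
  have k8 : (1 - η) * ((hgt β z + κ) * dist (shift β κ z) (shift β κ w)) ≤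
      Real.exp (-η) * (2 * (Real.exp η * r)) := by
    have : 0 ≤ (hgt β z + κ) * dist (shift β κ z) (shift β κ w) :=
      mul_nonneg (by linarith) dist_nonneg
    gcongr
  have k9 : Real.exp (-η) * Real.exp η = 1 := by rw [← Real.exp_add]; simp
  have : Real.exp (-η) * (2 * (Real.exp η * r)) = 2 * r := by linear_combination 2 * r * k9
  linarith

lemma closedBall_subset_inter (hη : 0 < η) (hη1 : η ≤ 1) {z w m : X}
    (hm1 : dist z m = dist z w / 2) (hm2 : dist w m = dist z w / 2)
    (hd : Real.exp (2 * dist z w) ≤ 1 + η / 4) :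
    closedBall m (η * dist z w / 8) ⊆ gball β z ((1 + η) * (hgt β z * dist z w) / 2) ∩
      gball β w ((1 + η) * (hgt β z * dist z w) / 2) := by
  intro y hy
  have hy' : dist m y ≤ η * dist z w / 8 := by rw [dist_comm]; exact hy
  set d := dist z w with hdd
  have hd0 : 0 ≤ d := dist_nonneg
  have hz := hgt_pos β z
  have hw := hgt_pos β w
  have key : ∀ v : X, dist v m = d / 2 → hgt β v ≤ Real.exp d * hgt β z →
      gap β v y ≤ (1 + η) * (hgt β z * d) / 2 := by
    intro v hv hvz
    have h1 : dist v y ≤ (1 + η / 4) * d / 2 := by linarith [dist_triangle v m y]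
    have h2 : dist v y ≤ d := by nlinarith
    have hv0 := hgt_pos β v
    have hy0 := dist_nonneg (x := v) (y := y)
    calc gap β v y ≤ Real.exp (dist v y) * (hgt β v * dist v y) := U.horo.gap_le v y
      _ ≤ Real.exp d * (Real.exp d * hgt β z * ((1 + η / 4) * d / 2)) := by gcongr
      _ = Real.exp (2 * d) * (hgt β z * ((1 + η / 4) * d / 2)) := by rw [two_mul, Real.exp_add]; ring
      _ ≤ (1 + η / 4) * (hgt β z * ((1 + η / 4) * d / 2)) := by gcongr
      _ ≤ (1 + η) * (hgt β z * d) / 2 := by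
        have h3 : (1 + η / 4) * (1 + η / 4) ≤ 1 + η := by nlinarith
        have h4 : 0 ≤ hgt β z * d / 2 := by positivity
        linarith [mul_le_mul_of_nonneg_right h3 h4]
  refine ⟨key z hm1 ?_, key w hm2 (U.horo.hgt_le z w)⟩
  have := Real.one_le_exp hd0
  nlinarith

set_option maxHeartbeats 1000000 in
/-- On pairs of good points the shift contracts at least as in the warped product model. -/
lemma shift_le_of_good (hκ : 0 ≤ κ) (hη : 0 < η) (hη1 : η ≤ 1) (p : X) (R : ℝ) :
    ∃ θ, 1 < θ ∧ ∀ k : ℕ, ∃ ε, 0 < ε ∧ ∀ z ∈ closedBall p R, ∀ w ∈ closedBall p R,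
      z ∈ goodSet n β θ κ k → w ∈ goodSet n β θ κ k → dist z w < ε →
      (1 - η) * ((hgt β z + κ) * dist (shift β κ z) (shift β κ w)) ≤
        (1 + η) * (hgt β z * dist z w) := by
  obtain ⟨c, hc0, hc⟩ := U.good.ahlfors_lower p (R + 1)
  have hp := hgt_pos β p
  have hkp := kappa_pos n
  set a := Real.exp (-(R + 1)) * hgt β p with ha
  set b := Real.exp (R + 1) * hgt β p with hb
  have ha0 : 0 < a := by positivity
  have hb0 : 0 < b := by positivity
  have hab : ∀ {x}, x ∈ closedBall p (R + 1) → a ≤ hgt β x ∧ hgt β x ≤ b :=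
    fun hx => U.horo.hgt_bounds hx
  set c₁ := (Real.exp (-1) * a) ^ n * (c * (η / (8 * b)) ^ n) with hc₁
  have hc₁0 : 0 < c₁ := by positivity
  set t := c₁ / (8 * kappa n) with ht
  have ht0 : 0 < t := by positivity
  refine ⟨1 + t, by linarith, fun k => ?_⟩
  have ev : ∀ᶠ d : ℝ in 𝓝 0, d < 1 ∧ b * d < 1 / ((k : ℝ) + 1) ∧ 2 * (b * d) < a ∧
      Real.exp (2 * d) < 1 + η / 4 ∧ d + b * d / a < η := by
    have f1 : Tendsto (fun d : ℝ => d) (𝓝 0) (𝓝 0) := tendsto_id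
    have f2 : Tendsto (fun d : ℝ => b * d) (𝓝 0) (𝓝 (b * 0)) := f1.const_mul b
    have f3 : Tendsto (fun d : ℝ => 2 * (b * d)) (𝓝 0) (𝓝 (2 * (b * 0))) := f2.const_mul 2
    have f4 : Tendsto (fun d : ℝ => Real.exp (2 * d)) (𝓝 0) (𝓝 (Real.exp (2 * 0))) :=
      (Real.continuous_exp.tendsto _).comp (f1.const_mul 2)
    have f5 : Tendsto (fun d : ℝ => d + b * d / a) (𝓝 0) (𝓝 (0 + b * 0 / a)) :=
      f1.add (f2.div_const a)
    refine (f1.eventually (gt_mem_nhds one_pos)).and ((f2.eventually (gt_mem_nhds ?_)).and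
      ((f3.eventually (gt_mem_nhds ?_)).and ((f4.eventually (gt_mem_nhds ?_)).and
      (f5.eventually (gt_mem_nhds ?_)))))
    · rw [mul_zero]; positivity
    · rw [mul_zero, mul_zero]; exact ha0
    · rw [mul_zero, Real.exp_zero]; linarith
    · rw [mul_zero, zero_div, add_zero]; exact hη
  obtain ⟨ε, hε, hball⟩ := Metric.eventually_nhds_iff.1 ev
  refine ⟨ε, hε, fun z hz w hw gz gw hd => ?_⟩
  by_contra! hcon
  set d := dist z w with hdd
  have hd0 : 0 < d := by
    refine dist_pos.2 fun h => ?_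
    simp [d, h] at hcon
  obtain ⟨e1, e2, e3, e4, e5⟩ := hball (y := d) (by rwa [dist_zero_right, Real.norm_of_nonneg hd0.le])
  have hz1 : z ∈ closedBall p (R + 1) := closedBall_subset_closedBall (by linarith) hz
  have hw1 : w ∈ closedBall p (R + 1) := closedBall_subset_closedBall (by linarith) hw
  obtain ⟨az, bz⟩ := hab hz1
  obtain ⟨aw, bw⟩ := hab hw1
  set r := (1 + η) * (hgt β z * d) / 2 with hr
  have hzp := hgt_pos β z
  have hmp : ∀ m, 0 < hgt β m := hgt_pos β
  have hr0 : 0 < r := by positivity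
  have hrb : r ≤ b * d := calc
    r ≤ (1 + 1) * (b * d) / 2 := by rw [hr]; gcongr
    _ = b * d := by ring
  have hdisj := U.disjoint_gball_shift hκ ha0 hr0 az aw (by linarith) (η := η) (w := w) (by
    have : r / a ≤ b * d / a := by gcongr
    linarith) (by rw [hr]; linarith)
  have gz' := gz r hr0 (by linarith) (by linarith)
  have gw' := gw r hr0 (by linarith) (by linarith)
  have hI := U.inter_le_of_disjoint hκ (by linarith) hr0 (by linarith) (by linarith) gz'.1 gw'.1
    gz'.2 gw'.2 hdisj
  obtain ⟨m, hm1, hm2⟩ := U.good.geod.exists_frac z w (l := 1 / 2) (by norm_num) (by norm_num)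
  have hsub := U.closedBall_subset_inter hη hη1 (z := z) (w := w) (m := m) (by rw [hm1]; ring)
    (by rw [dist_comm, hm2]; ring) e4.le
  rw [← hdd, ← hr] at hsub
  set s := η * d / 8 with hs
  have hs0 : 0 < s := by positivity
  have hs1 : s ≤ 1 := by rw [hs]; nlinarith
  have hmR : m ∈ closedBall p (R + 1) := by
    have h1 : dist z p ≤ R := hz
    have h2 := dist_triangle_left m p z
    rw [mem_closedBall]; linarith
  have v1 := U.le_real_horoVol (measurableSet_closedBall (x := m) (ε := s)) Subset.rfl
  have v2 := hc m hmR s hs0 hs1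
  have v3 : (horoVol n β).real (closedBall m s) ≤
      (horoVol n β).real (gball β z r ∩ gball β w r) :=
    measureReal_mono hsub ((measure_mono inter_subset_left).trans_lt
      (U.gball_lt_top (by linarith))).ne
  have v4 : c₁ * r ^ n ≤ (horoVol n β).real (closedBall m s) := by
    have hrs : η / (8 * b) * r ≤ s := by
      rw [hs, div_mul_eq_mul_div, div_le_div_iff₀ (by positivity) (by norm_num)]
      nlinarith
    calc c₁ * r ^ n = (Real.exp (-1) * a) ^ n * (c * (η / (8 * b) * r) ^ n) := by
          rw [hc₁, mul_pow (η / (8 * b))]; ring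
      _ ≤ (Real.exp (-s) * hgt β m) ^ n * (c * s ^ n) := by
          have h1 := (hab hmR).1
          have h2 := hmp m
          gcongr
      _ ≤ _ := le_trans (by have := hmp m; gcongr) v1
  set P := kappa n * r ^ n with hP
  have hP0 : 0 < P := by positivity
  have hc₁t : c₁ * r ^ n = 8 * t * P := by
    rw [ht, hP]; field_simp
  rw [hc₁t] at v4
  have h1 := v4.trans v3
  have h2 := mul_le_mul_of_nonneg_left h1 (by linarith : 0 ≤ 1 + t)
  have h3 : 0 < t * P := by positivity
  have h4 := mul_pos ht0 h3
  linarith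

end Cusp

end

section

namespace Cusp

variable {X : Type*} [MetricSpace X] [MeasurableSpace X] [BorelSpace X] [ProperSpace X]
  {n : ℕ} {β : X → ℝ} {K κ : ℝ} (U : Cusp n β K)
include U

lemma real_horoVol_closedBall_shift (hκ : 0 ≤ κ) {a b s : ℝ} (ha : 0 < a) {x : X}
    (ax : a ≤ hgt β x) (xb : hgt β x ≤ b) (hs : 0 ≤ s) (hs1 : s ≤ 1)
    (hsa : Real.exp 1 * (b + κ) * s ≤ a / 2) :
    (horoVol n β).real (shift β κ ⁻¹' closedBall (shift β κ x) s) =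
      (horoVol n β).real (closedBall (shift β κ x) s) := by
  refine congrArg ENNReal.toReal (U.horoVol_preimage_shift hκ measurableSet_closedBall
    (c := a / 2) (d := b + a / 2) (by linarith) fun y hy => ?_)
  have hx := U.hgt_shift' hκ x
  have h1 := U.horo.closedBall_subset_gball _ _ hy
  have h2 : Real.exp s * (hgt β (shift β κ x) * s) ≤ Real.exp 1 * ((b + κ) * s) := by
    have := hgt_pos β x
    rw [hx]; gcongr
  have h3 := abs_le.1 ((U.horo.abs_hgt_sub_le _ _).trans h1)
  constructor <;> linarith

lemma preimage_closedBall_shift_subset (hκ : 0 ≤ κ) {a b s : ℝ} (ha : 0 < a) {x : X}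
    (ax : a ≤ hgt β x) (xb : hgt β x ≤ b) (hs : 0 ≤ s) (hs1 : s ≤ 1)
    (hsa : Real.exp 1 * (b + κ) * s ≤ a / 2) :
    shift β κ ⁻¹' closedBall (shift β κ x) s ⊆
      closedBall x (Real.exp 1 * (Real.exp 1 * (b + κ) / a) * s) := by
  intro y hy
  have hx := U.hgt_shift' hκ x
  have h1 := U.horo.closedBall_subset_gball _ _ hy
  have h2 : Real.exp s * (hgt β (shift β κ x) * s) ≤ Real.exp 1 * (b + κ) * s := by
    have := hgt_pos β x
    rw [hx, mul_assoc (Real.exp 1)]; gcongr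
  have h3 : gap β x y ≤ Real.exp 1 * (b + κ) * s :=
    ((U.gap_le_gap_shift hκ x y).trans h1).trans h2
  have h4 := U.horo.dist_le_of_gap h3 (by linarith)
  set q := Real.exp 1 * (b + κ) * s with hq
  have hq0 : 0 ≤ q := by
    have : 0 ≤ b + κ := by linarith
    positivity
  have h5 : q / hgt β x ≤ 1 := by rw [div_le_one (by linarith)]; linarith
  have h6 : a * dist x y ≤ Real.exp 1 * q := calc
    _ ≤ hgt β x * dist x y := by gcongr
    _ ≤ _ := h4
    _ ≤ _ := by gcongr
  rw [mem_closedBall, dist_comm]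
  calc dist x y ≤ Real.exp 1 * q / a := by rw [le_div_iff₀ ha]; linarith
    _ = _ := by rw [hq]; ring

/-- Counting disjoint balls along the image of a geodesic. -/
lemma dist_shift_mul_le (hκ : 0 ≤ κ) {u v : X} (hs : 0 < dist u v) {c C : ℝ} {B : Set X}
    (hB : ∀ x ∈ closedBall u (dist u v), shift β κ ⁻¹' closedBall (shift β κ x) (dist u v) ⊆ B)
    (hBt : horoVol n β B ≠ ⊤) (hBC : (horoVol n β).real B ≤ C)
    (hc : ∀ x ∈ closedBall u (dist u v),
      c ≤ (horoVol n β).real (shift β κ ⁻¹' closedBall (shift β κ x) (dist u v))) (hc0 : 0 < c) :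
    dist (shift β κ u) (shift β κ v) * c ≤ 3 * dist u v * C := by
  obtain ⟨γ, ⟨-, hγ⟩, h0, h1⟩ := U.good.geod u v
  set s := dist u v with hsd
  set L := dist (shift β κ u) (shift β κ v) with hL
  have hT := U.continuous_shift hκ
  have hγc : ContinuousOn γ (Icc 0 s) := by
    refine LipschitzOnWith.continuousOn (K := 1) (LipschitzOnWith.of_dist_le_mul fun x hx y hy => ?_)
    rw [hγ x hx y hy, Real.dist_eq]; simp
  have hf : ContinuousOn (fun t => dist (shift β κ u) (shift β κ (γ t))) (Icc 0 s) :=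
    (continuous_const.dist hT).comp_continuousOn hγc
  have hivt := intermediate_value_Icc hs.le hf
  simp only [h0, h1, dist_self] at hivt
  set N := ⌊L / (3 * s)⌋₊ with hN
  have hNL : (N : ℝ) * (3 * s) ≤ L := by
    rw [← le_div_iff₀ (by positivity)]
    exact Nat.floor_le (by positivity)
  have hpt : ∀ j : Fin (N + 1), ∃ x ∈ closedBall u s, dist (shift β κ u) (shift β κ x) = j * (3 * s) := by
    intro j
    have hj : (j : ℝ) ≤ N := by exact_mod_cast Nat.lt_succ_iff.1 j.2
    obtain ⟨t, ht, h⟩ := hivt (show (j : ℝ) * (3 * s) ∈ Icc 0 L from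
      ⟨by positivity, le_trans (by gcongr) hNL⟩)
    refine ⟨γ t, ?_, h⟩
    rw [mem_closedBall, ← h0, hγ t ht 0 ⟨le_rfl, hs.le⟩, sub_zero, abs_of_nonneg ht.1]
    exact ht.2
  choose x hx hxd using hpt
  have hsep : ∀ i j, i ≠ j → 3 * s ≤ dist (shift β κ (x i)) (shift β κ (x j)) := by
    intro i j hij
    have h := abs_dist_sub_le (shift β κ (x i)) (shift β κ (x j)) (shift β κ u)
    rw [dist_comm _ (shift β κ u), dist_comm _ (shift β κ u), hxd, hxd, ← sub_mul, abs_mul,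
      abs_of_pos (by positivity : 0 < 3 * s)] at h
    have h1 : (1 : ℝ) ≤ |(i : ℝ) - j| := by
      have : (i : ℤ) - j ≠ 0 := by
        intro h; apply hij; apply Fin.ext; omega
      exact_mod_cast Int.one_le_abs this
    exact le_trans (by nlinarith) h
  have hinj : Function.Injective fun i => shift β κ (x i) := by
    intro i j hij
    by_contra hne
    have := hsep i j hne
    have h2 : shift β κ (x i) = shift β κ (x j) := hij
    rw [h2, dist_self] at this
    linarith
  have hmap : ∀ {A : Set X}, MeasurableSet A → ((horoVol n β).map (shift β κ)).real A =
      (horoVol n β).real (shift β κ ⁻¹' A) := fun hA => by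
    rw [measureReal_def, Measure.map_apply hT.measurable hA]; rfl
  set F : Finset X := Finset.univ.map ⟨_, hinj⟩ with hF
  have hFm : ∀ y ∈ F, ∃ i, shift β κ (x i) = y := by simp [F]
  have hδ : 3 * s / 3 = s := by ring
  set B' := ⋃ i, closedBall (shift β κ (x i)) s with hB'
  have hB'm : MeasurableSet B' := MeasurableSet.iUnion fun _ => measurableSet_closedBall
  have hB'B : shift β κ ⁻¹' B' ⊆ B := by
    rw [hB', preimage_iUnion]
    exact iUnion_subset fun i => hB _ (hx i)
  have hcard := card_mul_le_of_separated ((horoVol n β).map (shift β κ)) (B := B') (s := F)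
    (δ := 3 * s) (c := c)
    (by rw [Measure.map_apply hT.measurable hB'm]
        exact ((measure_mono hB'B).trans_lt hBt.lt_top).ne)
    (by
      intro y hy z hz hyz
      obtain ⟨i, rfl⟩ := hFm y hy
      obtain ⟨j, rfl⟩ := hFm z hz
      exact hsep i j fun h => hyz (by rw [h]))
    (by
      intro y hy
      obtain ⟨i, rfl⟩ := hFm y hy
      rw [hδ]
      exact subset_iUnion (fun i => closedBall (shift β κ (x i)) s) i)
    (by
      intro y hy
      obtain ⟨i, rfl⟩ := hFm y hy
      rw [hδ, hmap measurableSet_closedBall]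
      exact hc _ (hx i))
    (by positivity)
  rw [hmap hB'm, hF, Finset.card_map, Finset.card_univ, Fintype.card_fin] at hcard
  have h2 : ((N + 1 : ℕ) : ℝ) * c ≤ C := hcard.trans ((measureReal_mono hB'B hBt).trans hBC)
  have h3 : L ≤ (N + 1 : ℕ) * (3 * s) := by
    rw [← div_le_iff₀ (by positivity), Nat.cast_succ]
    exact (Nat.lt_floor_add_one _).le
  calc L * c ≤ (N + 1 : ℕ) * (3 * s) * c := by gcongr
    _ = 3 * s * ((N + 1 : ℕ) * c) := by ring
    _ ≤ _ := by gcongr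

lemma shift_lipschitz (hκ : 0 ≤ κ) (p : X) (R : ℝ) :
    ∃ C, 0 ≤ C ∧ ∃ ε, 0 < ε ∧ ∀ u ∈ closedBall p R, ∀ v ∈ closedBall p R, dist u v < ε →
      dist (shift β κ u) (shift β κ v) ≤ C * dist u v := by
  obtain ⟨C₂, hC₂, hup⟩ := U.good.ahlfors_upper
  obtain ⟨R', hR'⟩ := (((isCompact_closedBall p (R + 1)).image
    (U.continuous_shift hκ)).isBounded).subset_closedBall p
  obtain ⟨c, hc0, hc⟩ := U.good.ahlfors_lower p R'
  have hp := hgt_pos β p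
  have hmp : ∀ m, 0 < hgt β m := hgt_pos β
  set a := Real.exp (-(R + 1)) * hgt β p with ha
  set b := Real.exp (R + 1) * hgt β p with hb
  have ha0 : 0 < a := by positivity
  have hb0 : 0 < b := by positivity
  set M := Real.exp 1 * (b + κ) with hM
  have hM0 : 0 < M := by positivity
  set C₁ := 1 + Real.exp 1 * (M / a) with hC₁
  have hC₁0 : 0 < C₁ := by positivity
  set c' := (Real.exp (-1) * a) ^ n * c with hc'
  have hc'0 : 0 < c' := by positivity
  set C' := (Real.exp 1 * b) ^ n * (C₂ * C₁ ^ n) with hC'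
  have hC'0 : 0 < C' := by positivity
  refine ⟨3 * C' / c', by positivity, min 1 (min (1 / C₁) (a / 2 / M)), by positivity,
    fun u hu v hv hd => ?_⟩
  set s := dist u v with hsd
  obtain ⟨hs1, hd⟩ := lt_min_iff.1 hd
  obtain ⟨hs2, hs3⟩ := lt_min_iff.1 hd
  rw [lt_div_iff₀' (by positivity)] at hs2 hs3
  rcases (dist_nonneg (x := u) (y := v)).eq_or_lt with h | hs0
  · rw [dist_eq_zero.1 h.symm, dist_self]
    positivity
  rw [← hsd] at hs0
  have hin : ∀ {x}, x ∈ closedBall u s → x ∈ closedBall p (R + 1) := fun {x} hx => by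
    have h1 : dist u p ≤ R := hu
    have h2 : dist x u ≤ s := hx
    rw [mem_closedBall]; linarith [dist_triangle x u p]
  have hab : ∀ {x}, x ∈ closedBall u s → a ≤ hgt β x ∧ hgt β x ≤ b :=
    fun hx => U.horo.hgt_bounds (hin hx)
  have hub : hgt β u ≤ b := (hab (mem_closedBall_self hs0.le)).2
  have hup' := hup u (C₁ * s) (by positivity) hs2.le
  have key := U.dist_shift_mul_le hκ (u := u) (v := v) hs0 (c := c' * s ^ n) (C := C' * s ^ n)
    (B := closedBall u (C₁ * s)) ?_ (U.horoVol_lt_top Subset.rfl).ne ?_ ?_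
    (by positivity)
  · have hsn : 0 < s ^ n := by positivity
    rw [div_mul_eq_mul_div, le_div_iff₀ hc'0]
    refine le_of_mul_le_mul_right ?_ hsn
    rw [← hsd] at key
    calc _ = _ := by ring
      _ ≤ _ := key
      _ = _ := by ring
  · intro x hx
    have h2 : dist x u ≤ s := hx
    obtain ⟨h3, h4⟩ := hab hx
    refine (U.preimage_closedBall_shift_subset hκ ha0 h3 h4 hs0.le hs1.le hs3.le).trans
      (closedBall_subset_closedBall' ?_)
    rw [← hM, hC₁]
    linarith
  · calc _ ≤ (Real.exp (C₁ * s) * hgt β u) ^ n * (μH[(n : ℝ)] : Measure X).real (closedBall u (C₁ * s)) :=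
          U.real_horoVol_le measurableSet_closedBall Subset.rfl
      _ ≤ (Real.exp 1 * b) ^ n * (C₂ * (C₁ * s) ^ n) := by
          have := hmp u
          gcongr
      _ = _ := by rw [hC', mul_pow C₁]; ring
  · intro x hx
    obtain ⟨h3, h4⟩ := hab hx
    rw [U.real_horoVol_closedBall_shift hκ ha0 h3 h4 hs0.le hs1.le hs3.le]
    have h5 := hc _ (hR' ⟨x, hin hx, rfl⟩) s hs0 hs1.le
    have h6 : a ≤ hgt β (shift β κ x) := by rw [U.hgt_shift' hκ]; linarith
    have h7 := hmp (shift β κ x)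
    calc c' * s ^ n = (Real.exp (-1) * a) ^ n * (c * s ^ n) := by rw [hc']; ring
      _ ≤ (Real.exp (-s) * hgt β (shift β κ x)) ^ n *
          (μH[(n : ℝ)] : Measure X).real (closedBall (shift β κ x) s) := by gcongr
      _ ≤ _ := U.le_real_horoVol measurableSet_closedBall Subset.rfl

end Cusp

end

section

/-- If finitely many sets are small compared to `B`, some point of `B` lies in few of them. -/
lemma exists_sum_indicator_le {X : Type*} [MeasurableSpace X] (μ : Measure X) {B : Set X}
    (hBm : MeasurableSet B) {M : ℕ} (hM : 0 < M) {A : ℕ → Set X} {c : ℝ≥0∞} {σ : ℝ}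
    (hA : ∀ j < M, μ (A j) ≤ c) (hc : c < ENNReal.ofReal σ * μ B) :
    ∃ y ∈ B, ∑ j ∈ Finset.range M, (A j).indicator (fun _ => (1 : ℝ)) y ≤ M * σ := by
  by_contra! h
  have h1 : ∀ y ∈ B, ENNReal.ofReal (M * σ) ≤
      ∑ j ∈ Finset.range M, (toMeasurable μ (A j)).indicator (fun _ => (1 : ℝ≥0∞)) y := by
    intro y hy
    refine (ENNReal.ofReal_le_ofReal (h y hy).le).trans ?_
    rw [ENNReal.ofReal_sum_of_nonneg fun j _ => indicator_nonneg (fun _ _ => zero_le_one) _]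
    refine Finset.sum_le_sum fun j _ => ?_
    by_cases hj : y ∈ A j
    · simp [hj, subset_toMeasurable μ (A j) hj]
    · simp [hj]
  have h2 : ENNReal.ofReal (M * σ) * μ B ≤ M * c := calc
    _ = ∫⁻ _ in B, ENNReal.ofReal (M * σ) ∂μ := by simp
    _ ≤ ∫⁻ y in B, ∑ j ∈ Finset.range M,
        (toMeasurable μ (A j)).indicator (fun _ => (1 : ℝ≥0∞)) y ∂μ := setLIntegral_mono' hBm h1
    _ ≤ ∫⁻ y, ∑ j ∈ Finset.range M,
        (toMeasurable μ (A j)).indicator (fun _ => (1 : ℝ≥0∞)) y ∂μ := setLIntegral_le_lintegral _ _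
    _ = ∑ j ∈ Finset.range M, μ (A j) := by
        rw [lintegral_finsetSum _ fun j _ =>
          measurable_const.indicator (measurableSet_toMeasurable _ _)]
        refine Finset.sum_congr rfl fun j _ => ?_
        rw [lintegral_indicator_const (measurableSet_toMeasurable _ _), one_mul, measure_toMeasurable]
    _ ≤ ∑ j ∈ Finset.range M, c := Finset.sum_le_sum fun j hj => hA j (Finset.mem_range.1 hj)
    _ = M * c := by simp
  rw [ENNReal.ofReal_mul (by positivity), ENNReal.ofReal_natCast, mul_assoc] at h2
  exact hc.not_ge ((ENNReal.mul_le_mul_iff_right (by exact_mod_cast hM.ne') (by simp)).1 h2)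

namespace Cusp

variable {X : Type*} [MetricSpace X] [MeasurableSpace X] [BorelSpace X] [ProperSpace X]
  {n : ℕ} {β : X → ℝ} {K κ : ℝ} (U : Cusp n β K)
include U

lemma exists_frac_shift_le (hκ : 0 ≤ κ) {x x' : X} {η r l : ℝ} (hη : 0 < η) (hη1 : η ≤ 1)
    (hr : 0 < r) (hl : 0 < l) (hl1 : l ≤ 1) :
    ∃ y ∈ closedBall x' r, ∃ z, IsFrac x y l z ∧
      (1 - η) * κ * dist (shift β κ z) (shift β κ y) ≤
        (1 + η) * (Real.exp (dist x x' + r) * hgt β x) * (dist x x' + r) + η := by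
  set d := dist x x' with hdd
  have hd0 : 0 ≤ d := dist_nonneg
  set R := d + r with hR
  have hR0 : 0 < R := by positivity
  obtain ⟨θ, hθ, hstep⟩ := U.shift_le_of_good hκ hη hη1 x R
  obtain ⟨C, hC, εL, hεL, hlip⟩ := U.shift_lipschitz hκ x R
  have hbad := U.tendsto_bad hκ hθ x R
  set B := closedBall x' r with hB
  have hBR : B ⊆ closedBall x R := closedBall_subset_closedBall' (by rw [dist_comm, hR, ← hdd]; linarith)
  set σ := η / (4 * κ * C * R + 1) with hσ
  have hσ0 : 0 < σ := by positivity
  have hcR := contrC_pos hR0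
  set Q := ENNReal.ofReal ((contrC R / l) ^ n) with hQ
  have hlim : Tendsto (fun k => Q * (μH[(n : ℝ)] : Measure X) (closedBall x R \ goodSet n β θ κ k))
      atTop (𝓝 (Q * 0)) := ENNReal.Tendsto.const_mul hbad (Or.inr ENNReal.ofReal_ne_top)
  rw [mul_zero] at hlim
  obtain ⟨k, hk⟩ := (hlim.eventually (gt_mem_nhds (a := ENNReal.ofReal σ * μH[(n : ℝ)] B) (b := (0 : ℝ≥0∞))
    (ENNReal.mul_pos (ENNReal.ofReal_pos.2 hσ0).ne' (U.good.closedBall_pos x' hr).ne'))).exists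
  obtain ⟨ε, hε, hgood⟩ := hstep k
  obtain ⟨N, hN⟩ := exists_nat_gt (R / min ε εL)
  have hmin : 0 < min ε εL := lt_min hε hεL
  have hN0 : (0 : ℝ) < N := lt_of_le_of_lt (by positivity) hN
  have hNpos : 0 < N := by exact_mod_cast hN0
  have hNR : R / N < min ε εL := by rwa [div_lt_comm₀ hN0 hmin]
  choose γ hγ h0 h1 using fun y => U.good.geod x y
  set t : ℕ → ℝ := fun j => l + (1 - l) * (j / N) with ht
  have ht01 : ∀ {j}, j < N + 1 → l ≤ t j ∧ t j ≤ 1 := fun {j} hj => by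
    have hj' : (j : ℝ) / N ≤ 1 := (div_le_one hN0).2 (by exact_mod_cast Nat.lt_succ_iff.1 hj)
    have hj0 : 0 ≤ (j : ℝ) / N := by positivity
    constructor <;> simp only [ht] <;> nlinarith
  have hmem : ∀ {j} y, j < N + 1 → t j * dist x y ∈ Icc 0 (dist x y) := fun {j} y hj => by
    have := ht01 hj
    have hy := dist_nonneg (x := x) (y := y)
    exact ⟨mul_nonneg (by linarith) hy, by nlinarith⟩
  set z : ℕ → X → X := fun j y => γ y (t j * dist x y) with hz
  have hfrac : ∀ {j} y, j < N + 1 → IsFrac x y (t j) (z j y) := fun {j} y hj => by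
    have hy := dist_nonneg (x := x) (y := y)
    have h2 := (hγ y).2 0 ⟨le_rfl, hy⟩ _ (hmem y hj)
    have h3 := (hγ y).2 _ (hmem y hj) (dist x y) ⟨hy, le_rfl⟩
    have := hmem y hj
    rw [h0, zero_sub, abs_neg, abs_of_nonneg this.1] at h2
    rw [h1, abs_sub_comm, abs_of_nonneg (by linarith [this.2])] at h3
    exact ⟨h2, by rw [h3]; ring⟩
  have hyR : ∀ {y}, y ∈ B → dist x y ≤ R := fun hy => by rw [dist_comm]; exact hBR hy
  have hzR : ∀ {j y}, j < N + 1 → y ∈ B → z j y ∈ closedBall x R := fun {j y} hj hy => by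
    rw [mem_closedBall, dist_comm, (hfrac y hj).1]
    exact (hmem y hj).2.trans (hyR hy)
  have hA : ∀ j < N + 1, μH[(n : ℝ)] {y ∈ B | z j y ∉ goodSet n β θ κ k} ≤
      Q * μH[(n : ℝ)] (closedBall x R \ goodSet n β θ κ k) := fun j hj => by
    have h2 := ht01 hj
    have h3 : 0 < t j := by linarith
    refine (U.good.cosh.measure_le_of_frac (p := x) (n := n)
      (Z := closedBall x R \ goodSet n β θ κ k) h3 h2.2 hR0
      (fun y hy => hBR hy.1) (fun y hy => ⟨z j y, ⟨hzR hj hy.1, hy.2⟩, hfrac y hj⟩)).trans ?_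
    gcongr
    rw [hQ]
    gcongr
    exact h2.1
  obtain ⟨y, hy, hsum⟩ := exists_sum_indicator_le μH[(n : ℝ)] (B := B) measurableSet_closedBall
    (M := N + 1) (Nat.succ_pos N) hA hk
  refine ⟨y, hy, z 0 y, ?_, ?_⟩
  · have := hfrac (j := 0) y (Nat.succ_pos N)
    simpa [ht] using this
  have hzN : z N y = y := by
    simp only [hz, ht, div_self hN0.ne', mul_one, add_sub_cancel, one_mul]
    exact h1 y
  set I : ℕ → ℝ := fun j => ({y ∈ B | z j y ∉ goodSet n β θ κ k}).indicator (fun _ => (1 : ℝ)) y with hI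
  have hI0 : ∀ j, 0 ≤ I j := fun j => indicator_nonneg (fun _ _ => zero_le_one) _
  set g := (1 + η) * (Real.exp (d + r) * hgt β x) with hg
  have hg0 : 0 ≤ g := by have := hgt_pos β x; positivity
  have hone : ∀ j < N, (1 - η) * κ * dist (shift β κ (z j y)) (shift β κ (z (j + 1) y)) ≤
      g * (R / N) + (I j + I (j + 1)) * (κ * (C * (R / N))) := by
    intro j hj
    have j1 : j < N + 1 := by omega
    have j2 : j + 1 < N + 1 := by omega
    have hdz : dist (z j y) (z (j + 1) y) ≤ R / N := by
      have h2 := (hγ y).2 _ (hmem y j1) _ (hmem y j2)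
      have h3 := hyR hy
      have h4 := dist_nonneg (x := x) (y := y)
      have h5 : t j * dist x y - t (j + 1) * dist x y = - ((1 - l) * dist x y / N) := by
        simp only [ht, Nat.cast_succ]; ring
      have h6 : 0 ≤ 1 - l := by linarith
      rw [h5, abs_neg, abs_of_nonneg (by positivity)] at h2
      rw [hz]
      simp only
      rw [h2]
      gcongr
      nlinarith
    have hdz' := hdz.trans_lt hNR
    have hz1 := hzR j1 hy
    have hz2 := hzR j2 hy
    have hC' : 0 ≤ κ * (C * (R / N)) := by positivity
    have hD := dist_nonneg (x := shift β κ (z j y)) (y := shift β κ (z (j + 1) y))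
    by_cases hb : z j y ∈ goodSet n β θ κ k ∧ z (j + 1) y ∈ goodSet n β θ κ k
    · have h2 := hgood _ hz1 _ hz2 hb.1 hb.2 (hdz'.trans_le (min_le_left _ _))
      have h3 := (U.horo.hgt_bounds hz1).2
      have h4 := hgt_pos β (z j y)
      have h6 := h4.le.trans h3
      have h5 : 0 ≤ 1 - η := by linarith
      calc (1 - η) * κ * dist (shift β κ (z j y)) (shift β κ (z (j + 1) y))
          ≤ (1 - η) * ((hgt β (z j y) + κ) * dist (shift β κ (z j y)) (shift β κ (z (j + 1) y))) := by
            rw [mul_assoc]; gcongr; linarith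
        _ ≤ _ := h2
        _ ≤ (1 + η) * ((Real.exp (d + r) * hgt β x) * (R / N)) := by gcongr
        _ = g * (R / N) := by rw [hg]; ring
        _ ≤ _ := le_add_of_nonneg_right (mul_nonneg (add_nonneg (hI0 _) (hI0 _)) hC')
    · have h2 : 1 ≤ I j + I (j + 1) := by
        rw [not_and_or] at hb
        rcases hb with hb | hb
        · have : I j = 1 := indicator_of_mem (by exact ⟨hy, hb⟩) _
          linarith [hI0 (j + 1)]
        · have : I (j + 1) = 1 := indicator_of_mem (by exact ⟨hy, hb⟩) _
          linarith [hI0 j]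
      have h3 := hlip _ hz1 _ hz2 (hdz'.trans_le (min_le_right _ _))
      calc (1 - η) * κ * dist (shift β κ (z j y)) (shift β κ (z (j + 1) y))
          ≤ 1 * κ * (C * dist (z j y) (z (j + 1) y)) := by gcongr; linarith
        _ ≤ 1 * (κ * (C * (R / N))) := by rw [mul_assoc]; gcongr
        _ ≤ (I j + I (j + 1)) * (κ * (C * (R / N))) := by gcongr
        _ ≤ _ := le_add_of_nonneg_left (by positivity)
  have htel := dist_le_range_sum_dist (fun j => shift β κ (z j y)) N
  simp only [hzN] at htel
  have h5 : 0 ≤ (1 - η) * κ := mul_nonneg (by linarith) hκ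
  have hS1 : ∑ j ∈ Finset.range N, I j ≤ (N + 1 : ℕ) * σ := by
    rw [Finset.sum_range_succ] at hsum
    linarith [hI0 N]
  have hS2 : ∑ j ∈ Finset.range N, I (j + 1) ≤ (N + 1 : ℕ) * σ := by
    rw [Finset.sum_range_succ'] at hsum
    linarith [hI0 0]
  have hN1 : ((N + 1 : ℕ) : ℝ) ≤ 2 * N := by
    have : (1 : ℝ) ≤ N := by exact_mod_cast hNpos
    push_cast; linarith
  calc _ ≤ (1 - η) * κ * ∑ j ∈ Finset.range N, dist (shift β κ (z j y)) (shift β κ (z (j + 1) y)) := by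
        gcongr
    _ ≤ ∑ j ∈ Finset.range N, (g * (R / N) + (I j + I (j + 1)) * (κ * (C * (R / N)))) := by
        rw [Finset.mul_sum]
        exact Finset.sum_le_sum fun j hj => hone j (Finset.mem_range.1 hj)
    _ = g * R + (∑ j ∈ Finset.range N, I j + ∑ j ∈ Finset.range N, I (j + 1)) * (κ * (C * (R / N))) := by
        rw [Finset.sum_add_distrib, Finset.sum_const, ← Finset.sum_mul, Finset.sum_add_distrib,
          Finset.card_range, nsmul_eq_mul]
        field_simp
    _ ≤ g * R + (2 * N * σ + 2 * N * σ) * (κ * (C * (R / N))) := by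
        have := mul_le_mul_of_nonneg_right hN1 hσ0.le
        gcongr <;> linarith
    _ = g * R + (4 * κ * C * R) * σ := by field_simp; ring
    _ ≤ g * R + η := by
        have : (4 * κ * C * R) * σ ≤ η := by
          rw [hσ, mul_div_assoc', div_le_iff₀ (by positivity)]
          nlinarith
        linarith

/-- The shift contracts at least as in the warped product model. -/
lemma mul_dist_shift_le (hκ : 0 ≤ κ) (x x' : X) :
    κ * dist (shift β κ x) (shift β κ x') ≤ Real.exp (dist x x') * hgt β x * dist x x' := by
  set e : ℕ → ℝ := fun m => 1 / ((m : ℝ) + 1) with he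
  have he0 : ∀ m, 0 < e m := fun m => by positivity
  have he1 : ∀ m, e m ≤ 1 := fun m => by
    rw [he]; simp only
    rw [div_le_one (by positivity)]
    linarith [Nat.cast_nonneg (α := ℝ) m]
  choose y hy z hz h using fun m => U.exists_frac_shift_le hκ (x := x) (x' := x') (he0 m) (he1 m)
    (he0 m) (he0 m) (he1 m)
  have helim : Tendsto e atTop (𝓝 0) := tendsto_one_div_add_atTop_nhds_zero_nat
  have hyl : Tendsto y atTop (𝓝 x') :=
    tendsto_iff_dist_tendsto_zero.2 (squeeze_zero (fun _ => dist_nonneg) hy helim)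
  have hzl : Tendsto z atTop (𝓝 x) := by
    rw [tendsto_iff_dist_tendsto_zero]
    have : Tendsto (fun m => e m * dist x (y m)) atTop (𝓝 (0 * dist x x')) :=
      helim.mul (tendsto_const_nhds.dist hyl)
    rw [zero_mul] at this
    refine this.congr fun m => ?_
    exact (hz m).1.symm.trans (dist_comm _ _)
  have hT := U.continuous_shift hκ
  have hl := ((tendsto_const_nhds (x := (1 : ℝ)).sub helim).mul_const κ).mul
    (((hT.tendsto x).comp hzl).dist ((hT.tendsto x').comp hyl))
  have hd := (tendsto_const_nhds (x := dist x x')).add helim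
  have hr := (((tendsto_const_nhds (x := (1 : ℝ)).add helim).mul
    (((Real.continuous_exp.tendsto _).comp hd).mul_const (hgt β x))).mul hd).add helim
  have := le_of_tendsto_of_tendsto' hl hr h
  simpa using this

end Cusp

end

section

/-- The distance of the projections to the boundary at height zero, as seen from large heights. -/
noncomputable def horoDist {X : Type*} [MetricSpace X] (β : X → ℝ) (x y : X) : ℝ :=
  ⨆ m : ℕ, gap β (lev β x (m + 1)) (lev β y (m + 1))

lemma one_add_sq_le_cosh (a : ℝ) : 1 + a ^ 2 / 2 ≤ Real.cosh a := by
  wlog ha : 0 ≤ a with H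
  · simpa using H (-a) (by linarith)
  have h := Real.self_le_sinh_iff.2 (by linarith : 0 ≤ a / 2)
  have h2 : (a / 2) ^ 2 ≤ Real.sinh (a / 2) ^ 2 := pow_le_pow_left₀ (by linarith) h 2
  rw [cosh_eq_half]
  linarith

namespace Cusp

variable {X : Type*} [MetricSpace X] [MeasurableSpace X] [BorelSpace X] [ProperSpace X]
  {n : ℕ} {β : X → ℝ} {K : ℝ} (U : Cusp n β K)
include U

lemma gap_lev_sq (x y : X) {t : ℝ} (ht : 0 < t) :
    gap β (lev β x t) (lev β y t) ^ 2 = defect β (lev β x t) (lev β y t) := by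
  rw [gap, U.hgt_lev x ht, U.hgt_lev y ht, sub_self, zero_pow two_ne_zero, add_zero,
    Real.sq_sqrt (U.horo.defect_nonneg _ _)]

lemma gap_lev_mono (x y : X) {s t : ℝ} (hs : 0 < s) (hst : s ≤ t) :
    gap β (lev β x s) (lev β y s) ≤ gap β (lev β x t) (lev β y t) := by
  refine le_of_sq_le_sq ?_ (gap_nonneg _ _)
  rw [U.gap_lev_sq x y hs, U.gap_lev_sq x y (hs.trans_le hst)]
  exact U.defect_lev_mono x y hs hst hs hst

lemma gap_lev_sq_add_le (x y : X) {t : ℝ} (ht : 0 < t) {A : ℝ}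
    (hA : A = Real.exp (dist x y) * hgt β x * dist x y) :
    gap β (lev β x t) (lev β y t) ^ 2 + (hgt β x - hgt β y) ^ 2 ≤
      (Real.exp (A / t) * ((1 + hgt β x / t) * A)) ^ 2 := by
  have hx := hgt_pos β x
  have hy := hgt_pos β y
  have h1 := U.mul_dist_shift_le ht.le x y
  rw [← hA] at h1
  have h2 := U.horo.gap_le (shift β t x) (shift β t y)
  have hs : gap β (shift β t x) (shift β t y) ^ 2 =
      defect β (shift β t x) (shift β t y) + (hgt β x - hgt β y) ^ 2 := by
    rw [gap_sq, hgt_mul_sinh_sq, U.hgt_shift' ht.le, U.hgt_shift' ht.le]; ring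
  have h3 := U.defect_lev_mono x y ht (by linarith : t ≤ hgt β x + t) ht
    (by linarith : t ≤ hgt β y + t)
  rw [U.gap_lev_sq x y ht]
  change _ ≤ defect β (shift β t x) (shift β t y) at h3
  set d := dist (shift β t x) (shift β t y) with hd
  have hd0 : 0 ≤ d := dist_nonneg
  have h4 : d ≤ A / t := by rw [le_div_iff₀ ht]; linarith
  have h5 : gap β (shift β t x) (shift β t y) ≤ Real.exp (A / t) * ((1 + hgt β x / t) * A) := by
    refine h2.trans ?_
    rw [U.hgt_shift' ht.le]
    calc _ ≤ Real.exp (A / t) * ((hgt β x + t) * (A / t)) := by gcongr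
      _ = _ := by field_simp; ring
  have h6 := pow_le_pow_left₀ (gap_nonneg _ _) h5 2
  linarith

lemma tendsto_horoDist (x y : X) : Tendsto
    (fun m : ℕ => gap β (lev β x (m + 1)) (lev β y (m + 1))) atTop (𝓝 (horoDist β x y)) := by
  set A := Real.exp (dist x y) * hgt β x * dist x y with hA
  have hx := hgt_pos β x
  have hA0 : 0 ≤ A := by positivity
  refine tendsto_atTop_ciSup (fun m k hmk => U.gap_lev_mono x y (by positivity) (by gcongr)) ?_
  refine ⟨Real.exp (A / 1) * ((1 + hgt β x / 1) * A), ?_⟩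
  rintro _ ⟨m, rfl⟩
  have hm : (1 : ℝ) ≤ m + 1 := by linarith [Nat.cast_nonneg (α := ℝ) m]
  have h := U.gap_lev_sq_add_le x y (zero_lt_one.trans_le hm) hA
  refine (le_of_sq_le_sq (le_trans ?_ h) (by positivity)).trans (by gcongr)
  exact le_add_of_nonneg_right (sq_nonneg _)

lemma gap_lev_le_horoDist (x y : X) {t : ℝ} (ht : 0 < t) :
    gap β (lev β x t) (lev β y t) ≤ horoDist β x y := by
  refine ge_of_tendsto (U.tendsto_horoDist x y) ?_
  filter_upwards [eventually_ge_atTop ⌈t⌉₊] with m hm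
  refine U.gap_lev_mono x y ht ?_
  have : (⌈t⌉₊ : ℝ) ≤ m := by exact_mod_cast hm
  linarith [Nat.le_ceil t]

omit U in
lemma tendsto_nat_add_one : Tendsto (fun m : ℕ => (m : ℝ) + 1) atTop atTop :=
  tendsto_atTop_add_const_right _ _ tendsto_natCast_atTop_atTop

lemma horoDist_sq_add_le (x y : X) : horoDist β x y ^ 2 + (hgt β x - hgt β y) ^ 2 ≤
    (Real.exp (dist x y) * hgt β x * dist x y) ^ 2 := by
  set A := Real.exp (dist x y) * hgt β x * dist x y with hA
  have h1 := ((U.tendsto_horoDist x y).pow 2).add_const ((hgt β x - hgt β y) ^ 2)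
  have f : ∀ c : ℝ, Tendsto (fun m : ℕ => c / ((m : ℝ) + 1)) atTop (𝓝 0) := fun c =>
    tendsto_nat_add_one.const_div_atTop c
  have h2 := (((Real.continuous_exp.tendsto _).comp (f A)).mul
    (((tendsto_const_nhds (x := (1 : ℝ))).add (f (hgt β x))).mul_const A)).pow 2
  have := le_of_tendsto_of_tendsto' h1 h2 fun m => U.gap_lev_sq_add_le x y (by positivity) hA
  simpa using this

lemma horoDist_nonneg (x y : X) : 0 ≤ horoDist β x y :=
  (gap_nonneg _ _).trans (U.gap_lev_le_horoDist x y one_pos)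

lemma tendsto_mul_dist_lev (x y : X) : Tendsto
    (fun m : ℕ => ((m : ℝ) + 1) * dist (lev β x (m + 1)) (lev β y (m + 1))) atTop
    (𝓝 (horoDist β x y)) := by
  set B := horoDist β x y with hB
  have hB0 : 0 ≤ B := U.horoDist_nonneg x y
  have hpos : ∀ m : ℕ, (0 : ℝ) < m + 1 := fun m => by positivity
  have hd0 : Tendsto (fun m : ℕ => dist (lev β x (m + 1)) (lev β y (m + 1))) atTop (𝓝 0) := by
    refine squeeze_zero' (.of_forall fun _ => dist_nonneg) ?_
      (tendsto_nat_add_one.const_div_atTop (Real.exp 1 * B))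
    filter_upwards [tendsto_nat_add_one.eventually_ge_atTop (2 * B)] with m hm
    have h1 := U.gap_lev_le_horoDist x y (hpos m)
    have h2 := U.horo.dist_le_of_gap h1 (by rw [U.hgt_lev x (hpos m)]; linarith)
    rw [U.hgt_lev x (hpos m)] at h2
    rw [le_div_iff₀' (hpos m)]
    refine h2.trans ?_
    gcongr
    rw [div_le_one (hpos m)]
    linarith
  have hg := U.tendsto_horoDist x y
  have l1 := ((Real.continuous_exp.tendsto _).comp hd0.neg).mul hg
  have l2 := ((Real.continuous_exp.tendsto _).comp (hd0.div_const 2)).mul hg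
  simp only [neg_zero, zero_div, Real.exp_zero, one_mul] at l1 l2
  refine tendsto_of_tendsto_of_tendsto_of_le_of_le l1 l2 (fun m => ?_) fun m => ?_
  · have := U.horo.gap_le (lev β x (m + 1)) (lev β y (m + 1))
    rw [U.hgt_lev x (hpos m)] at this
    simp only [Function.comp]
    rwa [Real.exp_neg, inv_mul_le_iff₀ (Real.exp_pos _)]
  · have := U.horo.le_gap (lev β x (m + 1)) (lev β y (m + 1))
    rwa [U.hgt_lev x (hpos m)] at this

lemma horoDist_triangle (x y z : X) : horoDist β x z ≤ horoDist β x y + horoDist β y z := by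
  refine le_of_tendsto_of_tendsto' (U.tendsto_mul_dist_lev x z)
    ((U.tendsto_mul_dist_lev x y).add (U.tendsto_mul_dist_lev y z)) fun m => ?_
  rw [← mul_add]
  gcongr
  exact dist_triangle _ _ _

lemma horoDist_le_sum (c : ℕ → X) (N : ℕ) :
    horoDist β (c 0) (c N) ≤ ∑ i ∈ Finset.range N, horoDist β (c i) (c (i + 1)) := by
  induction N with
  | zero =>
    have := U.horoDist_sq_add_le (c 0) (c 0)
    simp only [dist_self, mul_zero, sub_self] at this
    simp only [Finset.range_zero, Finset.sum_empty]
    nlinarith [U.horoDist_nonneg (c 0) (c 0)]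
  | succ N ih =>
    rw [Finset.sum_range_succ]
    linarith [U.horoDist_triangle (c 0) (c N) (c (N + 1))]

/-- Development of a chain of points into the hyperbolic plane. -/
lemma horoDist_sq_le_cosh (c : ℕ → X) (N : ℕ) {s : ℝ} (hs : ∀ i < N, dist (c i) (c (i + 1)) = s) :
    horoDist β (c 0) (c N) ^ 2 + (hgt β (c 0) - hgt β (c N)) ^ 2 ≤
      2 * hgt β (c 0) * hgt β (c N) * (Real.cosh (N * (Real.exp (2 * s) * s)) - 1) := by
  have hp : ∀ z, 0 < hgt β z := hgt_pos β
  set S : ℕ → ℝ := fun i => ∑ j ∈ Finset.range i, horoDist β (c j) (c (j + 1)) with hS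
  set z : ℕ → UpperHalfPlane := fun i => ⟨⟨S i, hgt β (c i)⟩, hp _⟩ with hz
  have hcosh : ∀ i j, Real.cosh (dist (z i) (z j)) =
      1 + ((S i - S j) ^ 2 + (hgt β (c i) - hgt β (c j)) ^ 2) / (2 * hgt β (c i) * hgt β (c j)) := by
    intro i j
    have := hp (c i)
    have := hp (c j)
    rw [UpperHalfPlane.cosh_dist']
    change ((S i - S j) ^ 2 + hgt β (c i) ^ 2 + hgt β (c j) ^ 2) / (2 * hgt β (c i) * hgt β (c j)) = _
    field_simp
    ring
  have hone : ∀ i ∈ Finset.range N, dist (z i) (z (i + 1)) ≤ Real.exp (2 * s) * s := by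
    intro i hi
    have hi' := hs i (Finset.mem_range.1 hi)
    have hs0 : 0 ≤ s := hi' ▸ dist_nonneg
    have hq0 : 0 ≤ Real.exp (2 * s) * s := by positivity
    have h1 := U.horoDist_sq_add_le (c i) (c (i + 1))
    have h2 := U.horo.hgt_le (c (i + 1)) (c i)
    rw [dist_comm] at h2
    rw [hi'] at h1 h2
    have p1 := hp (c i)
    have p2 := hp (c (i + 1))
    have h3 : (Real.exp s * hgt β (c i) * s) ^ 2 ≤
        (Real.exp (2 * s) * s) ^ 2 * (hgt β (c i) * hgt β (c (i + 1))) := calc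
      _ = (Real.exp s * s) ^ 2 * hgt β (c i) * (1 * hgt β (c i)) := by ring
      _ ≤ (Real.exp s * s) ^ 2 * hgt β (c i) *
          (Real.exp s * (Real.exp s * hgt β (c (i + 1)))) := by
        have := Real.one_le_exp hs0
        gcongr
      _ = _ := by rw [two_mul, Real.exp_add]; ring
    have h4 : Real.cosh (dist (z i) (z (i + 1))) ≤ Real.cosh (Real.exp (2 * s) * s) := by
      refine le_trans ?_ (one_add_sq_le_cosh _)
      have h5 : S i - S (i + 1) = -horoDist β (c i) (c (i + 1)) := by
        simp only [hS, Finset.sum_range_succ]; ring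
      rw [hcosh, h5, neg_sq]
      gcongr 1 + ?_
      rw [div_le_div_iff₀ (by positivity) two_pos]
      linarith
    rwa [Real.cosh_le_cosh, abs_of_nonneg dist_nonneg, abs_of_nonneg hq0] at h4
  have h1 := (dist_le_range_sum_dist z N).trans (Finset.sum_le_sum hone)
  rw [Finset.sum_const, Finset.card_range, nsmul_eq_mul] at h1
  have h2 : Real.cosh (dist (z 0) (z N)) ≤ Real.cosh (N * (Real.exp (2 * s) * s)) := by
    rw [Real.cosh_le_cosh, abs_of_nonneg dist_nonneg]
    exact h1.trans (le_abs_self _)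
  have h3 : S 0 - S N = -S N := by simp [hS]
  have h4 : horoDist β (c 0) (c N) ^ 2 ≤ S N ^ 2 :=
    pow_le_pow_left₀ (U.horoDist_nonneg _ _) (U.horoDist_le_sum c N) 2
  have p1 := hp (c 0)
  have p2 := hp (c N)
  rw [hcosh, h3, neg_sq, ← le_sub_iff_add_le', div_le_iff₀ (by positivity)] at h2
  linarith

lemma horoDist_sq (x y : X) : horoDist β x y ^ 2 = defect β x y := by
  apply le_antisymm
  · obtain ⟨γ, ⟨-, hγ⟩, h0, h1⟩ := U.good.geod x y
    set d := dist x y with hd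
    have hd0 : 0 ≤ d := dist_nonneg
    have key : ∀ m : ℕ, horoDist β x y ^ 2 + (hgt β x - hgt β y) ^ 2 ≤
        2 * hgt β x * hgt β y * (Real.cosh (Real.exp (2 * d / ((m : ℝ) + 1)) * d) - 1) := by
      intro m
      have hm : (0 : ℝ) < m + 1 := by positivity
      have hmem : ∀ i : ℕ, i ≤ m + 1 → (i : ℝ) * (d / (m + 1)) ∈ Icc 0 d := fun i hi => by
        refine ⟨by positivity, ?_⟩
        rw [mul_div_assoc', div_le_iff₀ hm, mul_comm d]
        gcongr
        exact_mod_cast hi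
      have := U.horoDist_sq_le_cosh (fun i => γ (i * (d / (m + 1)))) (m + 1) (s := d / (m + 1))
        fun i hi => by
          rw [hγ _ (hmem i hi.le) _ (hmem (i + 1) hi), Nat.cast_succ, add_mul, sub_add_cancel_left,
            abs_neg, one_mul, abs_of_nonneg (by positivity)]
      have e1 : (m + 1) * (d / (m + 1)) = d := by field_simp
      simp only [Nat.cast_zero, zero_mul, h0, Nat.cast_succ, e1, h1] at this
      rwa [mul_left_comm, e1, mul_div_assoc'] at this
    have l := (((Real.continuous_cosh.tendsto _).comp ((((Real.continuous_exp.tendsto _).comp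
      (tendsto_nat_add_one.const_div_atTop (2 * d))).mul_const d))).sub_const 1).const_mul
        (2 * hgt β x * hgt β y)
    have h2 := ge_of_tendsto' l key
    rw [Real.exp_zero, one_mul] at h2
    have h3 := hgt_mul_sinh_sq (β := β) x y
    rw [← cosh_sub_one_eq, ← hd] at h3
    linarith
  · have hx := hgt_pos β x
    have hy := hgt_pos β y
    have h := U.defect_lev_mono x y hx (le_max_left _ (hgt β y)) hy (le_max_right (hgt β x) _)
    have ht : 0 < max (hgt β x) (hgt β y) := lt_max_of_lt_left hx
    rw [U.lev_self, U.lev_self, ← U.gap_lev_sq x y ht] at h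
    exact h.trans (pow_le_pow_left₀ (gap_nonneg _ _) (U.gap_lev_le_horoDist x y ht) 2)

lemma horoDist_lev (x y : X) {s t : ℝ} (hs : 0 < s) (ht : 0 < t) :
    horoDist β (lev β x s) (lev β y t) = horoDist β x y := by
  unfold horoDist
  congr 1 with m
  rw [U.lev_lev x hs (by positivity), U.lev_lev y ht (by positivity)]

lemma cosh_dist (x y : X) : Real.cosh (dist x y) =
    Real.cosh (β x - β y) + Real.exp (β x + β y) * horoDist β x y ^ 2 / 2 := by
  rw [U.horoDist_sq, defect]
  have : Real.exp (β x + β y) * hgt β x * hgt β y = 1 := by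
    rw [hgt, hgt, ← Real.exp_add, ← Real.exp_add]; simp
  linear_combination (Real.cosh (β x - β y) - Real.cosh (dist x y)) * this

end Cusp

end

section

namespace Cusp

variable {X : Type*} [MetricSpace X] [MeasurableSpace X] [BorelSpace X] [ProperSpace X]
  {n : ℕ} {β : X → ℝ} {K : ℝ} (U : Cusp n β K)
include U

lemma gap_sq_eq (x y : X) :
    gap β x y ^ 2 = horoDist β x y ^ 2 + (hgt β x - hgt β y) ^ 2 := by
  rw [gap_sq, hgt_mul_sinh_sq, U.horoDist_sq]

lemma horoDist_le_gap (x y : X) : horoDist β x y ≤ gap β x y := by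
  refine le_of_sq_le_sq ?_ (gap_nonneg _ _)
  rw [U.gap_sq_eq]
  exact le_add_of_nonneg_right (sq_nonneg _)

lemma horoDist_comm (x y : X) : horoDist β x y = horoDist β y x := by
  have h : horoDist β x y ^ 2 = horoDist β y x ^ 2 := by
    rw [U.horoDist_sq, U.horoDist_sq, defect_comm]
  exact (pow_left_inj₀ (U.horoDist_nonneg _ _) (U.horoDist_nonneg _ _) two_ne_zero).1 h

lemma continuous_horoDist (p : X) : Continuous (horoDist β p) := by
  have h : horoDist β p = fun y => √(gap β p y ^ 2 - (hgt β p - hgt β y) ^ 2) := by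
    ext y
    rw [U.gap_sq_eq, add_sub_cancel_right, Real.sqrt_sq (U.horoDist_nonneg _ _)]
  rw [h]
  have h1 := U.horo.continuous_gap.comp (continuous_const.prodMk continuous_id : Continuous
    fun y : X => (p, y))
  have h2 := U.horo.continuous_hgt
  exact ((h1.pow 2).sub ((continuous_const.sub h2).pow 2)).sqrt

variable {p y z : X} {R : ℝ}

lemma mul_dist_le_of_far (hR : 1 ≤ R) (hκ : 8 * (R + 3) ^ 2 ≤ hgt β p)
    (hy : |hgt β p - hgt β y| ≤ 1) (hD : horoDist β p y ≤ R + 1) :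
    hgt β p * dist p y ≤ 2 * (R + 3) ∧ (R + 3) * dist p y ≤ 1 / 4 ∧
      gap β p y ≤ horoDist β p y + 1 := by
  have hp := hgt_pos β p
  have hD0 := U.horoDist_nonneg p y
  have hg : gap β p y ≤ horoDist β p y + 1 := by
    refine le_of_sq_le_sq ?_ (by positivity)
    rw [U.gap_sq_eq]
    nlinarith [sq_le_one_iff_abs_le_one (hgt β p - hgt β y) |>.2 hy]
  have h1 := U.horo.dist_le_of_gap (q := R + 3) (by linarith : gap β p y ≤ R + 3)
    (by nlinarith)
  have h2 : Real.exp ((R + 3) / hgt β p) ≤ 2 := by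
    have h : (R + 3) / hgt β p ≤ 1 / 2 := by
      rw [div_le_iff₀ hp]; nlinarith
    have h3 : Real.exp (1 / 2) ≤ 2 := by
      have := Real.abs_exp_sub_one_le (x := 1 / 2) (by norm_num [abs_of_pos])
      rw [abs_of_pos (by norm_num : (0 : ℝ) < 1 / 2)] at this
      linarith [le_abs_self (Real.exp (1 / 2) - 1)]
    exact (Real.exp_le_exp.2 h).trans h3
  have h3 : hgt β p * dist p y ≤ 2 * (R + 3) :=
    h1.trans (mul_le_mul_of_nonneg_right h2 (by linarith))
  refine ⟨h3, ?_, hg⟩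
  have h4 := (mul_le_mul_of_nonneg_right hκ (dist_nonneg (x := p) (y := y))).trans h3
  have h5 : (R + 3) * (8 * ((R + 3) * dist p y) - 2) ≤ 0 := by linarith
  have := nonpos_of_mul_nonpos_right h5 (by linarith)
  linarith

/-- Where a point of a geodesic between two very high points lies. -/
lemma horoDist_frac_of_far (hR : 5 ≤ R) (hκ : 8 * (R + 3) ^ 2 ≤ hgt β p)
    (hy : |hgt β p - hgt β y| ≤ 1) (hD : |horoDist β p y - R| ≤ 1) {l : ℝ} (hl : 1 / 2 ≤ l)
    (hl1 : l ≤ 1) (hz : IsFrac p y l z) :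
    |horoDist β p z - l * R| ≤ 3 ∧ (hgt β z - hgt β p) ^ 2 ≤ 4 * (R + 3) := by
  obtain ⟨hz1, hz2⟩ := hz
  rw [abs_le] at hD
  obtain ⟨h1, h2, h3⟩ := U.mul_dist_le_of_far (by linarith : 1 ≤ R) hκ hy (by linarith)
  have hp := hgt_pos β p
  set d := dist p y with hd
  have hd0 : 0 ≤ d := dist_nonneg
  have hl0 : 0 ≤ 1 - l := by linarith
  set S := Real.exp d * (hgt β p * d) with hS
  have g1 : gap β p z ≤ l * S := by
    refine (U.horo.gap_le p z).trans ?_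
    rw [hz1, hS, mul_left_comm l, mul_left_comm l]
    gcongr
    nlinarith
  have g2 : gap β z y ≤ (1 - l) * S := by
    refine (U.horo.gap_le z y).trans ?_
    have := U.horo.hgt_le p z
    rw [hz1] at this
    rw [hz2]
    calc _ ≤ Real.exp ((1 - l) * d) * (Real.exp (l * d) * hgt β p * ((1 - l) * d)) := by gcongr
      _ = Real.exp ((1 - l) * d + l * d) * (hgt β p * ((1 - l) * d)) := by
        rw [Real.exp_add]; ring
      _ = _ := by rw [hS]; ring_nf
  have hS1 : S ≤ horoDist β p y + 2 := by
    have hg := U.horo.le_gap p y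
    rw [← hd] at hg
    have e1 : Real.exp d * Real.exp (d / 2) ≤ 1 + 4 * d := by
      rw [← Real.exp_add]
      have h2d : |2 * d| ≤ 1 := by rw [abs_of_nonneg (by linarith)]; nlinarith
      have := Real.abs_exp_sub_one_le h2d
      rw [abs_of_nonneg (by linarith : 0 ≤ 2 * d)] at this
      have h5 := Real.exp_le_exp.2 (by linarith : d + d / 2 ≤ 2 * d)
      linarith [le_abs_self (Real.exp (2 * d) - 1)]
    calc S ≤ Real.exp d * (Real.exp (d / 2) * gap β p y) := by rw [hS]; gcongr
      _ = Real.exp d * Real.exp (d / 2) * gap β p y := by ring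
      _ ≤ (1 + 4 * d) * gap β p y := mul_le_mul_of_nonneg_right e1 (gap_nonneg _ _)
      _ = gap β p y + 4 * d * gap β p y := by ring
      _ ≤ (horoDist β p y + 1) + 4 * d * (R + 3) := by gcongr; linarith
      _ ≤ _ := by linarith
  have t := U.horoDist_triangle p z y
  have k1 := U.horoDist_le_gap p z
  have k2 := U.horoDist_le_gap z y
  have hlow : l * S - 2 ≤ horoDist β p z := by linarith
  have hSlow : horoDist β p y ≤ S := by linarith
  refine ⟨?_, ?_⟩
  · rw [abs_le]
    constructor <;> nlinarith
  · have e := U.gap_sq_eq p z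
    have e1 : gap β p z ^ 2 ≤ (l * S) ^ 2 := pow_le_pow_left₀ (gap_nonneg _ _) g1 2
    have e2 : (l * S - 2) ^ 2 ≤ horoDist β p z ^ 2 := pow_le_pow_left₀ (by nlinarith) hlow 2
    have e3 : l * S ≤ 1 * S := by gcongr
    rw [← neg_sub, neg_sq]
    nlinarith

end Cusp

end

section

namespace Cusp

variable {X : Type*} [MetricSpace X] [MeasurableSpace X] [BorelSpace X] [ProperSpace X]
  {n : ℕ} {β : X → ℝ} {K : ℝ} (U : Cusp n β K)
include U

lemma horoDist_lev_left (x y : X) {t : ℝ} (ht : 0 < t) :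
    horoDist β (lev β x t) y = horoDist β x y := by
  conv_lhs => rw [← U.lev_self y]
  exact U.horoDist_lev x y ht (hgt_pos β y)

lemma horoDist_lev_right (x y : X) {t : ℝ} (ht : 0 < t) :
    horoDist β x (lev β y t) = horoDist β x y := by
  rw [U.horoDist_comm, U.horoDist_lev_left y x ht, U.horoDist_comm]

lemma horoVol_le_of_far (o x : X) {R : ℝ} (hR : 5 ≤ R) (hx : horoDist β o x = R) {l : ℝ}
    (hl : 1 / 2 ≤ l) (hl1 : l ≤ 1) :
    horoVol n β {y | (1 ≤ hgt β y ∧ hgt β y ≤ 2) ∧ horoDist β o y ≤ 1} ≤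
      ENNReal.ofReal ((8 * contrC 1) ^ n) * horoVol n β {z | |horoDist β x z - l * R| ≤ 3 ∧
        (hgt β z - 8 * (R + 3) ^ 2) ^ 2 ≤ 4 * (R + 3)} := by
  set κ := 8 * (R + 3) ^ 2 with hκ
  have hκ0 : 512 ≤ κ := by nlinarith
  set B : Set X := {y | (κ ≤ hgt β y ∧ hgt β y ≤ κ + 1) ∧ horoDist β o y ≤ 1} with hB
  set W : Set X := {z | |horoDist β x z - l * R| ≤ 3 ∧ (hgt β z - κ) ^ 2 ≤ 4 * (R + 3)} with hW
  have hcont := U.horo.continuous_hgt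
  have hBm : MeasurableSet B := (((isClosed_le continuous_const hcont).inter
    (isClosed_le hcont continuous_const)).inter
      (isClosed_le (U.continuous_horoDist o) continuous_const)).measurableSet
  have hWm : MeasurableSet W := ((isClosed_le (((U.continuous_horoDist x).sub
    continuous_const).abs) continuous_const).inter
      (isClosed_le ((hcont.sub continuous_const).pow 2) continuous_const)).measurableSet
  have hC := contrC_pos one_pos
  set p := lev β x κ with hp
  have hpκ : hgt β p = κ := U.hgt_lev x (by linarith)
  have hpD : ∀ y, horoDist β p y = horoDist β x y := fun y =>
    U.horoDist_lev_left x y (by linarith)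
  have hyB : ∀ y ∈ B, |hgt β p - hgt β y| ≤ 1 ∧ |horoDist β p y - R| ≤ 1 := by
    rintro y ⟨⟨h1, h2⟩, h3⟩
    rw [hpD, hpκ]
    have t1 := U.horoDist_triangle o y x
    have t2 := U.horoDist_triangle x o y
    rw [U.horoDist_comm y x] at t1
    rw [U.horoDist_comm x o] at t2
    constructor <;> rw [abs_le] <;> constructor <;> linarith
  have e1 : horoVol n β {y | (1 ≤ hgt β y ∧ hgt β y ≤ 2) ∧ horoDist β o y ≤ 1} ≤
      horoVol n β B := by
    refine le_trans (measure_mono ?_)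
      (U.horoVol_preimage_shift_le (κ := κ - 1) (by linarith) hBm)
    rintro y ⟨⟨h1, h2⟩, h3⟩
    refine ⟨?_, ?_⟩
    · rw [U.hgt_shift' (by linarith)]
      constructor <;> linarith
    · rwa [shift, U.horoDist_lev_right _ _ (by linarith)]
  have e2 : horoVol n β B ≤ ENNReal.ofReal ((κ + 1) ^ n) * μH[(n : ℝ)] B :=
    horoVol_le hBm fun y hy => hy.1.2
  have e3 : μH[(n : ℝ)] B ≤ ENNReal.ofReal ((contrC 1 / l) ^ n) * μH[(n : ℝ)] W := by
    refine U.good.cosh.measure_le_of_frac (p := p) (by linarith) hl1 one_pos ?_ ?_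
    · intro y hy
      obtain ⟨h1, h2⟩ := hyB y hy
      have h3 := (U.mul_dist_le_of_far (by linarith : 1 ≤ R) (by rw [hpκ]) h1
        (by linarith [(abs_le.1 h2).2])).2.1
      rw [mem_closedBall, dist_comm]
      nlinarith [dist_nonneg (x := p) (y := y)]
    · intro y hy
      obtain ⟨h1, h2⟩ := hyB y hy
      obtain ⟨z, hz⟩ := U.good.geod.exists_frac p y (by linarith : 0 ≤ l) hl1
      have h3 := U.horoDist_frac_of_far hR (by rw [hpκ]) h1 h2 hl hl1 hz
      rw [hpD, hpκ] at h3
      exact ⟨z, h3, hz⟩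
  have e4 : ENNReal.ofReal ((κ / 2) ^ n) * μH[(n : ℝ)] W ≤ horoVol n β W := by
    refine le_horoVol hWm (by linarith) fun z hz => ?_
    have h1 : (hgt β z - κ) ^ 2 ≤ (R + 3) ^ 2 := hz.2.trans (by nlinarith)
    have h2 := (abs_le_of_sq_le_sq' h1 (by linarith)).1
    nlinarith
  have e5 : (κ + 1) ^ n * (contrC 1 / l) ^ n ≤ (8 * contrC 1) ^ n * (κ / 2) ^ n := by
    rw [← mul_pow, ← mul_pow]
    refine pow_le_pow_left₀ (by positivity) ?_ n
    rw [mul_div_assoc', div_le_iff₀ (by linarith)]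
    nlinarith [mul_pos hC (by linarith : 0 < κ)]
  calc _ ≤ ENNReal.ofReal ((κ + 1) ^ n) *
        (ENNReal.ofReal ((contrC 1 / l) ^ n) * μH[(n : ℝ)] W) := e1.trans (e2.trans (by gcongr))
    _ = ENNReal.ofReal ((κ + 1) ^ n * (contrC 1 / l) ^ n) * μH[(n : ℝ)] W := by
      rw [ENNReal.ofReal_mul (by positivity), mul_assoc]
    _ ≤ ENNReal.ofReal ((8 * contrC 1) ^ n * (κ / 2) ^ n) * μH[(n : ℝ)] W := by gcongr
    _ = ENNReal.ofReal ((8 * contrC 1) ^ n) *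
        (ENNReal.ofReal ((κ / 2) ^ n) * μH[(n : ℝ)] W) := by
      rw [ENNReal.ofReal_mul (by positivity), mul_assoc]
    _ ≤ _ := by gcongr

lemma mul_horoVol_le_of_far (o x : X) {R : ℝ} (hR : 5 ≤ R) (hx : horoDist β o x = R) (M : ℕ)
    (hM : 7 * (M : ℝ) ≤ R / 2) :
    M * horoVol n β {y | (1 ≤ hgt β y ∧ hgt β y ≤ 2) ∧ horoDist β o y ≤ 1} ≤
      ENNReal.ofReal ((8 * contrC 1) ^ n) * ENNReal.ofReal (K * (4 * √(R + 3))) := by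
  set κ := 8 * (R + 3) ^ 2 with hκ
  set a := √(4 * (R + 3)) with ha
  have ha2 : a = 2 * √(R + 3) := by
    rw [ha, Real.sqrt_mul (by norm_num), show (4 : ℝ) = 2 ^ 2 by norm_num,
      Real.sqrt_sq (by norm_num)]
  have haκ : a < κ := by
    rw [ha, Real.sqrt_lt (by linarith) (by positivity), hκ]
    nlinarith [sq_nonneg ((R + 3) ^ 2), pow_pos (by linarith : 0 < R + 3) 2,
      pow_pos (by linarith : 0 < R + 3) 3]
  have ha0 : 0 ≤ a := Real.sqrt_nonneg _
  set W : ℕ → Set X := fun i => {z | |horoDist β x z - (1 - 7 * i / R) * R| ≤ 3 ∧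
    (hgt β z - κ) ^ 2 ≤ 4 * (R + 3)} with hW
  have hcont := U.horo.continuous_hgt
  have hWm : ∀ i, MeasurableSet (W i) := fun i => ((isClosed_le (((U.continuous_horoDist x).sub
    continuous_const).abs) continuous_const).inter
      (isClosed_le ((hcont.sub continuous_const).pow 2) continuous_const)).measurableSet
  have hdisj : Set.PairwiseDisjoint (↑(Finset.range M)) W := by
    intro i _ j _ hij
    refine Set.disjoint_left.2 fun z hi hj => ?_
    have h1 := hi.1
    have h2 := hj.1
    have e : ∀ i : ℕ, (1 - 7 * (i : ℝ) / R) * R = R - 7 * i := fun i => by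
      field_simp
    rw [e, abs_le] at h1 h2
    rcases lt_or_gt_of_ne hij with h | h
    · have : (i : ℝ) + 1 ≤ j := by exact_mod_cast h
      linarith
    · have : (j : ℝ) + 1 ≤ i := by exact_mod_cast h
      linarith
  have hsum : ∑ i ∈ Finset.range M, horoVol n β (W i) ≤ ENNReal.ofReal (K * (4 * √(R + 3))) := by
    rw [← measure_biUnion_finset hdisj fun i _ => hWm i]
    refine (measure_mono ?_).trans_eq ((U.slab (κ - a) (κ + a) (by linarith) (by linarith)).trans ?_)
    · refine iUnion₂_subset fun i _ z hz => ?_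
      have := Real.abs_le_sqrt hz.2
      rw [← ha, abs_le] at this
      exact ⟨by linarith, by linarith⟩
    · rw [ha2]; ring_nf
  calc _ = ∑ i ∈ Finset.range M,
        horoVol n β {y | (1 ≤ hgt β y ∧ hgt β y ≤ 2) ∧ horoDist β o y ≤ 1} := by simp
    _ ≤ ∑ i ∈ Finset.range M, ENNReal.ofReal ((8 * contrC 1) ^ n) * horoVol n β (W i) := by
      refine Finset.sum_le_sum fun i hi => U.horoVol_le_of_far o x hR hx ?_ ?_
      · have : (i : ℝ) ≤ M := by exact_mod_cast (Finset.mem_range.1 hi).le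
        have : 7 * (i : ℝ) / R ≤ 1 / 2 := by rw [div_le_iff₀ (by linarith)]; linarith
        linarith
      · have : 0 ≤ 7 * (i : ℝ) / R := by positivity
        linarith
    _ ≤ _ := by rw [← Finset.mul_sum]; gcongr

/-- The cross section of a cusp is bounded. -/
lemma exists_horoDist_le (o : X) : ∃ B, ∀ x, horoDist β o x ≤ B := by
  set A : Set X := {y | (1 ≤ hgt β y ∧ hgt β y ≤ 2) ∧ horoDist β o y ≤ 1} with hA
  have hcont := U.horo.continuous_hgt
  have hpos : 0 < horoVol n β A := by
    refine lt_of_lt_of_le (U.horoVol_pos (V := {y | (1 < hgt β y ∧ hgt β y < 2) ∧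
      horoDist β o y < 1}) ?_ ⟨lev β o (3 / 2), ?_⟩) (measure_mono ?_)
    · exact ((isOpen_lt continuous_const hcont).inter (isOpen_lt hcont continuous_const)).inter
        (isOpen_lt (U.continuous_horoDist o) continuous_const)
    · have h0 : horoDist β o o = 0 := by
        have := U.horoDist_sq o o
        rwa [defect, dist_self, sub_self, sub_self, mul_zero, sq_eq_zero_iff] at this
      have : hgt β (lev β o (3 / 2)) = 3 / 2 := U.hgt_lev o (by norm_num)
      refine ⟨?_, ?_⟩
      · rw [this]; norm_num
      · rw [U.horoDist_lev_right _ _ (by norm_num), h0]; norm_num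
    · rintro y ⟨⟨h1, h2⟩, h3⟩
      exact ⟨⟨h1.le, h2.le⟩, h3.le⟩
  have htop : horoVol n β A ≠ ⊤ := by
    have hsub : A ⊆ {y | 1 ≤ hgt β y ∧ hgt β y ≤ 2} := fun y hy => hy.1
    refine ne_top_of_le_ne_top ?_ (measure_mono hsub)
    rw [U.slab 1 2 one_pos one_le_two]
    exact ENNReal.ofReal_ne_top
  have hC := contrC_pos one_pos
  have hK := U.pos
  set c := (horoVol n β A).toReal with hc
  have hc0 : 0 < c := ENNReal.toReal_pos hpos.ne' htop
  set D := (8 * contrC 1) ^ n * (K * 4) / c with hD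
  have hD0 : 0 ≤ D := by positivity
  refine ⟨(14 * D + 17) ^ 2, fun x => ?_⟩
  by_contra! h
  set R := horoDist β o x with hR
  have hR5 : 5 ≤ R := by nlinarith
  have h1 := U.mul_horoVol_le_of_far o x hR5 rfl ⌊R / 14⌋₊ (by
    linarith [Nat.floor_le (by linarith : 0 ≤ R / 14)])
  rw [← ENNReal.ofReal_mul (by positivity), ← ENNReal.ofReal_toReal htop, ← hc,
    ← ENNReal.ofReal_natCast, ← ENNReal.ofReal_mul (by positivity),
    ENNReal.ofReal_le_ofReal_iff (by positivity)] at h1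
  have h2 : (⌊R / 14⌋₊ : ℝ) ≤ D * √(R + 3) := by
    rw [hD, div_mul_eq_mul_div, le_div_iff₀ hc0]
    linarith
  have h3 := Nat.lt_floor_add_one (R / 14)
  have h4 : √(R + 3) ^ 2 = R + 3 := Real.sq_sqrt (by linarith)
  have h5 : 14 * D + 17 ≤ √(R + 3) := Real.le_sqrt_of_sq_le (by linarith)
  nlinarith

end Cusp

end

section

/-- `π` exhibits `N` as the metric quotient of `X` for the boundary distance of `β`. -/
structure IsFiber {X N : Type*} [MetricSpace X] [MetricSpace N] (β : X → ℝ) (π : X → N) :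
    Prop where
  dist_eq : ∀ x y, dist (π x) (π y) = horoDist β x y
  surj : Function.Surjective π

lemma acoshR_cosh {d : ℝ} (hd : 0 ≤ d) : acoshR (Real.cosh d) = d := by
  rw [acoshR, Real.cosh_sq, add_sub_cancel_right, Real.sqrt_sq (Real.sinh_nonneg_iff.2 hd),
    Real.cosh_add_sinh, Real.log_exp]

namespace Cusp

variable {X : Type*} [MetricSpace X] [MeasurableSpace X] [BorelSpace X] [ProperSpace X]
  {n : ℕ} {β : X → ℝ} {K : ℝ} (U : Cusp n β K)
include U

lemma nonempty : Nonempty X := by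
  obtain ⟨_, _, _, ⟨x, -⟩, -⟩ := U.good.nontriv
  exact ⟨x⟩

lemma exists_isFiber : ∃ (N : Type) (_ : MetricSpace N) (π : X → N), IsFiber β π := by
  have : Nonempty X := U.nonempty
  have hinj : Function.Injective fun (x : X) (i : ℕ) => dist x (TopologicalSpace.denseSeq X i) := by
    intro x y h
    have h1 : (fun z => dist x z) = fun z => dist y z :=
      (TopologicalSpace.denseRange_denseSeq X).equalizer (by fun_prop) (by fun_prop) (by
        ext i; exact congrFun h i)
    have := congrFun h1 y
    rwa [dist_self, dist_eq_zero] at this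
  have : Small.{0} X := small_of_injective hinj
  let e := (equivShrink {x : X // β x = 0}).symm
  let D : Shrink.{0} {x : X // β x = 0} → Shrink.{0} {x : X // β x = 0} → ℝ :=
    fun a b => horoDist β (e a).1 (e b).1
  have hself : ∀ x : X, horoDist β x x = 0 := fun x => by
    have := U.horoDist_sq x x
    rwa [defect, dist_self, sub_self, sub_self, mul_zero, sq_eq_zero_iff] at this
  let _ : MetricSpace (Shrink.{0} {x : X // β x = 0}) :=
    { dist := D
      dist_self := fun a => hself _
      dist_comm := fun a b => U.horoDist_comm _ _
      dist_triangle := fun a b c => U.horoDist_triangle _ _ _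
      eq_of_dist_eq_zero := fun {a b} h => by
        refine e.injective (Subtype.ext (eq_of_defect_le_zero (β := β) ?_ ?_))
        · rw [(e a).2, (e b).2]
        · rw [← U.horoDist_sq]
          change D a b = 0 at h
          change D a b ^ 2 ≤ 0
          rw [h]; norm_num }
  have hlev : ∀ x, β (lev β x 1) = 0 := fun x => by
    have := log_hgt β (lev β x 1)
    rw [U.hgt_lev x one_pos, Real.log_one] at this
    linarith
  refine ⟨_, inferInstance, fun x => e.symm ⟨lev β x 1, hlev x⟩, fun x y => ?_, fun a => ?_⟩
  · change horoDist β (e _).1 (e _).1 = _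
    rw [Equiv.apply_symm_apply, Equiv.apply_symm_apply]
    exact U.horoDist_lev x y one_pos one_pos
  · refine ⟨(e a).1, ?_⟩
    rw [Equiv.symm_apply_eq]
    refine Subtype.ext ?_
    have h : hgt β (e a).1 = 1 := by rw [hgt, (e a).2]; simp
    have := U.lev_self (e a).1
    rwa [h] at this

variable {N : Type*} [MetricSpace N] {π : X → N} (F : IsFiber β π)
include F

lemma fiber_lev (x : X) {t : ℝ} (ht : 0 < t) : π (lev β x t) = π x := by
  rw [← dist_eq_zero, F.dist_eq, U.horoDist_lev_left x x ht, ← F.dist_eq, dist_self]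

lemma continuous_fiber : Continuous π := by
  refine continuous_iff_continuousAt.2 fun x => tendsto_iff_dist_tendsto_zero.2 ?_
  have h : Tendsto (fun y => Real.exp (dist x y) * hgt β x * dist x y) (𝓝 x) (𝓝 0) := by
    have : Continuous fun y => Real.exp (dist x y) * hgt β x * dist x y := by fun_prop
    simpa using this.tendsto x
  refine squeeze_zero (fun _ => dist_nonneg) (fun y => ?_) h
  have hx := hgt_pos β x
  rw [dist_comm, F.dist_eq]
  refine le_of_sq_le_sq (le_trans ?_ (U.horoDist_sq_add_le x y)) (by positivity)
  exact le_add_of_nonneg_right (sq_nonneg _)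

lemma compactSpace_fiber : CompactSpace N := by
  obtain ⟨x₀⟩ := U.nonempty
  have hlev : ∀ x, β (lev β x 1) = 0 := fun x => by
    have := log_hgt β (lev β x 1)
    rw [U.hgt_lev x one_pos, Real.log_one] at this
    linarith
  obtain ⟨B, hB⟩ := U.exists_horoDist_le (lev β x₀ 1)
  have hS : IsCompact {x | β x = 0} := by
    refine (isCompact_closedBall (lev β x₀ 1) B).of_isClosed_subset
      (isClosed_eq U.horo.continuous continuous_const) fun x hx => ?_
    have h1 := U.cosh_dist (lev β x₀ 1) x
    have h2 := one_add_sq_le_cosh (dist (lev β x₀ 1) x)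
    rw [mem_ofPred_eq] at hx
    rw [hx, hlev, sub_zero, add_zero, Real.cosh_zero, Real.exp_zero, one_mul] at h1
    rw [mem_closedBall, dist_comm]
    exact (le_of_sq_le_sq (by linarith) (U.horoDist_nonneg _ _)).trans (hB x)
  refine ⟨?_⟩
  convert hS.image (U.continuous_fiber F)
  refine (eq_univ_of_forall fun a => ?_).symm
  obtain ⟨x, rfl⟩ := F.surj a
  exact ⟨_, hlev x, U.fiber_lev F x one_pos⟩

lemma bijective_fiber : Function.Bijective fun x => (β x, π x) := by
  constructor
  · intro x y h
    simp only [Prod.mk.injEq] at h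
    refine eq_of_defect_le_zero h.1 ?_
    rw [← U.horoDist_sq, ← F.dist_eq, h.2, dist_self]
    norm_num
  · rintro ⟨s, a⟩
    obtain ⟨x, rfl⟩ := F.surj a
    refine ⟨lev β x (Real.exp (-s)), ?_⟩
    have := log_hgt β (lev β x (Real.exp (-s)))
    rw [U.hgt_lev x (Real.exp_pos _), Real.log_exp, neg_inj] at this
    simp [← this, U.fiber_lev F x (Real.exp_pos _)]

lemma dist_eq_warpDist (x y : X) : dist x y = warpDist (dist (π x) (π y)) (β x) (β y) := by
  rw [warpDist, F.dist_eq, ← U.cosh_dist, acoshR_cosh dist_nonneg]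

lemma cosh_dist_lev (x y : X) {t : ℝ} (ht : 0 < t) :
    Real.cosh (dist (lev β x t) (lev β y t)) = 1 + dist (π x) (π y) ^ 2 / (2 * t ^ 2) := by
  have h : defect β (lev β x t) (lev β y t) = dist (π x) (π y) ^ 2 := by
    rw [← U.horoDist_sq, U.horoDist_lev x y ht ht, F.dist_eq]
  have hβ : β (lev β x t) = β (lev β y t) :=
    hgt_eq_iff.1 (by rw [U.hgt_lev x ht, U.hgt_lev y ht])
  rw [← h, defect, hβ, sub_self, Real.cosh_zero, U.hgt_lev x ht, U.hgt_lev y ht]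
  field_simp
  ring

lemma tendsto_cmpAngle (p x y : X) (hx : π p ≠ π x) (hy : π p ≠ π y) :
    Tendsto (fun m : ℕ => cmpAngleNeg 1 (dist (lev β p (m + 1)) (lev β x (m + 1)))
      (dist (lev β p (m + 1)) (lev β y (m + 1))) (dist (lev β x (m + 1)) (lev β y (m + 1))))
      atTop (𝓝 (cmpAngleNeg 0 (dist (π p) (π x)) (dist (π p) (π y)) (dist (π x) (π y)))) := by
  have hA := dist_pos.2 hx
  have hB := dist_pos.2 hy
  set A := dist (π p) (π x)
  set B := dist (π p) (π y)
  set C := dist (π x) (π y)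
  simp only [cmpAngleNeg, one_ne_zero, if_false, if_true, Real.sqrt_one, one_mul, cmpAngleH,
    cmpAngleE]
  refine (Real.continuous_arccos.tendsto _).comp ?_
  have hinv : Tendsto (fun m : ℕ => 1 / (4 * ((m : ℝ) + 1) ^ 2)) atTop (𝓝 0) := by
    have := (tendsto_nat_add_one.const_div_atTop (1 / 2)).pow 2
    rw [zero_pow two_ne_zero] at this
    refine this.congr fun m => ?_
    field_simp
    norm_num
  have hlim : Tendsto (fun m : ℕ => ((A ^ 2 + B ^ 2 - C ^ 2) / 2 +
      A ^ 2 * B ^ 2 * (1 / (4 * ((m : ℝ) + 1) ^ 2))) /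
      (√(A ^ 2 + A ^ 4 * (1 / (4 * ((m : ℝ) + 1) ^ 2))) *
        √(B ^ 2 + B ^ 4 * (1 / (4 * ((m : ℝ) + 1) ^ 2))))) atTop
      (𝓝 ((A ^ 2 + B ^ 2 - C ^ 2) / (2 * A * B))) := by
    have := ((hinv.const_mul (A ^ 2 * B ^ 2)).const_add ((A ^ 2 + B ^ 2 - C ^ 2) / 2)).div
      (((hinv.const_mul (A ^ 4)).const_add (A ^ 2)).sqrt.mul
        ((hinv.const_mul (B ^ 4)).const_add (B ^ 2)).sqrt) (by
          simp only [mul_zero, add_zero, Real.sqrt_sq hA.le, Real.sqrt_sq hB.le]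
          positivity)
    simp only [mul_zero, add_zero, Real.sqrt_sq hA.le, Real.sqrt_sq hB.le] at this
    rwa [div_div, ← mul_assoc] at this
  refine hlim.congr fun m => ?_
  have ht : (0 : ℝ) < m + 1 := by positivity
  set t : ℝ := m + 1
  have hs : ∀ u v : X, Real.sinh (dist (lev β u t) (lev β v t)) =
      √(dist (π u) (π v) ^ 2 + dist (π u) (π v) ^ 4 * (1 / (4 * t ^ 2))) / t := fun u v => by
    rw [← Real.sqrt_sq (Real.sinh_nonneg_iff.2 dist_nonneg), Real.sinh_sq,
      U.cosh_dist_lev F u v ht, eq_div_iff ht.ne']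
    nth_rewrite 2 [← Real.sqrt_sq ht.le]
    rw [← Real.sqrt_mul' _ (sq_nonneg t)]
    congr 1
    field_simp
    ring
  rw [hs, hs, U.cosh_dist_lev F _ _ ht, U.cosh_dist_lev F _ _ ht, U.cosh_dist_lev F _ _ ht]
  have h1 : 0 < √(A ^ 2 + A ^ 4 * (1 / (4 * t ^ 2))) := Real.sqrt_pos.2 (by positivity)
  have h2 : 0 < √(B ^ 2 + B ^ 4 * (1 / (4 * t ^ 2))) := Real.sqrt_pos.2 (by positivity)
  change _ = ((1 + A ^ 2 / (2 * t ^ 2)) * (1 + B ^ 2 / (2 * t ^ 2)) - (1 + C ^ 2 / (2 * t ^ 2))) /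
    (√(A ^ 2 + A ^ 4 * (1 / (4 * t ^ 2))) / t * (√(B ^ 2 + B ^ 4 * (1 / (4 * t ^ 2))) / t))
  generalize √(A ^ 2 + A ^ 4 * (1 / (4 * t ^ 2))) = P at h1 ⊢
  generalize √(B ^ 2 + B ^ 4 * (1 / (4 * t ^ 2))) = Q at h2 ⊢
  field_simp
  ring

lemma isGeodesicSpace_fiber : IsGeodesicSpace N := by
  have hc := U.compactSpace_fiber F
  intro a b
  obtain ⟨x, rfl⟩ := F.surj a
  obtain ⟨y, rfl⟩ := F.surj b
  set D := dist (π x) (π y) with hD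
  rcases (dist_nonneg : 0 ≤ D).eq_or_lt with h0 | hD0
  · refine ⟨fun _ => π x, ⟨dist_nonneg, fun s hs t ht => ?_⟩, rfl, ?_⟩
    · rw [show D = 0 from h0.symm, Icc_self, mem_singleton_iff] at hs ht
      simp [hs, ht]
    · exact dist_eq_zero.1 h0.symm
  choose γ hγ h0 h1 using fun m : ℕ =>
    U.good.geod (lev β x ((m : ℝ) + 1)) (lev β y ((m : ℝ) + 1))
  set d : ℕ → ℝ := fun m => dist (lev β x ((m : ℝ) + 1)) (lev β y ((m : ℝ) + 1)) with hd
  have hdn : ∀ m, 0 ≤ d m := fun m => dist_nonneg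
  have hmem : ∀ m, ∀ s ∈ Icc 0 D, s * (d m / D) ∈ Icc 0 (d m) := fun m s hs => by
    have := hdn m
    refine ⟨mul_nonneg hs.1 (by positivity), ?_⟩
    rw [mul_div_assoc', div_le_iff₀ hD0, mul_comm]
    gcongr
    exact hs.2
  have hlim : Tendsto (fun m : ℕ => ((m : ℝ) + 1) * d m) atTop (𝓝 D) := by
    rw [hD, F.dist_eq]
    exact U.tendsto_mul_dist_lev x y
  have hd0 : Tendsto d atTop (𝓝 0) := by
    have := hlim.mul (tendsto_nat_add_one.const_div_atTop 1)
    rw [mul_zero] at this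
    refine this.congr fun m => ?_
    field_simp
  have hstep : ∀ m, ∀ s ∈ Icc 0 D, ∀ t ∈ Icc 0 D,
      dist (π (γ m (s * (d m / D)))) (π (γ m (t * (d m / D)))) ≤
        Real.exp (2 * d m) * (((m : ℝ) + 1) * d m) / D * |s - t| := by
    intro m s hs t ht
    have e0 := hdn m
    have e1 := (hγ m).2 _ (hmem m s hs) _ (hmem m t ht)
    have e2 : dist (lev β x ((m : ℝ) + 1)) (γ m (s * (d m / D))) ≤ d m := by
      rw [← h0 m, (hγ m).2 0 ⟨le_rfl, e0⟩ _ (hmem m s hs), zero_sub, abs_neg,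
        abs_of_nonneg (hmem m s hs).1]
      exact (hmem m s hs).2
    rw [← sub_mul, abs_mul, abs_of_nonneg (by positivity : 0 ≤ d m / D)] at e1
    have e3 := U.horo.hgt_le (lev β x ((m : ℝ) + 1)) (γ m (s * (d m / D)))
    rw [U.hgt_lev x (by positivity)] at e3
    have e4 := U.horoDist_sq_add_le (γ m (s * (d m / D))) (γ m (t * (d m / D)))
    have e5 := hgt_pos β (γ m (s * (d m / D)))
    have e6 : horoDist β (γ m (s * (d m / D))) (γ m (t * (d m / D))) ≤ _ :=
      le_of_sq_le_sq ((le_add_of_nonneg_right (sq_nonneg _)).trans e4) (by positivity)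
    have e7 : |s - t| * (d m / D) ≤ d m := by
      have : |s - t| ≤ D := by
        rw [abs_le]; constructor <;> linarith [hs.1, hs.2, ht.1, ht.2]
      rw [mul_div_assoc', div_le_iff₀ hD0, mul_comm]
      gcongr
    rw [F.dist_eq]
    refine e6.trans ?_
    rw [e1]
    calc _ ≤ Real.exp (d m) * (Real.exp (d m) * (m + 1)) * (|s - t| * (d m / D)) := by
          gcongr
          exact e3.trans (by gcongr)
      _ = _ := by rw [two_mul, Real.exp_add]; ring
  have hz : ∀ s : ℝ, ∃ z : N, Tendsto (fun m => π (γ m (s * (d m / D)))) ultra (𝓝 z) := by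
    intro s
    obtain ⟨r, hr⟩ := (isCompact_univ (X := N)).isBounded.subset_closedBall (π x)
    refine exists_tendsto_ultra (p := π x) (r := r) fun i => ?_
    have := hr (mem_univ (π (γ i (s * (d i / D)))))
    rwa [mem_closedBall, dist_comm] at this
  choose z hz using hz
  have hle : ∀ s ∈ Icc 0 D, ∀ t ∈ Icc 0 D, dist (z s) (z t) ≤ |s - t| := by
    intro s hs t ht
    have l := ((((Real.continuous_exp.tendsto _).comp (hd0.const_mul 2)).mul hlim).div_const
      D).mul_const |s - t|
    rw [mul_zero, Real.exp_zero, one_mul, div_self hD0.ne', one_mul] at l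
    exact le_of_tendsto_of_tendsto ((hz s).dist (hz t)) (l.mono_left ultra_le_atTop)
      (.of_forall fun m => hstep m s hs t ht)
  have hz0 : z 0 = π x := by
    refine tendsto_nhds_unique (hz 0) (tendsto_const_nhds.congr fun m => ?_)
    rw [zero_mul, h0 m, U.fiber_lev F x (by positivity)]
  have hz1 : z D = π y := by
    refine tendsto_nhds_unique (hz D) (tendsto_const_nhds.congr fun m => ?_)
    rw [mul_div_cancel₀ _ hD0.ne', h1 m, U.fiber_lev F y (by positivity)]
  have hge : ∀ s ∈ Icc 0 D, ∀ t ∈ Icc 0 D, s ≤ t → dist (z s) (z t) = t - s := by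
    intro s hs t ht hst
    have a1 := hle s hs t ht
    have a2 := hle 0 ⟨le_rfl, hD0.le⟩ s hs
    have a3 := hle t ht D ⟨hD0.le, le_rfl⟩
    rw [abs_sub_comm, abs_of_nonneg (sub_nonneg.2 hst)] at a1
    rw [zero_sub, abs_neg, abs_of_nonneg hs.1, hz0] at a2
    rw [abs_sub_comm, abs_of_nonneg (sub_nonneg.2 ht.2), hz1] at a3
    have := dist_triangle4 (π x) (z s) (z t) (π y)
    linarith
  refine ⟨z, ⟨hD0.le, fun s hs t ht => ?_⟩, hz0, hz1⟩
  rcases le_total s t with h | h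
  · rw [hge s hs t ht h, abs_sub_comm, abs_of_nonneg (sub_nonneg.2 h)]
  · rw [dist_comm, hge t ht s hs h, abs_of_nonneg (sub_nonneg.2 h)]

lemma curvGeZero_fiber (hX : CurvGeNegK X 1) : CurvGeZero N := by
  refine ⟨U.isGeodesicSpace_fiber F, fun p a b c ha hb hc => ?_⟩
  obtain ⟨p, rfl⟩ := F.surj p
  obtain ⟨a, rfl⟩ := F.surj a
  obtain ⟨b, rfl⟩ := F.surj b
  obtain ⟨c, rfl⟩ := F.surj c
  refine le_of_tendsto' (((U.tendsto_cmpAngle F p a b ha hb).add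
    (U.tendsto_cmpAngle F p b c hb hc)).add (U.tendsto_cmpAngle F p c a hc ha)) fun m => ?_
  have ht : (0 : ℝ) < m + 1 := by positivity
  have hne : ∀ u, π p ≠ π u → lev β p (m + 1) ≠ lev β u (m + 1) := fun u hu h => hu (by
    rw [← U.fiber_lev F p ht, ← U.fiber_lev F u ht, h])
  exact hX.2 _ _ _ _ (hne a ha) (hne b hb) (hne c hc)

end Cusp

end

/-- the case `n = 2, 3`: no finite-volume end, or splitting. -/
theorem stmt_17 {X : Type*} [MetricSpace X] [MeasurableSpace X] [BorelSpace X]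
    [ProperSpace X]
    (n : ℕ) (hn : n = 2 ∨ n = 3) (hA : AlexandrovNegOne X n)
    (hnc : NoncompactSpace X)
    (hlam : lambda0 (μH[(n:ℝ)] : Measure X) Set.univ = ((n:ℝ) - 1) ^ 2 / 4) :
    (∀ (p : X) (R₀ : ℝ) (E : Set X), IsEnd p R₀ E →
        (μH[(n:ℝ)] : Measure X) E = ⊤) ∨
      Nonempty (WarpSplitCompactData X) := by
  by_cases h : ∀ (p : X) (R₀ : ℝ) (E : Set X), IsEnd p R₀ E → (μH[(n:ℝ)] : Measure X) E = ⊤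
  · exact .inl h
  push Not at h
  obtain ⟨p, R₀, E, hE, hfin⟩ := h
  have hn2 : 2 ≤ n := by omega
  have hn2' : (2 : ℝ) ≤ n := by exact_mod_cast hn2
  have G : GoodSpace X n := goodSpace_of_lambda0 hA.1 (by
    rw [hlam]
    have : (n : ℝ) - 1 ≠ 0 := by linarith
    positivity)
  obtain ⟨β, H, hβ⟩ := G.geod.exists_horo hE
  have hβfin : ∀ c, (μH[(n:ℝ)] : Measure X) {x | β x ≤ c} ≠ ⊤ := fun c => by
    obtain ⟨r, hr⟩ := hβ c
    exact ((measure_mono hr).trans_lt ((measure_union_le _ _).trans_lt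
      (ENNReal.add_lt_top.2 ⟨hfin.lt_top, G.closedBall_lt_top p r⟩))).ne
  obtain ⟨K, U⟩ := H.exists_cusp G hβfin hn2 hlam
  obtain ⟨N, _, π, F⟩ := U.exists_isFiber
  exact .inr ⟨⟨N, U.compactSpace_fiber F, U.curvGeZero_fiber F hA.1, fun x => (β x, π x),
    U.bijective_fiber F, U.dist_eq_warpDist F⟩⟩
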